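/- Let d > 2s and let ρ be an admissible weight with exponents (γ₀,γ) and constants c, C. Let μ be a positive finite Radon measure on ℝ^d. Then there exists a weak solution u of the Cauchy problem ρ u_t + (-Δ)^s(u^m) = 0 with initial datum μ which: (a) conserves mass, i.e. ∫_{ℝ^d} u(x,t) ρ(x) dx = μ(ℝ^d) for a.e. t > 0; (b) satisfies the smoothing estimate ess sup_{x∈ℝ^d} u(x,t) ≤ K t^{-α} μ(ℝ^d)^β for a.e. t > 0, where α = (d-γ)/((m-1)(d-γ)+2s-γ), β = (2s-γ)/((m-1)(d-γ)+2s-γ), and K > 0 depends only on m, γ, s, d and the constant C in the weight bounds; and (c) satisfies the energy identity ∫_{t₁}^{t₂} ∥u^m(·,t)∥_{Ḣ^s}² dt + (1/(m+1)) ∫_{ℝ^d} u^{m+1}(x,t₂) ρ(x) dx = (1/(m+1)) ∫_{ℝ^d} u^{m+1}(x,t₁) ρ(x) dx for a.e. 0 < t₁ < t₂. -/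

import Mathlib

open MeasureTheory Filter Topology Set
open scoped ENNReal NNReal

noncomputable section

/-- `d`-dimensional Euclidean space. -/
abbrev Ed (d : ℕ) : Type := EuclideanSpace ℝ (Fin d)

/-- An admissible weight with exponents `(γ₀, γ)` and constants `0 < c < C`:
a measurable, everywhere positive function comparable to `|x|^{-γ₀}` near the
origin and to `|x|^{-γ}` at infinity. -/
def AdmissibleWeight (d : ℕ) (ρ : Ed d → ℝ) (γ₀ γ c C : ℝ) : Prop :=
  0 < c ∧ c < C ∧ Measurable ρ ∧ (∀ x, 0 < ρ x) ∧
    (∀ᵐ x ∂(volume : Measure (Ed d)), ‖x‖ ≤ 1 →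
      c * ‖x‖ ^ (-γ₀) ≤ ρ x ∧ ρ x ≤ C * ‖x‖ ^ (-γ₀)) ∧
    (∀ᵐ x ∂(volume : Measure (Ed d)), 1 < ‖x‖ →
      c * ‖x‖ ^ (-γ) ≤ ρ x ∧ ρ x ≤ C * ‖x‖ ^ (-γ))

/-- The Gagliardo bilinear form `E(v,w)` of order `s` with normalizing constant `κ`. -/
def gagliardoE (d : ℕ) (s κ : ℝ) (v w : Ed d → ℝ) : ℝ :=
  (κ / 2) * ∫ p : Ed d × Ed d,
    (v p.1 - v p.2) * (w p.1 - w p.2) / ‖p.1 - p.2‖ ^ ((d : ℝ) + 2 * s)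

/-- The squared homogeneous fractional Sobolev seminorm `‖v‖_{Ḣ^s}² = E(v,v)`,
with values in `[0,∞]`. -/
def gagliardoSq (d : ℕ) (s κ : ℝ) (v : Ed d → ℝ) : ℝ≥0∞ :=
  ENNReal.ofReal (κ / 2) * ∫⁻ p : Ed d × Ed d,
    ENNReal.ofReal ((v p.1 - v p.2) ^ 2 / ‖p.1 - p.2‖ ^ ((d : ℝ) + 2 * s))

/-- The weighted `L^p` norm `‖v‖_{p,ρ}`, valued in `[0,∞]`. -/
def wnorm (d : ℕ) (p : ℝ) (ρ v : Ed d → ℝ) : ℝ≥0∞ :=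
  (∫⁻ x : Ed d, ENNReal.ofReal (|v x| ^ p * ρ x)) ^ (1 / p)

/-- Smooth compactly supported test functions on `ℝ^d × (0,∞)`. -/
def IsTestFn (d : ℕ) (φ : Ed d × ℝ → ℝ) : Prop :=
  ContDiff ℝ (⊤ : ℕ∞) φ ∧ HasCompactSupport φ ∧ tsupport φ ⊆ univ ×ˢ Ioi (0 : ℝ)

/-- Conditions (i)–(iii) of the definition of weak solution of
`ρ u_t + (-Δ)^s(u^m) = 0` on `ℝ^d × (0,∞)` (no initial datum prescribed). -/
structure WeakSolCore (d : ℕ) (s m κ : ℝ) (ρ : Ed d → ℝ) (u : Ed d → ℝ → ℝ) : Prop where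
  measurable : Measurable (Function.uncurry u)
  nonneg : ∀ x t, 0 ≤ u x t
  /-- (i), first part: `ess sup_{t>0} ∫ u(·,t) ρ < ∞`. -/
  massBound : ∃ M : ℝ, ∀ᵐ t ∂(volume.restrict (Ioi (0 : ℝ))),
    Integrable (fun x : Ed d => u x t * ρ x) ∧ (∫ x : Ed d, u x t * ρ x) ≤ M
  /-- (i), second part: `u` essentially bounded on `ℝ^d × (τ,∞)` for every `τ > 0`. -/
  essBdd : ∀ τ : ℝ, 0 < τ → ∃ B : ℝ,
    ∀ᵐ p ∂(volume : Measure (Ed d × ℝ)), τ < p.2 → u p.1 p.2 ≤ B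
  /-- (ii), first part: `‖u^m(·,t)‖_{Ḣ^s} < ∞` for a.e. `t > 0`. -/
  energyFinite : ∀ᵐ t ∂(volume.restrict (Ioi (0 : ℝ))),
    gagliardoSq d s κ (fun x => u x t ^ m) < ⊤
  /-- (ii), second part: `t ↦ ‖u^m(·,t)‖_{Ḣ^s}²` locally integrable on `(0,∞)`. -/
  energyLocInt : ∀ t₁ t₂ : ℝ, 0 < t₁ → t₁ < t₂ →
    (∫⁻ t in Ioc t₁ t₂, gagliardoSq d s κ (fun x => u x t ^ m)) ≠ ⊤
  /-- (iii): the weak formulation against all test functions. -/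
  weakForm : ∀ φ : Ed d × ℝ → ℝ, IsTestFn d φ →
    -(∫ t in Ioi (0 : ℝ), ∫ x : Ed d, u x t * deriv (fun τ => φ (x, τ)) t * ρ x)
      + ∫ t in Ioi (0 : ℝ),
          gagliardoE d s κ (fun x => u x t ^ m) (fun x => φ (x, t)) = 0

/-- Condition (iv): `ρ(·)u(·,t) → μ` as `t → 0` essentially, tested against all
bounded continuous functions. -/
def HasInitialTrace (d : ℕ) (ρ : Ed d → ℝ) (u : Ed d → ℝ → ℝ)
    (μ : Measure (Ed d)) : Prop :=
  ∃ N : Set ℝ, volume N = 0 ∧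
    ∀ φ : Ed d → ℝ, Continuous φ → (∃ B : ℝ, ∀ x, |φ x| ≤ B) →
      Tendsto (fun t => ∫ x : Ed d, φ x * (u x t * ρ x))
        (𝓝[(Ioi (0 : ℝ)) \ N] 0) (𝓝 (∫ x, φ x ∂μ))

/-- Weak solution of the Cauchy problem with initial datum `μ`. -/
def IsWeakSolution (d : ℕ) (s m κ : ℝ) (ρ : Ed d → ℝ) (μ : Measure (Ed d))
    (u : Ed d → ℝ → ℝ) : Prop :=
  WeakSolCore d s m κ ρ u ∧ HasInitialTrace d ρ u μ

/-! ### Abstract quadratic forms of jump type -/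

section AbstractForm

variable {X : Type*}

/-- Increment of `w` along a pair of points. -/
def pdiff (w : X → ℝ) (p : X × X) : ℝ := w p.1 - w p.2

variable [MeasurableSpace X]

/-- Energy of `w` for the jump measure `Γ`. -/
def energy (Γ : Measure (X × X)) (w : X → ℝ) : ℝ≥0∞ :=
  ∫⁻ p, ENNReal.ofReal ((pdiff w p) ^ 2) ∂Γ

/-- Bilinear form of the jump measure `Γ`. -/
def eform (Γ : Measure (X × X)) (v w : X → ℝ) : ℝ := ∫ p, pdiff v p * pdiff w p ∂Γ

/-- Both marginals of the jump measure are absolutely continuous. -/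
structure MarginalsAC (ν : Measure X) (Γ : Measure (X × X)) : Prop where
  fst_ac : Γ.map Prod.fst ≪ ν
  snd_ac : Γ.map Prod.snd ≪ ν

variable {ν : Measure X} {Γ : Measure (X × X)}

lemma measurable_pdiff {w : X → ℝ} (hw : Measurable w) : Measurable (pdiff w) :=
  (hw.comp measurable_fst).sub (hw.comp measurable_snd)

lemma MarginalsAC.ae_prod (h : MarginalsAC ν Γ) {P : X → Prop} (hP : ∀ᵐ x ∂ν, P x) :
    ∀ᵐ p ∂Γ, P p.1 ∧ P p.2 := by
  have h1 := ae_of_ae_map measurable_fst.aemeasurable (h.fst_ac.ae_le hP)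
  have h2 := ae_of_ae_map measurable_snd.aemeasurable (h.snd_ac.ae_le hP)
  filter_upwards [h1, h2] with p a b using ⟨a, b⟩

lemma MarginalsAC.energy_congr (h : MarginalsAC ν Γ) {v w : X → ℝ} (hvw : v =ᵐ[ν] w) :
    energy Γ v = energy Γ w := by
  refine lintegral_congr_ae ?_
  filter_upwards [h.ae_prod hvw] with p hp
  simp [pdiff, hp.1, hp.2]

lemma energy_zero : energy Γ (fun _ : X => (0 : ℝ)) = 0 := by simp [energy, pdiff]

lemma memLp_pdiff_of_energy {w : X → ℝ} (hw : Measurable w) (h : energy Γ w ≠ ⊤) :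
    MemLp (pdiff w) 2 Γ := by
  refine (memLp_two_iff_integrable_sq (measurable_pdiff hw).aestronglyMeasurable).2 ?_
  refine ⟨((measurable_pdiff hw).pow_const 2).aestronglyMeasurable, ?_⟩
  rw [hasFiniteIntegral_iff_ofReal (Eventually.of_forall fun _ => sq_nonneg _)]
  exact lt_top_iff_ne_top.2 h

lemma energy_eq_ofReal_eform {w : X → ℝ} (h : MemLp (pdiff w) 2 Γ) :
    energy Γ w = ENNReal.ofReal (eform Γ w w) := by
  rw [energy, eform, ofReal_integral_eq_lintegral_ofReal]
  · simp only [sq]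
  · simpa only [sq] using h.integrable_sq
  · exact Eventually.of_forall fun _ => mul_self_nonneg _

lemma energy_ne_top {w : X → ℝ} (h : MemLp (pdiff w) 2 Γ) : energy Γ w ≠ ⊤ := by
  rw [energy_eq_ofReal_eform h]; exact ENNReal.ofReal_ne_top

lemma eform_self_nonneg (w : X → ℝ) : 0 ≤ eform Γ w w :=
  integral_nonneg fun _ => mul_self_nonneg _

lemma toReal_energy {w : X → ℝ} (h : MemLp (pdiff w) 2 Γ) :
    (energy Γ w).toReal = eform Γ w w := by
  rw [energy_eq_ofReal_eform h, ENNReal.toReal_ofReal (eform_self_nonneg w)]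

lemma integrable_pdiff_mul {v w : X → ℝ} (hv : MemLp (pdiff v) 2 Γ) (hw : MemLp (pdiff w) 2 Γ) :
    Integrable (fun p => pdiff v p * pdiff w p) Γ := hv.integrable_mul hw

lemma energy_mono_of_abs_le {v w : X → ℝ} (h : ∀ p, |pdiff v p| ≤ |pdiff w p|) :
    energy Γ v ≤ energy Γ w :=
  lintegral_mono fun p => ENNReal.ofReal_le_ofReal (sq_le_sq.2 (h p))

lemma abs_eform_le {v w : X → ℝ} (hv : MemLp (pdiff v) 2 Γ) (hw : MemLp (pdiff w) 2 Γ) :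
    |eform Γ v w| ≤ (eform Γ v v + eform Γ w w) / 2 := by
  have h1 := integrable_pdiff_mul hv hv
  have h2 := integrable_pdiff_mul hw hw
  rw [eform, eform, eform, ← integral_add h1 h2, ← integral_div]
  refine (abs_integral_le_integral_abs).trans ?_
  refine integral_mono (integrable_pdiff_mul hv hw).abs ((h1.add h2).div_const 2) fun p => ?_
  rw [abs_le]
  constructor <;> nlinarith [sq_nonneg (pdiff v p + pdiff w p), sq_nonneg (pdiff v p - pdiff w p)]

end AbstractForm

/-! ### Geometrically summable increments -/

lemma abs_sub_le_geometric {p : ℝ} (hp : 0 < p) {a : ℕ → ℝ} {Z : ℝ} {j : ℕ}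
    (h : (3 / 2 : ℝ) ^ j * |a j - a (j + 1)| ^ p ≤ Z) :
    |a j - a (j + 1)| ≤ Z ^ (1 / p) * ((2 / 3 : ℝ) ^ (1 / p)) ^ j := by
  have h1 : |a j - a (j + 1)| ^ p ≤ Z * (2 / 3 : ℝ) ^ j := by
    have : (2 / 3 : ℝ) ^ j = ((3 / 2 : ℝ) ^ j)⁻¹ := by rw [← inv_pow]; norm_num
    rw [this, ← div_eq_mul_inv, le_div_iff₀ (by positivity)]
    linarith
  have hZ : 0 ≤ Z := le_trans (by positivity) h
  have h2 := Real.rpow_le_rpow (by positivity) h1 (show 0 ≤ 1 / p by positivity)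
  rw [← Real.rpow_mul (abs_nonneg _), mul_one_div_cancel hp.ne', Real.rpow_one,
    Real.mul_rpow hZ (by positivity), ← Real.rpow_natCast, ← Real.rpow_mul (by norm_num)] at h2
  rwa [← Real.rpow_natCast, ← Real.rpow_mul (by norm_num), mul_comm (1 / p)]

/-- Geometric constant attached to the exponent `p`. -/
def geoConst (p : ℝ) : ℝ := 1 / (1 - (2 / 3 : ℝ) ^ (1 / p))

lemma cauchySeq_of_geometric {p : ℝ} (hp : 0 < p) {a : ℕ → ℝ} {Z : ℝ} {j₀ : ℕ}
    (h : ∀ j, j₀ ≤ j → (3 / 2 : ℝ) ^ j * |a j - a (j + 1)| ^ p ≤ Z) :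
    CauchySeq a ∧ ∀ n, j₀ ≤ n → |a n - a j₀| ≤ geoConst p * Z ^ (1 / p) := by
  have hr1 : (2 / 3 : ℝ) ^ (1 / p) < 1 :=
    Real.rpow_lt_one (by norm_num) (by norm_num) (by positivity)
  have hr0 : 0 ≤ (2 / 3 : ℝ) ^ (1 / p) := by positivity
  set r := (2 / 3 : ℝ) ^ (1 / p) with hr
  have hZ : 0 ≤ Z := le_trans (by positivity) (h j₀ le_rfl)
  have hb : ∀ n, dist (a (n + j₀)) (a (n + 1 + j₀)) ≤ Z ^ (1 / p) * r ^ n := by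
    intro n
    have h1 := abs_sub_le_geometric hp (h (n + j₀) (by omega))
    rw [Real.dist_eq, show n + 1 + j₀ = n + j₀ + 1 by ring]
    refine h1.trans ?_
    exact mul_le_mul_of_nonneg_left (pow_le_pow_of_le_one hr0 hr1.le (Nat.le_add_right n j₀))
      (by positivity)
  have hc := cauchySeq_of_le_geometric r _ hr1 hb
  refine ⟨(cauchySeq_shift j₀).1 hc, fun n hn => ?_⟩
  obtain ⟨k, rfl⟩ := Nat.exists_eq_add_of_le' hn
  have : ∀ k, dist (a (0 + j₀)) (a (k + j₀)) ≤ ∑ i ∈ Finset.range k, Z ^ (1 / p) * r ^ i :=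
    fun k => dist_le_range_sum_of_dist_le (f := fun n => a (n + j₀)) k (fun {i} _ => hb i)
  have h2 := this k
  rw [← Finset.mul_sum] at h2
  rw [abs_sub_comm, ← Real.dist_eq]
  simp only [zero_add] at h2
  refine h2.trans ?_
  rw [mul_comm, geoConst]
  gcongr
  rw [one_div, ← tsum_geometric_of_lt_one hr0 hr1]
  exact (summable_geometric_of_lt_one hr0 hr1).sum_le_tsum _ (fun i _ => by positivity)

/-- Pointwise weighted sum of the increments of a sequence. -/
def geoSum (p : ℝ) (a : ℕ → ℝ) : ℝ≥0∞ :=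
  ∑' j, ENNReal.ofReal ((3 / 2 : ℝ) ^ j * |a j - a (j + 1)| ^ p)

lemma cauchySeq_of_geoSum {p : ℝ} (hp : 0 < p) {a : ℕ → ℝ} (h : geoSum p a ≠ ⊤) :
    CauchySeq a ∧ ∀ n, |a n - a 0| ≤ geoConst p * (geoSum p a).toReal ^ (1 / p) := by
  have h1 := cauchySeq_of_geometric (j₀ := 0) hp (a := a) (Z := (geoSum p a).toReal) (fun j _ => by
    rw [← ENNReal.ofReal_le_iff_le_toReal h]
    exact ENNReal.le_tsum j)
  exact ⟨h1.1, fun n => h1.2 n (Nat.zero_le _)⟩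

lemma lintegral_geoSum_lt_top {Y : Type*} [MeasurableSpace Y] {η : Measure Y} {p : ℝ}
    {f : ℕ → Y → ℝ} (hf : ∀ n, Measurable (f n)) {C : ℝ≥0∞} (hC : C ≠ ⊤)
    (h : ∀ n, ∫⁻ y, ENNReal.ofReal (|f n y - f (n + 1) y| ^ p) ∂η ≤ C * (1 / 2) ^ n) :
    ∫⁻ y, geoSum p (fun n => f n y) ∂η < ⊤ := by
  unfold geoSum
  rw [lintegral_tsum (fun n => by
    have := hf n; have := hf (n+1); fun_prop)]
  have hb : ∀ n, ∫⁻ y, ENNReal.ofReal ((3 / 2 : ℝ) ^ n * |f n y - f (n + 1) y| ^ p) ∂η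
      ≤ C * (ENNReal.ofReal (3 / 4)) ^ n := by
    intro n
    simp_rw [ENNReal.ofReal_mul (show (0:ℝ) ≤ (3 / 2 : ℝ) ^ n by positivity)]
    rw [lintegral_const_mul' _ _ ENNReal.ofReal_ne_top]
    refine (mul_le_mul_right (h n) _).trans (le_of_eq ?_)
    rw [mul_left_comm, ENNReal.ofReal_pow (by norm_num), ← mul_pow]
    congr 2
    rw [show (1 / 2 : ℝ≥0∞) = ENNReal.ofReal (1 / 2) by
      rw [ENNReal.ofReal_div_of_pos (by norm_num)]; simp, ← ENNReal.ofReal_mul (by norm_num)]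
    norm_num
  refine (ENNReal.tsum_le_tsum hb).trans_lt ?_
  rw [ENNReal.tsum_mul_left, ENNReal.tsum_geometric]
  refine ENNReal.mul_lt_top hC.lt_top ?_
  rw [lt_top_iff_ne_top, ne_eq, ENNReal.inv_eq_top, tsub_eq_zero_iff_le, not_le]
  rw [← ENNReal.ofReal_one, ENNReal.ofReal_lt_ofReal_iff (by norm_num)]
  norm_num

/-! ### Minimization of a strongly convex functional -/

section Minimization

variable {X : Type*} [MeasurableSpace X] {ν : Measure X} {Γ : Measure (X × X)}

/-- Quadratic energy plus a convex integral functional. -/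
def jfun (ν : Measure X) (Γ : Measure (X × X)) (h : ℝ) (Ψ : X → ℝ → ℝ) (z : X → ℝ) : ℝ≥0∞ :=
  ENNReal.ofReal h * energy Γ z + ∫⁻ x, ENNReal.ofReal (Ψ x (z x)) ∂ν

lemma two_mul_energy_mid_le {a b : X → ℝ} (ha : Measurable a) :
    2 * energy Γ (fun x => (a x + b x) / 2) ≤ energy Γ a + energy Γ b := by
  unfold energy
  rw [← lintegral_add_left (((measurable_pdiff ha).pow_const 2).ennreal_ofReal),
    ← lintegral_const_mul' _ _ (by simp)]
  refine lintegral_mono fun p => ?_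
  rw [← ENNReal.ofReal_add (sq_nonneg _) (sq_nonneg _),
    show (2 : ℝ≥0∞) = ENNReal.ofReal 2 by simp, ← ENNReal.ofReal_mul (by norm_num)]
  refine ENNReal.ofReal_le_ofReal ?_
  simp only [pdiff]
  nlinarith [sq_nonneg ((a p.1 - a p.2) - (b p.1 - b p.2))]

lemma energy_le_liminf (hM : MarginalsAC ν Γ) {z : ℕ → X → ℝ} {w : X → ℝ}
    (hz : ∀ n, Measurable (z n))
    (hlim : ∀ᵐ x ∂ν, Tendsto (fun n => z n x) atTop (𝓝 (w x))) :
    energy Γ w ≤ liminf (fun n => energy Γ (z n)) atTop := by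
  unfold energy
  refine le_trans (le_of_eq (lintegral_congr_ae ?_))
    (lintegral_liminf_le fun n => ((measurable_pdiff (hz n)).pow_const 2).ennreal_ofReal)
  filter_upwards [hM.ae_prod hlim] with p hp
  refine (Tendsto.liminf_eq ?_).symm
  exact (ENNReal.continuous_ofReal.tendsto _).comp ((hp.1.sub hp.2).pow 2)

lemma liminf_add_liminf_le (f g : ℕ → ℝ≥0∞) :
    liminf f atTop + liminf g atTop ≤ liminf (fun n => f n + g n) atTop := by
  simp only [liminf_eq_iSup_iInf_of_nat]
  rw [ENNReal.iSup_add_iSup_of_monotone]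
  · refine iSup_mono fun n => le_iInf₂ fun i hi => add_le_add (iInf₂_le i hi) (iInf₂_le i hi)
  · exact fun a b hab => le_iInf₂ fun i hi => iInf₂_le i (hab.trans hi)
  · exact fun a b hab => le_iInf₂ fun i hi => iInf₂_le i (hab.trans hi)

theorem exists_minimizer (hM : MarginalsAC ν Γ) {h B c : ℝ} (hB : 0 ≤ B) (hc : 0 < c)
    {Ψ : X → ℝ → ℝ} (hΨm : Measurable (Function.uncurry Ψ))
    (hΨ0 : ∀ x, ∀ z ∈ Icc 0 B, 0 ≤ Ψ x z) (hΨc : ∀ x, Continuous (Ψ x))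
    (hmid : ∀ x, ∀ a ∈ Icc 0 B, ∀ b ∈ Icc 0 B,
      Ψ x ((a + b) / 2) + c * (a - b) ^ 2 ≤ (Ψ x a + Ψ x b) / 2)
    (hfin : ∫⁻ x, ENNReal.ofReal (Ψ x 0) ∂ν ≠ ⊤) :
    ∃ z : X → ℝ, Measurable z ∧ (∀ x, z x ∈ Icc 0 B) ∧ jfun ν Γ h Ψ z ≠ ⊤ ∧
      ∀ z' : X → ℝ, Measurable z' → (∀ x, z' x ∈ Icc 0 B) →
        jfun ν Γ h Ψ z ≤ jfun ν Γ h Ψ z' := by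
  set S : Set (X → ℝ) := {z | Measurable z ∧ ∀ x, z x ∈ Icc 0 B} with hS
  have hJm : ∀ z : X → ℝ, Measurable z → Measurable fun x => ENNReal.ofReal (Ψ x (z x)) :=
    fun z hz => (hΨm.comp (measurable_id.prodMk hz)).ennreal_ofReal
  have hS0 : (fun _ => (0 : ℝ)) ∈ S := ⟨measurable_const, fun x => ⟨le_rfl, hB⟩⟩
  set I : ℝ≥0∞ := ⨅ z ∈ S, jfun ν Γ h Ψ z with hI
  have hI_le : ∀ z ∈ S, I ≤ jfun ν Γ h Ψ z := fun z hz => iInf₂_le z hz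
  have hItop : I ≠ ⊤ := by
    refine ne_top_of_le_ne_top ?_ (hI_le _ hS0)
    simp only [jfun, energy_zero, mul_zero, zero_add]
    exact hfin
  have hex : ∀ n : ℕ, ∃ z ∈ S, jfun ν Γ h Ψ z ≤ I + (1 / 2) ^ n := by
    intro n
    have : I < I + (1 / 2) ^ n := ENNReal.lt_add_right hItop (by simp)
    rw [hI] at this
    simp only [iInf_lt_iff] at this
    obtain ⟨z, hz, hlt⟩ := this
    exact ⟨z, hz, hlt.le⟩
  choose z hzS hzI using hex
  have hkey : ∀ n, ∫⁻ x, ENNReal.ofReal (|z n x - z (n + 1) x| ^ (2 : ℝ)) ∂ν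
      ≤ (ENNReal.ofReal c)⁻¹ * (1 / 2) ^ n := by
    intro n
    set a := z n
    set b := z (n + 1)
    have ham := (hzS n).1
    have hbm := (hzS (n + 1)).1
    set w : X → ℝ := fun x => (a x + b x) / 2
    have hwm : Measurable w := (ham.add hbm).div_const 2
    have hwS : w ∈ S := ⟨hwm, fun x => by
      have h1 := (hzS n).2 x
      have h2 := (hzS (n + 1)).2 x
      simp only [mem_Icc] at h1 h2 ⊢
      constructor <;> simp only [w, a, b] <;> linarith [h1.1, h1.2, h2.1, h2.2]⟩
    have hbound : 2 * jfun ν Γ h Ψ w + 2 * (ENNReal.ofReal c *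
        ∫⁻ x, ENNReal.ofReal (|a x - b x| ^ (2 : ℝ)) ∂ν) ≤ jfun ν Γ h Ψ a + jfun ν Γ h Ψ b := by
      have h1 := two_mul_energy_mid_le (Γ := Γ) (b := b) ham
      have h2 : 2 * (∫⁻ x, ENNReal.ofReal (Ψ x (w x)) ∂ν) + 2 * (ENNReal.ofReal c *
          ∫⁻ x, ENNReal.ofReal (|a x - b x| ^ (2 : ℝ)) ∂ν) ≤
          (∫⁻ x, ENNReal.ofReal (Ψ x (a x)) ∂ν) + ∫⁻ x, ENNReal.ofReal (Ψ x (b x)) ∂ν := by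
        rw [← lintegral_const_mul' _ _ ENNReal.ofReal_ne_top,
          ← lintegral_const_mul' _ _ (by simp), ← lintegral_const_mul' _ _ (by simp),
          ← lintegral_add_left ((hJm w hwm).const_mul _), ← lintegral_add_left (hJm a ham)]
        refine lintegral_mono fun x => ?_
        have hw0 := hΨ0 x _ (hwS.2 x)
        have ha0 := hΨ0 x _ ((hzS n).2 x)
        have hb0 := hΨ0 x _ ((hzS (n + 1)).2 x)
        rw [← ENNReal.ofReal_mul hc.le, show (2 : ℝ≥0∞) = ENNReal.ofReal 2 by simp,
          ← ENNReal.ofReal_mul (by norm_num), ← ENNReal.ofReal_mul (by norm_num),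
          ← ENNReal.ofReal_add (by positivity) (by positivity), ← ENNReal.ofReal_add ha0 hb0]
        refine ENNReal.ofReal_le_ofReal ?_
        have := hmid x _ ((hzS n).2 x) _ ((hzS (n + 1)).2 x)
        simp only [Real.rpow_two, sq_abs]
        linarith
      calc 2 * jfun ν Γ h Ψ w + 2 * (ENNReal.ofReal c *
        ∫⁻ x, ENNReal.ofReal (|a x - b x| ^ (2 : ℝ)) ∂ν)
          = ENNReal.ofReal h * (2 * energy Γ w) + (2 * (∫⁻ x, ENNReal.ofReal (Ψ x (w x)) ∂ν)
            + 2 * (ENNReal.ofReal c * ∫⁻ x, ENNReal.ofReal (|a x - b x| ^ (2 : ℝ)) ∂ν)) := by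
            unfold jfun; ring
        _ ≤ ENNReal.ofReal h * (energy Γ a + energy Γ b) +
            ((∫⁻ x, ENNReal.ofReal (Ψ x (a x)) ∂ν) + ∫⁻ x, ENNReal.ofReal (Ψ x (b x)) ∂ν) := by
            gcongr
        _ = _ := by unfold jfun; ring
    have h3 : jfun ν Γ h Ψ a + jfun ν Γ h Ψ b ≤ 2 * I + 2 * (1 / 2) ^ n := by
      calc _ ≤ (I + (1 / 2) ^ n) + (I + (1 / 2) ^ (n + 1)) := add_le_add (hzI n) (hzI (n + 1))
        _ ≤ (I + (1 / 2) ^ n) + (I + (1 / 2) ^ n) := by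
          gcongr (I + (1 / 2) ^ n) + (I + ?_)
          exact pow_le_pow_of_le_one (zero_le) (by simp) (Nat.le_succ n)
        _ = _ := by ring
    have h4 : 2 * I + 2 * (ENNReal.ofReal c *
        ∫⁻ x, ENNReal.ofReal (|a x - b x| ^ (2 : ℝ)) ∂ν) ≤ 2 * I + 2 * (1 / 2) ^ n := by
      refine le_trans ?_ (hbound.trans h3)
      gcongr
      exact hI_le w hwS
    have h5 := (ENNReal.add_le_add_iff_left (ENNReal.mul_ne_top (by simp) hItop)).1 h4
    have h6 := (ENNReal.mul_le_mul_iff_right (by simp) (by simp)).1 h5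
    rw [mul_comm, ← div_eq_mul_inv, ENNReal.le_div_iff_mul_le (by simp [hc]) (by simp), mul_comm]
    exact h6
  have hgeo := lintegral_geoSum_lt_top (fun n => (hzS n).1)
    (ENNReal.inv_ne_top.2 (by simp [hc])) hkey
  have hgm : Measurable fun y => geoSum 2 (fun n => z n y) := by
    unfold geoSum
    refine Measurable.tsum fun n => ?_
    have := (hzS n).1; have := (hzS (n + 1)).1
    fun_prop
  have hae := ae_lt_top hgm hgeo.ne
  have hconv : ∀ᵐ x ∂ν, ∃ l, Tendsto (fun n => z n x) atTop (𝓝 l) := by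
    filter_upwards [hae] with x hx
    exact cauchySeq_tendsto_of_complete (cauchySeq_of_geoSum (by norm_num) hx.ne).1
  obtain ⟨w₀, hw₀m, hw₀⟩ := measurable_limit_of_tendsto_metrizable_ae
    (fun n => (hzS n).1.aemeasurable) hconv
  set w : X → ℝ := fun x => max 0 (min B (w₀ x)) with hw
  have hwm : Measurable w := measurable_const.max (measurable_const.min hw₀m)
  have hwS : ∀ x, w x ∈ Icc 0 B := fun x =>
    ⟨le_max_left _ _, max_le hB (min_le_left _ _)⟩
  have hwlim : ∀ᵐ x ∂ν, Tendsto (fun n => z n x) atTop (𝓝 (w x)) := by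
    filter_upwards [hw₀] with x hx
    have : w x = w₀ x := by
      have h1 : 0 ≤ w₀ x := ge_of_tendsto' hx fun n => ((hzS n).2 x).1
      have h2 : w₀ x ≤ B := le_of_tendsto' hx fun n => ((hzS n).2 x).2
      simp [hw, h1, h2]
    rwa [this]
  have hwI : jfun ν Γ h Ψ w ≤ I := by
    have h1 := energy_le_liminf hM (fun n => (hzS n).1) hwlim
    have h2 : ∫⁻ x, ENNReal.ofReal (Ψ x (w x)) ∂ν ≤
        liminf (fun n => ∫⁻ x, ENNReal.ofReal (Ψ x (z n x)) ∂ν) atTop := by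
      refine le_trans (le_of_eq (lintegral_congr_ae ?_))
        (lintegral_liminf_le fun n => hJm _ (hzS n).1)
      filter_upwards [hwlim] with x hx
      refine (Tendsto.liminf_eq ?_).symm
      exact (ENNReal.continuous_ofReal.tendsto _).comp (((hΨc x).tendsto _).comp hx)
    have h3 : liminf (fun n => jfun ν Γ h Ψ (z n)) atTop ≤ I := by
      have ht : Tendsto (fun n : ℕ => I + (1 / 2 : ℝ≥0∞) ^ n) atTop (𝓝 (I + 0)) := by
        refine tendsto_const_nhds.add ?_
        exact ENNReal.tendsto_pow_atTop_nhds_zero_of_lt_one (by simp)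
      rw [add_zero] at ht
      rw [← ht.liminf_eq]
      exact liminf_le_liminf (Eventually.of_forall hzI)
    refine le_trans ?_ h3
    unfold jfun
    refine le_trans ?_ (liminf_add_liminf_le _ _)
    refine add_le_add ?_ h2
    refine (mul_le_mul_right h1 _).trans ?_
    rw [ENNReal.liminf_const_mul_of_ne_top ENNReal.ofReal_ne_top]
  exact ⟨w, hwm, hwS, ne_top_of_le_ne_top hItop hwI, fun z' hz' hz'S =>
    hwI.trans (hI_le z' ⟨hz', hz'S⟩)⟩

end Minimization

/-! ### Pointwise power inequalities -/

/-- The exponent `1 + 1/m`, conjugate to `m + 1`. -/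
def conjExp (m : ℝ) : ℝ := 1 + 1 / m

lemma one_lt_conjExp {m : ℝ} (hm : 1 < m) : 1 < conjExp m := by
  have : 0 < 1 / m := by positivity
  unfold conjExp; linarith

lemma conjExp_lt_two {m : ℝ} (hm : 1 < m) : conjExp m < 2 := by
  have : 1 / m < 1 := by rw [div_lt_one (by linarith)]; exact hm
  unfold conjExp; linarith

lemma holderConjugate_conjExp {m : ℝ} (hm : 1 < m) : (m + 1).HolderConjugate (conjExp m) := by
  rw [Real.holderConjugate_iff]
  refine ⟨by linarith, ?_⟩
  unfold conjExp
  have : m + 1 ≠ 0 := by linarith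
  field_simp
  ring

lemma one_div_mul_add_one {m : ℝ} (hm : 1 < m) : 1 / m * (m + 1) = conjExp m := by
  have : m ≠ 0 := by linarith
  unfold conjExp; field_simp

lemma mul_conjExp {m : ℝ} (hm : 1 < m) : m * conjExp m = m + 1 := by
  have : m ≠ 0 := by linarith
  unfold conjExp; field_simp

lemma one_div_add_one {m : ℝ} (hm : 1 < m) : 1 / (m + 1) = 1 - 1 / conjExp m := by
  have := (holderConjugate_conjExp hm).inv_add_inv_eq_one
  simp only [one_div]; linarith

lemma rpow_root_tangent {m : ℝ} (hm : 1 < m) {z z' : ℝ} (hz : 0 ≤ z) (hz' : 0 ≤ z') :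
    z ^ conjExp m / conjExp m + z ^ (1 / m) * (z' - z) ≤ z' ^ conjExp m / conjExp m := by
  have h1 := Real.young_inequality_of_nonneg (Real.rpow_nonneg hz (1 / m)) hz'
    (holderConjugate_conjExp hm)
  rw [← Real.rpow_mul hz, one_div_mul_add_one hm] at h1
  have h2 : z ^ (1 / m) * z = z ^ conjExp m := by
    rw [conjExp, add_comm, Real.rpow_add_one' hz (by positivity)]
  have h3 := one_div_add_one hm
  have h4 : z ^ conjExp m / (m + 1) = z ^ conjExp m - z ^ conjExp m / conjExp m := by
    rw [div_eq_mul_one_div, h3]; ring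
  nlinarith

lemma rpow_mid_strong {q B : ℝ} (hq : 1 < q) (hq2 : q < 2) {a b : ℝ}
    (ha : a ∈ Icc 0 B) (hb : b ∈ Icc 0 B) :
    ((a + b) / 2) ^ q / q + (q - 1) * B ^ (q - 2) / 8 * (a - b) ^ 2 ≤
      (a ^ q / q + b ^ q / q) / 2 := by
  set c := (q - 1) * B ^ (q - 2) / 2 with hc
  have hconv : ConvexOn ℝ (Icc 0 B) fun z : ℝ => z ^ q / q - c * z ^ 2 := by
    refine convexOn_of_hasDerivWithinAt2_nonneg (convex_Icc 0 B)
      (f' := fun z => z ^ (q - 1) - c * (2 * z))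
      (f'' := fun z => (q - 1) * z ^ (q - 2) - c * 2) ?_ ?_ ?_ ?_
    · refine ContinuousOn.sub ?_ (by fun_prop)
      exact ((Real.continuous_rpow_const (by linarith)).div_const _).continuousOn
    · intro z hz
      rw [interior_Icc] at hz
      refine HasDerivAt.hasDerivWithinAt ?_
      have h1 := (Real.hasDerivAt_rpow_const (x := z) (p := q) (Or.inl hz.1.ne')).div_const q
      have h2 := ((hasDerivAt_pow 2 z).const_mul c)
      have hq0 : q ≠ 0 := by linarith
      rw [mul_div_cancel_left₀ _ hq0] at h1
      simp only [Nat.add_one_sub_one, pow_one, Nat.cast_ofNat] at h2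
      exact h1.sub h2
    · intro z hz
      rw [interior_Icc] at hz
      refine HasDerivAt.hasDerivWithinAt ?_
      have h1 := (Real.hasDerivAt_rpow_const (x := z) (p := q - 1) (Or.inl hz.1.ne'))
      have h2 := (((hasDerivAt_id z).const_mul 2).const_mul c)
      rw [show q - 1 - 1 = q - 2 by ring] at h1
      simp only [mul_one, id] at h2
      exact h1.sub h2
    · intro z hz
      rw [interior_Icc] at hz
      have : B ^ (q - 2) ≤ z ^ (q - 2) :=
        Real.rpow_le_rpow_of_nonpos hz.1 hz.2.le (by linarith)
      have : (q - 1) * B ^ (q - 2) ≤ (q - 1) * z ^ (q - 2) :=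
        mul_le_mul_of_nonneg_left this (by linarith)
      simp only [hc]; linarith
  have := hconv.2 ha hb (show (0 : ℝ) ≤ 1 / 2 by norm_num) (show (0 : ℝ) ≤ 1 / 2 by norm_num)
    (by norm_num)
  simp only [smul_eq_mul] at this
  rw [show 1 / 2 * a + 1 / 2 * b = (a + b) / 2 by ring] at this
  rw [show (q - 1) * B ^ (q - 2) / 8 = c / 4 by rw [hc]; ring]
  nlinarith

lemma sub_mul_rpow_ge {m : ℝ} (hm : 1 < m) {a b : ℝ} (ha : 0 ≤ a) (hb : 0 ≤ b) :
    (a ^ (m + 1) - b ^ (m + 1)) / (m + 1) ≤ (a - b) * a ^ m := by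
  have h1 := Real.young_inequality_of_nonneg hb (Real.rpow_nonneg ha m)
    (holderConjugate_conjExp hm)
  rw [← Real.rpow_mul ha, mul_conjExp hm] at h1
  have h2 : a * a ^ m = a ^ (m + 1) := by
    rw [Real.rpow_add_one' ha (by linarith)]; ring
  have h4 : a ^ (m + 1) / (m + 1) = a ^ (m + 1) - a ^ (m + 1) / conjExp m := by
    rw [div_eq_mul_one_div, one_div_add_one hm]; ring
  rw [sub_div, sub_mul, h2]
  linarith

lemma sub_mul_posPart_ge (a b k : ℝ) :
    (max (a - k) 0 ^ 2 - max (b - k) 0 ^ 2) / 2 ≤ (a - b) * max (a - k) 0 := by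
  rcases max_cases (a - k) 0 with ⟨h1, h2⟩ | ⟨h1, h2⟩ <;>
    rcases max_cases (b - k) 0 with ⟨h3, h4⟩ | ⟨h3, h4⟩ <;> rw [h1, h3] <;>
    nlinarith [sq_nonneg (a - b), sq_nonneg (b - k), sq_nonneg (a - k)]

lemma rpow_sub_rpow_ge {m k a b : ℝ} (hm : 1 < m) (hk : 0 < k) (hb : 0 ≤ b) (hab : b ≤ a) :
    k ^ (m - 1) * (max (a - k) 0 - max (b - k) 0) ≤ a ^ m - b ^ m := by
  have ha : 0 ≤ a := hb.trans hab
  have hmono : b ^ m ≤ a ^ m := Real.rpow_le_rpow hb hab (by linarith)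
  rcases le_total a k with hak | hak
  · rw [max_eq_right (by linarith), max_eq_right (by linarith)]; simpa using hmono
  have key : ∀ c, k ≤ c → c ≤ a → k ^ (m - 1) * (a - c) ≤ a ^ m - c ^ m := by
    intro c hc hca
    have h1 : a ^ m = a ^ (m - 1) * a := by
      rw [← Real.rpow_add_one' ha (by linarith)]; ring_nf
    have h2 : c ^ m = c ^ (m - 1) * c := by
      rw [← Real.rpow_add_one' (hk.le.trans hc) (by linarith)]; ring_nf
    have h3 : k ^ (m - 1) ≤ a ^ (m - 1) := Real.rpow_le_rpow hk.le hak (by linarith)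
    have h4 : c ^ (m - 1) ≤ a ^ (m - 1) :=
      Real.rpow_le_rpow (hk.le.trans hc) hca (by linarith)
    rw [h1, h2]
    nlinarith [hk.le.trans hc]
  rcases le_total b k with hbk | hbk
  · rw [max_eq_left (by linarith), max_eq_right (by linarith), sub_zero]
    refine (key k le_rfl hak).trans ?_
    have := Real.rpow_le_rpow hb hbk (show 0 ≤ m by linarith)
    linarith
  · rw [max_eq_left (by linarith), max_eq_left (by linarith)]
    have := key b hbk hab
    linarith

lemma sub_rpow_le_rpow_sub {m a b : ℝ} (hm : 1 < m) (hb : 0 ≤ b) (hab : b ≤ a) :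
    (a - b) ^ m ≤ a ^ m - b ^ m := by
  have := Real.add_rpow_le_rpow_add (sub_nonneg.2 hab) hb hm.le
  rw [sub_add_cancel] at this
  linarith

lemma abs_sub_rpow_le {m a b : ℝ} (hm : 1 < m) (ha : 0 ≤ a) (hb : 0 ≤ b) :
    |a - b| ^ (m + 1) ≤ (a - b) * (a ^ m - b ^ m) := by
  wlog hab : b ≤ a generalizing a b
  · have := this hb ha (le_of_not_ge hab)
    rw [abs_sub_comm]; linarith
  rw [abs_of_nonneg (sub_nonneg.2 hab), Real.rpow_add_one' (sub_nonneg.2 hab) (by linarith),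
    mul_comm]
  exact mul_le_mul_of_nonneg_left (sub_rpow_le_rpow_sub hm hb hab) (sub_nonneg.2 hab)

lemma abs_add_rpow_le {q : ℝ} (hq : 0 ≤ q) (a b : ℝ) :
    |a + b| ^ q ≤ 2 ^ q * (|a| ^ q + |b| ^ q) := by
  have h1 : |a + b| ≤ 2 * max |a| |b| := by
    refine (abs_add_le a b).trans ?_
    linarith [le_max_left |a| |b|, le_max_right |a| |b|]
  refine (Real.rpow_le_rpow (abs_nonneg _) h1 hq).trans ?_
  rw [Real.mul_rpow (by norm_num) (by positivity)]
  refine mul_le_mul_of_nonneg_left ?_ (by positivity)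
  have ha : 0 ≤ |a| ^ q := by positivity
  have hb : 0 ≤ |b| ^ q := by positivity
  rcases max_cases |a| |b| with ⟨h, _⟩ | ⟨h, _⟩ <;> rw [h] <;> linarith

/-! ### Test functions for the form -/

section FormTests

variable {X : Type*} [MeasurableSpace X] {ν : Measure X} {Γ : Measure (X × X)}

/-- Functions of finite energy and finite `q`-th moment. -/
structure FormTest (ν : Measure X) (Γ : Measure (X × X)) (q : ℝ) (w : X → ℝ) : Prop where
  meas : Measurable w
  intq : Integrable (fun x => |w x| ^ q) ν
  fin : energy Γ w ≠ ⊤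

lemma FormTest.memLp {q : ℝ} {w : X → ℝ} (h : FormTest ν Γ q w) : MemLp (pdiff w) 2 Γ :=
  memLp_pdiff_of_energy h.meas h.fin

lemma FormTest.add {q : ℝ} (hq : 0 ≤ q) {v w : X → ℝ} (hv : FormTest ν Γ q v)
    (hw : FormTest ν Γ q w) : FormTest ν Γ q (fun x => v x + w x) where
  meas := hv.meas.add hw.meas
  intq := by
    refine Integrable.mono' ((hv.intq.add hw.intq).const_mul (2 ^ q))
      ((hv.meas.add hw.meas).abs.pow_const q).aestronglyMeasurable
      (Eventually.of_forall fun x => ?_)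
    rw [Real.norm_of_nonneg (by positivity)]
    exact abs_add_rpow_le hq _ _
  fin := by
    refine energy_ne_top ?_
    have : pdiff (fun x => v x + w x) = pdiff v + pdiff w := by ext p; simp [pdiff]; ring
    rw [this]; exact hv.memLp.add hw.memLp

lemma FormTest.const_mul {q : ℝ} {w : X → ℝ} (hw : FormTest ν Γ q w) (c : ℝ) :
    FormTest ν Γ q (fun x => c * w x) where
  meas := hw.meas.const_mul c
  intq := by
    have : (fun x => |c * w x| ^ q) = fun x => |c| ^ q * |w x| ^ q := by
      ext x; rw [abs_mul, Real.mul_rpow (abs_nonneg _) (abs_nonneg _)]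
    rw [this]; exact hw.intq.const_mul _
  fin := by
    refine energy_ne_top ?_
    have : pdiff (fun x => c * w x) = fun p => c * pdiff w p := by ext p; simp [pdiff]; ring
    rw [this]; exact hw.memLp.const_mul c

lemma FormTest.sub {q : ℝ} (hq : 0 ≤ q) {v w : X → ℝ} (hv : FormTest ν Γ q v)
    (hw : FormTest ν Γ q w) : FormTest ν Γ q (fun x => v x - w x) := by
  have := hv.add hq (hw.const_mul (-1))
  convert this using 2; ring

lemma integrable_mul_of_rpow {p q : ℝ} (hpq : p.HolderConjugate q) {a w : X → ℝ}
    (ham : Measurable a) (hwm : Measurable w) (ha : Integrable (fun x => |a x| ^ p) ν)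
    (hw : Integrable (fun x => |w x| ^ q) ν) : Integrable (fun x => a x * w x) ν := by
  refine Integrable.mono' ((ha.div_const p).add (hw.div_const q))
    (ham.mul hwm).aestronglyMeasurable (Eventually.of_forall fun x => ?_)
  have := Real.young_inequality |a x| |w x| hpq
  rw [abs_abs, abs_abs, ← abs_mul] at this
  exact this

lemma integrable_rpow_of_bdd {a : X → ℝ} {N p : ℝ} (ham : Measurable a) (ha : Integrable a ν)
    (hN : ∀ x, |a x| ≤ N) (hp : 1 ≤ p) : Integrable (fun x => |a x| ^ p) ν := by
  refine Integrable.mono' (ha.abs.const_mul (N ^ (p - 1)))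
    (ham.abs.pow_const p).aestronglyMeasurable (Eventually.of_forall fun x => ?_)
  rw [Real.norm_of_nonneg (by positivity)]
  have h1 : |a x| ^ p = |a x| ^ (p - 1) * |a x| := by
    rw [← Real.rpow_add_one' (abs_nonneg _) (by linarith)]; ring_nf
  rw [h1]
  exact mul_le_mul_of_nonneg_right (Real.rpow_le_rpow (abs_nonneg _) (hN x) (by linarith))
    (abs_nonneg _)

lemma energy_le_of_abs_pdiff_le {v w : X → ℝ} {L : ℝ} (h : ∀ p, |pdiff v p| ≤ L * |pdiff w p|) :
    energy Γ v ≤ ENNReal.ofReal (L ^ 2) * energy Γ w := by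
  unfold energy
  rw [← lintegral_const_mul' _ _ ENNReal.ofReal_ne_top]
  refine lintegral_mono fun p => ?_
  rw [← ENNReal.ofReal_mul (sq_nonneg L)]
  refine ENNReal.ofReal_le_ofReal ?_
  have := pow_le_pow_left₀ (abs_nonneg _) (h p) 2
  rwa [mul_pow, sq_abs, sq_abs] at this

lemma eform_add_right {u v w : X → ℝ} (hu : MemLp (pdiff u) 2 Γ) (hv : MemLp (pdiff v) 2 Γ)
    (hw : MemLp (pdiff w) 2 Γ) :
    eform Γ u (fun x => v x + w x) = eform Γ u v + eform Γ u w := by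
  unfold eform
  rw [← integral_add (integrable_pdiff_mul hu hv) (integrable_pdiff_mul hu hw)]
  refine integral_congr_ae (Eventually.of_forall fun p => ?_)
  simp only [pdiff]; ring

lemma eform_comm (v w : X → ℝ) : eform Γ v w = eform Γ w v := by
  unfold eform; simp_rw [mul_comm]

lemma eform_const_mul_right (v w : X → ℝ) (c : ℝ) :
    eform Γ v (fun x => c * w x) = c * eform Γ v w := by
  unfold eform
  rw [← integral_const_mul]
  refine integral_congr_ae (Eventually.of_forall fun p => ?_)
  simp only [pdiff]; ring

lemma eform_sub_right {u v w : X → ℝ} (hu : MemLp (pdiff u) 2 Γ) (hv : MemLp (pdiff v) 2 Γ)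
    (hw : MemLp (pdiff w) 2 Γ) :
    eform Γ u (fun x => v x - w x) = eform Γ u v - eform Γ u w := by
  unfold eform
  rw [← integral_sub (integrable_pdiff_mul hu hv) (integrable_pdiff_mul hu hw)]
  refine integral_congr_ae (Eventually.of_forall fun p => ?_)
  simp only [pdiff]; ring

end FormTests

/-! ### One implicit time step -/

section ImplicitStep

variable {X : Type*} [MeasurableSpace X] {ν : Measure X} {Γ : Measure (X × X)}

/-- `u` solves `u - f + h L(u^m) = 0` in the sense of forms. -/
structure ImplicitStep (ν : Measure X) (Γ : Measure (X × X)) (m h N : ℝ) (f u : X → ℝ) : Prop where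
  meas : Measurable u
  mem : ∀ x, u x ∈ Icc 0 N
  int : Integrable u ν
  mass : ∫ x, u x ∂ν ≤ ∫ x, f x ∂ν
  fin : energy Γ (fun x => u x ^ m) ≠ ⊤
  eq : ∀ w, FormTest ν Γ (conjExp m) w →
    (∫ x, (u x - f x) * w x ∂ν) + h * eform Γ (fun x => u x ^ m) w = 0

lemma rpow_posPart_add_le {m v w ε : ℝ} (hm : 1 < m) (hv : 0 ≤ v) (hε0 : 0 ≤ ε) (hε : ε ≤ 1) :
    max (v + ε * w) 0 ^ (1 / m) ≤ v ^ (1 / m) + |w| ^ (1 / m) := by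
  have h1 : max (v + ε * w) 0 ≤ v + |w| := by
    refine max_le ?_ (by positivity)
    have : ε * w ≤ |w| := by
      calc ε * w ≤ ε * |w| := mul_le_mul_of_nonneg_left (le_abs_self w) hε0
        _ ≤ 1 * |w| := mul_le_mul_of_nonneg_right hε (abs_nonneg _)
        _ = |w| := one_mul _
    linarith
  refine (Real.rpow_le_rpow (le_max_right _ _) h1 (by positivity)).trans ?_
  exact Real.rpow_add_le_add_rpow hv (abs_nonneg w) (by positivity)
    (by rw [div_le_one (by linarith)]; exact hm.le)

lemma integral_nonneg_of_perturbation {m h : ℝ} (hm : 1 < m) {f v w : X → ℝ} {e₀ e₁ : ℝ}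
    (hfm : Measurable f) (hvm : Measurable v) (hwm : Measurable w) (hv0 : ∀ x, 0 ≤ v x)
    (hfi : Integrable (fun x => |f x| ^ (m + 1)) ν)
    (hvi : Integrable (fun x => |v x| ^ conjExp m) ν)
    (hwi : Integrable (fun x => |w x| ^ conjExp m) ν)
    (H : ∀ ε : ℝ, 0 < ε → ε ≤ 1 → 0 ≤ h * e₀ + ε * e₁ +
      ∫ x, (max (v x + ε * w x) 0 ^ (1 / m) - f x) * w x ∂ν) :
    0 ≤ (∫ x, (v x ^ (1 / m) - f x) * w x ∂ν) + h * e₀ := by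
  have hconj := holderConjugate_conjExp hm
  have hroot : ∀ z : X → ℝ, Integrable (fun x => |z x| ^ conjExp m) ν →
      Integrable (fun x => |(|z x| ^ (1 / m))| ^ (m + 1)) ν := by
    intro z hz
    refine hz.congr (Eventually.of_forall fun x => ?_)
    simp only
    rw [abs_of_nonneg (Real.rpow_nonneg (abs_nonneg _) _), ← Real.rpow_mul (abs_nonneg _),
      one_div_mul_add_one hm]
  have hfw := integrable_mul_of_rpow hconj hfm hwm hfi hwi
  have hvw := integrable_mul_of_rpow hconj (hvm.abs.pow_const (1 / m)) hwm (hroot v hvi) hwi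
  have hww := integrable_mul_of_rpow hconj (hwm.abs.pow_const (1 / m)) hwm (hroot w hwi) hwi
  set ε : ℕ → ℝ := fun n => 1 / ((n : ℝ) + 1) with hε
  have hε0 : ∀ n, 0 < ε n := fun n => by positivity
  have hε1 : ∀ n, ε n ≤ 1 := fun n => by
    simp only [hε]; rw [div_le_one (by positivity)]; linarith [n.cast_nonneg (α := ℝ)]
  have hεt : Tendsto ε atTop (𝓝 0) := tendsto_one_div_add_atTop_nhds_zero_nat
  have hlim : Tendsto (fun n => ∫ x, (max (v x + ε n * w x) 0 ^ (1 / m) - f x) * w x ∂ν) atTop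
      (𝓝 (∫ x, (v x ^ (1 / m) - f x) * w x ∂ν)) := by
    refine tendsto_integral_of_dominated_convergence
      (fun x => |(|v x| ^ (1 / m)) * w x| + |(|w x| ^ (1 / m)) * w x| + |f x * w x|)
      (fun n => ?_) ((hvw.abs.add hww.abs).add hfw.abs) (fun n => ?_) ?_
    · exact ((((hvm.add (hwm.const_mul _)).max measurable_const).pow_const _).sub hfm
        |>.mul hwm).aestronglyMeasurable
    · refine Eventually.of_forall fun x => ?_
      have h1 := rpow_posPart_add_le (w := w x) hm (hv0 x) (hε0 n).le (hε1 n)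
      rw [Real.norm_eq_abs, abs_mul, abs_mul, abs_mul, abs_mul,
        abs_of_nonneg (a := v x) (hv0 x), abs_of_nonneg (Real.rpow_nonneg (hv0 x) _),
        abs_of_nonneg (Real.rpow_nonneg (abs_nonneg (w x)) _), ← add_mul, ← add_mul]
      refine mul_le_mul_of_nonneg_right ?_ (abs_nonneg _)
      refine (abs_sub _ _).trans ?_
      rw [abs_of_nonneg (Real.rpow_nonneg (le_max_right _ _) _)]
      linarith
    · refine Eventually.of_forall fun x => ?_
      have h1 : Tendsto (fun n => max (v x + ε n * w x) 0) atTop (𝓝 (max (v x + 0 * w x) 0)) :=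
        (tendsto_const_nhds.add (hεt.mul_const _)).max tendsto_const_nhds
      rw [zero_mul, add_zero, max_eq_left (hv0 x)] at h1
      have h2 := ((Real.continuous_rpow_const (show 0 ≤ 1 / m by positivity)).tendsto _).comp h1
      exact (h2.sub_const _).mul_const _
  have hlim2 : Tendsto (fun n => h * e₀ + ε n * e₁ +
      ∫ x, (max (v x + ε n * w x) 0 ^ (1 / m) - f x) * w x ∂ν) atTop
      (𝓝 (h * e₀ + 0 * e₁ + ∫ x, (v x ^ (1 / m) - f x) * w x ∂ν)) :=
    (tendsto_const_nhds.add (hεt.mul_const _)).add hlim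
  have := ge_of_tendsto' hlim2 fun n => H _ (hε0 n) (hε1 n)
  linarith

lemma eform_nonneg_of_mul {v w : X → ℝ} (h : ∀ p, 0 ≤ pdiff v p * pdiff w p) :
    0 ≤ eform Γ v w := integral_nonneg h

/-- Truncation `min (max w 0) B`. -/
lemma abs_clamp_sub_le (B a b : ℝ) : |max 0 (min B a) - max 0 (min B b)| ≤ |a - b| := by
  refine (abs_max_sub_max_le_max _ _ _ _).trans ?_
  simp only [sub_self, abs_zero]
  refine max_le (abs_nonneg _) ((abs_min_sub_min_le_max _ _ _ _).trans ?_)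
  simp

/-- Convex density whose derivative is the `m`-th root. -/
lemma clamp_density_le {m N f z : ℝ} (hm : 1 < m) (hN : 0 ≤ N) (hf : f ∈ Icc 0 N) :
    max (max 0 (min (N ^ m) z)) 0 ^ conjExp m / conjExp m - f * max 0 (min (N ^ m) z) ≤
      max z 0 ^ conjExp m / conjExp m - f * z := by
  have hq := one_lt_conjExp hm
  have hB : 0 ≤ N ^ m := by positivity
  rcases le_total z 0 with hz | hz
  · rw [min_eq_right (hz.trans hB), max_eq_left hz, max_self, max_eq_right hz]
    nlinarith [hf.1]
  rcases le_total z (N ^ m) with hzB | hzB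
  · rw [min_eq_right hzB, max_eq_right hz]
  · rw [min_eq_left hzB, max_eq_right hB, max_eq_left hB, max_eq_left hz]
    have := rpow_root_tangent hm hB hz
    have h1 : (N ^ m) ^ (1 / m) = N := by
      rw [← Real.rpow_mul hN, mul_one_div_cancel (by linarith : m ≠ 0), Real.rpow_one]
    rw [h1] at this
    nlinarith [hf.2]

lemma density_tangent {m v z : ℝ} (hm : 1 < m) (hv : 0 ≤ v) :
    max z 0 ^ conjExp m / conjExp m - v ^ conjExp m / conjExp m ≤
      max z 0 ^ (1 / m) * (z - v) := by
  have hq := one_lt_conjExp hm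
  rcases le_total z 0 with hz | hz
  · rw [max_eq_right hz, Real.zero_rpow (by linarith), Real.zero_rpow (by positivity)]
    have : 0 ≤ v ^ conjExp m / conjExp m := by positivity
    simp; linarith
  · rw [max_eq_left hz]
    have := rpow_root_tangent hm hz hv
    nlinarith

/-- Integrand of the variational problem of one implicit step. -/
def stepDensity (m : ℝ) (f : X → ℝ) (x : X) (z : ℝ) : ℝ :=
  max z 0 ^ conjExp m / conjExp m - f x * z + (2 * f x) ^ (m + 1) / (m + 1)

lemma stepDensity_ge {X : Type*} {m : ℝ} (hm : 1 < m) {f : X → ℝ} {x : X} (hf : 0 ≤ f x) (z : ℝ) :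
    max z 0 ^ conjExp m / conjExp m / 2 ≤ stepDensity m f x z := by
  have hq := one_lt_conjExp hm
  unfold stepDensity
  rcases le_total z 0 with hz | hz
  · rw [max_eq_right hz, Real.zero_rpow (by linarith)]
    have : 0 ≤ (2 * f x) ^ (m + 1) / (m + 1) := by positivity
    have : f x * z ≤ 0 := mul_nonpos_of_nonneg_of_nonpos hf hz
    simp; linarith
  · rw [max_eq_left hz]
    have h1 := Real.young_inequality_of_nonneg (show 0 ≤ 2 * f x by positivity)
      (show 0 ≤ z / 2 by positivity) (holderConjugate_conjExp hm)
    have h2 : (z / 2) ^ conjExp m ≤ z ^ conjExp m / 2 := by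
      rw [Real.div_rpow hz (by norm_num)]
      refine div_le_div_of_nonneg_left (by positivity) (by norm_num) ?_
      calc (2 : ℝ) = 2 ^ (1 : ℝ) := by simp
        _ ≤ 2 ^ conjExp m := Real.rpow_le_rpow_of_exponent_le (by norm_num) hq.le
    have h3 : (z / 2) ^ conjExp m / conjExp m ≤ z ^ conjExp m / 2 / conjExp m := by gcongr
    have h4 : z ^ conjExp m / 2 / conjExp m = z ^ conjExp m / conjExp m / 2 := by ring
    have h5 : 2 * f x * (z / 2) = f x * z := by ring
    linarith


lemma integrable_rpow_root {m : ℝ} (hm : 1 < m) {z g : X → ℝ} (hg : Measurable g)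
    (h : ∀ x, |g x| ≤ |z x| ^ (1 / m)) (hz : Integrable (fun x => |z x| ^ conjExp m) ν) :
    Integrable (fun x => |g x| ^ (m + 1)) ν := by
  refine Integrable.mono' hz (hg.abs.pow_const _).aestronglyMeasurable
    (Eventually.of_forall fun x => ?_)
  rw [Real.norm_of_nonneg (by positivity), ← one_div_mul_add_one hm, Real.rpow_mul (abs_nonneg _)]
  exact Real.rpow_le_rpow (abs_nonneg _) (h x) (by linarith)

lemma integrable_stepDensity {m : ℝ} (hm : 1 < m) {f z : X → ℝ} (hfm : Measurable f)
    (hf0 : ∀ x, 0 ≤ f x) (hzm : Measurable z)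
    (hfi : Integrable (fun x => |f x| ^ (m + 1)) ν)
    (hzi : Integrable (fun x => |z x| ^ conjExp m) ν) :
    Integrable (fun x => stepDensity m f x (z x)) ν := by
  have hq := one_lt_conjExp hm
  unfold stepDensity
  refine Integrable.add (Integrable.sub ?_ ?_) ?_
  · refine Integrable.div_const (Integrable.mono' hzi
      ((hzm.max measurable_const).pow_const _).aestronglyMeasurable
      (Eventually.of_forall fun x => ?_)) _
    rw [Real.norm_of_nonneg (Real.rpow_nonneg (le_max_right _ _) _)]
    exact Real.rpow_le_rpow (le_max_right _ _) (max_le (le_abs_self _) (abs_nonneg _))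
      (by linarith)
  · exact integrable_mul_of_rpow (holderConjugate_conjExp hm) hfm hzm hfi hzi
  · refine Integrable.div_const ((hfi.const_mul (2 ^ (m + 1))).congr
      (Eventually.of_forall fun x => ?_)) _
    simp only
    rw [abs_of_nonneg (hf0 x), Real.mul_rpow (by norm_num) (hf0 x)]

lemma jfun_stepDensity {m h : ℝ} (hm : 1 < m) (hh : 0 < h) {f z : X → ℝ} (hfm : Measurable f)
    (hf0 : ∀ x, 0 ≤ f x) (hfi : Integrable (fun x => |f x| ^ (m + 1)) ν)
    (hz : FormTest ν Γ (conjExp m) z) :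
    jfun ν Γ (h / 2) (stepDensity m f) z =
      ENNReal.ofReal (h / 2 * eform Γ z z + ∫ x, stepDensity m f x (z x) ∂ν) := by
  have hq := one_lt_conjExp hm
  have hge : ∀ x, 0 ≤ stepDensity m f x (z x) := fun x =>
    le_trans (by have := le_max_right (z x) 0; positivity) (stepDensity_ge hm (hf0 x) _)
  rw [jfun, energy_eq_ofReal_eform hz.memLp, ← ENNReal.ofReal_mul (by positivity),
    ← ofReal_integral_eq_lintegral_ofReal
      (integrable_stepDensity hm hfm hf0 hz.meas hfi hz.intq) (Eventually.of_forall hge),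
    ENNReal.ofReal_add (mul_nonneg (by positivity) (eform_self_nonneg _)) (integral_nonneg hge)]

lemma eform_add_smul_self {v w : X → ℝ} (hv : MemLp (pdiff v) 2 Γ) (hw : MemLp (pdiff w) 2 Γ)
    (ε : ℝ) : eform Γ (fun x => v x + ε * w x) (fun x => v x + ε * w x) =
      eform Γ v v + 2 * ε * eform Γ v w + ε ^ 2 * eform Γ w w := by
  have hi : Integrable (fun p => pdiff v p * pdiff v p + 2 * ε * (pdiff v p * pdiff w p)) Γ :=
    (integrable_pdiff_mul hv hv).add ((integrable_pdiff_mul hv hw).const_mul _)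
  unfold eform
  rw [← integral_const_mul, ← integral_const_mul,
    ← integral_add (integrable_pdiff_mul hv hv) ((integrable_pdiff_mul hv hw).const_mul _),
    ← integral_add hi ((integrable_pdiff_mul hw hw).const_mul _)]
  refine integral_congr_ae (Eventually.of_forall fun p => ?_)
  simp only [pdiff]; ring

lemma minimizer_variation {m h N ε : ℝ} (hm : 1 < m) (hh : 0 < h) (hN : 0 < N) {f v w : X → ℝ}
    (hfm : Measurable f) (hf : ∀ x, f x ∈ Icc 0 N) (hfi : Integrable (fun x => |f x| ^ (m + 1)) ν)
    (hv : FormTest ν Γ (conjExp m) v) (hv0 : ∀ x, 0 ≤ v x)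
    (hmin : ∀ z : X → ℝ, Measurable z → (∀ x, z x ∈ Icc 0 (N ^ m)) →
      jfun ν Γ (h / 2) (stepDensity m f) v ≤ jfun ν Γ (h / 2) (stepDensity m f) z)
    (hw : FormTest ν Γ (conjExp m) w) (hε : 0 < ε) :
    0 ≤ h * eform Γ v w + ε * (h / 2 * eform Γ w w) +
      ∫ x, (max (v x + ε * w x) 0 ^ (1 / m) - f x) * w x ∂ν := by
  have hq := one_lt_conjExp hm
  have hB : 0 ≤ N ^ m := by positivity
  set z : X → ℝ := fun x => v x + ε * w x with hzdef
  have hz : FormTest ν Γ (conjExp m) z := hv.add (by linarith) (hw.const_mul ε)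
  set z' : X → ℝ := fun x => max 0 (min (N ^ m) (z x)) with hz'
  have h1 := hmin z' (measurable_const.max (measurable_const.min hz.meas)) fun x =>
    ⟨le_max_left _ _, max_le hB (min_le_left _ _)⟩
  have h2 : jfun ν Γ (h / 2) (stepDensity m f) z' ≤ jfun ν Γ (h / 2) (stepDensity m f) z := by
    unfold jfun
    refine add_le_add (mul_le_mul_right (energy_mono_of_abs_le fun p => abs_clamp_sub_le _ _ _) _)
      (lintegral_mono fun x => ENNReal.ofReal_le_ofReal ?_)
    exact add_le_add_left (clamp_density_le hm hN.le (hf x)) _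
  have hf0 : ∀ x, 0 ≤ f x := fun x => (hf x).1
  have h3 := h1.trans h2
  have hge : ∀ x, 0 ≤ stepDensity m f x (z x) := fun x =>
    le_trans (by have := le_max_right (z x) 0; positivity) (stepDensity_ge hm (hf0 x) _)
  rw [jfun_stepDensity hm hh hfm hf0 hfi hv, jfun_stepDensity hm hh hfm hf0 hfi hz,
    ENNReal.ofReal_le_ofReal_iff (add_nonneg (mul_nonneg (by positivity) (eform_self_nonneg _))
      (integral_nonneg hge)), eform_add_smul_self hv.memLp hw.memLp] at h3
  have hg : Measurable fun x => max (z x) 0 ^ (1 / m) :=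
    (hz.meas.max measurable_const).pow_const _
  have hgz : ∀ x, |max (z x) 0 ^ (1 / m)| ≤ |z x| ^ (1 / m) := fun x => by
    rw [abs_of_nonneg (Real.rpow_nonneg (le_max_right _ _) _)]
    exact Real.rpow_le_rpow (le_max_right _ _) (max_le (le_abs_self _) (abs_nonneg _))
      (by positivity)
  have hconj := holderConjugate_conjExp hm
  have hi1 := integrable_mul_of_rpow hconj hg hw.meas (integrable_rpow_root hm hg hgz hz.intq)
    hw.intq
  have hi2 := integrable_mul_of_rpow hconj hfm hw.meas hfi hw.intq
  have hi3 : Integrable (fun x => (max (z x) 0 ^ (1 / m) - f x) * w x) ν := by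
    refine (hi1.sub hi2).congr (Eventually.of_forall fun x => ?_)
    simp only [Pi.sub_apply]; ring
  have hsz := integrable_stepDensity hm hfm hf0 hz.meas hfi hz.intq
  have hsv := integrable_stepDensity hm hfm hf0 hv.meas hfi hv.intq
  have h4 : (∫ x, stepDensity m f x (z x) ∂ν) - ∫ x, stepDensity m f x (v x) ∂ν ≤
      ε * ∫ x, (max (z x) 0 ^ (1 / m) - f x) * w x ∂ν := by
    rw [← integral_sub hsz hsv, ← integral_const_mul]
    refine integral_mono (hsz.sub hsv) (hi3.const_mul ε) fun x => ?_
    have := density_tangent (z := z x) hm (hv0 x)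
    simp only [stepDensity]
    rw [max_eq_left (hv0 x)]
    have e : z x - v x = ε * w x := by simp [hzdef]
    rw [e] at this
    have e2 : f x * z x = f x * v x + f x * (ε * w x) := by rw [← e]; ring
    nlinarith
  have h5 : 0 ≤ ε * (h * eform Γ v w + ε * (h / 2 * eform Γ w w) +
      ∫ x, (max (z x) 0 ^ (1 / m) - f x) * w x ∂ν) := by nlinarith
  exact nonneg_of_mul_nonneg_right h5 hε

lemma mul_min_nonneg {ε : ℝ} (hε : 0 < ε) (a b : ℝ) :
    0 ≤ (a - b) * (min (a / ε) 1 - min (b / ε) 1) := by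
  rcases le_total a b with h | h
  · refine mul_nonneg_of_nonpos_of_nonpos (sub_nonpos.2 h) (sub_nonpos.2 ?_)
    gcongr
  · refine mul_nonneg (sub_nonneg.2 h) (sub_nonneg.2 ?_)
    gcongr

/-- Integrability and mass bound for a solution of the implicit equation. -/
lemma integrable_of_implicit_eq {m h : ℝ} (hm : 1 < m) (hh : 0 < h) {f u : X → ℝ}
    (hum : Measurable u) (hu0 : ∀ x, 0 ≤ u x) (hf0 : ∀ x, 0 ≤ f x)
    (hfi : Integrable f ν) (hfm : Measurable f) (hfp : Integrable (fun x => |f x| ^ (m + 1)) ν)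
    (hup : Integrable (fun x => |u x| ^ (m + 1)) ν)
    (hv : FormTest ν Γ (conjExp m) fun x => u x ^ m)
    (heq : ∀ w, FormTest ν Γ (conjExp m) w →
      (∫ x, (u x - f x) * w x ∂ν) + h * eform Γ (fun x => u x ^ m) w = 0) :
    Integrable u ν ∧ ∫ x, u x ∂ν ≤ ∫ x, f x ∂ν := by
  have hq := one_lt_conjExp hm
  have hconj := holderConjugate_conjExp hm
  have hv0 : ∀ x, 0 ≤ u x ^ m := fun x => Real.rpow_nonneg (hu0 x) _
  set ε : ℕ → ℝ := fun n => 1 / ((n : ℝ) + 1) with hε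
  have hε0 : ∀ n, 0 < ε n := fun n => by positivity
  set w : ℕ → X → ℝ := fun n x => min (u x ^ m / ε n) 1 with hw
  have hwm : ∀ n, Measurable (w n) := fun n =>
    ((hum.pow_const m).div_const _).min measurable_const
  have hw0 : ∀ n x, 0 ≤ w n x := fun n x => le_min (div_nonneg (hv0 x) (hε0 n).le) zero_le_one
  have hw1 : ∀ n x, w n x ≤ 1 := fun n x => min_le_right _ _
  have hwt : ∀ n, FormTest ν Γ (conjExp m) (w n) := fun n => by
    refine ⟨hwm n, ?_, ?_⟩
    · refine Integrable.mono' (hv.const_mul (1 / ε n)).intq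
        ((hwm n).abs.pow_const _).aestronglyMeasurable (Eventually.of_forall fun x => ?_)
      rw [Real.norm_of_nonneg (by positivity)]
      refine Real.rpow_le_rpow (abs_nonneg _) ?_ (by linarith)
      have h1 : 0 ≤ 1 / ε n * u x ^ m := mul_nonneg (by have := hε0 n; positivity) (hv0 x)
      rw [abs_of_nonneg (hw0 n x), abs_of_nonneg h1]
      refine (min_le_left _ _).trans (le_of_eq ?_)
      ring
    · refine ne_top_of_le_ne_top (ENNReal.mul_ne_top ENNReal.ofReal_ne_top hv.fin)
        (energy_le_of_abs_pdiff_le (L := 1 / ε n) (w := fun x => u x ^ m) fun p => ?_)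
      refine (abs_min_sub_min_le_max _ _ _ _).trans ?_
      simp only [sub_self, abs_zero, pdiff]
      refine max_le (le_of_eq ?_) (mul_nonneg (by have := hε0 n; positivity) (abs_nonneg _))
      rw [← sub_div, abs_div, abs_of_pos (hε0 n)]; ring
  have huw : ∀ n, Integrable (fun x => u x * w n x) ν := fun n =>
    integrable_mul_of_rpow hconj hum (hwm n) hup (hwt n).intq
  have hfw : ∀ n, Integrable (fun x => f x * w n x) ν := fun n =>
    integrable_mul_of_rpow hconj hfm (hwm n) hfp (hwt n).intq
  have hle : ∀ n, ∫ x, u x * w n x ∂ν ≤ ∫ x, f x ∂ν := fun n => by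
    have h1 := heq _ (hwt n)
    have h2 : 0 ≤ eform Γ (fun x => u x ^ m) (w n) :=
      eform_nonneg_of_mul fun p => mul_min_nonneg (hε0 n) _ _
    have h3 : ∫ x, (u x - f x) * w n x ∂ν = (∫ x, u x * w n x ∂ν) - ∫ x, f x * w n x ∂ν := by
      rw [← integral_sub (huw n) (hfw n)]
      exact integral_congr_ae (Eventually.of_forall fun x => by simp only; ring)
    have h4 : ∫ x, f x * w n x ∂ν ≤ ∫ x, f x ∂ν := integral_mono (hfw n) hfi fun x => by
      have := mul_le_mul_of_nonneg_left (hw1 n x) (hf0 x)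
      simpa using this
    have := mul_nonneg hh.le h2
    linarith
  have hlim : ∀ x, Tendsto (fun n => u x * w n x) atTop (𝓝 (u x)) := fun x => by
    rcases (hu0 x).eq_or_lt with hx | hx
    · simp [← hx]
    · have hvx : 0 < u x ^ m := Real.rpow_pos_of_pos hx m
      have hεt : Tendsto ε atTop (𝓝 0) := tendsto_one_div_add_atTop_nhds_zero_nat
      have : ∀ᶠ n in atTop, u x * w n x = u x := by
        filter_upwards [hεt.eventually (gt_mem_nhds hvx)] with n hn
        have : 1 ≤ u x ^ m / ε n := by rw [le_div_iff₀ (hε0 n)]; linarith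
        simp [hw, min_eq_right this]
      exact tendsto_const_nhds.congr' (this.mono fun n hn => hn.symm)
  have hfat : ∫⁻ x, ENNReal.ofReal (u x) ∂ν ≤ ENNReal.ofReal (∫ x, f x ∂ν) := by
    have h1 : ∫⁻ x, ENNReal.ofReal (u x) ∂ν =
        ∫⁻ x, liminf (fun n => ENNReal.ofReal (u x * w n x)) atTop ∂ν :=
      lintegral_congr fun x =>
        (((ENNReal.continuous_ofReal.tendsto _).comp (hlim x)).liminf_eq).symm
    rw [h1]
    refine (lintegral_liminf_le fun n => (hum.mul (hwm n)).ennreal_ofReal).trans ?_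
    refine liminf_le_of_le (by isBoundedDefault) fun b hb => ?_
    obtain ⟨n, hn⟩ := hb.exists
    refine hn.trans ?_
    simp only [Pi.mul_apply]
    rw [← ofReal_integral_eq_lintegral_ofReal (huw n)
      (Eventually.of_forall fun x => mul_nonneg (hu0 x) (hw0 n x))]
    exact ENNReal.ofReal_le_ofReal (hle n)
  have hui : Integrable u ν := by
    refine ⟨hum.aestronglyMeasurable, ?_⟩
    rw [hasFiniteIntegral_iff_ofReal (Eventually.of_forall hu0)]
    exact hfat.trans_lt ENNReal.ofReal_lt_top
  refine ⟨hui, ?_⟩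
  rw [← ofReal_integral_eq_lintegral_ofReal hui (Eventually.of_forall hu0),
    ENNReal.ofReal_le_ofReal_iff (integral_nonneg hf0)] at hfat
  exact hfat

theorem exists_implicitStep (hM : MarginalsAC ν Γ) {m h N : ℝ} (hm : 1 < m) (hh : 0 < h)
    (hN : 0 < N) {f : X → ℝ} (hfm : Measurable f) (hf : ∀ x, f x ∈ Icc 0 N)
    (hfi : Integrable f ν) : ∃ u, ImplicitStep ν Γ m h N f u := by
  have hq := one_lt_conjExp hm
  have hq2 := conjExp_lt_two hm
  have hf0 : ∀ x, 0 ≤ f x := fun x => (hf x).1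
  have hB : 0 < N ^ m := by positivity
  have hfp : Integrable (fun x => |f x| ^ (m + 1)) ν :=
    integrable_rpow_of_bdd hfm hfi (fun x => by rw [abs_of_nonneg (hf0 x)]; exact (hf x).2)
      (by linarith)
  have hge : ∀ x z, 0 ≤ stepDensity m f x z := fun x z =>
    le_trans (by have := le_max_right z 0; positivity) (stepDensity_ge hm (hf0 x) _)
  obtain ⟨v, hvm, hvB, hvJ, hvmin⟩ := exists_minimizer (ν := ν) hM (h := h / 2) (B := N ^ m)
    (c := (conjExp m - 1) * (N ^ m) ^ (conjExp m - 2) / 8) (Ψ := stepDensity m f) hB.le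
    (by have : 0 < conjExp m - 1 := by linarith
        positivity)
    (by
      have := hfm
      unfold stepDensity Function.uncurry
      fun_prop)
    (fun x z _ => hge x z)
    (fun x => by
      unfold stepDensity
      refine Continuous.add (Continuous.sub (Continuous.div_const ?_ _) (by fun_prop))
        continuous_const
      exact (Real.continuous_rpow_const (by linarith)).comp (continuous_id.max continuous_const))
    (fun x a ha b hb => by
      have := rpow_mid_strong hq hq2 ha hb
      simp only [stepDensity]
      rw [max_eq_left ha.1, max_eq_left hb.1, max_eq_left (by linarith [ha.1, hb.1])]
      linarith)
    (by
      have h0 : Integrable (fun x => stepDensity m f x 0) ν :=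
        integrable_stepDensity hm hfm hf0 measurable_const hfp
          (by simp [Real.zero_rpow (by linarith : conjExp m ≠ 0)])
      exact ((hasFiniteIntegral_iff_ofReal (Eventually.of_forall fun x => hge x 0)).1 h0.2).ne)
  have hv0 : ∀ x, 0 ≤ v x := fun x => (hvB x).1
  have hvt : FormTest ν Γ (conjExp m) v := by
    refine ⟨hvm, ⟨(hvm.abs.pow_const _).aestronglyMeasurable, ?_⟩, fun htop => hvJ ?_⟩
    · rw [hasFiniteIntegral_iff_ofReal (Eventually.of_forall fun x => by positivity)]
      have h1 : ∀ x, ENNReal.ofReal (|v x| ^ conjExp m) ≤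
          ENNReal.ofReal (2 * conjExp m) * ENNReal.ofReal (stepDensity m f x (v x)) := fun x => by
        rw [← ENNReal.ofReal_mul (by linarith)]
        refine ENNReal.ofReal_le_ofReal ?_
        have := stepDensity_ge hm (hf0 x) (v x)
        rw [max_eq_left (hv0 x)] at this
        rw [abs_of_nonneg (hv0 x)]
        calc v x ^ conjExp m = 2 * conjExp m * (v x ^ conjExp m / conjExp m / 2) := by field_simp
          _ ≤ _ := by gcongr
      refine (lintegral_mono h1).trans_lt ?_
      rw [lintegral_const_mul' _ _ ENNReal.ofReal_ne_top]
      exact ENNReal.mul_lt_top ENNReal.ofReal_lt_top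
        (lt_of_le_of_lt le_add_self (lt_top_iff_ne_top.2 hvJ))
    · rw [jfun, htop, ENNReal.mul_top (by simpa using hh), top_add]
  set u : X → ℝ := fun x => v x ^ (1 / m) with hu
  have hum : Measurable u := hvm.pow_const _
  have huv : (fun x => u x ^ m) = v := by
    ext x
    rw [hu, ← Real.rpow_mul (hv0 x), one_div_mul_cancel (by linarith), Real.rpow_one]
  have hu0 : ∀ x, 0 ≤ u x := fun x => Real.rpow_nonneg (hv0 x) _
  have hup : Integrable (fun x => |u x| ^ (m + 1)) ν :=
    integrable_rpow_root hm hum (fun x => by rw [abs_of_nonneg (hu0 x), abs_of_nonneg (hv0 x)])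
      hvt.intq
  have hineq : ∀ w, FormTest ν Γ (conjExp m) w →
      0 ≤ (∫ x, (u x - f x) * w x ∂ν) + h * eform Γ v w := fun w hw =>
    integral_nonneg_of_perturbation hm hfm hvm hw.meas hv0 hfp hvt.intq hw.intq
      (e₁ := h / 2 * eform Γ w w) fun ε hε _ =>
        minimizer_variation hm hh hN hfm hf hfp hvt hv0 hvmin hw hε
  have heq : ∀ w, FormTest ν Γ (conjExp m) w →
      (∫ x, (u x - f x) * w x ∂ν) + h * eform Γ (fun x => u x ^ m) w = 0 := fun w hw => by
    rw [huv]
    refine le_antisymm ?_ (hineq w hw)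
    have h1 := hineq _ (hw.const_mul (-1))
    rw [eform_const_mul_right] at h1
    have h2 : ∫ x, (u x - f x) * (-1 * w x) ∂ν = -∫ x, (u x - f x) * w x ∂ν := by
      rw [← integral_neg]
      exact integral_congr_ae (Eventually.of_forall fun x => by simp only; ring)
    rw [h2] at h1
    linarith
  have hint := integrable_of_implicit_eq hm hh hum hu0 hf0 hfi hfm hfp hup
    (by rw [huv]; exact hvt) heq
  refine ⟨u, hum, fun x => ⟨hu0 x, ?_⟩, hint.1, hint.2, by rw [huv]; exact hvt.fin, heq⟩
  have := Real.rpow_le_rpow (hv0 x) (hvB x).2 (show 0 ≤ 1 / m by positivity)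
  rwa [← Real.rpow_mul hN.le, mul_one_div_cancel (by linarith : m ≠ 0), Real.rpow_one] at this

end ImplicitStep

/-! ### Implicit time discretization -/

section Discretization

variable {X : Type*} [MeasurableSpace X] {ν : Measure X} {Γ : Measure (X × X)}

lemma FormTest.finset_sum {ι : Type*} {q : ℝ} (hq : 0 < q) (s : Finset ι) {w : ι → X → ℝ}
    (hw : ∀ i, FormTest ν Γ q (w i)) : FormTest ν Γ q (fun x => ∑ i ∈ s, w i x) := by
  classical
  induction s using Finset.induction_on with
  | empty =>
    refine ⟨by simp, ?_, ?_⟩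
    · simp [Real.zero_rpow hq.ne']
    · simp [energy_zero]
  | insert a s ha ih =>
    simp only [Finset.sum_insert ha]
    exact (hw a).add hq.le ih

/-- Bounded nonnegative integrable densities. -/
structure BddDensity (ν : Measure X) (N : ℝ) (u : X → ℝ) : Prop where
  meas : Measurable u
  mem : ∀ x, u x ∈ Icc 0 N
  int : Integrable u ν

lemma BddDensity.integrable_rpow {N p : ℝ} {u : X → ℝ} (hu : BddDensity ν N u) (hp : 1 ≤ p) :
    Integrable (fun x => |u x| ^ p) ν :=
  integrable_rpow_of_bdd hu.meas hu.int
    (fun x => by rw [abs_of_nonneg (hu.mem x).1]; exact (hu.mem x).2) hp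

lemma BddDensity.integrable_rpow' {N p : ℝ} {u : X → ℝ} (hu : BddDensity ν N u) (hp : 1 ≤ p) :
    Integrable (fun x => u x ^ p) ν :=
  (hu.integrable_rpow hp).congr (Eventually.of_forall fun x => by
    simp only; rw [abs_of_nonneg (hu.mem x).1])

lemma BddDensity.integrable_level {N k : ℝ} (hk : 0 ≤ k) {u : X → ℝ} (hu : BddDensity ν N u) :
    Integrable (fun x => max (u x - k) 0 ^ 2) ν := by
  refine Integrable.mono' (hu.integrable_rpow' (p := 2) (by norm_num))
    (((hu.meas.sub_const k).max measurable_const).pow_const 2).aestronglyMeasurable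
    (Eventually.of_forall fun x => ?_)
  rw [Real.norm_of_nonneg (sq_nonneg _), Real.rpow_two]
  refine pow_le_pow_left₀ (le_max_right _ _) (max_le ?_ (hu.mem x).1) 2
  linarith

lemma BddDensity.formTest_rpow {m N : ℝ} (hm : 1 < m) {u : X → ℝ} (hu : BddDensity ν N u)
    (hfin : energy Γ (fun x => u x ^ m) ≠ ⊤) : FormTest ν Γ (conjExp m) fun x => u x ^ m where
  meas := hu.meas.pow_const m
  intq := by
    refine (hu.integrable_rpow (p := m + 1) (by linarith)).congr (Eventually.of_forall fun x => ?_)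
    simp only
    rw [abs_of_nonneg (Real.rpow_nonneg (hu.mem x).1 m), ← Real.rpow_mul (hu.mem x).1,
      mul_conjExp hm, abs_of_nonneg (hu.mem x).1]
  fin := hfin

lemma pdiff_level_mul_le {X : Type*} {m k : ℝ} (hm : 1 < m) (hk : 0 < k) {u : X → ℝ} (hu : ∀ x, 0 ≤ u x)
    (p : X × X) : k ^ (m - 1) * (pdiff (fun x => max (u x - k) 0) p) ^ 2 ≤
      pdiff (fun x => u x ^ m) p * pdiff (fun x => max (u x - k) 0) p := by
  have key : ∀ a b : ℝ, 0 ≤ b → b ≤ a →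
      k ^ (m - 1) * (max (a - k) 0 - max (b - k) 0) ^ 2 ≤
        (a ^ m - b ^ m) * (max (a - k) 0 - max (b - k) 0) := by
    intro a b hb hab
    rw [sq, ← mul_assoc]
    refine mul_le_mul_of_nonneg_right (rpow_sub_rpow_ge hm hk hb hab) (sub_nonneg.2 ?_)
    gcongr
  simp only [pdiff]
  rcases le_total (u p.2) (u p.1) with h | h
  · exact key _ _ (hu _) h
  · have := key _ _ (hu _) h
    nlinarith

lemma abs_pdiff_level_le {X : Type*} {m k : ℝ} (hm : 1 < m) (hk : 0 < k) {u : X → ℝ} (hu : ∀ x, 0 ≤ u x)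
    (p : X × X) : |pdiff (fun x => max (u x - k) 0) p| ≤
      (k ^ (m - 1))⁻¹ * |pdiff (fun x => u x ^ m) p| := by
  have hpos : 0 < k ^ (m - 1) := Real.rpow_pos_of_pos hk _
  have h1 := pdiff_level_mul_le hm hk hu p
  have h2 := le_abs_self (pdiff (fun x => u x ^ m) p * pdiff (fun x => max (u x - k) 0) p)
  rw [abs_mul] at h2
  rcases (abs_nonneg (pdiff (fun x => max (u x - k) 0) p)).eq_or_lt with h0 | h0
  · rw [← h0]; positivity
  · rw [inv_mul_eq_div, le_div_iff₀ hpos]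
    refine le_of_mul_le_mul_right ?_ h0
    rw [← sq_abs] at h1
    nlinarith

lemma BddDensity.formTest_level {m k N : ℝ} (hm : 1 < m) (hk : 0 < k) {u : X → ℝ}
    (hu : BddDensity ν N u) (hfin : energy Γ (fun x => u x ^ m) ≠ ⊤) :
    FormTest ν Γ (conjExp m) fun x => max (u x - k) 0 where
  meas := (hu.meas.sub_const k).max measurable_const
  intq := by
    have hq := one_lt_conjExp hm
    refine Integrable.mono' (hu.integrable_rpow (p := conjExp m) hq.le)
      ((((hu.meas.sub_const k).max measurable_const).abs).pow_const _).aestronglyMeasurable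
      (Eventually.of_forall fun x => ?_)
    rw [Real.norm_of_nonneg (by positivity)]
    refine Real.rpow_le_rpow (abs_nonneg _) ?_ (by linarith)
    rw [abs_of_nonneg (le_max_right _ _), abs_of_nonneg (hu.mem x).1]
    exact max_le (by linarith) (hu.mem x).1
  fin := ne_top_of_le_ne_top (ENNReal.mul_ne_top ENNReal.ofReal_ne_top hfin)
    (energy_le_of_abs_pdiff_le (abs_pdiff_level_le hm hk fun x => (hu.mem x).1))

lemma ImplicitStep.bdd {m h N : ℝ} {f u : X → ℝ} (hu : ImplicitStep ν Γ m h N f u) :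
    BddDensity ν N u := ⟨hu.meas, hu.mem, hu.int⟩

lemma integrable_sub_mul_formTest {m N : ℝ} (hm : 1 < m) {u f w : X → ℝ} (hu : BddDensity ν N u)
    (hf : BddDensity ν N f) (hw : FormTest ν Γ (conjExp m) w) :
    Integrable (fun x => (u x - f x) * w x) ν := by
  have h1 := integrable_mul_of_rpow (holderConjugate_conjExp hm) hu.meas hw.meas
    (hu.integrable_rpow (by linarith)) hw.intq
  have h2 := integrable_mul_of_rpow (holderConjugate_conjExp hm) hf.meas hw.meas
    (hf.integrable_rpow (by linarith)) hw.intq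
  refine (h1.sub h2).congr (Eventually.of_forall fun x => ?_)
  simp only [Pi.sub_apply]; ring

lemma ImplicitStep.energy_le {m h N : ℝ} (hm : 1 < m) {f u : X → ℝ} (hf : BddDensity ν N f)
    (hu : ImplicitStep ν Γ m h N f u) :
    (∫ x, u x ^ (m + 1) ∂ν) / (m + 1) + h * eform Γ (fun x => u x ^ m) (fun x => u x ^ m) ≤
      (∫ x, f x ^ (m + 1) ∂ν) / (m + 1) := by
  have hvt := hu.bdd.formTest_rpow hm hu.fin
  have h1 := hu.eq _ hvt
  have h2 : ((∫ x, u x ^ (m + 1) ∂ν) - ∫ x, f x ^ (m + 1) ∂ν) / (m + 1) ≤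
      ∫ x, (u x - f x) * u x ^ m ∂ν := by
    have hiu := hu.bdd.integrable_rpow' (p := m + 1) (by linarith)
    have hif := hf.integrable_rpow' (p := m + 1) (by linarith)
    rw [← integral_sub hiu hif, ← integral_div]
    exact integral_mono ((hiu.sub hif).div_const _)
      (integrable_sub_mul_formTest hm hu.bdd hf hvt) fun x =>
        sub_mul_rpow_ge hm (hu.mem x).1 (hf.mem x).1
  rw [sub_div] at h2
  linarith

lemma ImplicitStep.level_le {m h N k : ℝ} (hm : 1 < m) (hh : 0 ≤ h) (hk : 0 < k) {f u : X → ℝ}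
    (hf : BddDensity ν N f) (hu : ImplicitStep ν Γ m h N f u) :
    (∫ x, max (u x - k) 0 ^ 2 ∂ν) + h * (2 * k ^ (m - 1) *
      eform Γ (fun x => max (u x - k) 0) (fun x => max (u x - k) 0)) ≤
      ∫ x, max (f x - k) 0 ^ 2 ∂ν := by
  have hvt := hu.bdd.formTest_rpow hm hu.fin
  have hwt := hu.bdd.formTest_level hm hk hu.fin
  have h1 := hu.eq _ hwt
  have h2 : ((∫ x, max (u x - k) 0 ^ 2 ∂ν) - ∫ x, max (f x - k) 0 ^ 2 ∂ν) / 2 ≤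
      ∫ x, (u x - f x) * max (u x - k) 0 ∂ν := by
    have hiu := hu.bdd.integrable_level hk.le
    have hif := hf.integrable_level hk.le
    rw [← integral_sub hiu hif, ← integral_div]
    exact integral_mono ((hiu.sub hif).div_const _)
      (integrable_sub_mul_formTest hm hu.bdd hf hwt) fun x => sub_mul_posPart_ge _ _ _
  have h3 : k ^ (m - 1) * eform Γ (fun x => max (u x - k) 0) (fun x => max (u x - k) 0) ≤
      eform Γ (fun x => u x ^ m) (fun x => max (u x - k) 0) := by
    unfold eform
    rw [← integral_const_mul]
    refine integral_mono ((integrable_pdiff_mul hwt.memLp hwt.memLp).const_mul _)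
      (integrable_pdiff_mul hvt.memLp hwt.memLp) fun p => ?_
    have := pdiff_level_mul_le hm hk (fun x => (hu.mem x).1) p
    simpa only [sq] using this
  have := mul_le_mul_of_nonneg_left h3 hh
  linarith

/-- A sequence of implicit steps of size `h` issued from `f`. -/
structure ImplicitScheme (ν : Measure X) (Γ : Measure (X × X)) (m h N : ℝ) (f : X → ℝ)
    (U : ℕ → X → ℝ) : Prop where
  zero : U 0 = f
  step : ∀ i, ImplicitStep ν Γ m h N (U i) (U (i + 1))

theorem exists_implicitScheme (hM : MarginalsAC ν Γ) {m h N : ℝ} (hm : 1 < m) (hh : 0 < h)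
    (hN : 0 < N) {f : X → ℝ} (hf : BddDensity ν N f) : ∃ U, ImplicitScheme ν Γ m h N f U := by
  have hex : ∀ g : {g : X → ℝ // BddDensity ν N g}, ∃ u, ImplicitStep ν Γ m h N g.1 u :=
    fun g => exists_implicitStep hM hm hh hN g.2.meas g.2.mem g.2.int
  choose S hS using hex
  let V : ℕ → {g : X → ℝ // BddDensity ν N g} := fun n =>
    Nat.rec ⟨f, hf⟩ (fun _ g => ⟨S g, (hS g).bdd⟩) n
  exact ⟨fun n => (V n).1, rfl, fun i => hS (V i)⟩

namespace ImplicitScheme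

variable {m h N : ℝ} {f : X → ℝ} {U : ℕ → X → ℝ}

lemma bdd (hU : ImplicitScheme ν Γ m h N f U) (hf : BddDensity ν N f) (i : ℕ) :
    BddDensity ν N (U i) := by
  cases i with
  | zero => rw [hU.zero]; exact hf
  | succ i => exact (hU.step i).bdd

lemma mass (hU : ImplicitScheme ν Γ m h N f U) (i : ℕ) : ∫ x, U i x ∂ν ≤ ∫ x, f x ∂ν := by
  induction i with
  | zero => rw [hU.zero]
  | succ i ih => exact (hU.step i).mass.trans ih

lemma energy_le (hU : ImplicitScheme ν Γ m h N f U) (hf : BddDensity ν N f) (hm : 1 < m)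
    (i n : ℕ) : (∫ x, U (i + n) x ^ (m + 1) ∂ν) / (m + 1) + ∑ l ∈ Finset.range n,
      h * eform Γ (fun x => U (i + l + 1) x ^ m) (fun x => U (i + l + 1) x ^ m) ≤
      (∫ x, U i x ^ (m + 1) ∂ν) / (m + 1) := by
  induction n with
  | zero => simp
  | succ n ih =>
    rw [Finset.sum_range_succ]
    have := (hU.step (i + n)).energy_le hm (hU.bdd hf _)
    rw [← add_assoc i n 1]
    linarith

lemma level_le (hU : ImplicitScheme ν Γ m h N f U) (hf : BddDensity ν N f) (hm : 1 < m)
    (hh : 0 ≤ h) {k : ℝ} (hk : 0 < k) (i n : ℕ) :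
    (∫ x, max (U (i + n) x - k) 0 ^ 2 ∂ν) + ∑ l ∈ Finset.range n, h * (2 * k ^ (m - 1) *
      eform Γ (fun x => max (U (i + l + 1) x - k) 0) (fun x => max (U (i + l + 1) x - k) 0)) ≤
      ∫ x, max (U i x - k) 0 ^ 2 ∂ν := by
  induction n with
  | zero => simp
  | succ n ih =>
    rw [Finset.sum_range_succ]
    have := (hU.step (i + n)).level_le hm hh hk (hU.bdd hf _)
    rw [← add_assoc i n 1]
    linarith

lemma formTest (hU : ImplicitScheme ν Γ m h N f U) (hm : 1 < m) (i : ℕ) :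
    FormTest ν Γ (conjExp m) fun x => U (i + 1) x ^ m :=
  (hU.step i).bdd.formTest_rpow hm (hU.step i).fin

lemma eq (hU : ImplicitScheme ν Γ m h N f U) (hf : BddDensity ν N f) (hm : 1 < m) (n : ℕ)
    {w : X → ℝ} (hw : FormTest ν Γ (conjExp m) w) :
    (∫ x, (U n x - f x) * w x ∂ν) +
      h * eform Γ w (fun x => ∑ l ∈ Finset.range n, U (l + 1) x ^ m) = 0 := by
  have hq := one_lt_conjExp hm
  induction n with
  | zero => simp [hU.zero, eform, pdiff]
  | succ n ih =>
    have h1 := (hU.step n).eq w hw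
    have h2 : ∫ x, (U (n + 1) x - f x) * w x ∂ν = (∫ x, (U (n + 1) x - U n x) * w x ∂ν) +
        ∫ x, (U n x - f x) * w x ∂ν := by
      rw [← integral_add (integrable_sub_mul_formTest hm (hU.bdd hf _) (hU.bdd hf _) hw)
        (integrable_sub_mul_formTest hm (hU.bdd hf _) hf hw)]
      exact integral_congr_ae (Eventually.of_forall fun x => by simp only; ring)
    simp only [Finset.sum_range_succ]
    rw [eform_add_right hw.memLp
      (FormTest.finset_sum (by linarith) _ fun l => hU.formTest hm l).memLp
      (hU.formTest hm n).memLp, h2, eform_comm w (fun x => U (n + 1) x ^ m)]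
    linarith

end ImplicitScheme

end Discretization

/-! ### Comparison of step sizes -/

lemma sum_range_half (a : ℕ → ℝ) (i : ℕ) :
    ∑ l ∈ Finset.range (i / 2 + 1), a l =
      (1 / 2) * ∑ l ∈ Finset.range (i + 1), a (l / 2) +
        (if i % 2 = 0 then 1 / 2 else 0) * a (i / 2) := by
  induction i with
  | zero => simp; ring
  | succ i ih =>
    rw [Finset.sum_range_succ _ (i + 1)]
    rcases Nat.mod_two_eq_zero_or_one i with h | h
    · have h1 : (i + 1) / 2 = i / 2 := by omega
      have h2 : (i + 1) % 2 = 1 := by omega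
      rw [h1, h2, ih, h]; simp; ring
    · have h1 : (i + 1) / 2 = i / 2 + 1 := by omega
      have h2 : (i + 1) % 2 = 0 := by omega
      rw [h1, h2, Finset.sum_range_succ, ih, h]; simp; ring

section Compare

variable {X : Type*} [MeasurableSpace X] {ν : Measure X} {Γ : Measure (X × X)}

lemma eform_self_sub_ge {v w : X → ℝ} (hv : MemLp (pdiff v) 2 Γ) (hw : MemLp (pdiff w) 2 Γ) :
    -(eform Γ w w / 4) ≤ eform Γ v (fun x => v x - w x) := by
  rw [eform_sub_right hv hv hw]
  have h := eform_self_nonneg (Γ := Γ) (fun x => v x + (-(1 / 2)) * w x)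
  rw [eform_add_smul_self hv hw] at h
  linarith

theorem ImplicitScheme.compare {m h N : ℝ} {f : X → ℝ} {U U' : ℕ → X → ℝ}
    (hU : ImplicitScheme ν Γ m h N f U) (hU' : ImplicitScheme ν Γ m (h / 2) N f U')
    (hf : BddDensity ν N f) (hm : 1 < m) (hh : 0 < h) (n : ℕ) :
    ∑ i ∈ Finset.range n, h / 2 * ∫ x, |U (i / 2 + 1) x - U' (i + 1) x| ^ (m + 1) ∂ν ≤
      h / 8 * ((∫ x, f x ^ (m + 1) ∂ν) / (m + 1)) := by
  have hq := one_lt_conjExp hm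
  have hq0 : 0 ≤ conjExp m := by linarith
  set v : ℕ → X → ℝ := fun i x => U (i + 1) x ^ m with hv
  set v' : ℕ → X → ℝ := fun i x => U' (i + 1) x ^ m with hv'
  have hvt : ∀ i, FormTest ν Γ (conjExp m) (v i) := fun i => hU.formTest hm i
  have hvt' : ∀ i, FormTest ν Γ (conjExp m) (v' i) := fun i => hU'.formTest hm i
  set a : ℕ → X → ℝ := fun i x => v (i / 2) x - v' i x with ha
  have hat : ∀ i, FormTest ν Γ (conjExp m) (a i) := fun i => (hvt _).sub hq0 (hvt' _)
  set S : ℕ → X → ℝ := fun i x => ∑ l ∈ Finset.range i, a l x with hS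
  have hSt : ∀ i, FormTest ν Γ (conjExp m) (S i) := fun i =>
    FormTest.finset_sum (by linarith) _ hat
  have hSs : ∀ i, S (i + 1) = fun x => S i x + 1 * a i x := fun i => by
    ext x; simp [hS, Finset.sum_range_succ]
  set β : ℕ → ℝ := fun i =>
    ∫ x, (U (i / 2 + 1) x - U' (i + 1) x) * a i x ∂ν with hβ
  have hβeq : ∀ i, β i = -(h / 2 * eform Γ (a i) (S (i + 1)) +
      h * (if i % 2 = 0 then 1 / 2 else 0) * eform Γ (a i) (v (i / 2))) := by
    intro i
    have e1 := hU.eq hf hm (i / 2 + 1) (hat i)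
    have e2 := hU'.eq hf hm (i + 1) (hat i)
    have e3 : β i = (∫ x, (U (i / 2 + 1) x - f x) * a i x ∂ν) -
        ∫ x, (U' (i + 1) x - f x) * a i x ∂ν := by
      rw [← integral_sub (integrable_sub_mul_formTest hm (hU.bdd hf _) hf (hat i))
        (integrable_sub_mul_formTest hm (hU'.bdd hf _) hf (hat i))]
      exact integral_congr_ae (Eventually.of_forall fun x => by simp only; ring)
    have e4 : (fun x => ∑ l ∈ Finset.range (i / 2 + 1), U (l + 1) x ^ m) = fun x =>
        1 / 2 * (S (i + 1) x + ∑ l ∈ Finset.range (i + 1), U' (l + 1) x ^ m) +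
          (if i % 2 = 0 then 1 / 2 else 0) * v (i / 2) x := by
      ext x
      have := sum_range_half (fun l => v l x) i
      simp only [hv] at this
      rw [this]
      simp only [hS, ha, hv, hv', ← Finset.sum_add_distrib, sub_add_cancel]
    have t1 := FormTest.finset_sum (by linarith) (Finset.range (i + 1)) hvt'
    have t2 := ((hSt (i + 1)).add hq0 t1).const_mul (1 / 2)
    have t3 := (hvt (i / 2)).const_mul (if i % 2 = 0 then 1 / 2 else 0)
    rw [e4, eform_add_right (hat i).memLp t2.memLp t3.memLp, eform_const_mul_right,
      eform_const_mul_right, eform_add_right (hat i).memLp (hSt _).memLp t1.memLp] at e1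
    linarith
  have key : ∀ n, ∑ i ∈ Finset.range n, β i + h / 4 * eform Γ (S n) (S n) ≤
      ∑ i ∈ Finset.range n, h / 8 * eform Γ (v' i) (v' i) := by
    intro n
    induction n with
    | zero => simp [hS, eform, pdiff]
    | succ n ih =>
      rw [Finset.sum_range_succ, Finset.sum_range_succ, hβeq n]
      have h1 := eform_add_smul_self (hSt n).memLp (hat n).memLp 1
      rw [← hSs n] at h1
      have h2 : eform Γ (a n) (S (n + 1)) = eform Γ (S n) (a n) + eform Γ (a n) (a n) := by
        rw [hSs n]
        simp only [one_mul]
        rw [eform_add_right (hat n).memLp (hSt n).memLp (hat n).memLp, eform_comm]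
      have h3 : -(h * (if n % 2 = 0 then 1 / 2 else 0) * eform Γ (a n) (v (n / 2))) ≤
          h / 8 * eform Γ (v' n) (v' n) := by
        have h4 := eform_self_sub_ge (hvt (n / 2)).memLp (hvt' n).memLp
        have h5 : eform Γ (v (n / 2)) (fun x => v (n / 2) x - v' n x) =
            eform Γ (a n) (v (n / 2)) := eform_comm _ _
        rw [h5] at h4
        have h6 := eform_self_nonneg (Γ := Γ) (v' n)
        split_ifs
        · nlinarith
        · simp only [mul_zero, zero_mul, neg_zero]; positivity
      have h7 := mul_nonneg hh.le (eform_self_nonneg (Γ := Γ) (a n))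
      rw [h2]
      nlinarith
  have hE := hU'.energy_le hf hm 0 n
  simp only [zero_add] at hE
  rw [hU'.zero] at hE
  have hpos : 0 ≤ (∫ x, U' n x ^ (m + 1) ∂ν) / (m + 1) :=
    div_nonneg (integral_nonneg fun x => Real.rpow_nonneg ((hU'.bdd hf n).mem x).1 _)
      (by linarith)
  have hE2 : ∑ i ∈ Finset.range n, h / 8 * eform Γ (v' i) (v' i) ≤
      1 / 4 * ((∫ x, f x ^ (m + 1) ∂ν) / (m + 1)) := by
    have : ∑ i ∈ Finset.range n, h / 8 * eform Γ (v' i) (v' i) =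
        1 / 4 * ∑ i ∈ Finset.range n, h / 2 * eform Γ (v' i) (v' i) := by
      rw [Finset.mul_sum]; exact Finset.sum_congr rfl fun i _ => by ring
    rw [this]
    refine mul_le_mul_of_nonneg_left ?_ (by norm_num)
    linarith
  have hβge : ∀ i, ∫ x, |U (i / 2 + 1) x - U' (i + 1) x| ^ (m + 1) ∂ν ≤ β i := by
    intro i
    have hb1 := hU.bdd hf (i / 2 + 1)
    have hb2 := hU'.bdd hf (i + 1)
    refine integral_mono_of_nonneg (Eventually.of_forall fun x => by positivity) ?_
      (Eventually.of_forall fun x => abs_sub_rpow_le hm (hb1.mem x).1 (hb2.mem x).1)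
    exact integrable_sub_mul_formTest hm hb1 hb2 (hat i)
  have hk := key n
  have hSn := mul_nonneg hh.le (eform_self_nonneg (Γ := Γ) (S n))
  calc _ ≤ ∑ i ∈ Finset.range n, h / 2 * β i :=
        Finset.sum_le_sum fun i _ => mul_le_mul_of_nonneg_left (hβge i) (by positivity)
    _ = h / 2 * ∑ i ∈ Finset.range n, β i := by rw [Finset.mul_sum]
    _ ≤ h / 2 * (1 / 4 * ((∫ x, f x ^ (m + 1) ∂ν) / (m + 1))) := by
        refine mul_le_mul_of_nonneg_left ?_ (by positivity)
        linarith
    _ = _ := by ring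

end Compare

/-! ### Step functions in time -/

lemma ceil_div_eq {h t : ℝ} (hh : 0 < h) {i : ℕ} (ht : t ∈ Ioc (i * h) ((i + 1 : ℕ) * h)) :
    ⌈t / h⌉₊ = i + 1 := by
  rw [Nat.ceil_eq_iff (by omega)]
  simp only [Nat.add_one_sub_one]
  rw [lt_div_iff₀ hh, div_le_iff₀ hh]
  exact ht

lemma lintegral_Ioc_ceil {h : ℝ} (hh : 0 < h) (g : ℕ → ℝ≥0∞) (i n : ℕ) :
    ∫⁻ t in Ioc (i * h) ((i + n : ℕ) * h), g ⌈t / h⌉₊ =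
      ∑ l ∈ Finset.range n, ENNReal.ofReal h * g (i + l + 1) := by
  induction n with
  | zero => simp
  | succ n ih =>
    have h1 : Ioc ((i : ℝ) * h) ((i + (n + 1) : ℕ) * h) =
        Ioc (i * h) ((i + n : ℕ) * h) ∪ Ioc ((i + n : ℕ) * h) ((i + n + 1 : ℕ) * h) := by
      rw [Ioc_union_Ioc_eq_Ioc]
      · rfl
      · push_cast; nlinarith [n.cast_nonneg (α := ℝ)]
      · push_cast; nlinarith
    rw [h1, lintegral_union measurableSet_Ioc, ih, Finset.sum_range_succ]
    · congr 1
      rw [setLIntegral_congr_fun measurableSet_Ioc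
        (g := fun _ => g (i + n + 1)) fun t ht => by simp only [ceil_div_eq hh ht]]
      rw [setLIntegral_const, Real.volume_Ioc, mul_comm]
      congr 2
      push_cast; ring
    · rw [Set.disjoint_left]
      intro t ht ht'
      exact absurd ht.2 (not_le.2 ht'.1)

lemma integral_Ioc_ceil {h : ℝ} (hh : 0 < h) (g : ℕ → ℝ) (n : ℕ) :
    IntegrableOn (fun t : ℝ => g ⌈t / h⌉₊) (Ioc 0 (n * h)) ∧
    ∫ t in Ioc 0 (n * h), g ⌈t / h⌉₊ = ∑ l ∈ Finset.range n, h * g (l + 1) := by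
  induction n with
  | zero => simp
  | succ n ih =>
    have h1 : Ioc 0 ((n + 1 : ℕ) * h) =
        Ioc 0 (n * h) ∪ Ioc ((n : ℝ) * h) ((n + 1 : ℕ) * h) := by
      rw [Ioc_union_Ioc_eq_Ioc]
      · positivity
      · push_cast; nlinarith
    have hcongr : EqOn (fun t : ℝ => g ⌈t / h⌉₊) (fun _ => g (n + 1))
        (Ioc ((n : ℝ) * h) ((n + 1 : ℕ) * h)) := fun t ht => by simp only [ceil_div_eq hh ht]
    have hi2 : IntegrableOn (fun t : ℝ => g ⌈t / h⌉₊) (Ioc ((n : ℝ) * h) ((n + 1 : ℕ) * h)) := by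
      rw [integrableOn_congr_fun hcongr measurableSet_Ioc]
      exact integrableOn_const (by simp)
    refine ⟨by rw [h1]; exact ih.1.union hi2, ?_⟩
    rw [h1, setIntegral_union _ measurableSet_Ioc ih.1 hi2, ih.2, Finset.sum_range_succ]
    · congr 1
      rw [setIntegral_congr_fun measurableSet_Ioc hcongr, setIntegral_const]
      simp only [measureReal_def, Real.volume_Ioc, smul_eq_mul]
      rw [ENNReal.toReal_ofReal (by push_cast; nlinarith)]
      push_cast; ring
    · rw [Set.disjoint_left]
      intro t ht ht'
      exact absurd ht.2 (not_le.2 ht'.1)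

lemma lintegral_Ioi_le_of_forall {h : ℝ} (hh : 0 < h) {F : ℝ → ℝ≥0∞} {K : ℝ≥0∞}
    (H : ∀ n : ℕ, ∫⁻ t in Ioc 0 (n * h), F t ≤ K) : ∫⁻ t in Ioi 0, F t ≤ K := by
  have hmono : Monotone fun n : ℕ => Ioc (0 : ℝ) (n * h) := fun a b hab =>
    Ioc_subset_Ioc_right (mul_le_mul_of_nonneg_right (Nat.cast_le.2 hab) hh.le)
  have hU : Ioi (0 : ℝ) = ⋃ n : ℕ, Ioc (0 : ℝ) (n * h) := by
    ext t
    simp only [mem_Ioi, mem_iUnion, mem_Ioc]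
    refine ⟨fun ht => ?_, fun ⟨n, hn⟩ => hn.1⟩
    obtain ⟨n, hn⟩ := exists_nat_ge (t / h)
    exact ⟨n, ht, (div_le_iff₀ hh).1 hn⟩
  rw [hU, setLIntegral_iUnion_of_directed _ hmono.directed_le]
  exact iSup_le H

section Limits

variable {X : Type*} [MeasurableSpace X] {ν : Measure X} {Γ : Measure (X × X)}

lemma measurable_geoSum {Y : Type*} [MeasurableSpace Y] {p : ℝ} {f : ℕ → Y → ℝ}
    (hf : ∀ n, Measurable (f n)) : Measurable fun y => geoSum p fun n => f n y := by
  unfold geoSum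
  refine Measurable.tsum fun n => ?_
  have := hf n
  have := hf (n + 1)
  fun_prop

lemma tendsto_integral_mul_of_bdd_sq {Y : Type*} [MeasurableSpace Y] {η : Measure Y}
    {g : ℕ → Y → ℝ} {g' ψ : Y → ℝ} {K : ℝ} (hg : ∀ n, MemLp (g n) 2 η) (hg' : MemLp g' 2 η)
    (hψ : MemLp ψ 2 η) (hK : ∀ n, ∫ y, (g n y) ^ 2 ∂η ≤ K)
    (hlim : ∀ᵐ y ∂η, Tendsto (fun n => g n y) atTop (𝓝 (g' y))) :
    Tendsto (fun n => ∫ y, g n y * ψ y ∂η) atTop (𝓝 (∫ y, g' y * ψ y ∂η)) := by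
  have hK0 : 0 ≤ K := (integral_nonneg fun y => sq_nonneg _).trans (hK 0)
  set K' := 2 * (K + ∫ y, (g' y) ^ 2 ∂η) with hK'
  have hd : ∀ n, MemLp (fun y => g n y - g' y) 2 η := fun n => (hg n).sub hg'
  have hdK : ∀ n, ∫ y, (g n y - g' y) ^ 2 ∂η ≤ K' := fun n => by
    have h1 : ∫ y, (g n y - g' y) ^ 2 ∂η ≤ ∫ y, 2 * ((g n y) ^ 2 + (g' y) ^ 2) ∂η :=
      integral_mono (hd n).integrable_sq (((hg n).integrable_sq.add hg'.integrable_sq).const_mul 2)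
        fun y => by nlinarith [sq_nonneg (g n y + g' y)]
    rw [integral_const_mul, integral_add (hg n).integrable_sq hg'.integrable_sq] at h1
    linarith [hK n]
  have hK'0 : 0 ≤ K' := (integral_nonneg fun y => sq_nonneg _).trans (hdK 0)
  have hmin : ∀ l : ℝ, 0 < l → Tendsto
      (fun n => ∫ y, min |g n y - g' y| (l * |ψ y|) * |ψ y| ∂η) atTop (𝓝 0) := by
    intro l hl
    rw [show (0 : ℝ) = ∫ _ : Y, (0 : ℝ) ∂η by simp]
    have hm : ∀ n, AEStronglyMeasurable (fun y => min |g n y - g' y| (l * |ψ y|) * |ψ y|) η :=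
      fun n => by
        have h1 : AEStronglyMeasurable (fun y => |g n y - g' y|) η := (hd n).1.norm
        have h2 : AEStronglyMeasurable (fun y => |ψ y|) η := hψ.1.norm
        exact (h1.inf (h2.const_mul l)).mul h2
    refine tendsto_integral_of_dominated_convergence (fun y => l * (ψ y) ^ 2) hm
      (hψ.integrable_sq.const_mul l) (fun n => Eventually.of_forall fun y => ?_) ?_
    · rw [Real.norm_of_nonneg (by positivity)]
      refine (mul_le_mul_of_nonneg_right (min_le_right _ _) (abs_nonneg _)).trans (le_of_eq ?_)
      rw [mul_assoc, ← sq, sq_abs]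
    · filter_upwards [hlim] with y hy
      have h1 : Tendsto (fun n => |g n y - g' y|) atTop (𝓝 0) := by
        have := (hy.sub_const (g' y)).abs
        simpa using this
      have h2 := (h1.min (tendsto_const_nhds (x := l * |ψ y|))).mul_const |ψ y|
      rwa [min_eq_left (by positivity), zero_mul] at h2
  rw [Metric.tendsto_atTop]
  intro ε hε
  obtain ⟨l, hl0, hl⟩ : ∃ l : ℝ, 0 < l ∧ K' / l < ε / 2 := by
    refine ⟨2 * (K' + 1) / ε, by positivity, ?_⟩
    rw [div_lt_iff₀ (by positivity)]
    field_simp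
    linarith
  obtain ⟨n₀, hn₀⟩ := Metric.tendsto_atTop.1 (hmin l hl0) (ε / 2) (by positivity)
  refine ⟨n₀, fun n hn => ?_⟩
  have h1 := hn₀ n hn
  rw [Real.dist_eq, sub_zero] at h1
  have h2 := (le_abs_self _).trans_lt h1
  have hi1 : Integrable (fun y => g n y * ψ y) η := (hg n).integrable_mul hψ
  have hi2 : Integrable (fun y => g' y * ψ y) η := hg'.integrable_mul hψ
  have hi3 : Integrable (fun y => (g n y - g' y) * ψ y) η := (hd n).integrable_mul hψ
  have hi4 : Integrable (fun y => min |g n y - g' y| (l * |ψ y|) * |ψ y|) η := by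
    refine Integrable.mono' (hψ.integrable_sq.const_mul l) ?_ (Eventually.of_forall fun y => ?_)
    · have h1 : AEStronglyMeasurable (fun y => |g n y - g' y|) η := (hd n).1.norm
      have h2 : AEStronglyMeasurable (fun y => |ψ y|) η := hψ.1.norm
      exact (h1.inf (h2.const_mul l)).mul h2
    · rw [Real.norm_of_nonneg (by positivity)]
      refine (mul_le_mul_of_nonneg_right (min_le_right _ _) (abs_nonneg _)).trans (le_of_eq ?_)
      rw [mul_assoc, ← sq, sq_abs]
  rw [Real.dist_eq, ← integral_sub hi1 hi2]
  simp_rw [← sub_mul]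
  calc |∫ y, (g n y - g' y) * ψ y ∂η| ≤ ∫ y, |(g n y - g' y) * ψ y| ∂η :=
        abs_integral_le_integral_abs
    _ ≤ ∫ y, (min |g n y - g' y| (l * |ψ y|) * |ψ y| + (g n y - g' y) ^ 2 / l) ∂η := by
        refine integral_mono hi3.abs (hi4.add ((hd n).integrable_sq.div_const l)) fun y => ?_
        simp only
        rw [abs_mul]
        rcases le_total |g n y - g' y| (l * |ψ y|) with hle | hle
        · rw [min_eq_left hle]
          have : 0 ≤ (g n y - g' y) ^ 2 / l := by positivity
          linarith
        · have h3 : |g n y - g' y| * |ψ y| ≤ (g n y - g' y) ^ 2 / l := by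
            rw [le_div_iff₀ hl0, ← sq_abs, sq, mul_assoc]
            exact mul_le_mul_of_nonneg_left (by linarith) (abs_nonneg _)
          have : 0 ≤ min |g n y - g' y| (l * |ψ y|) * |ψ y| := by positivity
          linarith
    _ < ε := by
        rw [integral_add hi4 ((hd n).integrable_sq.div_const l), integral_div]
        have := div_le_div_of_nonneg_right (hdK n) hl0.le
        linarith

/-- Almost everywhere convergence of a sequence dominated in `L^p`. -/
structure LimAt (ν : Measure X) (p : ℝ) (z : ℕ → X → ℝ) (w : X → ℝ) : Prop where
  tendsto : ∀ᵐ x ∂ν, Tendsto (fun n => z n x) atTop (𝓝 (w x))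
  dom : ∃ g : X → ℝ, Measurable g ∧ (∀ x, 0 ≤ g x) ∧ Integrable (fun x => g x ^ p) ν ∧
    ∀ᶠ n in atTop, ∀ᵐ x ∂ν, |z n x| ≤ g x

lemma LimAt.tendsto_integral_comp {p : ℝ} (hp : 0 ≤ p) {z : ℕ → X → ℝ} {w : X → ℝ}
    (h : LimAt ν p z w) (hz : ∀ n, Measurable (z n)) {θ : ℝ → ℝ} (hθ : Continuous θ) {C : ℝ}
    (hC : 0 ≤ C) (hb : ∀ a, |θ a| ≤ C * |a| ^ p) :
    Integrable (fun x => θ (w x)) ν ∧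
      Tendsto (fun n => ∫ x, θ (z n x) ∂ν) atTop (𝓝 (∫ x, θ (w x) ∂ν)) := by
  obtain ⟨g, hgm, hg0, hgi, hg⟩ := h.dom
  have hlim : ∀ᵐ x ∂ν, Tendsto (fun n => θ (z n x)) atTop (𝓝 (θ (w x))) :=
    h.tendsto.mono fun x hx => (hθ.tendsto _).comp hx
  have hbd : ∀ᶠ n in atTop, ∀ᵐ x ∂ν, ‖θ (z n x)‖ ≤ C * g x ^ p :=
    hg.mono fun n hn => hn.mono fun x hx => (hb _).trans
      (mul_le_mul_of_nonneg_left (Real.rpow_le_rpow (abs_nonneg _) hx hp) hC)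
  have hm : ∀ n, AEStronglyMeasurable (fun x => θ (z n x)) ν := fun n =>
    (hθ.measurable.comp (hz n)).aestronglyMeasurable
  refine ⟨?_, tendsto_integral_filter_of_dominated_convergence _ (Eventually.of_forall hm) hbd
    (hgi.const_mul C) hlim⟩
  obtain ⟨n₀, hn₀⟩ := eventually_atTop.1 hbd
  refine Integrable.mono' (hgi.const_mul C) (aestronglyMeasurable_of_tendsto_ae atTop hm hlim) ?_
  have h1 : ∀ᵐ x ∂ν, ∀ n, n₀ ≤ n → ‖θ (z n x)‖ ≤ C * g x ^ p :=
    ae_all_iff.2 fun n => by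
      by_cases hn : n₀ ≤ n
      · exact (hn₀ n hn).mono fun x hx _ => hx
      · exact Eventually.of_forall fun x hx => absurd hx hn
  filter_upwards [h1, hlim] with x hx hl
  exact le_of_tendsto hl.norm (eventually_atTop.2 ⟨n₀, hx⟩)

lemma LimAt.tendsto_integral_mul {p q : ℝ} (hpq : p.HolderConjugate q) {z : ℕ → X → ℝ}
    {w : X → ℝ} (h : LimAt ν p z w) (hz : ∀ n, Measurable (z n)) {φ : X → ℝ} (hφ : Measurable φ)
    (hφi : Integrable (fun x => |φ x| ^ q) ν) :
    Tendsto (fun n => ∫ x, z n x * φ x ∂ν) atTop (𝓝 (∫ x, w x * φ x ∂ν)) := by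
  obtain ⟨g, hgm, hg0, hgi, hg⟩ := h.dom
  have hgi' : Integrable (fun x => |g x| ^ p) ν := by simpa only [abs_of_nonneg (hg0 _)] using hgi
  refine tendsto_integral_filter_of_dominated_convergence (fun x => |g x * φ x|)
    (Eventually.of_forall fun n => ((hz n).mul hφ).aestronglyMeasurable)
    (hg.mono fun n hn => hn.mono fun x hx => ?_)
    (integrable_mul_of_rpow hpq hgm hφ hgi' hφi).abs
    (h.tendsto.mono fun x hx => hx.mul_const _)
  rw [Real.norm_eq_abs, abs_mul, abs_mul, abs_of_nonneg (hg0 x)]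
  exact mul_le_mul_of_nonneg_right hx (abs_nonneg _)

theorem exists_limit [SFinite ν] {p : ℝ} (hp : 1 ≤ p) {U : ℕ → ℝ → X → ℝ}
    (hU : ∀ n, Measurable (Function.uncurry (U n))) {b : ℝ → ℝ} (hb : Measurable b)
    (hb0 : ∀ t, 0 ≤ b t)
    (hUb : ∀ n, ∀ᵐ t ∂(volume.restrict (Ioi (0 : ℝ))), ∀ᵐ x ∂ν, U n t x ∈ Icc 0 (b t))
    (hint : ∀ n, ∀ᵐ t ∂(volume.restrict (Ioi (0 : ℝ))), Integrable (fun x => |U n t x| ^ p) ν)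
    {a c : ℕ → ℝ} (ha : Tendsto a atTop (𝓝 0)) (hc : Tendsto c atTop atTop) {C : ℝ≥0∞}
    (hC : C ≠ ⊤) (h : ∀ n, ∫⁻ t in Ioc (a n) (c n),
      ∫⁻ x, ENNReal.ofReal (|U n t x - U (n + 1) t x| ^ p) ∂ν ≤ C * (1 / 2) ^ n) :
    ∃ u : ℝ → X → ℝ, Measurable (Function.uncurry u) ∧ (∀ t x, u t x ∈ Icc 0 (b t)) ∧
      ∀ᵐ t ∂(volume.restrict (Ioi (0 : ℝ))), LimAt ν p (fun n => U n t) (u t) := by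
  have hp0 : 0 < p := by linarith
  have hUt : ∀ n t, Measurable (U n t) := fun n t => (hU n).of_uncurry_left
  have hI : Ioi (0 : ℝ) = ⋃ k : ℕ, Ioc (1 / ((k : ℝ) + 1)) (k + 1) := by
    ext t
    simp only [mem_Ioi, mem_iUnion, mem_Ioc]
    refine ⟨fun ht => ?_, fun ⟨k, hk⟩ => lt_trans (by positivity) hk.1⟩
    obtain ⟨k₁, hk₁⟩ := exists_nat_ge t
    obtain ⟨k₂, hk₂⟩ := exists_nat_one_div_lt ht
    refine ⟨max k₁ k₂, lt_of_le_of_lt ?_ hk₂, ?_⟩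
    · exact one_div_le_one_div_of_le (by positivity) (by gcongr; exact le_max_right _ _)
    · refine hk₁.trans ?_
      have : (k₁ : ℝ) ≤ (max k₁ k₂ : ℕ) := by exact_mod_cast le_max_left _ _
      linarith
  have key : ∀ᵐ t ∂(volume.restrict (Ioi (0 : ℝ))), ∃ n₀ : ℕ,
      ∫⁻ x, geoSum p (fun n => U (n + n₀) t x) ∂ν < ⊤ := by
    rw [hI, ae_restrict_iUnion_iff]
    intro k
    have h1 : ∀ᶠ n in atTop, a n ≤ 1 / ((k : ℝ) + 1) :=
      ha.eventually_le_const (by positivity)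
    obtain ⟨n₀, hn₀⟩ := eventually_atTop.1 (h1.and (hc.eventually_ge_atTop ((k : ℝ) + 1)))
    have h2 := lintegral_geoSum_lt_top
      (η := (volume.restrict (Ioc (1 / ((k : ℝ) + 1)) (k + 1))).prod ν) (p := p)
      (f := fun n => Function.uncurry (U (n + n₀))) (fun n => hU _) hC (fun n => by
        have hm1 := hU (n + n₀)
        have hm2 := hU (n + 1 + n₀)
        rw [lintegral_prod _ (by fun_prop)]
        refine (lintegral_mono_set (Ioc_subset_Ioc (hn₀ (n + n₀) (by omega)).1
          (hn₀ (n + n₀) (by omega)).2)).trans ?_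
        rw [show n + 1 + n₀ = n + n₀ + 1 by ring]
        refine (h (n + n₀)).trans (mul_le_mul_right (pow_le_pow_right_of_le_one' ?_ ?_) C)
        · exact ENNReal.div_le_of_le_mul (by norm_num)
        · omega)
    have hm := measurable_geoSum (p := p) (f := fun n => Function.uncurry (U (n + n₀)))
      (fun n => hU _)
    rw [lintegral_prod _ hm.aemeasurable] at h2
    filter_upwards [ae_lt_top hm.lintegral_prod_right' h2.ne] with t ht
    exact ⟨n₀, ht⟩
  have key2 : ∀ᵐ t ∂(volume.restrict (Ioi (0 : ℝ))), ∀ᵐ x ∂ν,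
      ∃ l, Tendsto (fun n => U n t x) atTop (𝓝 l) := by
    filter_upwards [key] with t ht
    obtain ⟨n₀, hn₀⟩ := ht
    filter_upwards [ae_lt_top (measurable_geoSum fun n => hUt (n + n₀) t) hn₀.ne] with x hx
    obtain ⟨l, hl⟩ := cauchySeq_tendsto_of_complete (cauchySeq_of_geoSum hp0 hx.ne).1
    exact ⟨l, (tendsto_add_atTop_iff_nat n₀).1 hl⟩
  have key3 : ∀ᵐ q ∂((volume.restrict (Ioi (0 : ℝ))).prod ν),
      ∃ l, Tendsto (fun n => Function.uncurry (U n) q) atTop (𝓝 l) :=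
    (Measure.ae_prod_iff_ae_ae (measurableSet_exists_tendsto fun n => hU n)).2 key2
  obtain ⟨u₀, hu₀m, hu₀⟩ := measurable_limit_of_tendsto_metrizable_ae
    (fun n => (hU n).aemeasurable) key3
  refine ⟨fun t x => max 0 (min (b t) (u₀ (t, x))), ?_, fun t x =>
    ⟨le_max_left _ _, max_le (hb0 t) (min_le_left _ _)⟩, ?_⟩
  · exact measurable_const.max ((hb.comp measurable_fst).min hu₀m)
  filter_upwards [key, Measure.ae_ae_of_ae_prod hu₀, ae_all_iff.2 hUb, ae_all_iff.2 hint]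
    with t ht hl hbt hit
  refine ⟨?_, ?_⟩
  · filter_upwards [hl, ae_all_iff.2 hbt] with x hx hbx
    have hmem : u₀ (t, x) ∈ Icc 0 (b t) := isClosed_Icc.mem_of_tendsto hx (Eventually.of_forall hbx)
    rw [min_eq_right hmem.2, max_eq_right hmem.1]
    exact hx
  · obtain ⟨n₀, hn₀⟩ := ht
    have hZm : Measurable fun x => geoSum p fun n => U (n + n₀) t x :=
      measurable_geoSum fun n => hUt (n + n₀) t
    have hgc : 0 ≤ geoConst p := by
      unfold geoConst
      have : (2 / 3 : ℝ) ^ (1 / p) < 1 :=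
        Real.rpow_lt_one (by norm_num) (by norm_num) (by positivity)
      exact one_div_nonneg.2 (by linarith)
    refine ⟨fun x => |U n₀ t x| + geoConst p *
      (geoSum p fun n => U (n + n₀) t x).toReal ^ (1 / p), ?_, fun x => by positivity, ?_, ?_⟩
    · have := hUt n₀ t
      fun_prop
    · refine Integrable.mono' (((hit n₀).add ((integrable_toReal_of_lintegral_ne_top
        hZm.aemeasurable hn₀.ne).const_mul (geoConst p ^ p))).const_mul (2 ^ p))
        ?_ (Eventually.of_forall fun x => ?_)
      · have := hUt n₀ t
        exact Measurable.aestronglyMeasurable (by fun_prop)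
      · rw [Real.norm_of_nonneg (by positivity)]
        have h1 := abs_add_rpow_le hp0.le |U n₀ t x| (geoConst p *
          (geoSum p fun n => U (n + n₀) t x).toReal ^ (1 / p))
        rw [abs_of_nonneg (by positivity), abs_abs, abs_of_nonneg (a := geoConst p * _)
          (by positivity)] at h1
        refine h1.trans (le_of_eq ?_)
        rw [Pi.add_apply, Real.mul_rpow hgc (by positivity), ← Real.rpow_mul ENNReal.toReal_nonneg,
          one_div_mul_cancel hp0.ne', Real.rpow_one]
    · refine eventually_atTop.2 ⟨n₀, fun n hn => ?_⟩
      filter_upwards [ae_lt_top hZm hn₀.ne] with x hx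
      have h1 := (cauchySeq_of_geoSum hp0 hx.ne).2 (n - n₀)
      simp only [Nat.sub_add_cancel hn, zero_add] at h1
      have h2 := abs_sub_abs_le_abs_sub (U n t x) (U n₀ t x)
      linarith

end Limits

section SpaceTime

variable {X : Type*} [MeasurableSpace X] {ν : Measure X} {Γ : Measure (X × X)}

lemma measurable_uncurry_pdiff {v : ℝ → X → ℝ} (hv : Measurable (Function.uncurry v)) :
    Measurable fun z : ℝ × (X × X) => pdiff (v z.1) z.2 :=
  (hv.comp (measurable_fst.prodMk (measurable_fst.comp measurable_snd))).sub
    (hv.comp (measurable_fst.prodMk (measurable_snd.comp measurable_snd)))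

lemma measurable_energy [SFinite Γ] {v : ℝ → X → ℝ} (hv : Measurable (Function.uncurry v)) :
    Measurable fun t => energy Γ (v t) :=
  (((measurable_uncurry_pdiff hv).pow_const 2).ennreal_ofReal).lintegral_prod_right'

lemma lintegral_pdiff_sq_prod [SFinite Γ] {η : Measure ℝ} [SFinite η] {v : ℝ → X → ℝ}
    (hv : Measurable (Function.uncurry v)) :
    ∫⁻ z, ENNReal.ofReal (pdiff (v z.1) z.2 ^ 2) ∂(η.prod Γ) = ∫⁻ t, energy Γ (v t) ∂η :=
  lintegral_prod _ (((measurable_uncurry_pdiff hv).pow_const 2).ennreal_ofReal).aemeasurable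

lemma memLp_pdiff_prod [SFinite Γ] {η : Measure ℝ} [SFinite η] {v : ℝ → X → ℝ}
    (hv : Measurable (Function.uncurry v)) (h : ∫⁻ t, energy Γ (v t) ∂η ≠ ⊤) :
    MemLp (fun z : ℝ × (X × X) => pdiff (v z.1) z.2) 2 (η.prod Γ) := by
  have hm := measurable_uncurry_pdiff hv
  refine (memLp_two_iff_integrable_sq hm.aestronglyMeasurable).2
    ⟨(hm.pow_const 2).aestronglyMeasurable, ?_⟩
  rw [hasFiniteIntegral_iff_ofReal (Eventually.of_forall fun _ => sq_nonneg _),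
    lintegral_pdiff_sq_prod hv]
  exact h.lt_top

lemma integral_eform_prod [SFinite Γ] {η : Measure ℝ} [SFinite η] {v w : ℝ → X → ℝ}
    (hv : MemLp (fun z : ℝ × (X × X) => pdiff (v z.1) z.2) 2 (η.prod Γ))
    (hw : MemLp (fun z : ℝ × (X × X) => pdiff (w z.1) z.2) 2 (η.prod Γ)) :
    Integrable (fun t => eform Γ (v t) (w t)) η ∧
    ∫ t, eform Γ (v t) (w t) ∂η = ∫ z, pdiff (v z.1) z.2 * pdiff (w z.1) z.2 ∂(η.prod Γ) :=
  ⟨(hv.integrable_mul hw).integral_prod_left, (integral_prod _ (hv.integrable_mul hw)).symm⟩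

lemma lintegral_energy_le_liminf [SFinite Γ] (hM : MarginalsAC ν Γ) {v : ℕ → ℝ → X → ℝ}
    {w : ℝ → X → ℝ} (hv : ∀ n, Measurable (Function.uncurry (v n))) {I : Set ℝ}
    (hL : ∀ᵐ t ∂(volume.restrict I), ∀ᵐ x ∂ν, Tendsto (fun n => v n t x) atTop (𝓝 (w t x)))
    {J : ℕ → Set ℝ} (hJm : ∀ n, MeasurableSet (J n))
    (hJ : ∀ᵐ t ∂(volume.restrict I), ∀ᶠ n in atTop, t ∈ J n) :
    ∫⁻ t in I, energy Γ (w t) ≤ liminf (fun n => ∫⁻ t in J n, energy Γ (v n t)) atTop := by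
  calc ∫⁻ t in I, energy Γ (w t)
      ≤ ∫⁻ t in I, liminf (fun n => (J n).indicator (fun t => energy Γ (v n t)) t) atTop := by
        refine lintegral_mono_ae ?_
        filter_upwards [hL, hJ] with t ht hJt
        refine (energy_le_liminf hM (fun n => (hv n).of_uncurry_left) ht).trans (le_of_eq ?_)
        refine liminf_congr (hJt.mono fun n hn => ?_)
        rw [indicator_of_mem hn]
    _ ≤ liminf (fun n => ∫⁻ t in I, (J n).indicator (fun t => energy Γ (v n t)) t) atTop :=
        lintegral_liminf_le fun n => (measurable_energy (hv n)).indicator (hJm n)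
    _ ≤ _ := by
        refine liminf_le_liminf (Eventually.of_forall fun n => ?_)
        refine (setLIntegral_le_lintegral _ _).trans ?_
        rw [lintegral_indicator (hJm n)]

/-- Restriction of a time-dependent function to a set of times. -/
def cutTime (J : Set ℝ) (v : ℝ → X → ℝ) : ℝ → X → ℝ := fun t x => J.indicator (fun t => v t x) t

lemma measurable_cutTime {J : Set ℝ} (hJ : MeasurableSet J) {v : ℝ → X → ℝ}
    (hv : Measurable (Function.uncurry v)) : Measurable (Function.uncurry (cutTime J v)) := by
  have : Function.uncurry (cutTime J v) = (J ×ˢ univ).indicator (Function.uncurry v) := by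
    ext ⟨t, x⟩
    by_cases ht : t ∈ J <;> simp [cutTime, ht]
  rw [this]
  exact hv.indicator (hJ.prod MeasurableSet.univ)

lemma energy_cutTime (J : Set ℝ) (v : ℝ → X → ℝ) (t : ℝ) :
    energy Γ (cutTime J v t) = J.indicator (fun t => energy Γ (v t)) t := by
  by_cases ht : t ∈ J <;> simp [cutTime, ht, energy, pdiff]

lemma eform_cutTime (J : Set ℝ) (v : ℝ → X → ℝ) (φ : X → ℝ) (t : ℝ) :
    eform Γ (cutTime J v t) φ = J.indicator (fun t => eform Γ (v t) φ) t := by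
  by_cases ht : t ∈ J <;> simp [cutTime, ht, eform, pdiff]

lemma setLIntegral_energy_cutTime {I J : Set ℝ} (hJ : MeasurableSet J) (hJI : J ⊆ I)
    (v : ℝ → X → ℝ) :
    ∫⁻ t in I, energy Γ (cutTime J v t) = ∫⁻ t in J, energy Γ (v t) := by
  simp_rw [energy_cutTime]
  rw [lintegral_indicator hJ, Measure.restrict_restrict hJ, inter_eq_left.2 hJI]

lemma setIntegral_eform_cutTime {I J : Set ℝ} (hJ : MeasurableSet J) (hJI : J ⊆ I)
    (v : ℝ → X → ℝ) (φ : X → ℝ) :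
    ∫ t in I, eform Γ (cutTime J v t) φ = ∫ t in J, eform Γ (v t) φ := by
  simp_rw [eform_cutTime]
  rw [integral_indicator hJ, Measure.restrict_restrict hJ, inter_eq_left.2 hJI]

lemma memLp_pdiff_const [SFinite Γ] {I : Set ℝ} (hI : volume I ≠ ⊤) {φ : X → ℝ}
    (hφm : Measurable φ) (hφ : energy Γ φ ≠ ⊤) :
    MemLp (fun z : ℝ × (X × X) => pdiff φ z.2) 2 ((volume.restrict I).prod Γ) := by
  refine memLp_pdiff_prod (v := fun _ => φ) (hφm.comp measurable_snd) ?_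
  rw [setLIntegral_const]
  exact ENNReal.mul_ne_top hφ hI

lemma tendsto_integral_eform [SFinite Γ] (hM : MarginalsAC ν Γ)
    {v : ℕ → ℝ → X → ℝ} {w : ℝ → X → ℝ} (hv : ∀ n, Measurable (Function.uncurry (v n)))
    (hw : Measurable (Function.uncurry w)) {I : Set ℝ} (hI : volume I ≠ ⊤) {J' : Set ℝ}
    {J : ℕ → Set ℝ} (hJ'm : MeasurableSet J') (hJm : ∀ n, MeasurableSet (J n))
    (hJ' : J' ⊆ I) (hJ : ∀ n, J n ⊆ I)
    (hL : ∀ᵐ t ∂(volume.restrict I), ∀ᵐ x ∂ν, Tendsto (fun n => v n t x) atTop (𝓝 (w t x)))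
    (hJJ : ∀ᵐ t ∂(volume.restrict I), ∀ᶠ n in atTop, (t ∈ J n ↔ t ∈ J'))
    {K : ℝ≥0∞} (hK : K ≠ ⊤) (hb : ∀ n, ∫⁻ t in J n, energy Γ (v n t) ≤ K) {φ : X → ℝ}
    (hφm : Measurable φ) (hφ : energy Γ φ ≠ ⊤) :
    Tendsto (fun n => ∫ t in J n, eform Γ (v n t) φ) atTop (𝓝 (∫ t in J', eform Γ (w t) φ)) := by
  have hwK : ∫⁻ t in J', energy Γ (w t) ≤ K := by
    refine (lintegral_energy_le_liminf hM hv (J := J) (ae_restrict_of_ae_restrict_of_subset hJ' hL)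
      hJm ?_).trans ?_
    · filter_upwards [ae_restrict_of_ae_restrict_of_subset hJ' hJJ, ae_restrict_mem hJ'm]
        with t ht htJ
      exact ht.mono fun n hn => hn.2 htJ
    · exact (liminf_le_liminf (Eventually.of_forall hb)).trans (by simp)
  have hvm := fun n => measurable_cutTime (hJm n) (hv n)
  have hwm := measurable_cutTime hJ'm hw
  have h1 : ∀ n, MemLp (fun z : ℝ × (X × X) => pdiff (cutTime (J n) (v n) z.1) z.2) 2
      ((volume.restrict I).prod Γ) := fun n => memLp_pdiff_prod (hvm n) (by
    rw [setLIntegral_energy_cutTime (hJm n) (hJ n)]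
    exact ne_top_of_le_ne_top hK (hb n))
  have h2 : MemLp (fun z : ℝ × (X × X) => pdiff (cutTime J' w z.1) z.2) 2
      ((volume.restrict I).prod Γ) := memLp_pdiff_prod hwm (by
    rw [setLIntegral_energy_cutTime hJ'm hJ']
    exact ne_top_of_le_ne_top hK hwK)
  have h3 := memLp_pdiff_const hI hφm hφ
  have key := tendsto_integral_mul_of_bdd_sq (K := K.toReal) h1 h2 h3 (fun n => ?_) ?_
  · have e1 : ∀ n, ∫ t in J n, eform Γ (v n t) φ = _ := fun n =>
      (setIntegral_eform_cutTime (hJm n) (hJ n) (v n) φ).symm.trans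
        (integral_eform_prod (w := fun _ => φ) (h1 n) h3).2
    simp_rw [e1]
    rwa [← setIntegral_eform_cutTime hJ'm hJ' w φ,
      (integral_eform_prod (w := fun _ => φ) h2 h3).2]
  · rw [integral_eq_lintegral_of_nonneg_ae (Eventually.of_forall fun _ => sq_nonneg _)
      ((measurable_uncurry_pdiff (hvm n)).pow_const 2).aestronglyMeasurable]
    refine ENNReal.toReal_mono hK ?_
    rw [lintegral_pdiff_sq_prod (hvm n), setLIntegral_energy_cutTime (hJm n) (hJ n)]
    exact hb n
  · refine (Measure.ae_prod_iff_ae_ae (measurableSet_tendsto_fun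
      (fun n => measurable_uncurry_pdiff (hvm n)) (measurable_uncurry_pdiff hwm))).2 ?_
    filter_upwards [hL, hJJ] with t ht hJt
    filter_upwards [hM.ae_prod ht] with p hp
    by_cases htJ : t ∈ J'
    · refine (((hp.1.sub hp.2).congr' (hJt.mono fun n hn => ?_))).trans (le_of_eq ?_)
      · simp [cutTime, pdiff, hn.2 htJ]
      · simp [cutTime, pdiff, htJ]
    · refine (tendsto_const_nhds (x := (0 : ℝ)).congr' (hJt.mono fun n hn => ?_)).trans
        (le_of_eq ?_)
      · have htn : t ∉ J n := fun h => htJ (hn.1 h)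
        simp [cutTime, pdiff, htn]
      · simp [cutTime, pdiff, htJ]

end SpaceTime

section Rothe

variable {X : Type*} [MeasurableSpace X] {ν : Measure X} {Γ : Measure (X × X)}

/-- Piecewise constant interpolation in time of a sequence of states. -/
def stepFun (U : ℕ → X → ℝ) (h : ℝ) : ℝ → X → ℝ := fun t => U ⌈t / h⌉₊

lemma measurable_stepFun {U : ℕ → X → ℝ} (hU : ∀ n, Measurable (U n)) (h : ℝ) :
    Measurable (Function.uncurry (stepFun U h)) := by
  have h1 : Measurable fun z : ℕ × X => U z.1 z.2 := measurable_from_prod_countable_right hU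
  exact h1.comp (((Nat.measurable_ceil.comp (measurable_id.div_const h)).comp
    measurable_fst).prodMk measurable_snd)

lemma ofReal_sum_mul {h : ℝ} (hh : 0 ≤ h) {E : ℕ → ℝ} (hE : ∀ i, 0 ≤ E i) (n : ℕ) :
    ENNReal.ofReal (∑ l ∈ Finset.range n, h * E l) =
      ∑ l ∈ Finset.range n, ENNReal.ofReal h * ENNReal.ofReal (E l) := by
  rw [ENNReal.ofReal_sum_of_nonneg fun i _ => mul_nonneg hh (hE i)]
  exact Finset.sum_congr rfl fun i _ => ENNReal.ofReal_mul hh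

lemma step_dissipation {h : ℝ} (hh : 0 < h) {Φ E : ℕ → ℝ} (hΦ : ∀ i, 0 ≤ Φ i)
    (hE : ∀ i, 0 ≤ E i) {g : ℕ → ℝ≥0∞} (hg : ∀ i, g (i + 1) = ENNReal.ofReal (E (i + 1)))
    (H : ∀ i n, Φ (i + n) + ∑ l ∈ Finset.range n, h * E (i + l + 1) ≤ Φ i) {s t : ℝ}
    (hs : 0 ≤ s) (hst : s ≤ t) :
    ENNReal.ofReal (Φ ⌈t / h⌉₊) + ∫⁻ r in Ioc (s + h) t, g ⌈r / h⌉₊ ≤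
      ENNReal.ofReal (Φ ⌈s / h⌉₊) := by
  obtain ⟨n, hn⟩ := Nat.exists_eq_add_of_le
    (Nat.ceil_mono (div_le_div_of_nonneg_right hst hh.le) : ⌈s / h⌉₊ ≤ ⌈t / h⌉₊)
  rw [hn]
  set i := ⌈s / h⌉₊ with hi
  have h1 : (i : ℝ) * h ≤ s + h := by
    have := (Nat.ceil_lt_add_one (div_nonneg hs hh.le)).le
    rw [← hi] at this
    calc (i : ℝ) * h ≤ (s / h + 1) * h := by gcongr
      _ = s + h := by field_simp
  have h2 : t ≤ ((i + n : ℕ) : ℝ) * h := by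
    rw [← hn, ← div_le_iff₀ hh]
    exact Nat.le_ceil _
  refine (add_le_add_right (lintegral_mono_set (Ioc_subset_Ioc h1 h2)) _).trans ?_
  rw [lintegral_Ioc_ceil hh]
  simp_rw [hg]
  rw [← ofReal_sum_mul hh.le fun l => hE (i + l + 1), ← ENNReal.ofReal_add (hΦ _)
    (Finset.sum_nonneg fun l _ => mul_nonneg hh.le (hE _))]
  exact ENNReal.ofReal_le_ofReal (H i n)

lemma step_dissipation_total {h : ℝ} (hh : 0 < h) {Φ E : ℕ → ℝ} (hΦ : ∀ i, 0 ≤ Φ i)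
    (hE : ∀ i, 0 ≤ E i) {g : ℕ → ℝ≥0∞} (hg : ∀ i, g (i + 1) = ENNReal.ofReal (E (i + 1)))
    (H : ∀ i n, Φ (i + n) + ∑ l ∈ Finset.range n, h * E (i + l + 1) ≤ Φ i) :
    ∫⁻ r in Ioi 0, g ⌈r / h⌉₊ ≤ ENNReal.ofReal (Φ 0) := by
  refine lintegral_Ioi_le_of_forall hh fun n => ?_
  have h1 := lintegral_Ioc_ceil hh g 0 n
  simp only [CharP.cast_eq_zero, zero_mul, zero_add] at h1
  rw [h1]
  simp_rw [hg]
  rw [← ofReal_sum_mul hh.le fun i => hE (i + 1)]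
  refine ENNReal.ofReal_le_ofReal ?_
  have h2 := H 0 n
  simp only [zero_add] at h2
  linarith [hΦ n]

namespace ImplicitScheme

variable {m h N : ℝ} {f : X → ℝ} {U : ℕ → X → ℝ}

lemma step_energy_le (hU : ImplicitScheme ν Γ m h N f U) (hf : BddDensity ν N f) (hm : 1 < m)
    (hh : 0 < h) {s t : ℝ} (hs : 0 ≤ s) (hst : s ≤ t) :
    ENNReal.ofReal ((∫ x, stepFun U h t x ^ (m + 1) ∂ν) / (m + 1)) +
      ∫⁻ r in Ioc (s + h) t, energy Γ (fun x => stepFun U h r x ^ m) ≤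
      ENNReal.ofReal ((∫ x, stepFun U h s x ^ (m + 1) ∂ν) / (m + 1)) :=
  step_dissipation hh (Φ := fun i => (∫ x, U i x ^ (m + 1) ∂ν) / (m + 1))
    (E := fun i => eform Γ (fun x => U i x ^ m) (fun x => U i x ^ m))
    (g := fun i => energy Γ (fun x => U i x ^ m))
    (fun i => div_nonneg (integral_nonneg fun x => Real.rpow_nonneg ((hU.bdd hf i).mem x).1 _)
      (by linarith)) (fun i => eform_self_nonneg _)
    (fun i => energy_eq_ofReal_eform (hU.formTest hm i).memLp) (hU.energy_le hf hm) hs hst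

lemma step_energy_total (hU : ImplicitScheme ν Γ m h N f U) (hf : BddDensity ν N f) (hm : 1 < m)
    (hh : 0 < h) :
    ∫⁻ r in Ioi 0, energy Γ (fun x => stepFun U h r x ^ m) ≤
      ENNReal.ofReal ((∫ x, f x ^ (m + 1) ∂ν) / (m + 1)) := by
  have := step_dissipation_total hh (Φ := fun i => (∫ x, U i x ^ (m + 1) ∂ν) / (m + 1))
    (E := fun i => eform Γ (fun x => U i x ^ m) (fun x => U i x ^ m))
    (g := fun i => energy Γ (fun x => U i x ^ m))
    (fun i => div_nonneg (integral_nonneg fun x => Real.rpow_nonneg ((hU.bdd hf i).mem x).1 _)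
      (by linarith)) (fun i => eform_self_nonneg _)
    (fun i => energy_eq_ofReal_eform (hU.formTest hm i).memLp) (hU.energy_le hf hm)
  rwa [hU.zero] at this

lemma step_level_le (hU : ImplicitScheme ν Γ m h N f U) (hf : BddDensity ν N f) (hm : 1 < m)
    (hh : 0 < h) {k : ℝ} (hk : 0 < k) {s t : ℝ} (hs : 0 ≤ s) (hst : s ≤ t) :
    ENNReal.ofReal (∫ x, max (stepFun U h t x - k) 0 ^ 2 ∂ν) +
      ENNReal.ofReal (2 * k ^ (m - 1)) *
        ∫⁻ r in Ioc (s + h) t, energy Γ (fun x => max (stepFun U h r x - k) 0) ≤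
      ENNReal.ofReal (∫ x, max (stepFun U h s x - k) 0 ^ 2 ∂ν) := by
  have hk2 : 0 ≤ 2 * k ^ (m - 1) := by positivity
  rw [← lintegral_const_mul' _ _ ENNReal.ofReal_ne_top]
  refine step_dissipation hh (Φ := fun i => ∫ x, max (U i x - k) 0 ^ 2 ∂ν)
    (E := fun i => 2 * k ^ (m - 1) *
      eform Γ (fun x => max (U i x - k) 0) (fun x => max (U i x - k) 0))
    (g := fun i => ENNReal.ofReal (2 * k ^ (m - 1)) * energy Γ (fun x => max (U i x - k) 0))
    (fun i => integral_nonneg fun x => sq_nonneg _)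
    (fun i => mul_nonneg hk2 (eform_self_nonneg _)) (fun i => ?_) (hU.level_le hf hm hh.le hk) hs hst
  rw [energy_eq_ofReal_eform ((hU.step i).bdd.formTest_level hm hk (hU.step i).fin).memLp,
    ENNReal.ofReal_mul hk2]

lemma step_eq (hU : ImplicitScheme ν Γ m h N f U) (hf : BddDensity ν N f) (hm : 1 < m)
    (hh : 0 < h) (t : ℝ) {w : X → ℝ} (hw : FormTest ν Γ (conjExp m) w) :
    (∫ x, (stepFun U h t x - f x) * w x ∂ν) +
      ∫ r in Ioc 0 (⌈t / h⌉₊ * h), eform Γ (fun x => stepFun U h r x ^ m) w = 0 := by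
  have hq := one_lt_conjExp hm
  have h1 := (integral_Ioc_ceil hh (fun i => eform Γ (fun x => U i x ^ m) w) ⌈t / h⌉₊).2
  have h2 : ∀ n, h * eform Γ w (fun x => ∑ l ∈ Finset.range n, U (l + 1) x ^ m) =
      ∑ l ∈ Finset.range n, h * eform Γ (fun x => U (l + 1) x ^ m) w := by
    intro n
    induction n with
    | zero => simp [eform, pdiff]
    | succ n ih =>
      simp only [Finset.sum_range_succ]
      rw [eform_add_right hw.memLp
        (FormTest.finset_sum (by linarith) _ fun l => hU.formTest hm l).memLp
        (hU.formTest hm n).memLp, mul_add, ih, eform_comm w (fun x => U (n + 1) x ^ m)]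
  have h3 := hU.eq hf hm ⌈t / h⌉₊ hw
  rw [h2] at h3
  simp only [stepFun]
  rw [h1]
  exact h3

lemma step_compare (hU : ImplicitScheme ν Γ m h N f U) {U' : ℕ → X → ℝ}
    (hU' : ImplicitScheme ν Γ m (h / 2) N f U') (hf : BddDensity ν N f) (hm : 1 < m)
    (hh : 0 < h) :
    ∫⁻ t in Ioi 0, ∫⁻ x, ENNReal.ofReal
      (|stepFun U h t x - stepFun U' (h / 2) t x| ^ (m + 1)) ∂ν ≤
      ENNReal.ofReal (h / 8 * ((∫ x, f x ^ (m + 1) ∂ν) / (m + 1))) := by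
  refine lintegral_Ioi_le_of_forall (half_pos hh) fun n => ?_
  have h1 := lintegral_Ioc_ceil (half_pos hh) (fun k => ∫⁻ x, ENNReal.ofReal
    (|U ((k + 1) / 2) x - U' k x| ^ (m + 1)) ∂ν) 0 n
  simp only [CharP.cast_eq_zero, zero_mul, zero_add] at h1
  have h2 : ∫⁻ t in Ioc 0 (n * (h / 2)), ∫⁻ x, ENNReal.ofReal
      (|stepFun U h t x - stepFun U' (h / 2) t x| ^ (m + 1)) ∂ν =
      ∫⁻ t in Ioc 0 (n * (h / 2)), ∫⁻ x, ENNReal.ofReal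
        (|U ((⌈t / (h / 2)⌉₊ + 1) / 2) x - U' ⌈t / (h / 2)⌉₊ x| ^ (m + 1)) ∂ν := by
    refine setLIntegral_congr_fun measurableSet_Ioc fun t ht => ?_
    have h3 : ⌈t / h⌉₊ = (⌈t / (h / 2)⌉₊ + 1) / 2 := by
      have hk0 : ⌈t / (h / 2)⌉₊ ≠ 0 := (Nat.ceil_pos.2 (div_pos ht.1 (half_pos hh))).ne'
      have hk1 := (Nat.ceil_eq_iff hk0).1 rfl
      set k := ⌈t / (h / 2)⌉₊ with hk
      have hj0 : (k + 1) / 2 ≠ 0 := by omega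
      have e : t / (h / 2) = 2 * (t / h) := by field_simp
      rw [e] at hk1
      refine (Nat.ceil_eq_iff hj0).2 ⟨?_, ?_⟩
      · have h5 : 2 * ((k + 1) / 2 - 1) ≤ k - 1 := by omega
        have h6 : 2 * (((k + 1) / 2 - 1 : ℕ) : ℝ) ≤ ((k - 1 : ℕ) : ℝ) := by exact_mod_cast h5
        linarith [hk1.1]
      · have h5 : k ≤ 2 * ((k + 1) / 2) := by omega
        have h6 : (k : ℝ) ≤ 2 * (((k + 1) / 2 : ℕ) : ℝ) := by exact_mod_cast h5
        linarith [hk1.2]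
    simp only [stepFun, h3]
  rw [h2, h1]
  have h4 : ∀ l, ∫⁻ x, ENNReal.ofReal (|U ((l + 1 + 1) / 2) x - U' (l + 1) x| ^ (m + 1)) ∂ν =
      ENNReal.ofReal (∫ x, |U (l / 2 + 1) x - U' (l + 1) x| ^ (m + 1) ∂ν) := by
    intro l
    rw [show (l + 1 + 1) / 2 = l / 2 + 1 by omega, ofReal_integral_eq_lintegral_ofReal]
    · have hb1 := hU.bdd hf (l / 2 + 1)
      have hb2 := hU'.bdd hf (l + 1)
      refine integrable_rpow_of_bdd (N := N) (hb1.meas.sub hb2.meas) (hb1.int.sub hb2.int)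
        (fun x => ?_) (by linarith)
      rw [abs_le]
      constructor <;> linarith [(hb1.mem x).1, (hb1.mem x).2, (hb2.mem x).1, (hb2.mem x).2]
    · exact Eventually.of_forall fun x => by positivity
  simp_rw [h4]
  rw [← ofReal_sum_mul (half_pos hh).le fun l => integral_nonneg fun x => by positivity]
  exact ENNReal.ofReal_le_ofReal (hU.compare hU' hf hm hh n)

end ImplicitScheme

end Rothe

section BoundedSolutions

variable {X : Type*} [MeasurableSpace X] {ν : Measure X} {Γ : Measure (X × X)}

/-- A bounded solution of the abstract diffusion equation `∂ₜ(u ν) + L(u^m) = 0` with initial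
datum `f`, together with a set `G` of full measure of times at which the estimates hold. -/
structure BddSol (ν : Measure X) (Γ : Measure (X × X)) (m N : ℝ) (f : X → ℝ) (u : ℝ → X → ℝ)
    (G : Set ℝ) : Prop where
  meas : Measurable (Function.uncurry u)
  mem : ∀ t x, u t x ∈ Icc 0 N
  pos : G ⊆ Ioi 0
  ae_mem : ∀ᵐ t ∂(volume.restrict (Ioi (0 : ℝ))), t ∈ G
  int : ∀ t ∈ G, Integrable (u t) ν
  mass : ∀ t ∈ G, ∫ x, u t x ∂ν ≤ ∫ x, f x ∂ν
  fin : ∀ t ∈ G, energy Γ (fun x => u t x ^ m) ≠ ⊤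
  energy_total : ∫⁻ t in Ioi 0, energy Γ (fun x => u t x ^ m) ≤
    ENNReal.ofReal ((∫ x, f x ^ (m + 1) ∂ν) / (m + 1))
  energy_le : ∀ t₁ ∈ G, ∀ t₂ ∈ G, t₁ < t₂ →
    ENNReal.ofReal ((∫ x, u t₂ x ^ (m + 1) ∂ν) / (m + 1)) +
      ∫⁻ r in Ioc t₁ t₂, energy Γ (fun x => u r x ^ m) ≤
      ENNReal.ofReal ((∫ x, u t₁ x ^ (m + 1) ∂ν) / (m + 1))
  level_le : ∀ k, 0 < k → ∀ t₁ ∈ G, ∀ t₂ ∈ G, t₁ < t₂ →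
    ENNReal.ofReal (∫ x, max (u t₂ x - k) 0 ^ 2 ∂ν) + ENNReal.ofReal (2 * k ^ (m - 1)) *
      ∫⁻ r in Ioc t₁ t₂, energy Γ (fun x => max (u r x - k) 0) ≤
      ENNReal.ofReal (∫ x, max (u t₁ x - k) 0 ^ 2 ∂ν)
  eq : ∀ t ∈ G, ∀ w, FormTest ν Γ (conjExp m) w →
    (∫ x, (u t x - f x) * w x ∂ν) + ∫ r in Ioc 0 t, eform Γ (fun x => u r x ^ m) w = 0

lemma ofReal_add_mul_le_of_liminf {A A' : ℕ → ℝ} {a a' : ℝ} (hA : Tendsto A atTop (𝓝 a))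
    (hA' : Tendsto A' atTop (𝓝 a')) {B : ℕ → ℝ≥0∞} {b c : ℝ≥0∞} (hc : c ≠ ⊤)
    (hb : b ≤ liminf B atTop)
    (h : ∀ᶠ n in atTop, ENNReal.ofReal (A n) + c * B n ≤ ENNReal.ofReal (A' n)) :
    ENNReal.ofReal a + c * b ≤ ENNReal.ofReal a' := by
  have h1 : Tendsto (fun n => ENNReal.ofReal (A n)) atTop (𝓝 (ENNReal.ofReal a)) :=
    ENNReal.tendsto_ofReal hA
  have h2 : Tendsto (fun n => ENNReal.ofReal (A' n)) atTop (𝓝 (ENNReal.ofReal a')) :=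
    ENNReal.tendsto_ofReal hA'
  calc ENNReal.ofReal a + c * b
      ≤ liminf (fun n => ENNReal.ofReal (A n)) atTop + liminf (fun n => c * B n) atTop := by
        rw [h1.liminf_eq, ENNReal.liminf_const_mul_of_ne_top hc]
        gcongr
    _ ≤ liminf (fun n => ENNReal.ofReal (A n) + c * B n) atTop := liminf_add_liminf_le _ _
    _ ≤ liminf (fun n => ENNReal.ofReal (A' n)) atTop := liminf_le_liminf h
    _ = _ := h2.liminf_eq

lemma level_sq_le_rpow {m k : ℝ} (hm : 1 < m) (hk : 0 < k) (a : ℝ) :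
    |max (a - k) 0 ^ 2| ≤ k ^ (1 - m) * |a| ^ (m + 1) := by
  rw [abs_of_nonneg (sq_nonneg _)]
  rcases le_total a k with h | h
  · rw [max_eq_right (by linarith)]
    have : 0 ≤ k ^ (1 - m) * |a| ^ (m + 1) := by positivity
    simpa using this
  · have ha : 0 < a := by linarith
    rw [max_eq_left (by linarith), abs_of_pos ha]
    have h1 : a ^ (1 - m) ≤ k ^ (1 - m) := Real.rpow_le_rpow_of_nonpos hk h (by linarith)
    calc (a - k) ^ 2 ≤ a ^ 2 := by gcongr; linarith
      _ = a ^ (1 - m) * a ^ (m + 1) := by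
        rw [← Real.rpow_add ha, show 1 - m + (m + 1) = (2 : ℕ) by push_cast; ring,
          Real.rpow_natCast]
      _ ≤ _ := by gcongr

/-- The solution operator: bounded integrable data give rise to bounded solutions. -/
theorem exists_bddSol [SFinite ν] [SFinite Γ] (hM : MarginalsAC ν Γ) {m N : ℝ} (hm : 1 < m)
    (hN : 0 < N) {f : X → ℝ} (hf : BddDensity ν N f) :
    ∃ u G, BddSol ν Γ m N f u G := by
  set h : ℕ → ℝ := fun n => (1 / 2) ^ n with hh_def
  have hh : ∀ n, 0 < h n := fun n => by positivity
  have hh1 : ∀ n, h n ≤ 1 := fun n => pow_le_one₀ (by norm_num) (by norm_num)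
  have hh0 : Tendsto h atTop (𝓝 0) :=
    tendsto_pow_atTop_nhds_zero_of_lt_one (by norm_num) (by norm_num)
  choose S hS using fun n => exists_implicitScheme hM hm (hh n) hN hf
  set U : ℕ → ℝ → X → ℝ := fun n => stepFun (S n) (h n) with hU_def
  have hUb : ∀ n t, BddDensity ν N (U n t) := fun n t => (hS n).bdd hf _
  have hUm : ∀ n, Measurable (Function.uncurry (U n)) := fun n =>
    measurable_stepFun (fun i => ((hS n).bdd hf i).meas) _
  set F : ℝ := (∫ x, f x ^ (m + 1) ∂ν) / (m + 1) with hF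
  obtain ⟨u, hum, hub, hlim⟩ := exists_limit (ν := ν) (p := m + 1) (by linarith) hUm
    (b := fun _ => N) measurable_const (fun _ => hN.le)
    (fun n => Eventually.of_forall fun t => Eventually.of_forall (hUb n t).mem)
    (fun n => Eventually.of_forall fun t => (hUb n t).integrable_rpow (by linarith))
    (a := fun _ => 0) (c := fun n => (n : ℝ)) tendsto_const_nhds tendsto_natCast_atTop_atTop
    (C := ENNReal.ofReal (F / 8)) ENNReal.ofReal_ne_top (fun n => by
      refine (lintegral_mono_set Ioc_subset_Ioi_self).trans ?_
      have e : h (n + 1) = h n / 2 := by simp only [hh_def, pow_succ]; ring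
      have h1 := (hS n).step_compare (e ▸ hS (n + 1)) hf hm (hh n)
      rw [← e] at h1
      refine h1.trans (le_of_eq ?_)
      rw [show h n / 8 * F = F / 8 * (1 / 2) ^ n by simp only [hh_def]; ring,
        ENNReal.ofReal_mul' (by positivity), ENNReal.ofReal_pow (by norm_num),
        ENNReal.ofReal_div_of_pos (by norm_num)]
      simp)
  have hut : ∀ t, Measurable (u t) := fun t => hum.of_uncurry_left
  have hvm : ∀ n, Measurable (Function.uncurry fun t x => U n t x ^ m) := fun n =>
    (hUm n).pow_const m
  have hwm : Measurable (Function.uncurry fun t x => u t x ^ m) := hum.pow_const m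
  have hcont : ∀ p : ℝ, 0 ≤ p → Continuous fun a : ℝ => a ^ p := fun p hp =>
    Real.continuous_rpow_const hp
  have hlimθ : ∀ θ : ℝ → ℝ, Continuous θ → ∀ᵐ t ∂(volume.restrict (Ioi (0 : ℝ))), ∀ᵐ x ∂ν,
      Tendsto (fun n => θ (U n t x)) atTop (𝓝 (θ (u t x))) := fun θ hθ =>
    hlim.mono fun t ht => ht.tendsto.mono fun x hx => (hθ.tendsto _).comp hx
  have hlimm : ∀ᵐ t ∂(volume.restrict (Ioi (0 : ℝ))), ∀ᵐ x ∂ν,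
      Tendsto (fun n => U n t x ^ m) atTop (𝓝 (u t x ^ m)) :=
    hlimθ (fun a => a ^ m) (hcont m (by linarith))
  have htot : ∫⁻ t in Ioi 0, energy Γ (fun x => u t x ^ m) ≤ ENNReal.ofReal F := by
    refine (lintegral_energy_le_liminf hM hvm (I := Ioi 0) (J := fun _ => Ioi 0)
      (w := fun t x => u t x ^ m)
      hlimm (fun _ => measurableSet_Ioi)
      ?_).trans ?_
    · filter_upwards [ae_restrict_mem measurableSet_Ioi] with t ht
      exact Eventually.of_forall fun _ => ht
    · refine (liminf_le_liminf (Eventually.of_forall fun n =>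
        (hS n).step_energy_total hf hm (hh n))).trans (by simp [hF])
  have hfin : ∀ᵐ t ∂(volume.restrict (Ioi (0 : ℝ))), energy Γ (fun x => u t x ^ m) ≠ ⊤ :=
    (ae_lt_top (measurable_energy hwm) (ne_top_of_le_ne_top ENNReal.ofReal_ne_top htot)).mono
      fun t ht => ht.ne
  have hΦ : ∀ t, LimAt ν (m + 1) (fun n => U n t) (u t) →
      Tendsto (fun n => (∫ x, U n t x ^ (m + 1) ∂ν) / (m + 1)) atTop
        (𝓝 ((∫ x, u t x ^ (m + 1) ∂ν) / (m + 1))) := fun t ht =>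
    ((ht.tendsto_integral_comp (by linarith) (fun n => (hUb n t).meas)
      (hcont (m + 1) (by linarith)) zero_le_one
      (fun a => by rw [one_mul]; exact Real.abs_rpow_le_abs_rpow _ _)).2).div_const _
  have hlev : ∀ k, 0 < k → ∀ t, LimAt ν (m + 1) (fun n => U n t) (u t) →
      Tendsto (fun n => ∫ x, max (U n t x - k) 0 ^ 2 ∂ν) atTop
        (𝓝 (∫ x, max (u t x - k) 0 ^ 2 ∂ν)) := fun k hk t ht =>
    (ht.tendsto_integral_comp (θ := fun a => max (a - k) 0 ^ 2) (by linarith)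
      (fun n => (hUb n t).meas) (by fun_prop) (by positivity) (level_sq_le_rpow hm hk)).2
  have hJ : ∀ t₁ t₂ : ℝ, ∀ᵐ t ∂(volume.restrict (Ioc t₁ t₂)),
      ∀ᶠ n in atTop, t ∈ Ioc (t₁ + h n) t₂ := fun t₁ t₂ => by
    filter_upwards [ae_restrict_mem measurableSet_Ioc] with t ht
    have h1 : Tendsto (fun n => t₁ + h n) atTop (𝓝 (t₁ + 0)) := hh0.const_add t₁
    rw [add_zero] at h1
    exact (h1.eventually_lt_const ht.1).mono fun n hn => ⟨hn, ht.2⟩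
  have hmass : ∀ t, LimAt ν (m + 1) (fun n => U n t) (u t) →
      ∫⁻ x, ENNReal.ofReal (u t x) ∂ν ≤ ENNReal.ofReal (∫ x, f x ∂ν) := fun t ht => by
    calc ∫⁻ x, ENNReal.ofReal (u t x) ∂ν
        = ∫⁻ x, liminf (fun n => ENNReal.ofReal (U n t x)) atTop ∂ν :=
          lintegral_congr_ae (ht.tendsto.mono fun x hx =>
            (ENNReal.tendsto_ofReal hx).liminf_eq.symm)
      _ ≤ liminf (fun n => ∫⁻ x, ENNReal.ofReal (U n t x) ∂ν) atTop :=
          lintegral_liminf_le fun n => (hUb n t).meas.ennreal_ofReal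
      _ ≤ liminf (fun _ : ℕ => ENNReal.ofReal (∫ x, f x ∂ν)) atTop := by
          refine liminf_le_liminf (Eventually.of_forall fun n => ?_)
          rw [← ofReal_integral_eq_lintegral_ofReal (hUb n t).int
            (Eventually.of_forall fun x => ((hUb n t).mem x).1)]
          exact ENNReal.ofReal_le_ofReal ((hS n).mass _)
      _ = _ := by simp
  refine ⟨u, {t | 0 < t ∧ LimAt ν (m + 1) (fun n => U n t) (u t) ∧
    energy Γ (fun x => u t x ^ m) ≠ ⊤}, ?_⟩
  have hint : ∀ t, LimAt ν (m + 1) (fun n => U n t) (u t) → Integrable (u t) ν := fun t ht => by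
    refine ⟨(hut t).aestronglyMeasurable, ?_⟩
    rw [hasFiniteIntegral_iff_ofReal (Eventually.of_forall fun x => (hub t x).1)]
    exact (hmass t ht).trans_lt ENNReal.ofReal_lt_top
  refine ⟨hum, hub, fun t ht => ht.1, ?_, fun t ht => hint t ht.2.1, ?_, fun t ht => ht.2.2, htot,
    ?_, ?_, ?_⟩
  · filter_upwards [hlim, hfin, ae_restrict_mem measurableSet_Ioi] with t h1 h2 h3
    exact ⟨h3, h1, h2⟩
  · intro t ht
    have h1 := hmass t ht.2.1
    rw [← ofReal_integral_eq_lintegral_ofReal (hint t ht.2.1)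
      (Eventually.of_forall fun x => (hub t x).1)] at h1
    exact (ENNReal.ofReal_le_ofReal_iff
      (integral_nonneg fun x => (hf.mem x).1)).1 h1
  · intro t₁ ht₁ t₂ ht₂ h12
    have := ofReal_add_mul_le_of_liminf (hΦ t₂ ht₂.2.1) (hΦ t₁ ht₁.2.1) ENNReal.one_ne_top
      (lintegral_energy_le_liminf hM hvm (I := Ioc t₁ t₂) (J := fun n => Ioc (t₁ + h n) t₂)
        (w := fun t x => u t x ^ m)
        (ae_restrict_of_ae_restrict_of_subset (Ioc_subset_Ioi_self.trans (Ioi_subset_Ioi ht₁.1.le))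
          hlimm) (fun _ => measurableSet_Ioc) (hJ t₁ t₂))
      (Eventually.of_forall fun n => by
        rw [one_mul]; exact (hS n).step_energy_le hf hm (hh n) ht₁.1.le h12.le)
    rwa [one_mul] at this
  · intro k hk t₁ ht₁ t₂ ht₂ h12
    have hθ : Continuous fun a : ℝ => max (a - k) 0 := by fun_prop
    exact ofReal_add_mul_le_of_liminf (hlev k hk t₂ ht₂.2.1) (hlev k hk t₁ ht₁.2.1)
      ENNReal.ofReal_ne_top
      (lintegral_energy_le_liminf hM (v := fun n t x => max (U n t x - k) 0)
        (fun n => hθ.measurable.comp (hUm n)) (I := Ioc t₁ t₂) (J := fun n => Ioc (t₁ + h n) t₂)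
        (w := fun t x => max (u t x - k) 0)
        (ae_restrict_of_ae_restrict_of_subset (Ioc_subset_Ioi_self.trans (Ioi_subset_Ioi ht₁.1.le))
          (hlimθ (fun a => max (a - k) 0) hθ)) (fun _ => measurableSet_Ioc) (hJ t₁ t₂))
      (Eventually.of_forall fun n => (hS n).step_level_le hf hm (hh n) hk ht₁.1.le h12.le)
  · intro t ht w hw
    have hT : ∀ n, t ≤ ⌈t / h n⌉₊ * h n ∧ (⌈t / h n⌉₊ : ℝ) * h n ≤ t + h n := fun n => by
      constructor
      · rw [← div_le_iff₀ (hh n)]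
        exact Nat.le_ceil _
      · have := (Nat.ceil_lt_add_one (div_nonneg ht.1.le (hh n).le)).le
        calc (⌈t / h n⌉₊ : ℝ) * h n ≤ (t / h n + 1) * h n := by
              have := (hh n).le
              gcongr
          _ = t + h n := by have := (hh n).ne'; field_simp
    have h1 := tendsto_integral_eform hM hvm hwm (I := Ioc 0 (t + 1)) (by simp)
      (J' := Ioc 0 t) (J := fun n => Ioc 0 (⌈t / h n⌉₊ * h n)) measurableSet_Ioc
      (fun _ => measurableSet_Ioc) (Ioc_subset_Ioc_right (by linarith))
      (fun n => Ioc_subset_Ioc_right (by linarith [(hT n).2, hh1 n]))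
      (ae_restrict_of_ae_restrict_of_subset Ioc_subset_Ioi_self
        hlimm) (by
        have hne : ∀ᵐ r : ℝ ∂(volume.restrict (Ioc 0 (t + 1))), r ≠ t :=
          ae_restrict_of_ae (by simp [ae_iff])
        filter_upwards [hne] with r hr
        rcases lt_or_gt_of_ne hr with hlt | hgt
        · refine Eventually.of_forall fun n => ?_
          simp only [mem_Ioc]
          exact and_congr_right fun _ => ⟨fun _ => hlt.le, fun _ => hlt.le.trans (hT n).1⟩
        · have h2 : Tendsto (fun n => t + h n) atTop (𝓝 (t + 0)) := hh0.const_add t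
          rw [add_zero] at h2
          filter_upwards [h2.eventually_lt_const hgt] with n hn
          simp only [mem_Ioc]
          exact and_congr_right fun _ =>
            ⟨fun h3 => by linarith [(hT n).2], fun h3 => by linarith⟩)
      (K := ENNReal.ofReal F) ENNReal.ofReal_ne_top
      (fun n => (lintegral_mono_set Ioc_subset_Ioi_self).trans
        ((hS n).step_energy_total hf hm (hh n))) hw.meas hw.fin
    have hpq := holderConjugate_conjExp hm
    have hif : Integrable (fun x => f x * w x) ν :=
      integrable_mul_of_rpow hpq hf.meas hw.meas (hf.integrable_rpow (by linarith)) hw.intq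
    have hiu : ∀ n, Integrable (fun x => U n t x * w x) ν := fun n =>
      integrable_mul_of_rpow hpq (hUb n t).meas hw.meas ((hUb n t).integrable_rpow (by linarith))
        hw.intq
    have hbt : BddDensity ν N (u t) := ⟨hut t, hub t, hint t ht.2.1⟩
    have hiut : Integrable (fun x => u t x * w x) ν :=
      integrable_mul_of_rpow hpq hbt.meas hw.meas (hbt.integrable_rpow (by linarith)) hw.intq
    have h2 : Tendsto (fun n => ∫ x, (U n t x - f x) * w x ∂ν) atTop
        (𝓝 (∫ x, (u t x - f x) * w x ∂ν)) := by
      simp_rw [sub_mul]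
      rw [integral_sub hiut hif]
      simp_rw [integral_sub (hiu _) hif]
      exact (ht.2.1.tendsto_integral_mul hpq (fun n => (hUb n t).meas) hw.meas hw.intq).sub_const _
    refine tendsto_nhds_unique (h2.add h1) ?_
    refine tendsto_const_nhds.congr fun n => ?_
    exact ((hS n).step_eq hf hm (hh n) t hw).symm

end BoundedSolutions

section Smoothing

variable {X : Type*} [MeasurableSpace X] {ν : Measure X} {Γ : Measure (X × X)}

/-- A Faber–Krahn type inequality for the form. -/
def FaberKrahn (ν : Measure X) (Γ : Measure (X × X)) (S σ : ℝ) : Prop :=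
  ∀ (w : X → ℝ) (B : ℝ), Measurable w → (∀ x, |w x| ≤ B) → Integrable w ν → energy Γ w ≠ ⊤ →
    ∫⁻ x, ENNReal.ofReal (w x ^ 2) ∂ν ≤ ENNReal.ofReal S * energy Γ w * ν {x | w x ≠ 0} ^ σ

lemma deGiorgi_decay {σ A b : ℝ} (hσ : 0 < σ) (hb : 0 < b) {y : ℕ → ℝ}
    (hy : ∀ j, 0 ≤ y j) (h : ∀ j, y (j + 1) ≤ A * b ^ j * y j ^ (1 + σ)) (hA0 : 0 ≤ A)
    (hA : A * y 0 ^ σ ≤ b ^ (-(1 / σ))) (j : ℕ) : y j ≤ y 0 * (b ^ (-(1 / σ))) ^ j := by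
  set q := b ^ (-(1 / σ)) with hq
  have hq0 : 0 < q := by positivity
  have hqb : b * q ^ σ = 1 := by
    rw [hq, ← Real.rpow_mul hb.le, neg_mul, one_div_mul_cancel hσ.ne', Real.rpow_neg hb.le,
      Real.rpow_one, mul_inv_cancel₀ hb.ne']
  induction j with
  | zero => simp
  | succ j ih =>
    have hy0 := hy 0
    calc y (j + 1) ≤ A * b ^ j * y j ^ (1 + σ) := h j
      _ ≤ A * b ^ j * (y 0 * q ^ j) ^ (1 + σ) := by
        have := hy j
        gcongr
      _ = (A * y 0 ^ σ) * (b * q ^ σ) ^ j * (y 0 * q ^ j) := by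
        rw [Real.rpow_add_of_nonneg (by positivity) zero_le_one hσ.le, Real.rpow_one,
          Real.mul_rpow hy0 (by positivity), mul_pow, ← Real.rpow_natCast q j,
          ← Real.rpow_natCast (q ^ σ) j, ← Real.rpow_mul hq0.le, ← Real.rpow_mul hq0.le,
          mul_comm σ (j : ℝ)]
        ring
      _ ≤ q * 1 ^ j * (y 0 * q ^ j) := by rw [hqb]; gcongr
      _ = y 0 * q ^ (j + 1) := by rw [one_pow, pow_succ]; ring

namespace BddSol

variable {m N : ℝ} {f : X → ℝ} {u : ℝ → X → ℝ} {G : Set ℝ}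

lemma bdd (hu : BddSol ν Γ m N f u G) {t : ℝ} (ht : t ∈ G) : BddDensity ν N (u t) :=
  ⟨hu.meas.of_uncurry_left, hu.mem t, hu.int t ht⟩

lemma level_antitone (hu : BddSol ν Γ m N f u G) {k : ℝ} (hk : 0 < k) {t₁ t₂ : ℝ} (h₁ : t₁ ∈ G)
    (h₂ : t₂ ∈ G) (h12 : t₁ < t₂) :
    ∫ x, max (u t₂ x - k) 0 ^ 2 ∂ν ≤ ∫ x, max (u t₁ x - k) 0 ^ 2 ∂ν := by
  have := le_self_add.trans (hu.level_le k hk t₁ h₁ t₂ h₂ h12)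
  exact (ENNReal.ofReal_le_ofReal_iff (integral_nonneg fun x => sq_nonneg _)).1 this

lemma level_mono (hu : BddSol ν Γ m N f u G) {k l : ℝ} (hk : 0 ≤ k) (hkl : k ≤ l) {t : ℝ}
    (ht : t ∈ G) : ∫ x, max (u t x - l) 0 ^ 2 ∂ν ≤ ∫ x, max (u t x - k) 0 ^ 2 ∂ν := by
  refine integral_mono ((hu.bdd ht).integrable_level (hk.trans hkl))
    ((hu.bdd ht).integrable_level hk) fun x => ?_
  exact pow_le_pow_left₀ (le_max_right _ _) (max_le_max (by linarith) le_rfl) 2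

lemma level_recurrence (hu : BddSol ν Γ m N f u G) (hm : 1 < m) {S σ : ℝ} (hσ : 0 < σ)
    (hS : 0 ≤ S) (hFK : FaberKrahn ν Γ S σ) {k l : ℝ} (hk : 0 < k) (hkl : k < l) {t₁ t₂ : ℝ}
    (h₁ : t₁ ∈ G) (h₂ : t₂ ∈ G) (h12 : t₁ < t₂) :
    2 * l ^ (m - 1) * (t₂ - t₁) * ∫ x, max (u t₂ x - l) 0 ^ 2 ∂ν ≤
      S * ((∫ x, max (u t₁ x - k) 0 ^ 2 ∂ν) / (l - k) ^ 2) ^ σ *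
        ∫ x, max (u t₁ x - k) 0 ^ 2 ∂ν := by
  have hl : 0 < l := hk.trans hkl
  set Y := ∫ x, max (u t₁ x - k) 0 ^ 2 ∂ν with hY
  have hY0 : 0 ≤ Y := integral_nonneg fun x => sq_nonneg _
  set c := ENNReal.ofReal ((Y / (l - k) ^ 2) ^ σ) with hc
  have hlk : 0 < (l - k) ^ 2 := by have := sub_pos.2 hkl; positivity
  have h1 : ∀ᵐ r ∂(volume.restrict (Ioc t₁ t₂)), ENNReal.ofReal (∫ x, max (u t₂ x - l) 0 ^ 2 ∂ν) ≤
      ENNReal.ofReal S * c * energy Γ (fun x => max (u r x - l) 0) := by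
    have hne : ∀ᵐ r : ℝ ∂(volume.restrict (Ioc t₁ t₂)), r ≠ t₂ :=
      ae_restrict_of_ae (by simp [ae_iff])
    filter_upwards [ae_restrict_mem measurableSet_Ioc, hne, ae_restrict_of_ae_restrict_of_subset
      (Ioc_subset_Ioi_self.trans (Ioi_subset_Ioi (hu.pos h₁).le)) hu.ae_mem] with r hr hr2 hrG
    have hb := hu.bdd hrG
    refine (ENNReal.ofReal_le_ofReal
      (hu.level_antitone hl hrG h₂ (lt_of_le_of_ne hr.2 hr2))).trans ?_
    rw [ofReal_integral_eq_lintegral_ofReal (hb.integrable_level hl.le)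
      (Eventually.of_forall fun x => sq_nonneg _)]
    have hft := hb.formTest_level hm hl (hu.fin r hrG)
    have hint : Integrable (fun x => max (u r x - l) 0) ν := by
      refine hb.int.mono' hft.meas.aestronglyMeasurable (Eventually.of_forall fun x => ?_)
      rw [Real.norm_of_nonneg (le_max_right _ _)]
      exact max_le (by linarith) (hb.mem x).1
    have hfk := hFK (fun x => max (u r x - l) 0) N hft.meas (fun x => by
      rw [abs_of_nonneg (le_max_right _ _)]
      exact max_le (by linarith [(hb.mem x).2]) ((hb.mem x).1.trans (hb.mem x).2)) hint hft.fin
    refine hfk.trans ?_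
    rw [mul_right_comm]
    gcongr
    rw [hc, ← ENNReal.ofReal_rpow_of_nonneg (by positivity) hσ.le]
    gcongr
    have hcheb := mul_meas_ge_le_lintegral (μ := ν)
      (f := fun x => ENNReal.ofReal (max (u r x - k) 0 ^ 2))
      (((hb.meas.sub_const k).max measurable_const).pow_const 2).ennreal_ofReal
      (ENNReal.ofReal ((l - k) ^ 2))
    rw [ENNReal.ofReal_div_of_pos hlk, ENNReal.le_div_iff_mul_le (Or.inl (by simpa using hlk.ne'))
      (Or.inl ENNReal.ofReal_ne_top), mul_comm]
    refine le_trans (mul_le_mul_right (measure_mono fun x hx => ?_) _) (hcheb.trans ?_)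
    · simp only [mem_ofPred_eq] at hx ⊢
      have hx' : l < u r x := by
        by_contra hcon
        exact hx (max_eq_right (by linarith))
      refine ENNReal.ofReal_le_ofReal (pow_le_pow_left₀ (by linarith) ?_ 2)
      exact le_max_of_le_left (by linarith)
    · rw [← ofReal_integral_eq_lintegral_ofReal (hb.integrable_level hk.le)
        (Eventually.of_forall fun x => sq_nonneg _)]
      exact ENNReal.ofReal_le_ofReal (hu.level_antitone hk h₁ hrG hr.1)
  have h2 := lintegral_mono_ae h1
  rw [setLIntegral_const, Real.volume_Ioc,
    lintegral_const_mul' _ _ (ENNReal.mul_ne_top ENNReal.ofReal_ne_top ENNReal.ofReal_ne_top)] at h2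
  have h3 := le_add_self.trans (hu.level_le l hl t₁ h₁ t₂ h₂ h12)
  have h4 : ENNReal.ofReal (2 * l ^ (m - 1)) * (ENNReal.ofReal (∫ x, max (u t₂ x - l) 0 ^ 2 ∂ν) *
      ENNReal.ofReal (t₂ - t₁)) ≤ ENNReal.ofReal S * c * ENNReal.ofReal Y := by
    calc _ ≤ ENNReal.ofReal (2 * l ^ (m - 1)) * (ENNReal.ofReal S * c *
          ∫⁻ r in Ioc t₁ t₂, energy Γ (fun x => max (u r x - l) 0)) := by gcongr
      _ = ENNReal.ofReal S * c * (ENNReal.ofReal (2 * l ^ (m - 1)) *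
          ∫⁻ r in Ioc t₁ t₂, energy Γ (fun x => max (u r x - l) 0)) := by ring
      _ ≤ ENNReal.ofReal S * c * ENNReal.ofReal Y := by
        gcongr
        exact h3.trans (ENNReal.ofReal_le_ofReal (hu.level_mono hk.le hkl.le h₁))
  have hZ0 : 0 ≤ ∫ x, max (u t₂ x - l) 0 ^ 2 ∂ν := integral_nonneg fun x => sq_nonneg _
  rw [hc, ← ENNReal.ofReal_mul hZ0, ← ENNReal.ofReal_mul (by positivity), ← ENNReal.ofReal_mul hS,
    ← ENNReal.ofReal_mul (by positivity), ENNReal.ofReal_le_ofReal_iff (by positivity)] at h4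
  linarith

end BddSol

end Smoothing

section SmoothingStep

variable {X : Type*} [MeasurableSpace X] {ν : Measure X} {Γ : Measure (X × X)}

lemma exists_mem_Ioo_of_ae {G : Set ℝ} (hG : ∀ᵐ t ∂(volume.restrict (Ioi (0 : ℝ))), t ∈ G)
    {a b : ℝ} (ha : 0 ≤ a) (hab : a < b) : ∃ t ∈ G, a < t ∧ t < b := by
  have h : ∀ᵐ t ∂(volume.restrict (Ioo a b)), t ∈ G :=
    ae_restrict_of_ae_restrict_of_subset (Ioo_subset_Ioi_self.trans (Ioi_subset_Ioi ha)) hG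
  have hne : (volume.restrict (Ioo a b)) ≠ 0 := by
    rw [Ne, Measure.restrict_eq_zero, Real.volume_Ioo]
    simpa using hab
  have : NeBot (ae (volume.restrict (Ioo a b))) := ae_neBot.2 hne
  obtain ⟨t, h1, h2⟩ := (h.and (ae_restrict_mem measurableSet_Ioo)).exists
  exact ⟨t, h1, h2.1, h2.2⟩

/-- The constant in the De Giorgi iteration. -/
def giorgiConst (m S σ : ℝ) : ℝ := S * 2 ^ m * 16 ^ σ * (2 * 4 ^ σ) ^ (1 / σ)

lemma giorgiConst_pos {m S σ : ℝ} (hS : 0 < S) : 0 < giorgiConst m S σ := by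
  unfold giorgiConst; positivity

namespace BddSol

variable {m N : ℝ} {f : X → ℝ} {u : ℝ → X → ℝ} {G : Set ℝ}

lemma ae_le_of_giorgi (hu : BddSol ν Γ m N f u G) (hm : 1 < m) {S σ : ℝ} (hσ : 0 < σ)
    (hS : 0 ≤ S) (hFK : FaberKrahn ν Γ S σ) {t τ B l : ℝ} (ht : t ∈ G) (hτ : 0 < τ) (hτt : τ ≤ t)
    (hB : 0 ≤ B) (hl : 0 < l) (hub : ∀ r ∈ G, r < t → t - τ < r → ∀ᵐ x ∂ν, u r x ≤ B)
    (hle : giorgiConst m S σ * (B * ∫ x, f x ∂ν) ^ σ ≤ τ * l ^ (m - 1 + 2 * σ)) :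
    ∀ᵐ x ∂ν, u t x ≤ l := by
  have hpick : ∀ j : ℕ, ∃ r ∈ G, t - τ * (1 / 2) ^ j < r ∧ r < t - 3 / 4 * (τ * (1 / 2) ^ j) := by
    intro j
    have h1 : (1 / 2 : ℝ) ^ j ≤ 1 := pow_le_one₀ (by norm_num) (by norm_num)
    have h2 : 0 < τ * (1 / 2 : ℝ) ^ j := by positivity
    refine exists_mem_Ioo_of_ae hu.ae_mem ?_ (by linarith)
    nlinarith
  choose r hrG hr1 hr2 using hpick
  have hrt : ∀ j, r j < t := fun j => by
    have h2 : 0 < τ * (1 / 2 : ℝ) ^ j := by positivity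
    linarith [hr2 j]
  have hgap : ∀ j, τ * (1 / 2) ^ j / 4 ≤ r (j + 1) - r j := fun j => by
    have h1 := hr1 (j + 1)
    have h2 := hr2 j
    rw [pow_succ] at h1
    linarith
  have hgap0 : ∀ j, r j < r (j + 1) := fun j => by
    have h2 : 0 < τ * (1 / 2 : ℝ) ^ j / 4 := by positivity
    linarith [hgap j]
  set k : ℕ → ℝ := fun j => l * (1 - (1 / 2) ^ (j + 1)) with hk
  have hpow : ∀ j : ℕ, (1 / 2 : ℝ) ^ (j + 1) ≤ 1 / 2 := fun j => by
    have : (1 / 2 : ℝ) ^ j ≤ 1 := pow_le_one₀ (by norm_num) (by norm_num)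
    rw [pow_succ]; linarith
  have hkl2 : ∀ j, l / 2 ≤ k j := fun j => by
    simp only [hk]; nlinarith [hpow j]
  have hk0 : ∀ j, 0 < k j := fun j => by linarith [hkl2 j]
  have hkle : ∀ j, k j ≤ l := fun j => by
    have : (0 : ℝ) < (1 / 2) ^ (j + 1) := by positivity
    simp only [hk]; nlinarith
  have hkdiff : ∀ j, k (j + 1) - k j = l * (1 / 2) ^ (j + 2) := fun j => by
    simp only [hk]; ring
  have hkk : ∀ j, k j < k (j + 1) := fun j => by
    have : 0 < l * (1 / 2 : ℝ) ^ (j + 2) := by positivity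
    linarith [hkdiff j]
  set y : ℕ → ℝ := fun j => ∫ x, max (u (r j) x - k j) 0 ^ 2 ∂ν with hy
  have hy0 : ∀ j, 0 ≤ y j := fun j => integral_nonneg fun x => sq_nonneg _
  set A := S * 2 ^ m * 16 ^ σ / (τ * l ^ (m - 1 + 2 * σ)) with hA
  set b : ℝ := 2 * 4 ^ σ with hb
  have hb1 : 1 < b := by
    have : (1 : ℝ) ≤ 4 ^ σ := Real.one_le_rpow (by norm_num) hσ.le
    rw [hb]; linarith
  have hrec : ∀ j, y (j + 1) ≤ A * b ^ j * y j ^ (1 + σ) := by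
    intro j
    have h1 := hu.level_recurrence hm hσ hS hFK (hk0 j) (hkk j) (hrG j) (hrG (j + 1)) (hgap0 j)
    change 2 * k (j + 1) ^ (m - 1) * (r (j + 1) - r j) * y (j + 1) ≤
      S * (y j / (k (j + 1) - k j) ^ 2) ^ σ * y j at h1
    have h2 : 2 * (l / 2) ^ (m - 1) * (τ * (1 / 2) ^ j / 4) * y (j + 1) ≤
        S * (y j / (k (j + 1) - k j) ^ 2) ^ σ * y j := by
      refine le_trans ?_ h1
      have := hy0 (j + 1)
      have := hgap j
      have := hkl2 (j + 1)
      have : 0 ≤ m - 1 := by linarith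
      have := (hk0 (j + 1)).le
      gcongr
    have h3 : (y j / (k (j + 1) - k j) ^ 2) ^ σ =
        y j ^ σ * (16 ^ σ * (4 ^ σ) ^ j / l ^ (2 * σ)) := by
      have e1 : y j / (k (j + 1) - k j) ^ 2 = y j * (16 * 4 ^ j / l ^ 2) := by
        rw [hkdiff, mul_pow, ← pow_mul, mul_comm (j + 2) 2, pow_mul, pow_add]
        have : ((1 / 2 : ℝ) ^ 2) ^ j = (4 ^ j)⁻¹ := by rw [← inv_pow]; norm_num
        rw [this]
        field_simp
        norm_num
      rw [e1, Real.mul_rpow (hy0 j) (by positivity), Real.div_rpow (by positivity) (by positivity),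
        Real.mul_rpow (by norm_num) (by positivity), ← Real.rpow_natCast 4 j,
        ← Real.rpow_natCast (4 ^ σ) j, ← Real.rpow_mul (by norm_num), ← Real.rpow_mul (by norm_num),
        ← Real.rpow_natCast l 2, ← Real.rpow_mul hl.le, mul_comm (j : ℝ)]
      norm_num
    have h4 : 2 * (l / 2) ^ (m - 1) * (τ * (1 / 2) ^ j / 4) = τ * l ^ (m - 1) / (2 ^ m * 2 ^ j) := by
      rw [Real.div_rpow hl.le (by norm_num), Real.rpow_sub_one (by norm_num : (2 : ℝ) ≠ 0), one_div,
        inv_pow]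
      field_simp
      norm_num
    rw [h3, h4] at h2
    rw [Real.rpow_add_of_nonneg (hy0 j) zero_le_one hσ.le, Real.rpow_one, hA, hb, mul_pow,
      Real.rpow_add hl]
    have hc : 0 < τ * l ^ (m - 1) / (2 ^ m * 2 ^ j) := by positivity
    rw [← mul_le_mul_iff_right₀ hc]
    refine h2.trans (le_of_eq ?_)
    field_simp
  have hbase : A * y 0 ^ σ ≤ b ^ (-(1 / σ)) := by
    have h1 : y 0 ≤ B * ∫ x, f x ∂ν := by
      have hint := (hu.bdd (hrG 0)).int
      calc y 0 ≤ ∫ x, B * u (r 0) x ∂ν := by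
            refine integral_mono_ae ((hu.bdd (hrG 0)).integrable_level (hk0 0).le)
              (hint.const_mul B) ?_
            filter_upwards [hub (r 0) (hrG 0) (hrt 0) (by simpa using hr1 0)] with x hx
            have h0 := (hu.mem (r 0) x).1
            have : max (u (r 0) x - k 0) 0 ≤ u (r 0) x := max_le (by linarith [hk0 0]) h0
            calc max (u (r 0) x - k 0) 0 ^ 2 ≤ u (r 0) x ^ 2 :=
                  pow_le_pow_left₀ (le_max_right _ _) this 2
              _ ≤ B * u (r 0) x := by nlinarith
        _ = B * ∫ x, u (r 0) x ∂ν := integral_const_mul _ _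
        _ ≤ _ := mul_le_mul_of_nonneg_left (hu.mass _ (hrG 0)) hB
    have hBM : 0 ≤ B * ∫ x, f x ∂ν := (hy0 0).trans h1
    rw [Real.rpow_neg (by positivity), hA, div_mul_eq_mul_div, div_le_iff₀ (by positivity),
      ← div_eq_inv_mul, le_div_iff₀ (by positivity)]
    refine le_trans ?_ hle
    have := hy0 0
    unfold giorgiConst
    calc S * 2 ^ m * 16 ^ σ * y 0 ^ σ * b ^ (1 / σ) = S * 2 ^ m * 16 ^ σ * b ^ (1 / σ) * y 0 ^ σ := by
          ring
      _ ≤ _ := by gcongr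
  have hdec := deGiorgi_decay hσ (by linarith) hy0 hrec (by positivity) hbase
  have hlim : Tendsto (fun j => y 0 * (b ^ (-(1 / σ))) ^ j) atTop (𝓝 0) := by
    have := (tendsto_pow_atTop_nhds_zero_of_lt_one (r := b ^ (-(1 / σ))) (by positivity)
      (Real.rpow_lt_one_of_one_lt_of_neg hb1 (by rw [neg_lt_zero]; positivity))).const_mul (y 0)
    simpa using this
  have hfin : ∫ x, max (u t x - l) 0 ^ 2 ∂ν ≤ 0 := by
    refine ge_of_tendsto' hlim fun j => le_trans ?_ (hdec j)
    exact (hu.level_antitone hl (hrG j) ht (hrt j)).trans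
      (hu.level_mono (hk0 j).le (hkle j) (hrG j))
  have hz := (integral_eq_zero_iff_of_nonneg (fun x => sq_nonneg _)
    ((hu.bdd ht).integrable_level hl.le)).1 (le_antisymm hfin (integral_nonneg fun x => sq_nonneg _))
  filter_upwards [hz] with x hx
  have : max (u t x - l) 0 = 0 := by simpa using hx
  linarith [max_eq_right_iff.1 this]

lemma smoothing_step (hu : BddSol ν Γ m N f u G) (hm : 1 < m) {S σ α : ℝ} (hσ : 0 < σ)
    (hS : 0 ≤ S) (hFK : FaberKrahn ν Γ S σ) (hα : α = 1 / (m - 1 + σ)) {T B B' : ℝ} (hB : 0 < B)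
    (hB' : 0 < B') (hM : 0 ≤ ∫ x, f x ∂ν)
    (h : ∀ r ∈ G, r ≤ T → ∀ᵐ x ∂ν, u r x ≤ B * r ^ (-α))
    (hle : 2 * giorgiConst m S σ * 2 ^ (α * σ) * (∫ x, f x ∂ν) ^ σ * B ^ σ ≤
      B' ^ (m - 1 + 2 * σ)) :
    ∀ r ∈ G, r ≤ T → ∀ᵐ x ∂ν, u r x ≤ B' * r ^ (-α) := by
  intro t ht htT
  have ht0 : 0 < t := hu.pos ht
  have hmσ : 0 < m - 1 + σ := by linarith
  have hα0 : 0 < α := by rw [hα]; positivity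
  refine hu.ae_le_of_giorgi hm hσ hS hFK ht (half_pos ht0) (half_le_self ht0.le)
    (B := B * (t / 2) ^ (-α)) (by positivity) (by positivity) (fun r hr hrt htr => ?_) ?_
  · filter_upwards [h r hr (hrt.le.trans htT)] with x hx
    refine hx.trans ?_
    gcongr B * ?_
    exact Real.rpow_le_rpow_of_nonpos (by positivity) (by linarith) (by linarith)
  · set M := ∫ x, f x ∂ν
    have e1 : (B * (t / 2) ^ (-α) * M) ^ σ = B ^ σ * (t ^ (-(α * σ)) * 2 ^ (α * σ)) * M ^ σ := by
      rw [Real.mul_rpow (by positivity) hM, Real.mul_rpow hB.le (by positivity),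
        ← Real.rpow_mul (by positivity), Real.div_rpow ht0.le (by norm_num), neg_mul,
        Real.rpow_neg (by norm_num : (0 : ℝ) ≤ 2), div_inv_eq_mul]
    have e2 : t * (B' * t ^ (-α)) ^ (m - 1 + 2 * σ) = B' ^ (m - 1 + 2 * σ) * t ^ (-(α * σ)) := by
      rw [Real.mul_rpow hB'.le (by positivity), ← Real.rpow_mul ht0.le, mul_left_comm]
      congr 1
      nth_rw 1 [← Real.rpow_one t]
      rw [← Real.rpow_add ht0]
      congr 1
      rw [hα]; field_simp; ring
    rw [e1, div_mul_eq_mul_div, e2, le_div_iff₀ two_pos]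
    calc _ = (2 * giorgiConst m S σ * 2 ^ (α * σ) * M ^ σ * B ^ σ) * t ^ (-(α * σ)) := by ring
      _ ≤ _ := by gcongr

end BddSol

/-- The constant in the smoothing estimate. -/
def smoothConst (m S σ : ℝ) : ℝ :=
  2 * (2 * giorgiConst m S σ * 2 ^ (1 / (m - 1 + σ) * σ)) ^ (1 / (m - 1 + σ))

lemma smoothConst_pos {m S σ : ℝ} (hS : 0 < S) : 0 < smoothConst m S σ := by
  have := giorgiConst_pos (m := m) (σ := σ) hS
  unfold smoothConst; positivity

/-- The smoothing effect for bounded solutions. -/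
lemma BddSol.smoothing {m N : ℝ} {f : X → ℝ} {u : ℝ → X → ℝ} {G : Set ℝ}
    (hu : BddSol ν Γ m N f u G) (hm : 1 < m) {S σ : ℝ} (hσ : 0 < σ)
    (hS : 0 < S) (hFK : FaberKrahn ν Γ S σ) {T : ℝ} (hT : T ∈ G) :
    ∀ᵐ x ∂ν, u T x ≤ smoothConst m S σ * T ^ (-(1 / (m - 1 + σ))) *
      (∫ x, f x ∂ν) ^ (σ / (m - 1 + σ)) := by
  have hT0 : 0 < T := hu.pos hT
  have hmσ : 0 < m - 1 + σ := by linarith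
  have h0M : 0 ≤ ∫ x, u T x ∂ν := integral_nonneg fun x => (hu.mem T x).1
  have hM0 := h0M.trans (hu.mass T hT)
  rcases hM0.eq_or_lt with hM | hM
  · have hz := (integral_eq_zero_iff_of_nonneg (fun x => (hu.mem T x).1) (hu.int T hT)).1
      (le_antisymm ((hu.mass T hT).trans hM.symm.le) h0M)
    filter_upwards [hz] with x hx
    rw [← hM, Real.zero_rpow (by positivity), mul_zero, hx, Pi.zero_apply]
  set M := ∫ x, f x ∂ν with hMdef
  set α := 1 / (m - 1 + σ) with hα
  have hα0 : 0 < α := by positivity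
  have hC := giorgiConst_pos (m := m) (σ := σ) hS
  set D := 2 * giorgiConst m S σ * 2 ^ (α * σ) * M ^ σ with hD
  have hD0 : 0 < D := by positivity
  set L := D ^ α with hL
  have hL0 : 0 < L := by positivity
  set θ := σ / (m - 1 + 2 * σ) with hθ
  have hθ0 : 0 < θ := by positivity
  have hθ1 : θ < 1 := by rw [hθ, div_lt_one (by linarith)]; linarith
  have hLD : L ^ (m - 1 + σ) = D := by
    rw [hL, hα, ← Real.rpow_mul hD0.le, one_div_mul_cancel hmσ.ne', Real.rpow_one]
  have hstep : ∀ x : ℝ, 0 < x → (∀ r ∈ G, r ≤ T → ∀ᵐ y ∂ν, u r y ≤ L * x * r ^ (-α)) →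
      ∀ r ∈ G, r ≤ T → ∀ᵐ y ∂ν, u r y ≤ L * x ^ θ * r ^ (-α) := by
    intro x hx h
    refine hu.smoothing_step hm hσ hS.le hFK hα (by positivity) (by positivity) hM.le h ?_
    rw [← hMdef, ← hD, Real.mul_rpow hL0.le hx.le, Real.mul_rpow hL0.le (by positivity),
      ← Real.rpow_mul hx.le, hθ, div_mul_cancel₀ _ (by positivity), ← mul_assoc]
    nth_rw 1 [← hLD]
    rw [← Real.rpow_add hL0]
    ring_nf
    exact le_rfl
  have hN0 : 0 ≤ N := by
    by_contra hcon
    have hne : ν ≠ 0 := by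
      rintro rfl
      simp [hMdef] at hM
    obtain ⟨x⟩ : Nonempty X := by
      by_contra hX
      rw [not_nonempty_iff] at hX
      exact hne (Measure.eq_zero_of_isEmpty ν)
    exact hcon ((hu.mem T x).1.trans (hu.mem T x).2)
  set x₀ := max 1 (N * T ^ α / L) with hx₀
  have hx₀1 : 1 ≤ x₀ := le_max_left _ _
  have hx₀0 : 0 < x₀ := by linarith
  have hiter : ∀ n : ℕ, ∀ r ∈ G, r ≤ T → ∀ᵐ y ∂ν, u r y ≤ L * x₀ ^ (θ ^ n) * r ^ (-α) := by
    intro n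
    induction n with
    | zero =>
      intro r hr hrT
      have hr0 : 0 < r := hu.pos hr
      refine Eventually.of_forall fun y => (hu.mem r y).2.trans ?_
      have h1 : N * T ^ α ≤ L * x₀ := by
        rw [← div_le_iff₀' hL0]; exact le_max_right _ _
      have h2 : N ≤ L * x₀ * T ^ (-α) := by
        rw [Real.rpow_neg hT0.le, ← div_eq_mul_inv, le_div_iff₀ (by positivity)]; exact h1
      rw [pow_zero, Real.rpow_one]
      refine h2.trans ?_
      gcongr L * x₀ * ?_
      exact Real.rpow_le_rpow_of_nonpos hr0 hrT (by linarith)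
    | succ n ih =>
      have := hstep (x₀ ^ (θ ^ n)) (by positivity) ih
      rwa [← Real.rpow_mul hx₀0.le, ← pow_succ] at this
  have hlim : Tendsto (fun n : ℕ => x₀ ^ (θ ^ n)) atTop (𝓝 (x₀ ^ (0 : ℝ))) :=
    (Real.continuous_const_rpow hx₀0.ne').continuousAt.tendsto.comp
      (tendsto_pow_atTop_nhds_zero_of_lt_one hθ0.le hθ1)
  rw [Real.rpow_zero] at hlim
  obtain ⟨n, hn⟩ := (hlim.eventually (gt_mem_nhds one_lt_two)).exists
  filter_upwards [hiter n T hT le_rfl] with y hy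
  refine hy.trans ?_
  have hfin : smoothConst m S σ * T ^ (-α) * M ^ (σ / (m - 1 + σ)) = L * 2 * T ^ (-α) := by
    have e : σ / (m - 1 + σ) = σ * α := by rw [hα, mul_one_div]
    have e2 : smoothConst m S σ = 2 * (2 * giorgiConst m S σ * 2 ^ (α * σ)) ^ α := rfl
    rw [hL, hD, e2, Real.mul_rpow (x := 2 * giorgiConst m S σ * 2 ^ (α * σ)) (by positivity)
      (by positivity), ← Real.rpow_mul hM.le, e]
    ring
  rw [hfin]
  gcongr

end SmoothingStep

section Oleinik

lemma memLp_gram {Y : Type*} [MeasurableSpace Y] {Λ : Measure Y} [SFinite Λ]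
    {η : Measure ℝ} [IsFiniteMeasure η] {H : ℝ × Y → ℝ} (hH : Measurable H)
    (hH2 : MemLp H 2 (η.prod Λ)) :
    MemLp (fun z : (ℝ × ℝ) × Y => H (z.1.1, z.2)) 2 ((η.prod η).prod Λ) ∧
    MemLp (fun z : (ℝ × ℝ) × Y => H (z.1.2, z.2)) 2 ((η.prod η).prod Λ) := by
  have hm1 : Measurable fun z : (ℝ × ℝ) × Y => H (z.1.1, z.2) :=
    hH.comp ((measurable_fst.comp measurable_fst).prodMk measurable_snd)
  have hm2 : Measurable fun z : (ℝ × ℝ) × Y => H (z.1.2, z.2) :=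
    hH.comp ((measurable_snd.comp measurable_fst).prodMk measurable_snd)
  have hfin : ∫⁻ r, ∫⁻ p, ENNReal.ofReal (H (r, p) ^ 2) ∂Λ ∂η ≠ ⊤ := by
    rw [← lintegral_prod _ (hH.pow_const 2).ennreal_ofReal.aemeasurable]
    have := ((memLp_two_iff_integrable_sq hH.aestronglyMeasurable).1 hH2).2
    rw [hasFiniteIntegral_iff_ofReal (Eventually.of_forall fun _ => sq_nonneg _)] at this
    exact this.ne
  have hg : Measurable fun r => ∫⁻ p, ENNReal.ofReal (H (r, p) ^ 2) ∂Λ :=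
    (hH.pow_const 2).ennreal_ofReal.lintegral_prod_right'
  constructor
  · refine (memLp_two_iff_integrable_sq hm1.aestronglyMeasurable).2
      ⟨(hm1.pow_const 2).aestronglyMeasurable, ?_⟩
    rw [hasFiniteIntegral_iff_ofReal (Eventually.of_forall fun _ => sq_nonneg _),
      lintegral_prod _ (hm1.pow_const 2).ennreal_ofReal.aemeasurable,
      lintegral_prod (fun z : ℝ × ℝ => ∫⁻ p, ENNReal.ofReal (H (z.1, p) ^ 2) ∂Λ)
        (hg.comp measurable_fst).aemeasurable]
    simp only [lintegral_const]
    rw [lintegral_mul_const _ hg]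
    exact (ENNReal.mul_ne_top hfin (measure_ne_top _ _)).lt_top
  · refine (memLp_two_iff_integrable_sq hm2.aestronglyMeasurable).2
      ⟨(hm2.pow_const 2).aestronglyMeasurable, ?_⟩
    rw [hasFiniteIntegral_iff_ofReal (Eventually.of_forall fun _ => sq_nonneg _),
      lintegral_prod _ (hm2.pow_const 2).ennreal_ofReal.aemeasurable,
      lintegral_prod (fun z : ℝ × ℝ => ∫⁻ p, ENNReal.ofReal (H (z.2, p) ^ 2) ∂Λ)
        (hg.comp measurable_snd).aemeasurable]
    simp only [lintegral_const]
    exact (ENNReal.mul_ne_top hfin (measure_ne_top _ _)).lt_top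

lemma integral_gram_nonneg {Y : Type*} [MeasurableSpace Y] {Λ : Measure Y} [SFinite Λ]
    {τ T : ℝ} {H : ℝ × Y → ℝ} (hH : Measurable H)
    (hH2 : MemLp H 2 ((volume.restrict (Ioc τ T)).prod Λ)) :
    Integrable (fun t => ∫ r in Ioc τ t, ∫ p, H (r, p) * H (t, p) ∂Λ) (volume.restrict (Ioc τ T)) ∧
    0 ≤ ∫ t in Ioc τ T, ∫ r in Ioc τ t, ∫ p, H (r, p) * H (t, p) ∂Λ := by
  set η : Measure ℝ := volume.restrict (Ioc τ T) with hη
  have hG : Integrable (fun z : (ℝ × ℝ) × Y => H (z.1.1, z.2) * H (z.1.2, z.2))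
      ((η.prod η).prod Λ) := (memLp_gram hH hH2).1.integrable_mul (memLp_gram hH hH2).2
  set K : ℝ × ℝ → ℝ := fun z => ∫ p, H (z.1, p) * H (z.2, p) ∂Λ with hK
  have hKi : Integrable K (η.prod η) := hG.integral_prod_left
  have hsymm : ∀ z, K z.swap = K z := fun z => by simp [hK, mul_comm]
  have htot : 0 ≤ ∫ z, K z ∂(η.prod η) := by
    have e1 : ∫ z, K z ∂(η.prod η) =
        ∫ z, H (z.1.1, z.2) * H (z.1.2, z.2) ∂((η.prod η).prod Λ) := (integral_prod _ hG).symm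
    rw [e1, integral_prod_symm _ hG]
    refine integral_nonneg fun p => ?_
    have : ∫ z : ℝ × ℝ, H (z.1, p) * H (z.2, p) ∂(η.prod η) = (∫ r, H (r, p) ∂η) * ∫ r, H (r, p) ∂η :=
      integral_prod_mul (fun r => H (r, p)) (fun r => H (r, p))
    rw [Pi.zero_apply, this]
    exact mul_self_nonneg _
  set D : Set (ℝ × ℝ) := {z | z.1 ≤ z.2} with hD
  have hDm : MeasurableSet D := measurableSet_le measurable_fst measurable_snd
  have hdiag : (η.prod η) {z : ℝ × ℝ | z.1 = z.2} = 0 := by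
    rw [Measure.measure_prod_null (measurableSet_eq_fun measurable_fst measurable_snd)]
    refine Eventually.of_forall fun r => ?_
    have : (Prod.mk r ⁻¹' {z : ℝ × ℝ | z.1 = z.2}) = {r} := by ext; simp [eq_comm]
    change η (Prod.mk r ⁻¹' {z : ℝ × ℝ | z.1 = z.2}) = 0
    rw [this]; simp
  have hcompl : ∫ z in Dᶜ, K z ∂(η.prod η) = ∫ z in D, K z ∂(η.prod η) := by
    have e1 : (Dᶜ : Set (ℝ × ℝ)) =ᵐ[η.prod η] Prod.swap ⁻¹' D := by
      have : ∀ᵐ z ∂(η.prod η), z.1 ≠ z.2 := by rw [ae_iff]; simpa using hdiag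
      filter_upwards [this] with z hz
      change (z ∈ Dᶜ) = (z ∈ Prod.swap ⁻¹' D)
      refine propext ⟨fun h => ?_, fun h => ?_⟩
      · exact (not_le.1 (show ¬ z.1 ≤ z.2 from h)).le
      · exact not_le.2 (lt_of_le_of_ne (show z.2 ≤ z.1 from h) hz.symm)
    rw [setIntegral_congr_set e1]
    have hmp : MeasurePreserving Prod.swap (η.prod η) (η.prod η) := Measure.measurePreserving_swap
    have := hmp.setIntegral_preimage_emb MeasurableEquiv.prodComm.measurableEmbedding K D
    rw [← this]
    simp_rw [hsymm]
  have hhalf : 0 ≤ ∫ z in D, K z ∂(η.prod η) := by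
    rw [← integral_add_compl hDm hKi, hcompl] at htot
    linarith
  have hDi : Integrable (D.indicator K) (η.prod η) := hKi.indicator hDm
  have hinner : ∀ t ∈ Ioc τ T, ∫ r, D.indicator K (r, t) ∂η =
      ∫ r in Ioc τ t, ∫ p, H (r, p) * H (t, p) ∂Λ := by
    intro t ht
    have e : (fun r => D.indicator K (r, t)) = (Iic t).indicator fun r => K (r, t) := by
      ext r
      by_cases h : r ≤ t
      · rw [indicator_of_mem (show (r, t) ∈ D from h), indicator_of_mem (show r ∈ Iic t from h)]
      · rw [indicator_of_notMem (show (r, t) ∉ D from h), indicator_of_notMem (show r ∉ Iic t from h)]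
    rw [e, integral_indicator measurableSet_Iic, hη, Measure.restrict_restrict measurableSet_Iic]
    have : Iic t ∩ Ioc τ T = Ioc τ t := by
      ext r
      constructor
      · rintro ⟨h1, h2⟩; exact ⟨h2.1, h1⟩
      · rintro ⟨h1, h2⟩; exact ⟨h2, h1, h2.trans ht.2⟩
    rw [this]
  have hae : (fun t => ∫ r, D.indicator K (r, t) ∂η) =ᵐ[η]
      fun t => ∫ r in Ioc τ t, ∫ p, H (r, p) * H (t, p) ∂Λ := by
    filter_upwards [ae_restrict_mem measurableSet_Ioc] with t ht using hinner t ht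
  refine ⟨hDi.integral_prod_right.congr hae, ?_⟩
  rw [← integral_congr_ae hae, ← integral_prod_symm _ hDi, integral_indicator hDm]
  exact hhalf

variable {X : Type*} [MeasurableSpace X] {ν : Measure X} {Γ : Measure (X × X)}

namespace BddSol

variable {m N N' : ℝ} {f f' : X → ℝ} {u u' : ℝ → X → ℝ} {G G' : Set ℝ}

lemma formTest (hu : BddSol ν Γ m N f u G) (hm : 1 < m) {t : ℝ} (ht : t ∈ G) :
    FormTest ν Γ (conjExp m) fun x => u t x ^ m := (hu.bdd ht).formTest_rpow hm (hu.fin t ht)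

lemma meas_rpow (hu : BddSol ν Γ m N f u G) : Measurable (Function.uncurry fun t x => u t x ^ m) :=
  hu.meas.pow_const m

lemma memLp_pdiff [SFinite Γ] (hu : BddSol ν Γ m N f u G) {I : Set ℝ} (hI : I ⊆ Ioi 0) :
    MemLp (fun z : ℝ × (X × X) => pdiff (fun x => u z.1 x ^ m) z.2) 2
      ((volume.restrict I).prod Γ) :=
  memLp_pdiff_prod hu.meas_rpow (ne_top_of_le_ne_top ENNReal.ofReal_ne_top
    ((lintegral_mono_set hI).trans hu.energy_total))

lemma integrableOn_eform [SFinite Γ] (hu : BddSol ν Γ m N f u G) {τ t : ℝ} (hτ : 0 ≤ τ)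
    {w : X → ℝ} (hw : FormTest ν Γ (conjExp m) w) :
    IntegrableOn (fun r => eform Γ (fun x => u r x ^ m) w) (Ioc τ t) :=
  (integral_eform_prod (w := fun _ => w) (hu.memLp_pdiff
    (Ioc_subset_Ioi_self.trans (Ioi_subset_Ioi hτ)))
    (memLp_pdiff_const (by simp) hw.meas hw.fin)).1

lemma integrable_sub_mul (hu : BddSol ν Γ m N f u G) (hm : 1 < m) {τ t : ℝ} (hτ : τ ∈ G)
    (ht : t ∈ G) {w : X → ℝ} (hw : FormTest ν Γ (conjExp m) w) :
    Integrable (fun x => (u t x - u τ x) * w x) ν :=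
  integrable_sub_mul_formTest hm (hu.bdd ht) (hu.bdd hτ) hw

lemma eq_between [SFinite Γ] (hu : BddSol ν Γ m N f u G) (hm : 1 < m) (hf : BddDensity ν N f)
    {τ t : ℝ} (hτ : τ ∈ G) (ht : t ∈ G) (hτt : τ < t) {w : X → ℝ}
    (hw : FormTest ν Γ (conjExp m) w) :
    (∫ x, (u t x - u τ x) * w x ∂ν) + ∫ r in Ioc τ t, eform Γ (fun x => u r x ^ m) w = 0 := by
  have h1 := hu.eq t ht w hw
  have h2 := hu.eq τ hτ w hw
  have hsplit : ∫ r in Ioc 0 t, eform Γ (fun x => u r x ^ m) w =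
      (∫ r in Ioc 0 τ, eform Γ (fun x => u r x ^ m) w) +
        ∫ r in Ioc τ t, eform Γ (fun x => u r x ^ m) w := by
    rw [← setIntegral_union (Ioc_disjoint_Ioc_of_le le_rfl) measurableSet_Ioc
      (hu.integrableOn_eform le_rfl hw) (hu.integrableOn_eform (hu.pos hτ).le hw),
      Ioc_union_Ioc_eq_Ioc (hu.pos hτ).le hτt.le]
  have i1 := integrable_sub_mul_formTest hm (hu.bdd ht) hf hw
  have i2 := integrable_sub_mul_formTest hm (hu.bdd hτ) hf hw
  have hsub : ∫ x, (u t x - u τ x) * w x ∂ν =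
      (∫ x, (u t x - f x) * w x ∂ν) - ∫ x, (u τ x - f x) * w x ∂ν := by
    rw [← integral_sub i1 i2]
    congr 1; ext x; ring
  linarith

lemma bound_rpow (hu : BddSol ν Γ m N f u G) (hm : 1 < m) (t : ℝ) (x : X) :
    |u t x ^ m| ≤ N ^ m := by
  rw [abs_of_nonneg (Real.rpow_nonneg (hu.mem t x).1 m)]
  exact Real.rpow_le_rpow (hu.mem t x).1 (hu.mem t x).2 (by linarith)

lemma integrable_pairing [SFinite ν] (hu : BddSol ν Γ m N f u G) (hu' : BddSol ν Γ m N' f' u' G')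
    (hm : 1 < m) {a : X → ℝ} (ham : Measurable a) (ha : Integrable a ν) {τ T : ℝ} :
    IntegrableOn (fun t => ∫ x, a x * (u t x ^ m - u' t x ^ m) ∂ν) (Ioc τ T) := by
  have hmeas : Measurable (Function.uncurry fun (t : ℝ) x => a x * (u t x ^ m - u' t x ^ m)) :=
    (ham.comp measurable_snd).mul (hu.meas_rpow.sub hu'.meas_rpow)
  refine Integrable.mono' (g := fun _ => (N ^ m + N' ^ m) * ∫ x, |a x| ∂ν) (integrable_const _)
    (hmeas.stronglyMeasurable.integral_prod_right).aestronglyMeasurable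
    (Eventually.of_forall fun t => ?_)
  rw [← integral_const_mul]
  refine norm_integral_le_of_norm_le (ha.abs.const_mul _) (Eventually.of_forall fun x => ?_)
  rw [Real.norm_eq_abs, abs_mul, mul_comm]
  gcongr
  exact (abs_sub _ _).trans (add_le_add (hu.bound_rpow hm t x) (hu'.bound_rpow hm t x))

/-- The difference of two bounded solutions is controlled by the difference of their values at an
earlier time, tested against the difference of the fluxes. -/
lemma compare [SFinite ν] [SFinite Γ] (hu : BddSol ν Γ m N f u G) (hu' : BddSol ν Γ m N' f' u' G')
    (hm : 1 < m) (hf : BddDensity ν N f) (hf' : BddDensity ν N' f') {τ T : ℝ} (hτ : τ ∈ G)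
    (hτ' : τ ∈ G') :
    ∫⁻ t in Ioc τ T, ∫⁻ x, ENNReal.ofReal (|u t x - u' t x| ^ (m + 1)) ∂ν ≤
      ENNReal.ofReal (∫ t in Ioc τ T, ∫ x, (u τ x - u' τ x) * (u t x ^ m - u' t x ^ m) ∂ν) := by
  have hτ0 : 0 ≤ τ := (hu.pos hτ).le
  have hI : Ioc τ T ⊆ Ioi 0 := Ioc_subset_Ioi_self.trans (Ioi_subset_Ioi hτ0)
  set b : ℝ → X → ℝ := fun t x => u t x ^ m - u' t x ^ m with hb
  have hbm : Measurable (Function.uncurry b) := hu.meas_rpow.sub hu'.meas_rpow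
  have hgram := integral_gram_nonneg (Λ := Γ) (τ := τ) (T := T)
    (H := fun z => pdiff (b z.1) z.2) (measurable_uncurry_pdiff hbm) (by
      refine ((hu.memLp_pdiff hI).sub (hu'.memLp_pdiff hI)).ae_eq (Eventually.of_forall fun z => ?_)
      simp only [pdiff, hb, Pi.sub_apply]; ring)
  have hgi : IntegrableOn (fun t => ∫ r in Ioc τ t, ∫ p, pdiff (b r) p * pdiff (b t) p ∂Γ)
    (Ioc τ T) := hgram.1
  have hBi : IntegrableOn (fun t => ∫ x, (u τ x - u' τ x) * (u t x ^ m - u' t x ^ m) ∂ν)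
    (Ioc τ T) := hu.integrable_pairing hu' hm (τ := τ) (T := T)
    ((hu.bdd hτ).meas.sub (hu'.bdd hτ').meas) ((hu.bdd hτ).int.sub (hu'.bdd hτ').int)
  have hmono : conjExp m ≥ 0 := (zero_le_one.trans (one_lt_conjExp hm).le)
  have hgood : ∀ᵐ t ∂(volume.restrict (Ioc τ T)), t ∈ G ∧ t ∈ G' ∧ τ < t := by
    filter_upwards [ae_restrict_of_ae_restrict_of_subset hI hu.ae_mem,
      ae_restrict_of_ae_restrict_of_subset hI hu'.ae_mem, ae_restrict_mem measurableSet_Ioc]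
      with t h1 h2 h3 using ⟨h1, h2, h3.1⟩
  set A : ℝ → ℝ := fun t => ∫ x, (u t x - u' t x) * b t x ∂ν with hA
  have hbF : ∀ t ∈ G, t ∈ G' → FormTest ν Γ (conjExp m) (b t) := fun t h1 h2 =>
    (hu.formTest hm h1).sub hmono (hu'.formTest hm h2)
  have hident : ∀ᵐ t ∂(volume.restrict (Ioc τ T)), A t =
      (∫ x, (u τ x - u' τ x) * (u t x ^ m - u' t x ^ m) ∂ν) -
        ∫ r in Ioc τ t, ∫ p, pdiff (b r) p * pdiff (b t) p ∂Γ := by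
    filter_upwards [hgood] with t ⟨h1, h2, h3⟩
    have hw := hbF t h1 h2
    have e1 := hu.eq_between hm hf hτ h1 h3 hw
    have e2 := hu'.eq_between hm hf' hτ' h2 h3 hw
    have i1 := hu.integrable_sub_mul hm hτ h1 hw
    have i2 := hu'.integrable_sub_mul hm hτ' h2 hw
    have i3 : Integrable (fun x => (u τ x - u' τ x) * b t x) ν :=
      integrable_sub_mul_formTest hm (N := max N N')
        ⟨(hu.bdd hτ).meas, fun x => ⟨(hu.mem τ x).1, (hu.mem τ x).2.trans (le_max_left _ _)⟩,
          (hu.bdd hτ).int⟩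
        ⟨(hu'.bdd hτ').meas, fun x => ⟨(hu'.mem τ x).1, (hu'.mem τ x).2.trans (le_max_right _ _)⟩,
          (hu'.bdd hτ').int⟩ hw
    have e3 : ∫ r in Ioc τ t, ∫ p, pdiff (b r) p * pdiff (b t) p ∂Γ =
        (∫ r in Ioc τ t, eform Γ (fun x => u r x ^ m) (b t)) -
          ∫ r in Ioc τ t, eform Γ (fun x => u' r x ^ m) (b t) := by
      rw [← integral_sub (hu.integrableOn_eform hτ0 hw) (hu'.integrableOn_eform hτ0 hw)]
      have hsub : Ioc τ t ⊆ Ioi 0 := Ioc_subset_Ioi_self.trans (Ioi_subset_Ioi hτ0)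
      refine integral_congr_ae ?_
      filter_upwards [ae_restrict_of_ae_restrict_of_subset hsub hu.ae_mem,
        ae_restrict_of_ae_restrict_of_subset hsub hu'.ae_mem] with r hr hr'
      have := eform_sub_right hw.memLp (hu.formTest hm hr).memLp (hu'.formTest hm hr').memLp
      rw [eform_comm _ (b t), eform_comm _ (b t), ← this, eform_comm]
      rfl
    have e4 : A t = (∫ x, (u t x - u τ x) * b t x ∂ν) - (∫ x, (u' t x - u' τ x) * b t x ∂ν) +
        ∫ x, (u τ x - u' τ x) * b t x ∂ν := by
      have i12 : Integrable (fun x => (u t x - u τ x) * b t x - (u' t x - u' τ x) * b t x) ν :=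
        i1.sub i2
      rw [← integral_sub i1 i2, ← integral_add i12 i3]
      refine integral_congr_ae (Eventually.of_forall fun x => ?_)
      change (u t x - u' t x) * b t x = (u t x - u τ x) * b t x - (u' t x - u' τ x) * b t x +
        (u τ x - u' τ x) * b t x
      ring
    have e5 : ∫ x, (u τ x - u' τ x) * (u t x ^ m - u' t x ^ m) ∂ν =
      ∫ x, (u τ x - u' τ x) * b t x ∂ν := rfl
    linarith
  have hAi : IntegrableOn A (Ioc τ T) := (hBi.sub hgi).congr (by
    filter_upwards [hident] with t ht
    rw [ht]; rfl)
  have hpt : ∀ t x, |u t x - u' t x| ^ (m + 1) ≤ (u t x - u' t x) * b t x := fun t x =>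
    abs_sub_rpow_le hm (hu.mem t x).1 (hu'.mem t x).1
  have hA0 : ∀ t, 0 ≤ A t := fun t => integral_nonneg fun x =>
    (by positivity : (0 : ℝ) ≤ |u t x - u' t x| ^ (m + 1)).trans (hpt t x)
  calc ∫⁻ t in Ioc τ T, ∫⁻ x, ENNReal.ofReal (|u t x - u' t x| ^ (m + 1)) ∂ν
      ≤ ∫⁻ t in Ioc τ T, ENNReal.ofReal (A t) := by
        refine lintegral_mono_ae ?_
        filter_upwards [hgood] with t ⟨h1, h2, h3⟩
        have hi : Integrable (fun x => (u t x - u' t x) * b t x) ν :=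
          integrable_sub_mul_formTest hm (N := max N N')
            ⟨(hu.bdd h1).meas, fun x => ⟨(hu.mem t x).1, (hu.mem t x).2.trans (le_max_left _ _)⟩,
              (hu.bdd h1).int⟩
            ⟨(hu'.bdd h2).meas, fun x => ⟨(hu'.mem t x).1,
              (hu'.mem t x).2.trans (le_max_right _ _)⟩, (hu'.bdd h2).int⟩ (hbF t h1 h2)
        rw [hA, ofReal_integral_eq_lintegral_ofReal hi (Eventually.of_forall fun x =>
          (by positivity : (0 : ℝ) ≤ |u t x - u' t x| ^ (m + 1)).trans (hpt t x))]
        exact lintegral_mono fun x => ENNReal.ofReal_le_ofReal (hpt t x)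
    _ = ENNReal.ofReal (∫ t in Ioc τ T, A t) :=
        (ofReal_integral_eq_lintegral_ofReal hAi (Eventually.of_forall hA0)).symm
    _ ≤ _ := by
        refine ENNReal.ofReal_le_ofReal ?_
        rw [integral_congr_ae hident, integral_sub hBi hgi]
        linarith [hgram.2]

end BddSol

end Oleinik

section Concrete

variable {d : ℕ}

/-- The measure `ρ dx`. -/
def weightMeasure (ρ : Ed d → ℝ) : Measure (Ed d) :=
  volume.withDensity fun x => ENNReal.ofReal (ρ x)

/-- The jump kernel of the fractional Laplacian. -/
def jumpKernel (d : ℕ) (s κ : ℝ) (p : Ed d × Ed d) : ℝ :=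
  κ / 2 / ‖p.1 - p.2‖ ^ ((d : ℝ) + 2 * s)

/-- The jump measure of the fractional Laplacian. -/
def jumpMeasure (d : ℕ) (s κ : ℝ) : Measure (Ed d × Ed d) :=
  volume.withDensity fun p => ENNReal.ofReal (jumpKernel d s κ p)

instance (ρ : Ed d → ℝ) : SigmaFinite (weightMeasure ρ) :=
  SigmaFinite.withDensity_ofReal ρ

@[fun_prop]
lemma measurable_jumpKernel (s κ : ℝ) : Measurable (jumpKernel d s κ) := by
  unfold jumpKernel; fun_prop

lemma jumpKernel_nonneg {s κ : ℝ} (hκ : 0 ≤ κ) (p : Ed d × Ed d) : 0 ≤ jumpKernel d s κ p := by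
  unfold jumpKernel; positivity

instance (s κ : ℝ) : SigmaFinite (jumpMeasure d s κ) :=
  SigmaFinite.withDensity_ofReal (jumpKernel d s κ)

lemma weightMeasure_ac {ρ : Ed d → ℝ} (hρ : Measurable ρ) (hpos : ∀ x, 0 < ρ x) :
    (volume : Measure (Ed d)) ≪ weightMeasure ρ :=
  withDensity_absolutelyContinuous' (by fun_prop) (.of_forall fun x => by simp [hpos x])

lemma marginalsAC_jump {ρ : Ed d → ℝ} (hρ : Measurable ρ) (hpos : ∀ x, 0 < ρ x) (s κ : ℝ) :
    MarginalsAC (weightMeasure ρ) (jumpMeasure d s κ) := by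
  have hJ : jumpMeasure d s κ ≪ (volume : Measure (Ed d)).prod volume :=
    withDensity_absolutelyContinuous _ _
  constructor
  · exact ((hJ.map measurable_fst).trans
      (Measure.quasiMeasurePreserving_fst.absolutelyContinuous)).trans (weightMeasure_ac hρ hpos)
  · exact ((hJ.map measurable_snd).trans
      (Measure.quasiMeasurePreserving_snd.absolutelyContinuous)).trans (weightMeasure_ac hρ hpos)

lemma lintegral_weightMeasure {ρ : Ed d → ℝ} (hρ : Measurable ρ) {g : Ed d → ℝ≥0∞}
    (hg : Measurable g) :
    ∫⁻ x, g x ∂weightMeasure ρ = ∫⁻ x, ENNReal.ofReal (ρ x) * g x := by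
  rw [weightMeasure, lintegral_withDensity_eq_lintegral_mul _ (by fun_prop) hg]
  rfl

lemma integral_weightMeasure {ρ : Ed d → ℝ} (hρ : Measurable ρ) (hpos : ∀ x, 0 < ρ x)
    (g : Ed d → ℝ) : ∫ x, g x ∂weightMeasure ρ = ∫ x, g x * ρ x := by
  rw [weightMeasure, integral_withDensity_eq_integral_toReal_smul (by fun_prop) (by simp)]
  refine integral_congr_ae (.of_forall fun x => ?_)
  simp [ENNReal.toReal_ofReal (hpos x).le, mul_comm]

lemma integrable_weightMeasure {ρ : Ed d → ℝ} (hρ : Measurable ρ) (hpos : ∀ x, 0 < ρ x)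
    {g : Ed d → ℝ} : Integrable g (weightMeasure ρ) ↔ Integrable (fun x => g x * ρ x) := by
  rw [weightMeasure, integrable_withDensity_iff (by fun_prop) (by simp)]
  simp [ENNReal.toReal_ofReal (hpos _).le]

lemma energy_jump_eq {s κ : ℝ} (hκ : 0 ≤ κ) {v : Ed d → ℝ} (hv : Measurable v) :
    energy (jumpMeasure d s κ) v = gagliardoSq d s κ v := by
  rw [energy, jumpMeasure, lintegral_withDensity_eq_lintegral_mul _ (by fun_prop)
    (by exact ((measurable_pdiff hv).pow_const 2).ennreal_ofReal), gagliardoSq,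
    ← lintegral_const_mul' _ _ ENNReal.ofReal_ne_top]
  refine lintegral_congr fun p => ?_
  simp only [Pi.mul_apply]
  rw [← ENNReal.ofReal_mul (jumpKernel_nonneg hκ p), ← ENNReal.ofReal_mul (by positivity)]
  congr 1
  simp only [jumpKernel, pdiff]
  ring

lemma eform_jump_eq {s κ : ℝ} (hκ : 0 ≤ κ) (v w : Ed d → ℝ) :
    eform (jumpMeasure d s κ) v w = gagliardoE d s κ v w := by
  rw [eform, jumpMeasure, integral_withDensity_eq_integral_toReal_smul (by fun_prop) (by simp),
    gagliardoE, ← integral_const_mul]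
  refine integral_congr_ae (.of_forall fun p => ?_)
  have h := ENNReal.toReal_ofReal (jumpKernel_nonneg (d := d) (s := s) hκ p)
  simp only [h, smul_eq_mul]
  simp only [jumpKernel, pdiff]
  ring

lemma AdmissibleWeight.ae_le {ρ : Ed d → ℝ} {γ₀ γ c C : ℝ} (h : AdmissibleWeight d ρ γ₀ γ c C)
    (hd : 0 < d) (hγ : γ₀ ≤ γ) : ∀ᵐ x, ρ x ≤ C * ‖x‖ ^ (-γ) := by
  have : Nonempty (Fin d) := ⟨⟨0, hd⟩⟩
  have hx0 : ∀ᵐ x : Ed d, x ≠ 0 := by simp [ae_iff]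
  obtain ⟨hc, hcC, -, -, h1, h2⟩ := h
  filter_upwards [h1, h2, hx0] with x h1 h2 hx0
  rcases le_or_gt ‖x‖ 1 with hx | hx
  · refine (h1 hx).2.trans ?_
    have : 0 < C := hc.trans hcC
    gcongr ?_ * ?_
    exact Real.rpow_le_rpow_of_exponent_ge (norm_pos_iff.2 hx0) hx (by linarith)
  · exact (h2 hx).2

/-- A lower bound for an admissible weight. -/
lemma AdmissibleWeight.ae_ge {ρ : Ed d → ℝ} {γ₀ γ c C : ℝ} (h : AdmissibleWeight d ρ γ₀ γ c C)
    (hd : 0 < d) (hγ₀ : 0 ≤ γ₀) (hγ : γ₀ ≤ γ) :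
    ∀ᵐ x, c * (1 + ‖x‖) ^ (-γ) ≤ ρ x := by
  have : Nonempty (Fin d) := ⟨⟨0, hd⟩⟩
  have hx0 : ∀ᵐ x : Ed d, x ≠ 0 := by simp [ae_iff]
  obtain ⟨hc, hcC, -, -, h1, h2⟩ := h
  filter_upwards [h1, h2, hx0] with x h1 h2 hx0
  have hx0 := norm_pos_iff.2 hx0
  rcases le_or_gt ‖x‖ 1 with hx | hx
  · refine le_trans ?_ (h1 hx).1
    gcongr ?_ * ?_
    exact (Real.rpow_le_one_of_one_le_of_nonpos (by linarith) (by linarith)).trans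
      (Real.one_le_rpow_of_pos_of_le_one_of_nonpos hx0 hx (by linarith))
  · refine le_trans ?_ (h2 hx).1
    gcongr ?_ * ?_
    exact Real.rpow_le_rpow_of_nonpos hx0 (by linarith) (by linarith)

end Concrete

section LocalEnergy

variable {d : ℕ}

/-- The local energy density of order `s`. -/
def localEnergy (d : ℕ) (s : ℝ) (w : Ed d → ℝ) (x : Ed d) : ℝ≥0∞ :=
  ∫⁻ y, ENNReal.ofReal ((w x - w y) ^ 2 / ‖x - y‖ ^ ((d : ℝ) + 2 * s))

@[fun_prop]
lemma measurable_localEnergy {s : ℝ} {w : Ed d → ℝ} (hw : Measurable w) :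
    Measurable (localEnergy d s w) := by
  unfold localEnergy
  have : Measurable fun p : Ed d × Ed d =>
      ENNReal.ofReal ((w p.1 - w p.2) ^ 2 / ‖p.1 - p.2‖ ^ ((d : ℝ) + 2 * s)) := by fun_prop
  exact this.lintegral_prod_right'

lemma energy_jump_eq_localEnergy {s κ : ℝ} (hκ : 0 ≤ κ) {w : Ed d → ℝ} (hw : Measurable w) :
    energy (jumpMeasure d s κ) w = ENNReal.ofReal (κ / 2) * ∫⁻ x, localEnergy d s w x := by
  rw [energy_jump_eq hκ hw, gagliardoSq]
  congr 1
  have : Measurable fun p : Ed d × Ed d =>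
      ENNReal.ofReal ((w p.1 - w p.2) ^ 2 / ‖p.1 - p.2‖ ^ ((d : ℝ) + 2 * s)) := by fun_prop
  exact lintegral_prod _ this.aemeasurable

lemma integrableOn_of_bdd {w : Ed d → ℝ} (hw : Measurable w) {B : ℝ} (hB : ∀ x, |w x| ≤ B)
    {A : Set (Ed d)} (hA : volume A ≠ ⊤) : IntegrableOn w A :=
  Measure.integrableOn_of_bounded (M := B) hA hw.aestronglyMeasurable
    (.of_forall fun x => by simpa using hB x)

/-- Jensen's inequality for the distance to an average. -/
lemma sq_sub_average_le {w : Ed d → ℝ} (hw : Measurable w) {B : ℝ} (hB : ∀ x, |w x| ≤ B)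
    {A : Set (Ed d)} (hA0 : volume A ≠ 0) (hA : volume A ≠ ⊤) (a : ℝ) :
    ENNReal.ofReal ((a - ⨍ y in A, w y) ^ 2) ≤
      (volume A)⁻¹ * ∫⁻ y in A, ENNReal.ofReal ((a - w y) ^ 2) := by
  have hi : IntegrableOn w A := integrableOn_of_bdd hw hB hA
  have hc : IntegrableOn (fun _ : Ed d => a) A := integrableOn_const hA
  have hi' : IntegrableOn (fun y => a - w y) A := hc.sub hi
  have hsq : IntegrableOn (fun y => (a - w y) ^ 2) A := by
    refine integrableOn_of_bdd (by fun_prop) (B := (|a| + B) ^ 2) (fun x => ?_) hA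
    rw [abs_pow]
    gcongr
    exact (abs_sub _ _).trans (by gcongr; exact hB x)
  have hpos : 0 < volume.real A := ENNReal.toReal_pos hA0 hA
  have havg : (⨍ y in A, (a - w y)) = a - ⨍ y in A, w y := by
    rw [setAverage_eq, setAverage_eq, integral_sub hc hi]
    simp only [integral_const, measureReal_restrict_apply_univ, smul_eq_mul]
    field_simp
  have hJ := ConvexOn.map_set_average_le (g := fun z : ℝ => z ^ 2) (s := univ)
    (even_two.convexOn_pow) (by fun_prop) isClosed_univ hA0 hA (by simp) hi' hsq
  rw [havg] at hJ
  refine (ENNReal.ofReal_le_ofReal hJ).trans (le_of_eq ?_)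
  rw [setAverage_eq, smul_eq_mul, ENNReal.ofReal_mul (by positivity),
    ofReal_integral_eq_lintegral_ofReal hsq (.of_forall fun x => sq_nonneg _),
    ENNReal.ofReal_inv_of_pos hpos, ofReal_measureReal hA]

lemma lintegral_sq_le_localEnergy {s : ℝ} (hs : 0 < s) {w : Ed d → ℝ} {A : Set (Ed d)}
    (hAm : MeasurableSet A) {x : Ed d} {r : ℝ} (hA : A ⊆ Metric.closedBall x r) :
    ∫⁻ y in A, ENNReal.ofReal ((w x - w y) ^ 2) ≤
      ENNReal.ofReal (r ^ ((d : ℝ) + 2 * s)) * localEnergy d s w x := by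
  rw [localEnergy, ← lintegral_const_mul' _ _ ENNReal.ofReal_ne_top]
  refine (setLIntegral_mono' hAm fun y hy => ?_).trans (setLIntegral_le_lintegral A _)
  have hy := hA hy
  rw [Metric.mem_closedBall, dist_comm, dist_eq_norm] at hy
  have hr : 0 ≤ r := (norm_nonneg _).trans hy
  rw [← ENNReal.ofReal_mul (by positivity)]
  refine ENNReal.ofReal_le_ofReal ?_
  rcases eq_or_ne x y with rfl | hxy
  · simp
  have hpos : 0 < ‖x - y‖ := norm_pos_iff.2 (sub_ne_zero.2 hxy)
  rw [mul_div_assoc', le_div_iff₀ (by positivity), mul_comm]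
  have : ‖x - y‖ ^ ((d : ℝ) + 2 * s) ≤ r ^ ((d : ℝ) + 2 * s) := by gcongr
  gcongr

lemma sq_sub_average_le_localEnergy {s : ℝ} (hs : 0 < s) {w : Ed d → ℝ} (hw : Measurable w)
    {B : ℝ} (hB : ∀ x, |w x| ≤ B) {A : Set (Ed d)} (hAm : MeasurableSet A)
    (hA0 : volume A ≠ 0) {x : Ed d} {r : ℝ} (hA : A ⊆ Metric.closedBall x r) :
    ENNReal.ofReal ((w x - ⨍ y in A, w y) ^ 2) ≤
      (volume A)⁻¹ * ENNReal.ofReal (r ^ ((d : ℝ) + 2 * s)) * localEnergy d s w x := by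
  have hAt : volume A ≠ ⊤ := ((measure_mono hA).trans_lt measure_closedBall_lt_top).ne
  rw [mul_assoc]
  exact (sq_sub_average_le hw hB hA0 hAt _).trans
    (by gcongr; exact lintegral_sq_le_localEnergy hs hAm hA)

lemma volume_ball_eq [NeZero d] (x : Ed d) {r : ℝ} (hr : 0 ≤ r) :
    volume (Metric.ball x r) =
      ENNReal.ofReal (r ^ d * volume.real (Metric.ball (0 : Ed d) 1)) := by
  rw [Measure.addHaar_ball _ _ hr, ENNReal.ofReal_mul (by positivity),
    ofReal_measureReal measure_ball_lt_top.ne, finrank_euclideanSpace, Fintype.card_fin]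

lemma volume_real_unitBall_pos : 0 < volume.real (Metric.ball (0 : Ed d) 1) :=
  ENNReal.toReal_pos (Metric.measure_ball_pos _ _ one_pos).ne' measure_ball_lt_top.ne

/-- Control of the averages on balls of a function vanishing at infinity in the mean. -/
lemma exists_average_bound [NeZero d] {s : ℝ} (hs : 0 < s) (hd : 2 * s < d) :
    ∃ A : ℝ, 0 < A ∧ ∀ (w : Ed d → ℝ) (B : ℝ), Measurable w → (∀ x, |w x| ≤ B) →
      ∀ x : Ed d, Tendsto (fun r => ⨍ y in Metric.ball x r, w y) atTop (𝓝 0) →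
      ∀ r : ℝ, 0 < r → ENNReal.ofReal ((⨍ y in Metric.ball x r, w y) ^ 2) ≤
        ENNReal.ofReal (A * r ^ (2 * s - d)) * ∫⁻ y, localEnergy d s w y := by
  set ω := volume.real (Metric.ball (0 : Ed d) 1) with hω
  have hω0 : 0 < ω := volume_real_unitBall_pos
  set C1 : ℝ := 3 ^ ((d : ℝ) + 2 * s) / (ω ^ 2 * 2 ^ d) with hC1
  have hC10 : 0 < C1 := by positivity
  set θ : ℝ := 2 ^ (s - d / 2) with hθ
  have hθ0 : 0 < θ := by positivity
  have hθ1 : θ < 1 := Real.rpow_lt_one_of_one_lt_of_neg (by norm_num) (by linarith)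
  refine ⟨C1 / (1 - θ) ^ 2, div_pos hC10 (pow_pos (by linarith) _), ?_⟩
  intro w B hw hB x hlim r hr
  have hA0 : 0 < C1 / (1 - θ) ^ 2 := div_pos hC10 (pow_pos (by linarith) _)
  by_cases hE : ∫⁻ y, localEnergy d s w y = ⊤
  · rw [hE, ENNReal.mul_top (by rw [Ne, ENNReal.ofReal_eq_zero, not_le]; positivity)]
    exact le_top
  set E := (∫⁻ y, localEnergy d s w y).toReal with hEdef
  have hE' : ∫⁻ y, localEnergy d s w y = ENNReal.ofReal E := (ENNReal.ofReal_toReal hE).symm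
  have hE0 : 0 ≤ E := ENNReal.toReal_nonneg
  have hstep : ∀ r : ℝ, 0 < r → ((⨍ y in Metric.ball x r, w y) -
      ⨍ y in Metric.ball x (2 * r), w y) ^ 2 ≤ C1 * r ^ (2 * s - d) * E := by
    intro r hr
    have hv : ∀ r : ℝ, 0 < r → volume (Metric.ball x r) ≠ 0 := fun r hr =>
      (Metric.measure_ball_pos _ _ hr).ne'
    have h1 := sq_sub_average_le hw hB (hv r hr) measure_ball_lt_top.ne
      (⨍ y in Metric.ball x (2 * r), w y)
    have h2 : ∫⁻ y in Metric.ball x r,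
        ENNReal.ofReal (((⨍ y in Metric.ball x (2 * r), w y) - w y) ^ 2) ≤
        (volume (Metric.ball x (2 * r)))⁻¹ * ENNReal.ofReal ((3 * r) ^ ((d : ℝ) + 2 * s)) *
          ENNReal.ofReal E := by
      rw [← hE', ← lintegral_const_mul _ (measurable_localEnergy hw)]
      refine (setLIntegral_mono' measurableSet_ball fun y hy => ?_).trans
        (setLIntegral_le_lintegral _ _)
      rw [← neg_sub, neg_sq]
      refine sq_sub_average_le_localEnergy hs hw hB measurableSet_ball
        (hv _ (by positivity)) fun z hz => ?_
      rw [Metric.mem_ball] at hy hz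
      rw [Metric.mem_closedBall]
      linarith [dist_triangle_right z y x]
    have h3 := h1.trans (mul_le_mul_right h2 _)
    rw [volume_ball_eq x hr.le, volume_ball_eq x (r := 2 * r) (by positivity),
      ← ENNReal.ofReal_inv_of_pos (by positivity), ← ENNReal.ofReal_inv_of_pos (by positivity),
      ← ENNReal.ofReal_mul (by positivity), ← ENNReal.ofReal_mul (by positivity),
      ← ENNReal.ofReal_mul (by positivity), ENNReal.ofReal_le_ofReal_iff (by positivity)] at h3
    rw [← neg_sub, neg_sq]
    refine h3.trans (le_of_eq ?_)
    rw [hC1, Real.mul_rpow (by norm_num) hr.le, Real.rpow_sub hr, Real.rpow_add hr,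
      Real.rpow_natCast, ← hω, mul_pow]
    field_simp
  set L := √(C1 * r ^ (2 * s - d) * E) with hL
  have hgeo : ∀ j : ℕ, dist (⨍ y in Metric.ball x (2 ^ j * r), w y)
      (⨍ y in Metric.ball x (2 ^ (j + 1) * r), w y) ≤ L * θ ^ j := by
    intro j
    have h := hstep (2 ^ j * r) (by positivity)
    rw [Real.dist_eq, pow_succ', mul_assoc 2]
    refine (Real.abs_le_sqrt h).trans (le_of_eq ?_)
    rw [hL, Real.mul_rpow (by positivity) hr.le]
    have : ((2 : ℝ) ^ j) ^ (2 * s - d) = (θ ^ j) ^ 2 := by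
      rw [← Real.rpow_natCast 2 j, ← pow_mul, ← Real.rpow_natCast θ, hθ,
        ← Real.rpow_mul zero_le_two, ← Real.rpow_mul zero_le_two]
      congr 1
      push_cast
      ring
    rw [this, show C1 * ((θ ^ j) ^ 2 * r ^ (2 * s - d)) * E =
      (C1 * r ^ (2 * s - d) * E) * (θ ^ j) ^ 2 by ring, Real.sqrt_mul (by positivity),
      Real.sqrt_sq (by positivity)]
  have hlim' : Tendsto (fun j : ℕ => ⨍ y in Metric.ball x (2 ^ j * r), w y) atTop (𝓝 0) :=
    hlim.comp ((tendsto_pow_atTop_atTop_of_one_lt (by norm_num)).atTop_mul_const hr)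
  have hfin := dist_le_of_le_geometric_of_tendsto₀ θ L hθ1 hgeo hlim'
  rw [pow_zero, one_mul, dist_zero_right, Real.norm_eq_abs] at hfin
  rw [hE', ← ENNReal.ofReal_mul (by positivity)]
  refine ENNReal.ofReal_le_ofReal ?_
  rw [← sq_abs]
  calc |⨍ y in Metric.ball x r, w y| ^ 2 ≤ (L / (1 - θ)) ^ 2 := by gcongr
    _ = _ := by
      rw [div_pow, hL, Real.sq_sqrt (by positivity)]
      ring

/-- Integrability of radial powers near the origin. -/
lemma exists_radial_integral [NeZero d] {a : ℝ} (ha : a < d) :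
    ∃ I : ℝ, 0 < I ∧ ∀ R : ℝ, 0 < R →
      ∫⁻ x in Metric.ball (0 : Ed d) R, ENNReal.ofReal (‖x‖ ^ (-a)) ≤
        ENNReal.ofReal (I * R ^ (d - a)) := by
  have hd : 0 < (d : ℝ) := by exact_mod_cast NeZero.pos d
  refine ⟨d * volume.real (Metric.ball (0 : Ed d) 1) / (d - a), ?_, fun R hR => ?_⟩
  · have := volume_real_unitBall_pos (d := d)
    have : 0 < d - a := by linarith
    positivity
  have hfin : Module.finrank ℝ (Ed d) = d := by simp
  have hint : IntegrableOn (fun x : Ed d => ‖x‖ ^ (-a)) (Metric.ball 0 R) := by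
    refine integrableOn_ball_of_norm_le_rpow (C := 1) (α := a) ?_ ?_ ?_ ?_
    · rw [hfin]; exact NeZero.one_le
    · rw [hfin]; exact ha
    · exact .of_forall fun x => by
        rw [one_mul, Real.norm_of_nonneg (by positivity)]
    · exact Measurable.aestronglyMeasurable (by fun_prop)
  rw [← ofReal_integral_eq_lintegral_ofReal hint (.of_forall fun x => by positivity)]
  refine ENNReal.ofReal_le_ofReal (le_of_eq ?_)
  rw [← integral_indicator measurableSet_ball]
  have h1 : ∀ x : Ed d, (Metric.ball (0 : Ed d) R).indicator (fun x => ‖x‖ ^ (-a)) x =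
      (Iio R).indicator (fun y : ℝ => y ^ (-a)) ‖x‖ := fun x => by
    simp [indicator]
  simp_rw [h1]
  rw [integral_fun_norm_addHaar volume (fun y => (Iio R).indicator (fun y : ℝ => y ^ (-a)) y),
    hfin]
  have h2 : ∀ y ∈ Ioi (0 : ℝ), y ^ (d - 1) • (Iio R).indicator (fun y : ℝ => y ^ (-a)) y =
      (Iio R).indicator (fun y : ℝ => y ^ ((d : ℝ) - 1 - a)) y := by
    intro y hy
    have hy : 0 < y := hy
    by_cases hyR : y < R
    · simp only [mem_Iio, hyR, indicator_of_mem, smul_eq_mul]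
      rw [← Real.rpow_natCast, ← Real.rpow_add hy, Nat.cast_sub NeZero.one_le]
      congr 1
      push_cast
      ring
    · simp [hyR]
  rw [setIntegral_congr_fun measurableSet_Ioi h2, setIntegral_indicator measurableSet_Iio,
    Ioi_inter_Iio, ← integral_Ioc_eq_integral_Ioo, ← intervalIntegral.integral_of_le hR.le,
    integral_rpow (Or.inl (by linarith))]
  have : (d : ℝ) - 1 - a + 1 = d - a := by ring
  rw [this, Real.zero_rpow (by linarith), nsmul_eq_mul, smul_eq_mul]
  ring

end LocalEnergy

section WeightedFaberKrahn

variable {d : ℕ}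

lemma tendsto_average_zero [NeZero d] {ρ : Ed d → ℝ} {γ c : ℝ} (hρ : Measurable ρ)
    (hpos : ∀ x, 0 < ρ x) (hc : 0 < c) (hγ : 0 ≤ γ) (hγd : γ < d)
    (hge : ∀ᵐ x, c * (1 + ‖x‖) ^ (-γ) ≤ ρ x) {w : Ed d → ℝ} (hw : Measurable w) {B : ℝ}
    (hB : ∀ x, |w x| ≤ B) (hi : Integrable w (weightMeasure ρ)) (x : Ed d) :
    Tendsto (fun r => ⨍ y in Metric.ball x r, w y) atTop (𝓝 0) := by
  set ω := volume.real (Metric.ball (0 : Ed d) 1) with hω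
  have hω0 : 0 < ω := volume_real_unitBall_pos
  have hi' : Integrable fun x => |w x| * ρ x := by
    refine ((integrable_weightMeasure hρ hpos).1 hi).abs.congr (.of_forall fun x => ?_)
    simp [abs_mul, abs_of_pos (hpos x)]
  set M := ∫ x, |w x| * ρ x
  have hM : 0 ≤ M := integral_nonneg fun x => mul_nonneg (abs_nonneg _) (hpos x).le
  have hlim : Tendsto (fun r : ℝ => M * 2 ^ γ / (c * ω) * r ^ (-(d - γ))) atTop (𝓝 0) := by
    simpa using (tendsto_rpow_neg_atTop (sub_pos.2 hγd)).const_mul (M * 2 ^ γ / (c * ω))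
  refine squeeze_zero_norm' ?_ hlim
  filter_upwards [eventually_ge_atTop (1 + ‖x‖)] with r hr
  have hr0 : 0 < r := by linarith [norm_nonneg x]
  have hvr : volume.real (Metric.ball x r) = r ^ d * ω := by
    rw [Measure.real, volume_ball_eq x hr0.le, ENNReal.toReal_ofReal (by positivity)]
  have hwi : IntegrableOn w (Metric.ball x r) := integrableOn_of_bdd hw hB measure_ball_lt_top.ne
  have h1 : ∫ y in Metric.ball x r, |w y| ≤ (2 * r) ^ γ / c * M := by
    rw [← integral_const_mul]
    refine (setIntegral_mono_ae_restrict hwi.abs (hi'.const_mul _).integrableOn ?_).trans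
      (setIntegral_le_integral (hi'.const_mul _) (.of_forall fun x =>
        mul_nonneg (by positivity) (mul_nonneg (abs_nonneg _) (hpos x).le)))
    filter_upwards [ae_restrict_of_ae hge, ae_restrict_mem measurableSet_ball] with y hy hyr
    have hy2 : 1 + ‖y‖ ≤ 2 * r := by
      have : dist y x < r := hyr
      rw [dist_eq_norm] at this
      linarith [norm_le_norm_add_norm_sub x y, norm_sub_rev x y]
    have h2 : c * (2 * r) ^ (-γ) ≤ ρ y := by
      refine le_trans ?_ hy
      gcongr ?_ * ?_
      exact Real.rpow_le_rpow_of_nonpos (by positivity) hy2 (by linarith)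
    rw [Real.rpow_neg (by positivity), ← div_eq_mul_inv, div_le_iff₀ (by positivity)] at h2
    have h3 : 1 ≤ (2 * r) ^ γ / c * ρ y := by
      rw [div_mul_eq_mul_div, one_le_div hc]
      linarith
    calc |w y| ≤ |w y| * ((2 * r) ^ γ / c * ρ y) := le_mul_of_one_le_right (abs_nonneg _) h3
      _ = _ := by ring
  rw [setAverage_eq, hvr, norm_smul, Real.norm_of_nonneg (by positivity)]
  calc (r ^ d * ω)⁻¹ * ‖∫ y in Metric.ball x r, w y‖
      ≤ (r ^ d * ω)⁻¹ * ((2 * r) ^ γ / c * M) := by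
        gcongr
        exact (norm_integral_le_integral_norm _).trans h1
    _ = _ := by
      rw [neg_sub, Real.rpow_sub hr0, Real.mul_rpow zero_le_two hr0.le, Real.rpow_natCast]
      field_simp

/-- A pointwise bound for functions with finite energy. -/
lemma exists_sq_bound [NeZero d] {s : ℝ} (hs : 0 < s) (hd : 2 * s < d) :
    ∃ A : ℝ, 0 < A ∧ ∀ (w : Ed d → ℝ) (B : ℝ), Measurable w → (∀ x, |w x| ≤ B) →
      (∀ x : Ed d, Tendsto (fun r => ⨍ y in Metric.ball x r, w y) atTop (𝓝 0)) →
      ∀ (x : Ed d) (r : ℝ), 0 < r → ENNReal.ofReal (w x ^ 2) ≤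
        ENNReal.ofReal (A * r ^ (2 * s)) * localEnergy d s w x +
        ENNReal.ofReal (A * r ^ (2 * s - d)) * ∫⁻ y, localEnergy d s w y := by
  obtain ⟨A, hA, hbd⟩ := exists_average_bound (d := d) hs hd
  set ω := volume.real (Metric.ball (0 : Ed d) 1) with hω
  have hω0 : 0 < ω := volume_real_unitBall_pos
  refine ⟨2 * max (1 / ω) A, by positivity, fun w B hw hB hlim x r hr => ?_⟩
  have h1 := hbd w B hw hB x (hlim x) r hr
  have h2 := sq_sub_average_le_localEnergy hs hw hB measurableSet_ball
    (Metric.measure_ball_pos _ _ hr).ne' (Metric.ball_subset_closedBall (x := x) (ε := r))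
  rw [volume_ball_eq x hr.le, ← ENNReal.ofReal_inv_of_pos (by positivity),
    ← ENNReal.ofReal_mul (by positivity)] at h2
  set a := ⨍ y in Metric.ball x r, w y
  calc ENNReal.ofReal (w x ^ 2)
      ≤ ENNReal.ofReal 2 * (ENNReal.ofReal ((w x - a) ^ 2) + ENNReal.ofReal (a ^ 2)) := by
        rw [← ENNReal.ofReal_add (by positivity) (by positivity),
          ← ENNReal.ofReal_mul (by positivity)]
        refine ENNReal.ofReal_le_ofReal ?_
        nlinarith [sq_nonneg (w x - 2 * a)]
    _ ≤ ENNReal.ofReal 2 * (ENNReal.ofReal (max (1 / ω) A * r ^ (2 * s)) * localEnergy d s w x +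
        ENNReal.ofReal (max (1 / ω) A * r ^ (2 * s - d)) * ∫⁻ y, localEnergy d s w y) := by
        refine mul_le_mul_right (add_le_add ?_ ?_) _
        · refine h2.trans ?_
          gcongr ?_ * _
          refine ENNReal.ofReal_le_ofReal ?_
          rw [Real.rpow_add hr, Real.rpow_natCast]
          have : (r ^ d * volume.real (Metric.ball (0 : Ed d) 1))⁻¹ * (r ^ d * r ^ (2 * s)) =
              1 / ω * r ^ (2 * s) := by
            rw [← hω]; field_simp
          rw [this]
          gcongr
          exact le_max_left _ _
        · refine h1.trans ?_
          gcongr ?_ * _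
          refine ENNReal.ofReal_le_ofReal ?_
          gcongr
          exact le_max_right _ _
    _ = _ := by
        rw [mul_add, ← mul_assoc, ← mul_assoc, ← ENNReal.ofReal_mul (by positivity),
          ← ENNReal.ofReal_mul (by positivity), mul_assoc 2, mul_assoc 2]

lemma exists_faberKrahn_radius [NeZero d] {s γ C : ℝ} (hs : 0 < s) (hd : 2 * s < d)
    (hγ0 : 0 ≤ γ) (hγs : γ < 2 * s) (hC : 0 < C) :
    ∃ A : ℝ, 0 < A ∧ ∀ (γ₀ c : ℝ) (ρ : Ed d → ℝ), 0 ≤ γ₀ → γ₀ ≤ γ →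
      AdmissibleWeight d ρ γ₀ γ c C → ∀ (w : Ed d → ℝ) (B : ℝ), Measurable w →
      (∀ x, |w x| ≤ B) → Integrable w (weightMeasure ρ) → ∀ R : ℝ, 0 < R →
      ∫⁻ x, ENNReal.ofReal (w x ^ 2) ∂weightMeasure ρ ≤
        ENNReal.ofReal A * (ENNReal.ofReal (R ^ (2 * s - γ)) +
          ENNReal.ofReal (R ^ (2 * s - d)) * weightMeasure ρ {x | w x ≠ 0}) *
          ∫⁻ x, localEnergy d s w x := by
  obtain ⟨A, hA, hbd⟩ := exists_sq_bound (d := d) hs hd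
  obtain ⟨I, hI, hrad⟩ := exists_radial_integral (d := d) (a := d + γ - 2 * s) (by linarith)
  have hd0 : 0 < d := NeZero.pos d
  refine ⟨A * (C + C * I + 1), by positivity, ?_⟩
  intro γ₀ c ρ hγ₀ hγ₀γ hρ w B hw hB hi R hR
  have hle := hρ.ae_le hd0 hγ₀γ
  have hge := hρ.ae_ge hd0 hγ₀ hγ₀γ
  obtain ⟨hc, hcC, hρm, hpos, -, -⟩ := hρ
  have hlim := tendsto_average_zero hρm hpos hc hγ0 (by linarith) hge hw hB hi
  have hx0 : ∀ᵐ x : Ed d, x ≠ 0 := by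
    have : Nonempty (Fin d) := ⟨⟨0, hd0⟩⟩
    simp [ae_iff]
  set E := ∫⁻ x, localEnergy d s w x with hE
  set Ω : Set (Ed d) := {x | w x ≠ 0} with hΩ
  have hΩm : MeasurableSet Ω := hw (measurableSet_singleton 0).compl
  have hνΩ : ∫⁻ x, Ω.indicator (fun x => ENNReal.ofReal (ρ x)) x = weightMeasure ρ Ω := by
    rw [lintegral_indicator hΩm, weightMeasure, withDensity_apply _ hΩm]
  have key : ∀ᵐ x : Ed d, ENNReal.ofReal (ρ x) * ENNReal.ofReal (w x ^ 2) ≤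
      ENNReal.ofReal (A * C * R ^ (2 * s - γ)) * localEnergy d s w x +
      (ENNReal.ofReal (A * C) * E) * (Metric.ball (0 : Ed d) R).indicator
        (fun x => ENNReal.ofReal (‖x‖ ^ (-(d + γ - 2 * s)))) x +
      (ENNReal.ofReal (A * R ^ (2 * s - d)) * E) * Ω.indicator
        (fun x => ENNReal.ofReal (ρ x)) x := by
    filter_upwards [hle, hx0] with x hx hx0
    have hx0 := norm_pos_iff.2 hx0
    by_cases hwx : w x = 0
    · simp [hwx]
    by_cases hxR : ‖x‖ < R
    · have h := mul_le_mul_right (hbd w B hw hB hlim x ‖x‖ hx0) (ENNReal.ofReal (ρ x))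
      refine le_add_right (h.trans ?_)
      rw [mul_add, ← mul_assoc, ← mul_assoc, ← ENNReal.ofReal_mul (hpos x).le,
        ← ENNReal.ofReal_mul (hpos x).le, indicator_of_mem (by simpa using hxR),
        mul_right_comm (ENNReal.ofReal (A * C)) E,
        ← ENNReal.ofReal_mul (by positivity)]
      gcongr ?_ * _ + ?_ * _
      · refine ENNReal.ofReal_le_ofReal ?_
        calc ρ x * (A * ‖x‖ ^ (2 * s)) ≤ C * ‖x‖ ^ (-γ) * (A * ‖x‖ ^ (2 * s)) := by gcongr
          _ = A * C * ‖x‖ ^ (2 * s - γ) := by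
            rw [sub_eq_add_neg, Real.rpow_add hx0]; ring
          _ ≤ _ := by
            gcongr
      · refine ENNReal.ofReal_le_ofReal ?_
        calc ρ x * (A * ‖x‖ ^ (2 * s - d)) ≤ C * ‖x‖ ^ (-γ) * (A * ‖x‖ ^ (2 * s - d)) := by gcongr
          _ = A * C * ‖x‖ ^ (-(d + γ - 2 * s)) := by
            rw [show -(d + γ - 2 * s) = -γ + (2 * s - d) by ring, Real.rpow_add hx0]; ring
    · have h := mul_le_mul_right (hbd w B hw hB hlim x R hR) (ENNReal.ofReal (ρ x))
      refine h.trans ?_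
      have hxΩ : x ∈ Ω := hwx
      rw [mul_add, ← mul_assoc, ← ENNReal.ofReal_mul (hpos x).le,
        indicator_of_notMem (by simpa using hxR), mul_zero, add_zero, indicator_of_mem hxΩ,
        mul_comm (ENNReal.ofReal (ρ x)) (_ * E)]
      gcongr ?_ * _ + _
      refine ENNReal.ofReal_le_ofReal ?_
      have hRx : R ≤ ‖x‖ := not_lt.1 hxR
      calc ρ x * (A * R ^ (2 * s)) ≤ C * ‖x‖ ^ (-γ) * (A * R ^ (2 * s)) := by gcongr
        _ ≤ C * R ^ (-γ) * (A * R ^ (2 * s)) := by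
          gcongr ?_ * ?_ * _
          exact Real.rpow_le_rpow_of_nonpos hR hRx (by linarith)
        _ = _ := by rw [sub_eq_add_neg, Real.rpow_add hR]; ring
  rw [lintegral_weightMeasure hρm (by fun_prop)]
  refine (lintegral_mono_ae key).trans ?_
  have hm1 : Measurable fun x : Ed d =>
      ENNReal.ofReal (A * C * R ^ (2 * s - γ)) * localEnergy d s w x := by fun_prop
  have hm2 : Measurable fun x : Ed d => (Metric.ball (0 : Ed d) R).indicator
      (fun x => ENNReal.ofReal (‖x‖ ^ (-(d + γ - 2 * s)))) x :=
    Measurable.indicator (by fun_prop) measurableSet_ball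
  have hm3 : Measurable fun x : Ed d => Ω.indicator (fun x => ENNReal.ofReal (ρ x)) x :=
    Measurable.indicator (by fun_prop) hΩm
  rw [lintegral_add_right _ (hm3.const_mul _), lintegral_add_right _ (hm2.const_mul _),
    lintegral_const_mul _ (measurable_localEnergy hw), lintegral_const_mul _ hm2,
    lintegral_const_mul _ hm3, hνΩ, lintegral_indicator measurableSet_ball, ← hE]
  have h2 := hrad R hR
  rw [show d - (d + γ - 2 * s) = 2 * s - γ by ring] at h2
  calc _ ≤ ENNReal.ofReal (A * C * R ^ (2 * s - γ)) * E + ENNReal.ofReal (A * C) * E *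
        ENNReal.ofReal (I * R ^ (2 * s - γ)) +
        ENNReal.ofReal (A * R ^ (2 * s - d)) * E * weightMeasure ρ Ω := by gcongr
    _ = (ENNReal.ofReal (A * (C + C * I) * R ^ (2 * s - γ)) +
        ENNReal.ofReal (A * R ^ (2 * s - d)) * weightMeasure ρ Ω) * E := by
      rw [show A * (C + C * I) * R ^ (2 * s - γ) =
        A * C * R ^ (2 * s - γ) + (A * C) * (I * R ^ (2 * s - γ)) by ring,
        ENNReal.ofReal_add (by positivity) (by positivity),
        ENNReal.ofReal_mul (p := A * C) (q := I * _) (by positivity)]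
      ring
    _ ≤ (ENNReal.ofReal (A * (C + C * I + 1) * R ^ (2 * s - γ)) +
        ENNReal.ofReal (A * (C + C * I + 1) * R ^ (2 * s - d)) * weightMeasure ρ Ω) * E := by
      gcongr (ENNReal.ofReal (A * ?_ * _) + ENNReal.ofReal (?_ * _) * _) * _
      · linarith
      · have : 0 ≤ A * (C + C * I) := by positivity
        linarith
    _ = _ := by
      rw [ENNReal.ofReal_mul (q := R ^ (2 * s - γ)) (by positivity),
        ENNReal.ofReal_mul (q := R ^ (2 * s - d)) (by positivity)]
      ring

theorem exists_faberKrahn [NeZero d] {s γ C κ : ℝ} (hs : 0 < s) (hd : 2 * s < d) (hκ : 0 < κ)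
    (hγ0 : 0 ≤ γ) (hγs : γ < 2 * s) (hC : 0 < C) :
    ∃ S : ℝ, 0 < S ∧ ∀ (γ₀ c : ℝ) (ρ : Ed d → ℝ), 0 ≤ γ₀ → γ₀ ≤ γ →
      AdmissibleWeight d ρ γ₀ γ c C →
      FaberKrahn (weightMeasure ρ) (jumpMeasure d s κ) S ((2 * s - γ) / (d - γ)) := by
  obtain ⟨A, hA, hbd⟩ := exists_faberKrahn_radius (d := d) hs hd hγ0 hγs hC
  refine ⟨A * 2 / (κ / 2), by positivity, ?_⟩
  intro γ₀ c ρ hγ₀ hγ₀γ hρ w B hw hB hi _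
  have h := hbd γ₀ c ρ hγ₀ hγ₀γ hρ w B hw hB hi
  obtain ⟨-, -, hρm, hpos, -, -⟩ := hρ
  set E := ∫⁻ x, localEnergy d s w x with hE
  have hσ : 0 < (2 * s - γ) / (d - γ) := div_pos (by linarith) (by linarith)
  have hrhs : ENNReal.ofReal (A * 2 / (κ / 2)) * energy (jumpMeasure d s κ) w =
      ENNReal.ofReal (A * 2) * E := by
    rw [energy_jump_eq_localEnergy hκ.le hw, ← hE, ← mul_assoc,
      ← ENNReal.ofReal_mul (by positivity), div_mul_cancel₀ _ (by positivity)]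
  rw [hrhs]
  rcases eq_or_ne (weightMeasure ρ {x | w x ≠ 0}) 0 with h0 | h0
  · have : ∀ᵐ x ∂weightMeasure ρ, w x = 0 := by
      rw [ae_iff]; exact h0
    rw [lintegral_congr_ae (g := fun _ => 0) (this.mono fun x hx => by simp [hx])]
    simp
  rcases eq_or_ne E 0 with hE0 | hE0
  · have := h 1 one_pos
    rw [hE0, mul_zero] at this
    exact this.trans (by simp)
  rcases eq_or_ne (weightMeasure ρ {x | w x ≠ 0}) ⊤ with ht | ht
  · rw [ht, ENNReal.top_rpow_of_pos hσ, ENNReal.mul_top]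
    · exact le_top
    · refine mul_ne_zero ?_ hE0
      rw [Ne, ENNReal.ofReal_eq_zero, not_le]
      positivity
  set V := (weightMeasure ρ {x | w x ≠ 0}).toReal with hV
  have hV0 : 0 < V := ENNReal.toReal_pos h0 ht
  have hVe : weightMeasure ρ {x | w x ≠ 0} = ENNReal.ofReal V := (ENNReal.ofReal_toReal ht).symm
  have hdγ : 0 < d - γ := by linarith
  have h1 := h (V ^ (1 / (d - γ))) (by positivity)
  refine h1.trans (le_of_eq ?_)
  rw [hVe, ENNReal.ofReal_rpow_of_pos hV0, ← ENNReal.ofReal_mul (by positivity),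
    ← Real.rpow_mul hV0.le, ← Real.rpow_mul hV0.le]
  have e2 : V ^ (1 / (d - γ) * (2 * s - d)) * V = V ^ ((2 * s - γ) / (d - γ)) := by
    conv_lhs => rw [← Real.rpow_one V]
    rw [← Real.rpow_mul hV0.le, ← Real.rpow_add hV0]
    congr 1
    field_simp
    ring
  rw [e2, show 1 / (d - γ) * (2 * s - γ) = (2 * s - γ) / (d - γ) by ring,
    ENNReal.ofReal_mul hA.le, show ENNReal.ofReal 2 = 2 by simp]
  ring

end WeightedFaberKrahn

section Rellich

variable {d : ℕ}

/-- A countable partition of space into sets contained in balls of radius `1 / (k + 1)`. -/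
def cell (d k i : ℕ) : Set (Ed d) :=
  disjointed (fun i => Metric.ball (TopologicalSpace.denseSeq (Ed d) i) (1 / ((k : ℝ) + 1))) i

lemma measurableSet_cell (k i : ℕ) : MeasurableSet (cell d k i) :=
  .disjointed (fun _ => measurableSet_ball) i

lemma cell_subset (k i : ℕ) :
    cell d k i ⊆ Metric.ball (TopologicalSpace.denseSeq (Ed d) i) (1 / ((k : ℝ) + 1)) :=
  disjointed_subset _ i

lemma pairwise_disjoint_cell (k : ℕ) : Pairwise (Function.onFun Disjoint (cell d k)) :=
  disjoint_disjointed _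

lemma exists_ball_subset_cells (k : ℕ) (R : ℝ) :
    ∃ N : ℕ, Metric.ball (0 : Ed d) R ⊆ ⋃ i ∈ Finset.range N, cell d k i := by
  have hk : 0 < 1 / ((k : ℝ) + 1) := by positivity
  have hcov : Metric.closedBall (0 : Ed d) R ⊆
      ⋃ i, Metric.ball (TopologicalSpace.denseSeq (Ed d) i) (1 / ((k : ℝ) + 1)) := by
    intro x _
    obtain ⟨i, hi⟩ := (TopologicalSpace.denseRange_denseSeq (Ed d)).exists_dist_lt x hk
    exact mem_iUnion.2 ⟨i, hi⟩
  obtain ⟨t, ht⟩ := (isCompact_closedBall (0 : Ed d) R).elim_finite_subcover _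
    (fun _ => Metric.isOpen_ball) hcov
  refine ⟨t.sup id + 1, fun x hx => ?_⟩
  obtain ⟨i, hit, hxi⟩ := mem_iUnion₂.1 (ht (Metric.ball_subset_closedBall hx))
  have hx' : x ∈ ⋃ j ≤ i, cell d k j := by
    have := partialSups_disjointed
      (fun i => Metric.ball (TopologicalSpace.denseSeq (Ed d) i) (1 / ((k : ℝ) + 1)))
    have h2 := congrFun (congrArg DFunLike.coe this) i
    rw [partialSups_eq_biSup, partialSups_eq_biSup] at h2
    change x ∈ ⨆ j ≤ i, cell d k j
    change (⨆ j ≤ i, cell d k j) = _ at h2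
    rw [h2]
    exact mem_iUnion₂.2 ⟨i, le_rfl, hxi⟩
  obtain ⟨j, hj, hxj⟩ := mem_iUnion₂.1 hx'
  refine mem_iUnion₂.2 ⟨j, ?_, hxj⟩
  have : i ≤ t.sup id := Finset.le_sup (f := id) hit
  simp only [Finset.mem_range]
  omega

lemma exists_weight_level {ρ : Ed d → ℝ} (hρ : Measurable ρ) {R : ℝ}
    (hfin : weightMeasure ρ (Metric.ball 0 R) ≠ ⊤) {η : ℝ} (hη : 0 < η) :
    ∃ l : ℝ, 0 < l ∧
      weightMeasure ρ (Metric.ball 0 R ∩ {x | l < ρ x}) ≤ ENNReal.ofReal η := by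
  have h : Tendsto (fun n : ℕ => weightMeasure ρ (Metric.ball 0 R ∩ {x | (n : ℝ) < ρ x})) atTop
      (𝓝 (weightMeasure ρ (⋂ n : ℕ, Metric.ball 0 R ∩ {x | (n : ℝ) < ρ x}))) := by
    refine tendsto_measure_iInter_atTop (fun n =>
      (measurableSet_ball.inter (measurableSet_lt measurable_const hρ)).nullMeasurableSet) ?_ ?_
    · exact fun a b hab => inter_subset_inter_right _ fun x (hx : (b : ℝ) < ρ x) =>
        lt_of_le_of_lt (by exact_mod_cast hab) hx
    · exact ⟨0, ((measure_mono inter_subset_left).trans_lt hfin.lt_top).ne⟩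
  have h0 : (⋂ n : ℕ, Metric.ball (0 : Ed d) R ∩ {x | (n : ℝ) < ρ x}) = ∅ := by
    refine eq_empty_of_forall_notMem fun x hx => ?_
    obtain ⟨n, hn⟩ := exists_nat_ge (ρ x)
    exact (not_lt.2 hn) (mem_iInter.1 hx n).2
  rw [h0, measure_empty] at h
  obtain ⟨n, hn, hn1⟩ := ((h.eventually (Iic_mem_nhds (ENNReal.ofReal_pos.2 hη))).and
    (eventually_ge_atTop 1)).exists
  exact ⟨n, by exact_mod_cast hn1, hn⟩

lemma lintegral_cell_le [NeZero d] {s : ℝ} (hs : 0 < s) {ρ : Ed d → ℝ} (hρ : Measurable ρ)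
    {k i : ℕ} {Q : Set (Ed d)} (hQm : MeasurableSet Q) (hQ : Q ⊆ cell d k i) {w : Ed d → ℝ}
    (hw : Measurable w) {B : ℝ} (hB : ∀ x, |w x| ≤ B) {l δ : ℝ} (hl : 0 < l) (hδ : 0 < δ) :
    ∃ a : ℝ, |a| ≤ B ∧ ∫⁻ x in Q, ENNReal.ofReal |w x - a| ∂weightMeasure ρ ≤
      ENNReal.ofReal (2 * B) * weightMeasure ρ (Q ∩ {x | l < ρ x}) +
      ENNReal.ofReal δ * weightMeasure ρ Q +
      ENNReal.ofReal (l / δ * (2 ^ ((d : ℝ) + 2 * s) /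
        volume.real (Metric.ball (0 : Ed d) 1)) * (1 / ((k : ℝ) + 1)) ^ (2 * s)) *
        ∫⁻ x in Q, localEnergy d s w x := by
  set ω := volume.real (Metric.ball (0 : Ed d) 1) with hω
  have hω0 : 0 < ω := volume_real_unitBall_pos
  set z := TopologicalSpace.denseSeq (Ed d) i
  set r : ℝ := 1 / ((k : ℝ) + 1) with hr
  have hr0 : 0 < r := by positivity
  set a := ⨍ y in Metric.ball z r, w y with ha
  have haB : |a| ≤ B := by
    have hv : 0 < volume.real (Metric.ball z r) :=
      ENNReal.toReal_pos (Metric.measure_ball_pos _ _ hr0).ne' measure_ball_lt_top.ne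
    rw [ha, setAverage_eq, smul_eq_mul, abs_mul, abs_of_pos (inv_pos.2 hv)]
    have := norm_setIntegral_le_of_norm_le_const (μ := volume) (s := Metric.ball z r) (f := w)
      (C := B) measure_ball_lt_top fun x _ => by simpa using hB x
    rw [Real.norm_eq_abs] at this
    rw [inv_mul_le_iff₀ hv, mul_comm]
    exact this
  refine ⟨a, haB, ?_⟩
  have hpt : ∀ x ∈ Q, ENNReal.ofReal (ρ x) * ENNReal.ofReal |w x - a| ≤
      ENNReal.ofReal (2 * B) * {x | l < ρ x}.indicator (fun x => ENNReal.ofReal (ρ x)) x +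
      ENNReal.ofReal δ * ENNReal.ofReal (ρ x) +
      ENNReal.ofReal (l / δ * (2 ^ ((d : ℝ) + 2 * s) / ω) * r ^ (2 * s)) *
        localEnergy d s w x := by
    intro x hx
    by_cases hlx : l < ρ x
    · rw [indicator_of_mem (by exact hlx), add_assoc]
      refine le_add_right ?_
      rw [mul_comm]
      gcongr
      exact (abs_sub _ _).trans (by linarith [hB x])
    · rw [indicator_of_notMem (by exact hlx), mul_zero, zero_add]
      rcases le_or_gt (ρ x) 0 with hρ0 | hρ0
      · simp [ENNReal.ofReal_of_nonpos hρ0]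
      have hsub : Metric.ball z r ⊆ Metric.closedBall x (2 * r) := by
        intro y hy
        have h1 : dist x z < r := cell_subset k i (hQ hx)
        have h2 : dist y z < r := hy
        rw [Metric.mem_closedBall]
        linarith [dist_triangle_right y x z]
      have h2 := sq_sub_average_le_localEnergy hs hw hB measurableSet_ball
        (Metric.measure_ball_pos _ _ hr0).ne' hsub
      rw [volume_ball_eq z hr0.le, ← ENNReal.ofReal_inv_of_pos (by positivity),
        ← ENNReal.ofReal_mul (by positivity), ← ha, ← hω] at h2
      have e1 : (r ^ d * ω)⁻¹ * (2 * r) ^ ((d : ℝ) + 2 * s) =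
          2 ^ ((d : ℝ) + 2 * s) / ω * r ^ (2 * s) := by
        rw [Real.mul_rpow zero_le_two hr0.le, Real.rpow_add hr0, Real.rpow_natCast]
        field_simp
      rw [e1] at h2
      have h3 : |w x - a| ≤ δ + 1 / δ * (w x - a) ^ 2 := by
        rw [← sub_nonneg, ← sq_abs]
        have : δ + 1 / δ * |w x - a| ^ 2 - |w x - a| =
            ((|w x - a| - δ) ^ 2 + |w x - a| * δ) / δ := by field_simp; ring
        rw [this]
        positivity
      calc ENNReal.ofReal (ρ x) * ENNReal.ofReal |w x - a|
          ≤ ENNReal.ofReal (ρ x) * (ENNReal.ofReal δ +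
              ENNReal.ofReal (1 / δ) * ENNReal.ofReal ((w x - a) ^ 2)) := by
            rw [← ENNReal.ofReal_mul (p := 1 / δ) (by positivity),
              ← ENNReal.ofReal_add hδ.le (by positivity)]
            gcongr
        _ ≤ ENNReal.ofReal δ * ENNReal.ofReal (ρ x) + ENNReal.ofReal l * (ENNReal.ofReal (1 / δ) *
              (ENNReal.ofReal (2 ^ ((d : ℝ) + 2 * s) / ω * r ^ (2 * s)) *
                localEnergy d s w x)) := by
            rw [mul_add, mul_comm (ENNReal.ofReal (ρ x)) (ENNReal.ofReal δ)]
            gcongr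
            exact not_lt.1 hlx
        _ = _ := by
            rw [← mul_assoc (ENNReal.ofReal (1 / δ)), ← mul_assoc (ENNReal.ofReal l),
              ← ENNReal.ofReal_mul (p := 1 / δ) (by positivity),
              ← ENNReal.ofReal_mul (p := l) (by positivity)]
            congr 3
            ring
  rw [weightMeasure, setLIntegral_withDensity_eq_setLIntegral_mul _ (by fun_prop) (by fun_prop)
    hQm]
  refine (setLIntegral_mono' hQm hpt).trans (le_of_eq ?_)
  have hS : MeasurableSet {x | l < ρ x} := measurableSet_lt measurable_const hρ
  have hm1 : Measurable fun x => {x | l < ρ x}.indicator (fun x => ENNReal.ofReal (ρ x)) x :=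
    Measurable.indicator (by fun_prop) hS
  have hm2 : Measurable fun x => ENNReal.ofReal (ρ x) := by fun_prop
  rw [lintegral_add_right _ ((measurable_localEnergy hw).const_mul _),
    lintegral_add_right _ (hm2.const_mul _), lintegral_const_mul _ hm1, lintegral_const_mul _ hm2,
    lintegral_const_mul _ (measurable_localEnergy hw), setLIntegral_indicator hS,
    withDensity_apply _ (hQm.inter hS), withDensity_apply _ hQm, inter_comm Q]

/-- A quantitative form of the Rellich compactness theorem. -/
theorem exists_rellich [NeZero d] {s κ : ℝ} (hs : 0 < s) (hκ : 0 < κ) {ρ : Ed d → ℝ}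
    (hρ : Measurable ρ) {R : ℝ} (hfin : weightMeasure ρ (Metric.ball 0 R) ≠ ⊤) {B η : ℝ}
    (hB0 : 0 < B) (hη : 0 < η) :
    ∃ k N : ℕ, ∀ f w : Ed d → ℝ, Measurable f → Measurable w → (∀ x, |f x| ≤ B) →
      (∀ x, |w x| ≤ B) → energy (jumpMeasure d s κ) w ≠ ⊤ →
      |∫ x in Metric.ball 0 R, f x * w x ∂weightMeasure ρ| ≤
        η * (1 + (energy (jumpMeasure d s κ) w).toReal) +
        B * ∑ i ∈ Finset.range N,
          |∫ x in cell d k i ∩ Metric.ball 0 R, f x ∂weightMeasure ρ| := by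
  set ω := volume.real (Metric.ball (0 : Ed d) 1) with hω
  have hω0 : 0 < ω := volume_real_unitBall_pos
  set ν := weightMeasure ρ with hν
  set V := (ν (Metric.ball 0 R)).toReal with hV
  have hV0 : 0 ≤ V := ENNReal.toReal_nonneg
  obtain ⟨l, hl, hlν⟩ := exists_weight_level hρ hfin (η := η / (4 * B * B)) (by positivity)
  set δ := η / (2 * B * (V + 1)) with hδ
  have hδ0 : 0 < δ := by positivity
  have hlim : Tendsto (fun k : ℕ => B * (l / δ * (2 ^ ((d : ℝ) + 2 * s) / ω) *
      (1 / ((k : ℝ) + 1)) ^ (2 * s)) * (2 / κ)) atTop (𝓝 0) := by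
    have h1 : Tendsto (fun k : ℕ => (1 / ((k : ℝ) + 1)) ^ (2 * s)) atTop (𝓝 0) := by
      have := (tendsto_one_div_add_atTop_nhds_zero_nat (𝕜 := ℝ)).rpow_const
        (p := 2 * s) (Or.inr (by positivity))
      rwa [Real.zero_rpow (by positivity)] at this
    simpa using ((h1.const_mul (l / δ * (2 ^ ((d : ℝ) + 2 * s) / ω))).const_mul B).mul_const (2 / κ)
  obtain ⟨k, hk⟩ := (hlim.eventually (Iic_mem_nhds hη)).exists
  obtain ⟨N, hN⟩ := exists_ball_subset_cells (d := d) k R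
  refine ⟨k, N, fun f w hf hw hfB hwB hE => ?_⟩
  set c1 := l / δ * (2 ^ ((d : ℝ) + 2 * s) / ω) * (1 / ((k : ℝ) + 1)) ^ (2 * s) with hc1
  have hc10 : 0 ≤ c1 := by positivity
  set Q : ℕ → Set (Ed d) := fun i => cell d k i ∩ Metric.ball 0 R with hQ
  have hQm : ∀ i, MeasurableSet (Q i) := fun i => (measurableSet_cell k i).inter measurableSet_ball
  have hQd : Pairwise (Function.onFun Disjoint Q) := fun i j hij =>
    (pairwise_disjoint_cell k hij).mono inter_subset_left inter_subset_left
  have hQU : Metric.ball 0 R = ⋃ i ∈ Finset.range N, Q i := by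
    rw [hQ, ← iUnion₂_inter]
    exact (inter_eq_right.2 hN).symm
  have hQfin : ∀ i, ν (Q i) ≠ ⊤ := fun i =>
    ((measure_mono inter_subset_right).trans_lt hfin.lt_top).ne
  have hint : ∀ g : Ed d → ℝ, Measurable g → ∀ b : ℝ, (∀ x, |g x| ≤ b) → ∀ i,
      IntegrableOn g (Q i) ν := fun g hg b hb i =>
    Measure.integrableOn_of_bounded (M := b) (hQfin i) hg.aestronglyMeasurable
      (.of_forall fun x => by simpa using hb x)
  choose a haB ha using fun i => lintegral_cell_le hs hρ (hQm i) (k := k) (i := i)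
    inter_subset_left hw hwB hl hδ0
  have hmain : ∀ i, |∫ x in Q i, f x * w x ∂ν| ≤ B * |∫ x in Q i, f x ∂ν| +
      B * ∫ x in Q i, |w x - a i| ∂ν := by
    intro i
    have hfw : IntegrableOn (fun x => f x * (w x - a i)) (Q i) ν :=
      hint _ (by fun_prop) (B * (B + B)) (fun x => by
        rw [abs_mul]
        have h1 := hfB x
        have h2 := (abs_sub (w x) (a i)).trans (add_le_add (hwB x) (haB i))
        gcongr) i
    have hwa : IntegrableOn (fun x => |w x - a i|) (Q i) ν :=
      hint _ (by fun_prop) (B + B) (fun x => by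
        rw [abs_abs]
        exact (abs_sub _ _).trans (add_le_add (hwB x) (haB i))) i
    have e : ∫ x in Q i, f x * w x ∂ν =
        a i * (∫ x in Q i, f x ∂ν) + ∫ x in Q i, f x * (w x - a i) ∂ν := by
      rw [← integral_const_mul, ← integral_add ((hint f hf B hfB i).const_mul _) hfw]
      exact integral_congr_ae (.of_forall fun x => by ring)
    rw [e]
    refine (abs_add_le _ _).trans (add_le_add ?_ ?_)
    · rw [abs_mul]
      gcongr
      exact haB i
    · rw [← integral_const_mul]
      refine (abs_integral_le_integral_abs).trans (integral_mono hfw.abs (hwa.const_mul _) ?_)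
      intro x
      simp only [abs_mul]
      gcongr
      exact hfB x
  have hsum : ∑ i ∈ Finset.range N, ∫ x in Q i, |w x - a i| ∂ν ≤
      2 * B * (η / (4 * B * B)) + δ * V + c1 * (2 / κ * (energy (jumpMeasure d s κ) w).toReal) := by
    rw [← ENNReal.ofReal_le_ofReal_iff (by positivity),
      ENNReal.ofReal_sum_of_nonneg fun i _ => integral_nonneg fun x => abs_nonneg _]
    calc ∑ i ∈ Finset.range N, ENNReal.ofReal (∫ x in Q i, |w x - a i| ∂ν)
        ≤ ∑ i ∈ Finset.range N, (ENNReal.ofReal (2 * B) * ν (Q i ∩ {x | l < ρ x}) +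
            ENNReal.ofReal δ * ν (Q i) + ENNReal.ofReal c1 *
            ∫⁻ x in Q i, localEnergy d s w x) := by
          refine Finset.sum_le_sum fun i _ => ?_
          rw [ofReal_integral_eq_lintegral_ofReal _ (.of_forall fun x => abs_nonneg _)]
          · exact ha i
          · exact hint _ (by fun_prop) (B + B) (fun x => by
              rw [abs_abs]
              exact (abs_sub _ _).trans (add_le_add (hwB x) (haB i))) i
      _ = ENNReal.ofReal (2 * B) * ν (Metric.ball 0 R ∩ {x | l < ρ x}) +
            ENNReal.ofReal δ * ν (Metric.ball 0 R) + ENNReal.ofReal c1 *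
            ∫⁻ x in Metric.ball 0 R, localEnergy d s w x := by
          rw [Finset.sum_add_distrib, Finset.sum_add_distrib, ← Finset.mul_sum, ← Finset.mul_sum,
            ← Finset.mul_sum]
          have h1 : ν (Metric.ball 0 R) = ∑ i ∈ Finset.range N, ν (Q i) := by
            rw [hQU]
            exact measure_biUnion_finset (hQd.set_pairwise _) fun i _ => hQm i
          have h2 : ν (Metric.ball 0 R ∩ {x | l < ρ x}) =
              ∑ i ∈ Finset.range N, ν (Q i ∩ {x | l < ρ x}) := by
            rw [hQU, iUnion₂_inter]
            exact measure_biUnion_finset (fun i _ j _ hij => (hQd hij).mono inter_subset_left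
              inter_subset_left) fun i _ => (hQm i).inter (measurableSet_lt measurable_const hρ)
          have h3 : ∫⁻ x in Metric.ball 0 R, localEnergy d s w x =
              ∑ i ∈ Finset.range N, ∫⁻ x in Q i, localEnergy d s w x := by
            rw [hQU]
            exact lintegral_biUnion_finset (hQd.set_pairwise _) (fun i _ => hQm i) _
          rw [h1, h2, h3]
      _ ≤ ENNReal.ofReal (2 * B) * ENNReal.ofReal (η / (4 * B * B)) +
            ENNReal.ofReal δ * ENNReal.ofReal V + ENNReal.ofReal c1 *
            (ENNReal.ofReal (2 / κ) * energy (jumpMeasure d s κ) w) := by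
          rw [energy_jump_eq_localEnergy hκ.le hw, ← mul_assoc (ENNReal.ofReal (2 / κ)),
            ← ENNReal.ofReal_mul (p := 2 / κ) (by positivity),
            show (2 / κ * (κ / 2) : ℝ) = 1 by field_simp,
            ENNReal.ofReal_one, one_mul, hV, ENNReal.ofReal_toReal hfin]
          exact add_le_add (add_le_add (mul_le_mul_right hlν _) le_rfl)
            (mul_le_mul_right (setLIntegral_le_lintegral _ _) _)
      _ = _ := by
          conv_lhs => rw [← ENNReal.ofReal_toReal hE]
          rw [← ENNReal.ofReal_mul (by positivity), ← ENNReal.ofReal_mul (by positivity),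
            ← ENNReal.ofReal_mul (by positivity), ← ENNReal.ofReal_mul (by positivity),
            ← ENNReal.ofReal_add (by positivity) (by positivity),
            ← ENNReal.ofReal_add (by positivity) (by positivity)]
  have hsplit : ∫ x in Metric.ball 0 R, f x * w x ∂ν =
      ∑ i ∈ Finset.range N, ∫ x in Q i, f x * w x ∂ν := by
    rw [hQU]
    refine integral_biUnion_finset _ (fun i _ => hQm i) (hQd.set_pairwise _) fun i _ => ?_
    refine hint _ (by fun_prop) (B * B) (fun x => ?_) i
    rw [abs_mul]
    have h1 := hfB x
    have h2 := hwB x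
    gcongr
  rw [hsplit]
  have hk : B * c1 * (2 / κ) ≤ η := hk
  set En := (energy (jumpMeasure d s κ) w).toReal
  have hEn : 0 ≤ En := ENNReal.toReal_nonneg
  calc |∑ i ∈ Finset.range N, ∫ x in Q i, f x * w x ∂ν|
      ≤ ∑ i ∈ Finset.range N, (B * |∫ x in Q i, f x ∂ν| + B * ∫ x in Q i, |w x - a i| ∂ν) :=
        (Finset.abs_sum_le_sum_abs _ _).trans (Finset.sum_le_sum fun i _ => hmain i)
    _ = B * (∑ i ∈ Finset.range N, |∫ x in Q i, f x ∂ν|) +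
        B * ∑ i ∈ Finset.range N, ∫ x in Q i, |w x - a i| ∂ν := by
        rw [Finset.sum_add_distrib, ← Finset.mul_sum, ← Finset.mul_sum]
    _ ≤ B * (∑ i ∈ Finset.range N, |∫ x in Q i, f x ∂ν|) +
        B * (2 * B * (η / (4 * B * B)) + δ * V + c1 * (2 / κ * En)) := by gcongr
    _ ≤ _ := by
        have h1 : B * (2 * B * (η / (4 * B * B))) = η / 2 := by field_simp; ring
        have h2 : B * (δ * V) ≤ η / 2 := by
          have : B * (δ * V) = η / 2 * (V / (V + 1)) := by rw [hδ]; field_simp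
          rw [this]
          exact mul_le_of_le_one_right (by positivity) ((div_le_one (by positivity)).2 (by linarith))
        have h3 : B * (c1 * (2 / κ * En)) ≤ η * En := by
          rw [show B * (c1 * (2 / κ * En)) = B * c1 * (2 / κ) * En by ring]
          gcongr
        linarith

end Rellich

section TestFunctions

variable {d : ℕ}

/-- Size `A` and scale `R` of a test function. -/
structure TestBound (A R : ℝ) (φ : Ed d → ℝ) : Prop where
  cont : Continuous φ
  bound : ∀ x, |φ x| ≤ A
  eq_zero : ∀ x, R ≤ ‖x‖ → φ x = 0
  diff : ∀ x y, |φ x - φ y| ≤ A * (‖x - y‖ / R)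
  diff₂ : ∀ x z, |φ (x + z) + φ (x - z) - 2 * φ x| ≤ A * (‖z‖ / R) ^ 2

/-- The kernel `|z|^{-d-2s}` weighted to be integrable. -/
def tameKernel (d : ℕ) (s : ℝ) (z : Ed d) : ℝ := min (‖z‖ ^ 2) 1 * ‖z‖ ^ (-((d : ℝ) + 2 * s))

/-- The kernel `|z|^{-d-2s}` truncated near the origin. -/
def cutKernel (d : ℕ) (s ε : ℝ) (z : Ed d) : ℝ :=
  (Metric.closedBall (0 : Ed d) ε)ᶜ.indicator (fun z => ‖z‖ ^ (-((d : ℝ) + 2 * s))) z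

@[fun_prop]
lemma measurable_tameKernel (s : ℝ) : Measurable (tameKernel d s) := by
  unfold tameKernel; fun_prop

@[fun_prop]
lemma measurable_cutKernel (s ε : ℝ) : Measurable (cutKernel d s ε) := by
  unfold cutKernel
  exact Measurable.indicator (by fun_prop) measurableSet_closedBall.compl

lemma tameKernel_nonneg (s : ℝ) (z : Ed d) : 0 ≤ tameKernel d s z := by
  unfold tameKernel; positivity

lemma cutKernel_nonneg (s ε : ℝ) (z : Ed d) : 0 ≤ cutKernel d s ε z :=
  indicator_nonneg (fun z _ => by positivity) z

lemma cutKernel_le (s ε : ℝ) (z : Ed d) : cutKernel d s ε z ≤ ‖z‖ ^ (-((d : ℝ) + 2 * s)) :=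
  indicator_le_self' (fun z _ => by positivity) z

lemma cutKernel_neg (s ε : ℝ) (z : Ed d) : cutKernel d s ε (-z) = cutKernel d s ε z := by
  simp [cutKernel, indicator]

lemma integrable_tameKernel [NeZero d] {s : ℝ} (hs0 : 0 < s) (hs1 : s < 1) :
    Integrable (tameKernel d s) := by
  have hfin : Module.finrank ℝ (Ed d) = d := by simp
  rw [← integrableOn_univ, ← union_compl_self (Metric.ball (0 : Ed d) 1)]
  refine IntegrableOn.union ?_ ?_
  · refine integrableOn_ball_of_norm_le_rpow (C := 1) (α := d + 2 * s - 2) ?_ ?_ ?_ ?_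
    · rw [hfin]; exact NeZero.one_le
    · rw [hfin]; linarith
    · refine .of_forall fun x => ?_
      rw [one_mul, Real.norm_of_nonneg (tameKernel_nonneg s x)]
      rcases eq_or_ne x 0 with rfl | hx
      · simp [tameKernel]
        positivity
      · have hx := norm_pos_iff.2 hx
        have : -((d : ℝ) + 2 * s - 2) = 2 + -((d : ℝ) + 2 * s) := by ring
        rw [this, Real.rpow_add hx, Real.rpow_two]
        unfold tameKernel
        gcongr
        exact min_le_left _ _
    · exact (measurable_tameKernel s).aestronglyMeasurable
  · have h := (integrable_one_add_norm (E := Ed d) (μ := volume) (r := d + 2 * s)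
      (by rw [hfin]; linarith)).const_mul (2 ^ ((d : ℝ) + 2 * s))
    refine (h.integrableOn (s := (Metric.ball (0 : Ed d) 1)ᶜ)).mono'
      (measurable_tameKernel s).aestronglyMeasurable ?_
    refine (ae_restrict_iff' measurableSet_ball.compl).2 (.of_forall fun x hx => ?_)
    have hx1 : 1 ≤ ‖x‖ := by simpa using hx
    rw [Real.norm_of_nonneg (tameKernel_nonneg s x)]
    have h1 : (2 * ‖x‖) ^ (-((d : ℝ) + 2 * s)) ≤ (1 + ‖x‖) ^ (-((d : ℝ) + 2 * s)) :=
      Real.rpow_le_rpow_of_nonpos (by positivity) (by linarith) (by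
        have : (0 : ℝ) ≤ d := by positivity
        linarith)
    rw [Real.mul_rpow zero_le_two (by positivity)] at h1
    calc tameKernel d s x ≤ 1 * ‖x‖ ^ (-((d : ℝ) + 2 * s)) := by
          unfold tameKernel
          gcongr
          exact min_le_right _ _
      _ = 2 ^ ((d : ℝ) + 2 * s) * (2 ^ (-((d : ℝ) + 2 * s)) * ‖x‖ ^ (-((d : ℝ) + 2 * s))) := by
          rw [← mul_assoc, ← Real.rpow_add two_pos, add_neg_cancel, Real.rpow_zero]
      _ ≤ _ := by gcongr

lemma integrable_cutKernel [NeZero d] {s ε : ℝ} (hs0 : 0 < s) (hs1 : s < 1) (hε : 0 < ε) :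
    Integrable (cutKernel d s ε) := by
  refine ((integrable_tameKernel hs0 hs1).const_mul (1 / min (ε ^ 2) 1)).mono'
    (measurable_cutKernel s ε).aestronglyMeasurable (.of_forall fun z => ?_)
  rw [Real.norm_of_nonneg (cutKernel_nonneg s ε z)]
  have h0 : 0 < min (ε ^ 2) 1 := by positivity
  by_cases hz : z ∈ (Metric.closedBall (0 : Ed d) ε)ᶜ
  · rw [cutKernel, indicator_of_mem hz, tameKernel, ← mul_assoc]
    have hz : ε < ‖z‖ := by simpa using hz
    refine le_mul_of_one_le_left (by positivity) ?_
    rw [one_div, ← div_eq_inv_mul, one_le_div h0]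
    gcongr
  · rw [cutKernel, indicator_of_notMem hz]
    have := tameKernel_nonneg s z
    positivity

/-- The integral of the scaled kernel. -/
lemma integral_tameKernel_scaled [NeZero d] {s R : ℝ} (hs0 : 0 < s) (hs1 : s < 1) (hR : 0 < R) :
    Integrable (fun z : Ed d => min ((‖z‖ / R) ^ 2) 1 * ‖z‖ ^ (-((d : ℝ) + 2 * s))) ∧
    ∫ z : Ed d, min ((‖z‖ / R) ^ 2) 1 * ‖z‖ ^ (-((d : ℝ) + 2 * s)) =
      R ^ (-(2 * s)) * ∫ z, tameKernel d s z := by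
  have h : (fun z : Ed d => min ((‖z‖ / R) ^ 2) 1 * ‖z‖ ^ (-((d : ℝ) + 2 * s))) =
      fun z => R ^ (-((d : ℝ) + 2 * s)) * tameKernel d s (R⁻¹ • z) := by
    funext z
    rw [tameKernel, norm_smul, Real.norm_of_nonneg (by positivity),
      Real.mul_rpow (by positivity) (by positivity), Real.inv_rpow hR.le, ← div_eq_inv_mul]
    have := (Real.rpow_pos_of_pos hR (-((d : ℝ) + 2 * s))).ne'
    field_simp
  rw [h]
  refine ⟨((integrable_tameKernel hs0 hs1).comp_smul (by positivity)).const_mul _, ?_⟩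
  rw [integral_const_mul, Measure.integral_comp_inv_smul, smul_eq_mul, ← mul_assoc]
  congr 1
  rw [finrank_euclideanSpace_fin, abs_of_pos (by positivity), ← Real.rpow_natCast,
    ← Real.rpow_add hR]
  congr 1
  ring

lemma TestBound.nonneg {A R : ℝ} {φ : Ed d → ℝ} (h : TestBound A R φ) : 0 ≤ A :=
  (abs_nonneg _).trans (h.bound 0)

lemma TestBound.integrable_cut [NeZero d] {A R s ε : ℝ} {φ : Ed d → ℝ} (h : TestBound A R φ)
    (hs0 : 0 < s) (hs1 : s < 1) (hε : 0 < ε) (x : Ed d) :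
    Integrable fun y => (φ x - φ y) * cutKernel d s ε (x - y) := by
  refine (((integrable_cutKernel hs0 hs1 hε).comp_sub_left x).const_mul (2 * A)).mono' ?_
    (.of_forall fun y => ?_)
  · have := h.cont.measurable
    exact Measurable.aestronglyMeasurable (by fun_prop)
  · rw [norm_mul, Real.norm_of_nonneg (cutKernel_nonneg s ε _), Real.norm_eq_abs]
    refine mul_le_mul_of_nonneg_right ?_ (cutKernel_nonneg s ε _)
    exact (abs_sub _ _).trans (by linarith [h.bound x, h.bound y])

lemma TestBound.abs_integral_cut_le_near [NeZero d] {A R s ε : ℝ} {φ : Ed d → ℝ}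
    (h : TestBound A R φ) (hs0 : 0 < s) (hs1 : s < 1) (hε : 0 < ε) (hR : 0 < R) (x : Ed d) :
    |∫ y, (φ x - φ y) * cutKernel d s ε (x - y)| ≤
      2 * A * (R ^ (-(2 * s)) * ∫ z, tameKernel d s z) := by
  have hA := h.nonneg
  have e1 : ∫ y, (φ x - φ y) * cutKernel d s ε (x - y) =
      ∫ z, (φ x - φ (x - z)) * cutKernel d s ε z := by
    rw [← integral_sub_left_eq_self (fun z => (φ x - φ (x - z)) * cutKernel d s ε z) volume x]
    simp
  have e2 : ∫ z, (φ x - φ (x - z)) * cutKernel d s ε z =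
      ∫ z, (φ x - φ (x + z)) * cutKernel d s ε z := by
    rw [← integral_neg_eq_self]
    simp [cutKernel_neg]
  have i1 : Integrable fun z => (φ x - φ (x - z)) * cutKernel d s ε z := by
    simpa using (h.integrable_cut hs0 hs1 hε x).comp_sub_left x
  have i2 : Integrable fun z => (φ x - φ (x + z)) * cutKernel d s ε z := by
    simpa [cutKernel_neg] using i1.comp_neg
  obtain ⟨hi, hI⟩ := integral_tameKernel_scaled (d := d) hs0 hs1 hR
  have e3 : 2 * ∫ y, (φ x - φ y) * cutKernel d s ε (x - y) =
      ∫ z, ((φ x - φ (x - z)) * cutKernel d s ε z + (φ x - φ (x + z)) * cutKernel d s ε z) := by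
    rw [integral_add i1 i2, ← e2, ← e1, two_mul]
  have e4 : |2 * ∫ y, (φ x - φ y) * cutKernel d s ε (x - y)| ≤
      4 * A * (R ^ (-(2 * s)) * ∫ z, tameKernel d s z) := by
    rw [e3, ← hI, ← integral_const_mul, ← Real.norm_eq_abs]
    refine norm_integral_le_of_norm_le (hi.const_mul _) (.of_forall fun z => ?_)
    rw [← add_mul, norm_mul, Real.norm_of_nonneg (cutKernel_nonneg s ε _), Real.norm_eq_abs,
      ← mul_assoc]
    refine mul_le_mul ?_ (cutKernel_le s ε z) (cutKernel_nonneg s ε _) (by positivity)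
    have : |φ x - φ (x - z) + (φ x - φ (x + z))| = |φ (x + z) + φ (x - z) - 2 * φ x| := by
      rw [← abs_neg]
      congr 1
      ring
    rw [this, mul_min_of_nonneg _ _ (by positivity)]
    refine le_min ((h.diff₂ x z).trans ?_) ?_
    · have : 0 ≤ (‖z‖ / R) ^ 2 := by positivity
      nlinarith
    · have h1 := h.bound x
      have h2 := h.bound (x + z)
      have h3 := h.bound (x - z)
      rw [abs_le] at *
      constructor <;> linarith
  rw [abs_mul, abs_two] at e4
  linarith

lemma abs_integral_cut_le_far [NeZero d] {A R s ε : ℝ} {φ : Ed d → ℝ}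
    (hb : ∀ x, |φ x| ≤ A) (h0 : ∀ x, R ≤ ‖x‖ → φ x = 0) (hs0 : 0 < s) (hR : 0 < R) {x : Ed d}
    (hx : 2 * R ≤ ‖x‖) :
    |∫ y, (φ x - φ y) * cutKernel d s ε (x - y)| ≤
      A * (‖x‖ / 2) ^ (-((d : ℝ) + 2 * s)) * (R ^ d * volume.real (Metric.ball (0 : Ed d) 1)) := by
  have hA : 0 ≤ A := (abs_nonneg _).trans (hb 0)
  have hx0 : 0 < ‖x‖ := by linarith
  have hvol : volume.real (Metric.ball (0 : Ed d) R) =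
      R ^ d * volume.real (Metric.ball (0 : Ed d) 1) := by
    rw [measureReal_def, volume_ball_eq 0 hR.le, ENNReal.toReal_ofReal (by positivity)]
  rw [h0 x (by linarith)]
  have e1 : ∫ y, (0 - φ y) * cutKernel d s ε (x - y) =
      ∫ y in Metric.ball 0 R, (0 - φ y) * cutKernel d s ε (x - y) := by
    refine (setIntegral_eq_integral_of_forall_compl_eq_zero fun y hy => ?_).symm
    rw [h0 y (by simpa using hy)]
    simp
  rw [e1, ← hvol, ← Real.norm_eq_abs]
  refine norm_setIntegral_le_of_norm_le_const measure_ball_lt_top fun y hy => ?_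
  rw [norm_mul, Real.norm_of_nonneg (cutKernel_nonneg s ε _), Real.norm_eq_abs, zero_sub, abs_neg]
  refine mul_le_mul (hb y) ((cutKernel_le s ε _).trans ?_) (cutKernel_nonneg s ε _) hA
  have hy : ‖y‖ < R := by simpa using hy
  refine Real.rpow_le_rpow_of_nonpos (by positivity) ?_ ?_
  · linarith [norm_sub_norm_le x y]
  · have : (0 : ℝ) ≤ d := by positivity
    linarith

/-- The fractional Laplacian of a test function decays at infinity. -/
lemma exists_integral_cut_bound [NeZero d] {s γ : ℝ} (hs0 : 0 < s) (hs1 : s < 1) (hγ0 : 0 ≤ γ)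
    (hγs : γ < 2 * s) :
    ∃ D : ℝ, 0 < D ∧ ∀ (A R ε : ℝ) (φ : Ed d → ℝ), TestBound A R φ → 1 ≤ R → 0 < ε →
      ∀ x, |∫ y, (φ x - φ y) * cutKernel d s ε (x - y)| ≤
        D * A * R ^ (γ - 2 * s) * (1 + ‖x‖) ^ (-γ) := by
  set I := ∫ z, tameKernel d s z with hI
  set ω := volume.real (Metric.ball (0 : Ed d) 1) with hω
  have hI0 : 0 ≤ I := integral_nonneg (tameKernel_nonneg s)
  have hω0 : 0 < ω := volume_real_unitBall_pos
  refine ⟨2 * I * 3 ^ γ + 2 ^ ((d : ℝ) + 2 * s) * ω * 2 ^ γ, by positivity, ?_⟩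
  intro A R ε φ h hR hε x
  have hA := h.nonneg
  have hR0 : 0 < R := by linarith
  have key : ∀ a b : ℝ, 0 ≤ b → a ≤ A * R ^ (γ - 2 * s) * (1 + ‖x‖) ^ (-γ) * b → ∀ b' : ℝ, 0 ≤ b' →
      a ≤ (b + b') * A * R ^ (γ - 2 * s) * (1 + ‖x‖) ^ (-γ) := by
    intro a b hb hab b' hb'
    have : 0 ≤ A * R ^ (γ - 2 * s) * (1 + ‖x‖) ^ (-γ) * b' := by positivity
    nlinarith
  rcases lt_or_ge ‖x‖ (2 * R) with hx | hx
  · refine key _ (2 * I * 3 ^ γ) (by positivity) ?_ _ (by positivity)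
    refine (h.abs_integral_cut_le_near hs0 hs1 hε hR0 x).trans ?_
    have h1 : (3 * R) ^ (-γ) ≤ (1 + ‖x‖) ^ (-γ) :=
      Real.rpow_le_rpow_of_nonpos (by positivity) (by linarith) (by linarith)
    rw [Real.mul_rpow (by norm_num) hR0.le, Real.rpow_neg (by norm_num),
      inv_mul_le_iff₀ (by positivity)] at h1
    calc 2 * A * (R ^ (-(2 * s)) * I) = 2 * A * (R ^ (γ - 2 * s) * R ^ (-γ) * I) := by
          rw [← Real.rpow_add hR0]
          congr 4
          ring
      _ ≤ 2 * A * (R ^ (γ - 2 * s) * (3 ^ γ * (1 + ‖x‖) ^ (-γ)) * I) := by gcongr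
      _ = _ := by ring
  · have hx0 : 0 < ‖x‖ := by linarith
    rw [add_comm (2 * I * 3 ^ γ)]
    refine key _ (2 ^ ((d : ℝ) + 2 * s) * ω * 2 ^ γ) (by positivity) ?_ _ (by positivity)
    refine (abs_integral_cut_le_far h.bound h.eq_zero hs0 hR0 hx).trans ?_
    have h1 : (2 * ‖x‖) ^ (-γ) ≤ (1 + ‖x‖) ^ (-γ) :=
      Real.rpow_le_rpow_of_nonpos (by positivity) (by linarith) (by linarith)
    rw [Real.mul_rpow zero_le_two hx0.le, Real.rpow_neg zero_le_two,
      inv_mul_le_iff₀ (by positivity)] at h1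
    have hd0 : (0 : ℝ) ≤ d := by positivity
    have h2 : ‖x‖ ^ (-((d : ℝ) + 2 * s)) * R ^ d ≤ R ^ (γ - 2 * s) * ‖x‖ ^ (-γ) := by
      have e : -((d : ℝ) + 2 * s) = (γ - d - 2 * s) + -γ := by ring
      rw [e, Real.rpow_add hx0, mul_right_comm]
      gcongr
      calc ‖x‖ ^ (γ - d - 2 * s) * R ^ d ≤ R ^ (γ - d - 2 * s) * R ^ d := by
            gcongr ?_ * _
            exact Real.rpow_le_rpow_of_nonpos hR0 (by linarith) (by linarith)
        _ = R ^ (γ - 2 * s) := by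
            rw [← Real.rpow_natCast, ← Real.rpow_add hR0]
            congr 1
            ring
    calc A * (‖x‖ / 2) ^ (-((d : ℝ) + 2 * s)) * (R ^ d * ω)
        = A * 2 ^ ((d : ℝ) + 2 * s) * (‖x‖ ^ (-((d : ℝ) + 2 * s)) * R ^ d) * ω := by
          rw [Real.div_rpow hx0.le zero_le_two, Real.rpow_neg zero_le_two, div_inv_eq_mul]
          ring
      _ ≤ A * 2 ^ ((d : ℝ) + 2 * s) * (R ^ (γ - 2 * s) * (2 ^ γ * (1 + ‖x‖) ^ (-γ))) * ω := by
          exact mul_le_mul_of_nonneg_right (mul_le_mul_of_nonneg_left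
            (h2.trans (mul_le_mul_of_nonneg_left h1 (by positivity))) (by positivity)) hω0.le
      _ = _ := by ring

lemma integral_jumpMeasure {s κ : ℝ} (hκ : 0 ≤ κ) (g : Ed d × Ed d → ℝ) :
    ∫ p, g p ∂jumpMeasure d s κ = ∫ p, g p * jumpKernel d s κ p := by
  rw [jumpMeasure, integral_withDensity_eq_integral_toReal_smul (by fun_prop) (by simp)]
  refine integral_congr_ae (.of_forall fun p => ?_)
  have h := ENNReal.toReal_ofReal (jumpKernel_nonneg (d := d) (s := s) hκ p)
  simp only [h, smul_eq_mul, mul_comm]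

lemma indicator_jumpKernel (s κ ε : ℝ) (p : Ed d × Ed d) :
    {p : Ed d × Ed d | ε < ‖p.1 - p.2‖}.indicator (jumpKernel d s κ) p =
      κ / 2 * cutKernel d s ε (p.1 - p.2) := by
  by_cases h : ε < ‖p.1 - p.2‖
  · have := Real.rpow_neg (norm_nonneg (p.1 - p.2)) ((d : ℝ) + 2 * s)
    simp [indicator, cutKernel, h, jumpKernel, this, div_eq_mul_inv, -neg_add_rev]
  · simp [indicator, cutKernel, h]

/-- The truncated form. -/
lemma TestBound.setIntegral_jump_eq [NeZero d] {A R s κ ε : ℝ} {φ v : Ed d → ℝ}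
    (h : TestBound A R φ) (hs0 : 0 < s) (hs1 : s < 1) (hκ : 0 ≤ κ) (hε : 0 < ε)
    (hv : Measurable v) (hvi : Integrable fun x => v x * ∫ y, |φ x - φ y| * cutKernel d s ε (x - y)) :
    ∫ p in {p : Ed d × Ed d | ε < ‖p.1 - p.2‖}, pdiff v p * pdiff φ p ∂jumpMeasure d s κ =
      κ * ∫ x, v x * ∫ y, (φ x - φ y) * cutKernel d s ε (x - y) := by
  have hφm := h.cont.measurable
  have hSm : MeasurableSet {p : Ed d × Ed d | ε < ‖p.1 - p.2‖} :=
    measurableSet_lt measurable_const (by fun_prop)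
  set H : Ed d × Ed d → ℝ := fun p => v p.1 * ((φ p.1 - φ p.2) * cutKernel d s ε (p.1 - p.2))
    with hH
  have hHm : Measurable H := by fun_prop
  have hHi : Integrable H (volume.prod volume) := by
    refine (integrable_prod_iff hHm.aestronglyMeasurable).2 ⟨.of_forall fun x => ?_, ?_⟩
    · exact (h.integrable_cut hs0 hs1 hε x).const_mul (v x)
    · refine hvi.norm.congr (.of_forall fun x => ?_)
      simp only [hH, norm_mul, integral_const_mul]
      congr 1
      rw [Real.norm_of_nonneg (integral_nonneg fun y =>
        mul_nonneg (abs_nonneg _) (cutKernel_nonneg s ε _))]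
      refine integral_congr_ae (.of_forall fun y => ?_)
      simp only [Real.norm_eq_abs, abs_of_nonneg (cutKernel_nonneg s ε (x - y))]
  have e0 : ∀ p : Ed d × Ed d, {p : Ed d × Ed d | ε < ‖p.1 - p.2‖}.indicator
      (fun p => pdiff v p * pdiff φ p) p * jumpKernel d s κ p =
      κ / 2 * (H p + H p.swap) := by
    intro p
    have e : {p : Ed d × Ed d | ε < ‖p.1 - p.2‖}.indicator
        (fun p => pdiff v p * pdiff φ p) p * jumpKernel d s κ p =
        pdiff v p * pdiff φ p * {p : Ed d × Ed d | ε < ‖p.1 - p.2‖}.indicator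
          (jumpKernel d s κ) p := by
      by_cases hp : p ∈ {p : Ed d × Ed d | ε < ‖p.1 - p.2‖} <;> simp [hp]
    rw [e, indicator_jumpKernel]
    simp only [hH, pdiff, Prod.fst_swap, Prod.snd_swap]
    rw [← cutKernel_neg s ε (p.2 - p.1), neg_sub]
    ring
  rw [← integral_indicator hSm, integral_jumpMeasure hκ]
  simp_rw [e0]
  have hswap : Integrable (fun p => H p.swap) (volume.prod volume) := hHi.swap
  rw [integral_const_mul]
  have e1 : ∫ p : Ed d × Ed d, (H p + H p.swap) = 2 * ∫ p, H p ∂(volume.prod volume) := by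
    rw [Measure.volume_eq_prod, integral_add hHi hswap, integral_prod_swap, two_mul]
  rw [e1, integral_prod _ hHi]
  simp only [hH, integral_const_mul]
  ring

lemma exists_integral_abs_cut_bound [NeZero d] {A R s ε γ : ℝ} {φ : Ed d → ℝ}
    (h : TestBound A R φ) (hs0 : 0 < s) (hs1 : s < 1) (hγ0 : 0 ≤ γ) (hγs : γ < 2 * s)
    (hR : 1 ≤ R) (hε : 0 < ε) :
    ∃ D : ℝ, ∀ x, ∫ y, |φ x - φ y| * cutKernel d s ε (x - y) ≤ D * (1 + ‖x‖) ^ (-γ) := by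
  have hA := h.nonneg
  have hR0 : 0 < R := by linarith
  set J := ∫ z, cutKernel d s ε z with hJ
  have hJ0 : 0 ≤ J := integral_nonneg (cutKernel_nonneg s ε)
  set ω := volume.real (Metric.ball (0 : Ed d) 1) with hω
  have hω0 : 0 < ω := volume_real_unitBall_pos
  set D₁ := 2 * A * J * (3 * R) ^ γ with hD₁
  set D₂ := A * 2 ^ ((d : ℝ) + 2 * s) * (R ^ d * ω) * 2 ^ γ with hD₂
  have hD₁0 : 0 ≤ D₁ := by positivity
  have hD₂0 : 0 ≤ D₂ := by positivity
  refine ⟨D₁ + D₂, fun x => ?_⟩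
  have hw : 0 ≤ (1 + ‖x‖) ^ (-γ) := by positivity
  rw [add_mul]
  rcases lt_or_ge ‖x‖ (2 * R) with hx | hx
  · refine le_trans ?_ (le_add_of_nonneg_right (by positivity))
    have h1 : (3 * R) ^ (-γ) ≤ (1 + ‖x‖) ^ (-γ) :=
      Real.rpow_le_rpow_of_nonpos (by positivity) (by linarith) (by linarith)
    rw [Real.rpow_neg (by positivity), inv_le_iff_one_le_mul₀' (by positivity)] at h1
    have e : ∫ y, cutKernel d s ε (x - y) = J :=
      integral_sub_left_eq_self (cutKernel d s ε) volume x
    calc ∫ y, |φ x - φ y| * cutKernel d s ε (x - y)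
        ≤ ∫ y, 2 * A * cutKernel d s ε (x - y) := by
          refine integral_mono_of_nonneg (.of_forall fun y =>
            mul_nonneg (abs_nonneg _) (cutKernel_nonneg s ε _))
            (((integrable_cutKernel hs0 hs1 hε).comp_sub_left x).const_mul _)
            (.of_forall fun y => mul_le_mul_of_nonneg_right ?_ (cutKernel_nonneg s ε _))
          exact (abs_sub _ _).trans (by linarith [h.bound x, h.bound y])
      _ = 2 * A * J := by rw [integral_const_mul, e]
      _ ≤ 2 * A * J * ((3 * R) ^ γ * (1 + ‖x‖) ^ (-γ)) :=
          le_mul_of_one_le_right (by positivity) h1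
      _ = _ := by rw [hD₁]; ring
  · refine le_trans ?_ (le_add_of_nonneg_left (by positivity))
    have hx0 : 0 < ‖x‖ := by linarith
    have hd0 : (0 : ℝ) ≤ d := by positivity
    have h1 : (2 * ‖x‖) ^ (-γ) ≤ (1 + ‖x‖) ^ (-γ) :=
      Real.rpow_le_rpow_of_nonpos (by positivity) (by linarith) (by linarith)
    rw [Real.mul_rpow zero_le_two hx0.le, Real.rpow_neg zero_le_two,
      inv_mul_le_iff₀ (by positivity)] at h1
    have hφx := h.eq_zero x (by linarith)
    have h2 := abs_integral_cut_le_far (d := d) (s := s) (ε := ε) (φ := fun x => |φ x|)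
      (fun x => by rw [abs_abs]; exact h.bound x)
      (fun x hx => by rw [h.eq_zero x hx, abs_zero]) hs0 hR0 hx
    have e : ∫ y, |φ x - φ y| * cutKernel d s ε (x - y) =
        -∫ y, (|φ x| - |φ y|) * cutKernel d s ε (x - y) := by
      rw [← integral_neg]
      refine integral_congr_ae (.of_forall fun y => ?_)
      simp [hφx]
    rw [e]
    refine (neg_le_abs _).trans (h2.trans ?_)
    calc A * (‖x‖ / 2) ^ (-((d : ℝ) + 2 * s)) * (R ^ d * ω)
        = A * 2 ^ ((d : ℝ) + 2 * s) * (R ^ d * ω) * ‖x‖ ^ (-((d : ℝ) + 2 * s)) := by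
          rw [Real.div_rpow hx0.le zero_le_two, Real.rpow_neg zero_le_two, div_inv_eq_mul]
          ring
      _ ≤ A * 2 ^ ((d : ℝ) + 2 * s) * (R ^ d * ω) * (2 ^ γ * (1 + ‖x‖) ^ (-γ)) := by
          refine mul_le_mul_of_nonneg_left (le_trans ?_ h1) (by positivity)
          exact Real.rpow_le_rpow_of_exponent_le (by linarith) (by linarith)
      _ = _ := by rw [hD₂]; ring

/-- The form tested with a test function is controlled by a weighted `L¹` norm. -/
theorem exists_eform_bound [NeZero d] {s γ κ c : ℝ} (hs0 : 0 < s) (hs1 : s < 1) (hγ0 : 0 ≤ γ)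
    (hγs : γ < 2 * s) (hκ : 0 < κ) (hc : 0 < c) {ρ : Ed d → ℝ} (hρ : Measurable ρ)
    (hpos : ∀ x, 0 < ρ x) (hge : ∀ᵐ x, c * (1 + ‖x‖) ^ (-γ) ≤ ρ x) :
    ∃ D : ℝ, 0 < D ∧ ∀ (A R : ℝ) (v φ : Ed d → ℝ), TestBound A R φ → 1 ≤ R → Measurable v →
      Integrable v (weightMeasure ρ) → energy (jumpMeasure d s κ) v ≠ ⊤ →
      energy (jumpMeasure d s κ) φ ≠ ⊤ →
      |eform (jumpMeasure d s κ) v φ| ≤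
        D * A * R ^ (γ - 2 * s) * ∫ x, |v x| ∂weightMeasure ρ := by
  obtain ⟨D, hD, hDb⟩ := exists_integral_cut_bound (d := d) hs0 hs1 hγ0 hγs
  refine ⟨κ * (D / c), by positivity, fun A R v φ h hR hv hvi hvE hφE => ?_⟩
  have hA := h.nonneg
  have hφm := h.cont.measurable
  have hvρ : Integrable fun x => |v x| * ρ x := by
    refine ((integrable_weightMeasure hρ hpos).1 hvi).norm.congr (.of_forall fun x => ?_)
    simp [abs_of_pos (hpos x)]
  set S : ℕ → Set (Ed d × Ed d) := fun n => {p | 1 / ((n : ℝ) + 1) < ‖p.1 - p.2‖} with hS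
  have hSm : ∀ n, MeasurableSet (S n) := fun n => measurableSet_lt measurable_const (by fun_prop)
  have hSmono : Monotone S := by
    intro a b hab p hp
    have hab : (a : ℝ) ≤ b := by exact_mod_cast hab
    have : 1 / ((b : ℝ) + 1) ≤ 1 / ((a : ℝ) + 1) := by gcongr
    exact lt_of_le_of_lt this hp
  have hint : Integrable (fun p => pdiff v p * pdiff φ p) (jumpMeasure d s κ) :=
    integrable_pdiff_mul (memLp_pdiff_of_energy hv hvE) (memLp_pdiff_of_energy hφm hφE)
  have hlim := tendsto_setIntegral_of_monotone hSm hSmono hint.integrableOn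
  have hU : ∫ p in ⋃ n, S n, pdiff v p * pdiff φ p ∂jumpMeasure d s κ =
      eform (jumpMeasure d s κ) v φ := by
    refine setIntegral_eq_integral_of_forall_compl_eq_zero fun p hp => ?_
    have : p.1 = p.2 := by
      by_contra hne
      obtain ⟨n, hn⟩ := exists_nat_one_div_lt (norm_pos_iff.2 (sub_ne_zero.2 hne))
      exact hp (mem_iUnion.2 ⟨n, hn⟩)
    simp [pdiff, this]
  rw [hU] at hlim
  refine le_of_tendsto hlim.abs (.of_forall fun n => ?_)
  have hε : (0 : ℝ) < 1 / ((n : ℝ) + 1) := by positivity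
  obtain ⟨D', hD'⟩ := exists_integral_abs_cut_bound h hs0 hs1 hγ0 hγs hR hε
  have hlow : ∀ᵐ x, (1 + ‖x‖) ^ (-γ) ≤ ρ x / c := by
    filter_upwards [hge] with x hx
    rwa [le_div_iff₀' hc]
  rw [h.setIntegral_jump_eq hs0 hs1 hκ.le hε hv, abs_mul, abs_of_pos hκ,
    integral_weightMeasure hρ hpos, mul_assoc κ, mul_assoc κ, mul_assoc κ]
  · refine mul_le_mul_of_nonneg_left ?_ hκ.le
    rw [← integral_const_mul, ← Real.norm_eq_abs]
    refine norm_integral_le_of_norm_le (hvρ.const_mul _) ?_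
    filter_upwards [hlow] with x hx
    rw [norm_mul, Real.norm_eq_abs, Real.norm_eq_abs]
    calc |v x| * _ ≤ |v x| * (D * A * R ^ (γ - 2 * s) * (ρ x / c)) := by
          refine mul_le_mul_of_nonneg_left ((hDb A R _ φ h hR hε x).trans ?_) (abs_nonneg _)
          exact mul_le_mul_of_nonneg_left hx (by positivity)
      _ = _ := by ring
  · refine (hvρ.const_mul (|D'| / c)).mono' ?_ ?_
    · have : Measurable fun x => ∫ y, |φ x - φ y| * cutKernel d s (1 / ((n : ℝ) + 1)) (x - y) :=
        (StronglyMeasurable.integral_prod_right (f := fun x y : Ed d => |φ x - φ y| *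
          cutKernel d s (1 / ((n : ℝ) + 1)) (x - y))
          (Measurable.stronglyMeasurable (by unfold Function.uncurry; fun_prop))).measurable
      exact (hv.mul this).aestronglyMeasurable
    · filter_upwards [hlow] with x hx
      have h0 : 0 ≤ ∫ y, |φ x - φ y| * cutKernel d s (1 / ((n : ℝ) + 1)) (x - y) :=
        integral_nonneg fun y => mul_nonneg (abs_nonneg _) (cutKernel_nonneg s _ _)
      rw [norm_mul, Real.norm_eq_abs, Real.norm_of_nonneg h0]
      calc |v x| * _ ≤ |v x| * (|D'| * (ρ x / c)) := by
            refine mul_le_mul_of_nonneg_left ((hD' x).trans ?_) (abs_nonneg _)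
            exact mul_le_mul (le_abs_self _) hx (by positivity) (abs_nonneg _)
        _ = _ := by ring

/-- Test functions with given bounds have uniformly bounded energy. -/
lemma exists_energy_bound [NeZero d] {s κ : ℝ} (hs0 : 0 < s) (hs1 : s < 1) (hκ : 0 ≤ κ) (A : ℝ)
    {R : ℝ} (hR : 0 < R) :
    ∃ E : ℝ≥0∞, E ≠ ⊤ ∧ ∀ φ : Ed d → ℝ, TestBound A R φ → energy (jumpMeasure d s κ) φ ≤ E := by
  obtain ⟨hi, -⟩ := integral_tameKernel_scaled (d := d) hs0 hs1 hR
  set k : Ed d → ℝ := fun z => min ((‖z‖ / R) ^ 2) 1 * ‖z‖ ^ (-((d : ℝ) + 2 * s)) with hk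
  have hk0 : ∀ z, 0 ≤ k z := fun z => by positivity
  have hkm : Measurable k := by fun_prop
  set B := Metric.ball (0 : Ed d) R with hB
  set L := ∫⁻ z, ENNReal.ofReal (k z) with hL
  have hLtop : L ≠ ⊤ := by
    rw [hL, ← ofReal_integral_eq_lintegral_ofReal hi (.of_forall hk0)]
    exact ENNReal.ofReal_ne_top
  refine ⟨ENNReal.ofReal (κ / 2) * (ENNReal.ofReal (4 * A ^ 2) * (volume B * L + volume B * L)),
    ?_, fun φ h => ?_⟩
  · have hBv : volume B ≠ ⊤ := measure_ball_lt_top.ne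
    exact ENNReal.mul_ne_top ENNReal.ofReal_ne_top (ENNReal.mul_ne_top ENNReal.ofReal_ne_top
      (ENNReal.add_ne_top.2 ⟨ENNReal.mul_ne_top hBv hLtop, ENNReal.mul_ne_top hBv hLtop⟩))
  have hA := h.nonneg
  rw [energy_jump_eq hκ h.cont.measurable, gagliardoSq]
  refine mul_le_mul_right ?_ _
  set a : Ed d × Ed d → ℝ≥0∞ := fun p => B.indicator 1 p.1 * ENNReal.ofReal (k (p.1 - p.2)) with ha
  have ham : Measurable a := ((measurable_one.indicator measurableSet_ball).comp
    measurable_fst).mul (by fun_prop)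
  have hae : ∫⁻ p, a p ∂(volume.prod volume) = volume B * L := by
    rw [lintegral_prod _ ham.aemeasurable]
    simp only [ha]
    have : ∀ x, ∫⁻ y, B.indicator 1 x * ENNReal.ofReal (k (x - y)) = B.indicator (fun _ => L) x := by
      intro x
      rw [lintegral_const_mul _ (by fun_prop),
        lintegral_sub_left_eq_self (fun z => ENNReal.ofReal (k z)) x]
      by_cases hx : x ∈ B <;> simp [hx, hL]
    simp_rw [this]
    rw [lintegral_indicator measurableSet_ball, setLIntegral_const, mul_comm]
  have hsw : ∫⁻ p : Ed d × Ed d, a p.swap ∂(volume.prod volume) = volume B * L := by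
    rw [lintegral_prod_swap, hae]
  calc ∫⁻ p : Ed d × Ed d, ENNReal.ofReal ((φ p.1 - φ p.2) ^ 2 / ‖p.1 - p.2‖ ^ ((d : ℝ) + 2 * s))
      ≤ ∫⁻ p : Ed d × Ed d, ENNReal.ofReal (4 * A ^ 2) * (a p + a p.swap) := by
        refine lintegral_mono fun p => ?_
        by_cases hp : p.1 ∈ B ∨ p.2 ∈ B
        · have h1 : ENNReal.ofReal (k (p.1 - p.2)) ≤ a p + a p.swap := by
            rcases hp with hp | hp
            · refine le_add_of_le_left ?_
              simp [ha, hp]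
            · refine le_add_of_le_right ?_
              simp [ha, hp, hk, norm_sub_rev p.2 p.1]
          refine le_trans ?_ (mul_le_mul_right h1 _)
          rw [← ENNReal.ofReal_mul (by positivity)]
          refine ENNReal.ofReal_le_ofReal ?_
          simp only [hk]
          rw [div_eq_mul_inv, ← Real.rpow_neg (norm_nonneg _), ← mul_assoc]
          refine mul_le_mul_of_nonneg_right ?_ (by positivity)
          rw [mul_min_of_nonneg _ _ (by positivity), ← sq_abs]
          refine le_min ?_ ?_
          · have := pow_le_pow_left₀ (abs_nonneg _) (h.diff p.1 p.2) 2
            rw [mul_pow] at this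
            have h2 : 0 ≤ A ^ 2 * (‖p.1 - p.2‖ / R) ^ 2 := by positivity
            linarith
          · have h3 : |φ p.1 - φ p.2| ≤ 2 * A :=
              (abs_sub _ _).trans (by linarith [h.bound p.1, h.bound p.2])
            have := pow_le_pow_left₀ (abs_nonneg _) h3 2
            linarith
        · push Not at hp
          rw [h.eq_zero p.1 (by simpa [hB] using hp.1), h.eq_zero p.2 (by simpa [hB] using hp.2)]
          simp
    _ = _ := by
        rw [lintegral_const_mul' _ _ ENNReal.ofReal_ne_top, lintegral_add_left ham,
          Measure.volume_eq_prod, hae, hsw]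

lemma TestBound.formTest [NeZero d] {A R s κ q : ℝ} {φ : Ed d → ℝ} (h : TestBound A R φ)
    (hs0 : 0 < s) (hs1 : s < 1) (hκ : 0 ≤ κ) (hR : 0 < R) (hq : 0 < q) {ρ : Ed d → ℝ}
    (hfin : weightMeasure ρ (Metric.ball 0 R) ≠ ⊤) :
    FormTest (weightMeasure ρ) (jumpMeasure d s κ) q φ := by
  obtain ⟨E, hE, hEb⟩ := exists_energy_bound (d := d) hs0 hs1 hκ A hR
  refine ⟨h.cont.measurable, ?_, ne_top_of_le_ne_top hE (hEb φ h)⟩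
  have h1 : IntegrableOn (fun x => |φ x| ^ q) (Metric.ball 0 R) (weightMeasure ρ) := by
    refine Measure.integrableOn_of_bounded (M := A ^ q) hfin ?_ (.of_forall fun x => ?_)
    · have := h.cont.measurable
      exact Measurable.aestronglyMeasurable (by fun_prop)
    · rw [Real.norm_of_nonneg (by positivity)]
      exact Real.rpow_le_rpow (abs_nonneg _) (h.bound x) hq.le
  rw [← integrable_indicator_iff measurableSet_ball] at h1
  refine h1.congr (.of_forall fun x => ?_)
  by_cases hx : x ∈ Metric.ball 0 R
  · simp [hx]
  · have h0 := h.eq_zero x (by simpa using hx)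
    simp only [indicator_of_notMem hx, h0, abs_zero, Real.zero_rpow hq.ne']

end TestFunctions

section SmoothTestFunctions

variable {d : ℕ}

lemma exists_difference_bounds {E : Type*} [NormedAddCommGroup E] [NormedSpace ℝ E] {f : E → ℝ}
    (hf : ContDiff ℝ 2 f) (hc : HasCompactSupport f) :
    ∃ L : ℝ, 0 ≤ L ∧ (∀ x, |f x| ≤ L) ∧ (∀ x y, |f x - f y| ≤ L * ‖x - y‖) ∧
      ∀ x z, |f (x + z) + f (x - z) - 2 * f x| ≤ L * ‖z‖ ^ 2 := by
  obtain ⟨B, hB⟩ := hc.exists_bound_of_continuous hf.continuous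
  obtain ⟨L₁, hL₁⟩ := hf.lipschitzWith_of_hasCompactSupport hc (by simp)
  obtain ⟨L₂, hL₂⟩ := (hf.fderiv_right (m := 1) (by norm_num)).lipschitzWith_of_hasCompactSupport
    (hc.fderiv ℝ) (by simp)
  set L := max B (max L₁ L₂) with hL
  have hdiff : Differentiable ℝ f := hf.differentiable (by simp)
  refine ⟨L, le_max_of_le_right (le_max_of_le_left L₁.2), fun x => ?_, fun x y => ?_,
    fun x z => ?_⟩
  · exact (hB x).trans (le_max_left _ _)
  · have := hL₁.dist_le_mul x y
    rw [Real.dist_eq, dist_eq_norm] at this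
    exact this.trans (mul_le_mul_of_nonneg_right
      ((le_max_left _ _).trans (le_max_right _ _)) (norm_nonneg _))
  · have h1 : ∀ y, HasFDerivAt (fun y => f (y + z) - f y) (fderiv ℝ f (y + z) - fderiv ℝ f y) y :=
      fun y => ((hasFDerivAt_comp_add_right z).2 (hdiff (y + z)).hasFDerivAt).sub (hdiff y).hasFDerivAt
    have h2 := Convex.norm_image_sub_le_of_norm_hasFDerivWithin_le (s := univ)
      (C := L₂ * ‖z‖) (x := x - z) (y := x) (fun y _ => (h1 y).hasFDerivWithinAt) (fun y _ => by
        have := hL₂.dist_le_mul (y + z) y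
        rwa [dist_eq_norm, dist_eq_norm, add_sub_cancel_left] at this) convex_univ
        (mem_univ _) (mem_univ _)
    simp only [sub_add_cancel, sub_sub_cancel] at h2
    have e : f (x + z) + f (x - z) - 2 * f x = f (x + z) - f x - (f x - f (x - z)) := by ring
    rw [e, ← Real.norm_eq_abs, sq, ← mul_assoc]
    refine h2.trans (mul_le_mul_of_nonneg_right (mul_le_mul_of_nonneg_right
      ((le_max_right _ _).trans (le_max_right _ _)) (norm_nonneg _)) (norm_nonneg _))

lemma testBound_of_difference_bounds {L R : ℝ} (hL : 0 ≤ L) (hR : 1 ≤ R) {f : Ed d → ℝ}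
    (hf : Continuous f) (h0 : ∀ x, R ≤ ‖x‖ → f x = 0) (h1 : ∀ x, |f x| ≤ L)
    (h2 : ∀ x y, |f x - f y| ≤ L * ‖x - y‖)
    (h3 : ∀ x z, |f (x + z) + f (x - z) - 2 * f x| ≤ L * ‖z‖ ^ 2) :
    TestBound (L * R ^ 2) R f := by
  have hR0 : R ≠ 0 := by positivity
  refine ⟨hf, fun x => (h1 x).trans (le_mul_of_one_le_right hL (one_le_pow₀ hR)), h0,
    fun x y => (h2 x y).trans ?_, fun x z => (h3 x z).trans (le_of_eq ?_)⟩
  · have : L * R ^ 2 * (‖x - y‖ / R) = R * (L * ‖x - y‖) := by field_simp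
    rw [this]
    exact le_mul_of_one_le_left (by positivity) hR
  · field_simp

lemma exists_testBound {φ : Ed d → ℝ} (hφ : ContDiff ℝ 2 φ) (hc : HasCompactSupport φ) :
    ∃ A R : ℝ, 1 ≤ R ∧ TestBound A R φ := by
  obtain ⟨L, hL, h1, h2, h3⟩ := exists_difference_bounds hφ hc
  obtain ⟨r, hr⟩ := hc.isCompact.isBounded.subset_ball 0
  refine ⟨_, max r 1, le_max_right _ _, testBound_of_difference_bounds hL (le_max_right _ _)
    hφ.continuous (fun x hx => ?_) h1 h2 h3⟩
  by_contra hne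
  have := hr (subset_tsupport φ hne)
  rw [mem_ball_zero_iff] at this
  exact (this.trans_le ((le_max_left _ _).trans hx)).false

lemma exists_testBound_family {Φ : Ed d × ℝ → ℝ} (hΦ : ContDiff ℝ 2 Φ)
    (hc : HasCompactSupport Φ) :
    ∃ A R : ℝ, 1 ≤ R ∧ ∀ t, TestBound A R fun x => Φ (x, t) := by
  obtain ⟨L, hL, h1, h2, h3⟩ := exists_difference_bounds hΦ hc
  obtain ⟨r, hr⟩ := hc.isCompact.isBounded.subset_ball 0
  refine ⟨_, max r 1, le_max_right _ _, fun t => testBound_of_difference_bounds hL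
    (le_max_right _ _) (hΦ.continuous.comp (by fun_prop)) (fun x hx => ?_) (fun x => h1 _)
    (fun x y => ?_) (fun x z => ?_)⟩
  · by_contra hne
    have h := hr (subset_tsupport Φ hne)
    rw [mem_ball_zero_iff] at h
    have h' : ‖x‖ ≤ ‖(x, t)‖ := norm_fst_le (x, t)
    exact ((h'.trans_lt h).trans_le ((le_max_left _ _).trans hx)).false
  · simpa [Prod.norm_def] using h2 (x, t) (y, t)
  · simpa [Prod.norm_def] using h3 (x, t) (z, 0)

lemma TestBound.scale {A R : ℝ} {g : Ed d → ℝ} (h : TestBound A 1 g) (hR : 0 < R) :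
    TestBound A R fun x => g (R⁻¹ • x) := by
  have hn : ∀ z : Ed d, ‖R⁻¹ • z‖ = ‖z‖ / R := fun z => by
    rw [norm_smul, norm_inv, Real.norm_of_nonneg hR.le, div_eq_inv_mul]
  refine ⟨h.cont.comp (by fun_prop), fun x => h.bound _, fun x hx => h.eq_zero _ ?_,
    fun x y => ?_, fun x z => ?_⟩
  · rw [hn, le_div_iff₀ hR]; linarith
  · have := h.diff (R⁻¹ • x) (R⁻¹ • y)
    rwa [← smul_sub, hn, div_one] at this
  · have := h.diff₂ (R⁻¹ • x) (R⁻¹ • z)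
    rwa [← smul_sub, ← smul_add, hn, div_one] at this

/-- Cutoff functions at every scale. -/
lemma exists_cutoff (d : ℕ) :
    ∃ (A : ℝ) (η : ℝ → Ed d → ℝ), ∀ R : ℝ, 1 ≤ R → TestBound A R (η R) ∧
      (∀ x, η R x ∈ Icc 0 1) ∧ ∀ x, ‖x‖ ≤ R / 2 → η R x = 1 := by
  let b : ContDiffBump (0 : Ed d) := ⟨1 / 2, 1, by norm_num, by norm_num⟩
  obtain ⟨L, hL, h1, h2, h3⟩ := exists_difference_bounds (f := b) b.contDiff b.hasCompactSupport
  have hb := testBound_of_difference_bounds hL le_rfl b.continuous (fun x hx => by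
    have : x ∉ Function.support b := by
      rw [b.support_eq]; simpa [b] using hx
    simpa using this) h1 h2 h3
  refine ⟨_, fun R x => b (R⁻¹ • x), fun R hR => ⟨hb.scale (by linarith), fun x =>
    ⟨b.nonneg, b.le_one⟩, fun x hx => ?_⟩⟩
  apply b.one_of_mem_closedBall
  have hR0 : 0 < R := by linarith
  rw [mem_closedBall_zero_iff, norm_smul, norm_inv, Real.norm_of_nonneg hR0.le,
    inv_mul_le_iff₀ hR0]
  change ‖x‖ ≤ R * (1 / 2)
  linarith

lemma exists_smooth_approx {f : Ed d → ℝ} (hf : Continuous f) (hc : HasCompactSupport f) {ε : ℝ}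
    (hε : 0 < ε) :
    ∃ g : Ed d → ℝ, ContDiff ℝ 2 g ∧ HasCompactSupport g ∧ ∀ x, |g x - f x| ≤ ε := by
  obtain ⟨δ, hδ, h⟩ := Metric.uniformContinuous_iff.1
    (hc.uniformContinuous_of_continuous hf) ε hε
  obtain ⟨g, hg, hgf⟩ := hf.exists_contDiff_dist_le_of_forall_mem_ball_dist_le hδ
  refine ⟨g, contDiff_infty.1 hg 2, ?_, fun x => hgf x ε fun y hy => (h hy).le⟩
  obtain ⟨r, hr⟩ := hc.isCompact.isBounded.subset_ball 0
  refine HasCompactSupport.intro (isCompact_closedBall 0 (r + δ)) fun x hx => ?_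
  have hx : r + δ < ‖x‖ := by simpa using hx
  have h0 : ∀ y ∈ Metric.ball x δ, f y = 0 := fun y hy => by
    by_contra hne
    have h1 := hr (subset_tsupport f hne)
    rw [mem_ball_zero_iff] at h1
    rw [mem_ball_iff_norm'] at hy
    linarith [norm_sub_norm_le x y]
  have h2 := hgf x 0 fun y hy => by rw [h0 y hy, h0 x (Metric.mem_ball_self hδ), dist_self]
  rwa [h0 x (Metric.mem_ball_self hδ), dist_le_zero] at h2

end SmoothTestFunctions

variable {X : Type*} [MeasurableSpace X] {ν : Measure X} {Γ : Measure (X × X)}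

lemma BddSol.mono_times {m N : ℝ} {f : X → ℝ} {u : ℝ → X → ℝ} {G G' : Set ℝ}
    (hu : BddSol ν Γ m N f u G) (hG : G' ⊆ G)
    (hae : ∀ᵐ t ∂(volume.restrict (Ioi (0 : ℝ))), t ∈ G') : BddSol ν Γ m N f u G' where
  meas := hu.meas
  mem := hu.mem
  pos := hG.trans hu.pos
  ae_mem := hae
  int t ht := hu.int t (hG ht)
  mass t ht := hu.mass t (hG ht)
  fin t ht := hu.fin t (hG ht)
  energy_total := hu.energy_total
  energy_le t₁ h₁ t₂ h₂ := hu.energy_le t₁ (hG h₁) t₂ (hG h₂)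
  level_le k hk t₁ h₁ t₂ h₂ := hu.level_le k hk t₁ (hG h₁) t₂ (hG h₂)
  eq t ht := hu.eq t (hG ht)

/-- A sequence of solutions with bounded data, of mass at most `M`, bounded by `b` at the times
of `G`. -/
structure ApproxSeq (ν : Measure X) (Γ : Measure (X × X)) (m M : ℝ) (b : ℝ → ℝ) (N : ℕ → ℝ)
    (f : ℕ → X → ℝ) (u : ℕ → ℝ → X → ℝ) (G : Set ℝ) : Prop where
  sol : ∀ n, BddSol ν Γ m (N n) (f n) (u n) G
  dens : ∀ n, BddDensity ν (N n) (f n)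
  mass : ∀ n, ∫ x, f n x ∂ν ≤ M
  bound : ∀ n, ∀ t ∈ G, ∀ᵐ x ∂ν, u n t x ≤ b t
  bound_nonneg : ∀ t, 0 ≤ b t
  bound_anti : AntitoneOn b (Ioi 0)
  bound_meas : Measurable b

/-- A solution for positive times, of mass at most `M` and bounded by `b`. -/
structure LimitSol (ν : Measure X) (Γ : Measure (X × X)) (m M : ℝ) (b : ℝ → ℝ)
    (u : ℝ → X → ℝ) (G : Set ℝ) : Prop where
  meas : Measurable (Function.uncurry u)
  mem : ∀ t x, u t x ∈ Icc 0 (b t)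
  pos : G ⊆ Ioi 0
  ae_mem : ∀ᵐ t ∂(volume.restrict (Ioi (0 : ℝ))), t ∈ G
  int : ∀ t ∈ G, Integrable (u t) ν
  mass : ∀ t ∈ G, ∫ x, u t x ∂ν ≤ M
  fin : ∀ t ∈ G, energy Γ (fun x => u t x ^ m) ≠ ⊤
  energy_le : ∀ t₁ ∈ G, ∀ t₂ ∈ G, t₁ < t₂ →
    ENNReal.ofReal ((∫ x, u t₂ x ^ (m + 1) ∂ν) / (m + 1)) +
      ∫⁻ r in Ioc t₁ t₂, energy Γ (fun x => u r x ^ m) ≤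
      ENNReal.ofReal ((∫ x, u t₁ x ^ (m + 1) ∂ν) / (m + 1))
  eq : ∀ t₁ ∈ G, ∀ t₂ ∈ G, t₁ < t₂ → ∀ w, FormTest ν Γ (conjExp m) w →
    (∫ x, (u t₂ x - u t₁ x) * w x ∂ν) + ∫ r in Ioc t₁ t₂, eform Γ (fun x => u r x ^ m) w = 0

namespace ApproxSeq

variable {m M : ℝ} {b : ℝ → ℝ} {N : ℕ → ℝ} {f : ℕ → X → ℝ} {u : ℕ → ℝ → X → ℝ} {G : Set ℝ}

lemma comp (h : ApproxSeq ν Γ m M b N f u G) (ψ : ℕ → ℕ) :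
    ApproxSeq ν Γ m M b (N ∘ ψ) (f ∘ ψ) (u ∘ ψ) G :=
  ⟨fun n => h.sol (ψ n), fun n => h.dens (ψ n), fun n => h.mass (ψ n), fun n => h.bound (ψ n),
    h.bound_nonneg, h.bound_anti, h.bound_meas⟩

lemma mass_le (h : ApproxSeq ν Γ m M b N f u G) (n : ℕ) {t : ℝ} (ht : t ∈ G) :
    ∫ x, u n t x ∂ν ≤ M := ((h.sol n).mass t ht).trans (h.mass n)

lemma lintegral_energy_le (h : ApproxSeq ν Γ m M b N f u G) (hm : 1 < m) (n : ℕ) {τ : ℝ}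
    (hτ : τ ∈ G) (t : ℝ) :
    ∫⁻ r in Ioc τ t, energy Γ (fun x => u n r x ^ m) ≤ ENNReal.ofReal (b τ ^ m * M) := by
  have hG0 : ∀ᵐ r ∂(volume.restrict (Ioi (0 : ℝ))), r ∈ G := (h.sol n).ae_mem
  have hτ0 : (0 : ℝ) < τ := (h.sol n).pos hτ
  obtain ⟨t', ht', htt', -⟩ := exists_mem_Ioo_of_ae hG0 (a := max τ t) (b := max τ t + 1)
    (hτ0.le.trans (le_max_left _ _)) (by linarith)
  have h1 := (h.sol n).energy_le τ hτ t' ht' ((le_max_left _ _).trans_lt htt')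
  calc ∫⁻ r in Ioc τ t, energy Γ (fun x => u n r x ^ m)
      ≤ ∫⁻ r in Ioc τ t', energy Γ (fun x => u n r x ^ m) :=
        lintegral_mono_set (Ioc_subset_Ioc_right ((le_max_right _ _).trans htt'.le))
    _ ≤ ENNReal.ofReal ((∫ x, u n τ x ^ (m + 1) ∂ν) / (m + 1)) := le_add_self.trans h1
    _ ≤ ENNReal.ofReal (b τ ^ m * M) := by
      apply ENNReal.ofReal_le_ofReal
      have h0 : ∀ x, 0 ≤ u n τ x := fun x => ((h.sol n).mem τ x).1
      have h2 : ∫ x, u n τ x ^ (m + 1) ∂ν ≤ ∫ x, b τ ^ m * u n τ x ∂ν := by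
        refine integral_mono_of_nonneg (Eventually.of_forall fun x => Real.rpow_nonneg (h0 x) _)
          (((h.sol n).int τ hτ).const_mul _) ((h.bound n τ hτ).mono fun x hx => ?_)
        change u n τ x ^ (m + 1) ≤ b τ ^ m * u n τ x
        rw [Real.rpow_add_one' (h0 x) (by linarith)]
        exact mul_le_mul_of_nonneg_right (Real.rpow_le_rpow (h0 x) hx (by linarith)) (h0 x)
      rw [integral_const_mul] at h2
      have h3 : 0 ≤ ∫ x, u n τ x ^ (m + 1) ∂ν :=
        integral_nonneg fun x => Real.rpow_nonneg (h0 x) _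
      calc (∫ x, u n τ x ^ (m + 1) ∂ν) / (m + 1) ≤ ∫ x, u n τ x ^ (m + 1) ∂ν :=
            div_le_self h3 (by linarith)
        _ ≤ b τ ^ m * M := h2.trans (mul_le_mul_of_nonneg_left (h.mass_le n hτ)
            (Real.rpow_nonneg (h.bound_nonneg τ) _))

lemma exists_limitSol [SFinite ν] [SFinite Γ] (h : ApproxSeq ν Γ m M b N f u G)
    (hM : MarginalsAC ν Γ) (hm : 1 < m) {a c : ℕ → ℝ} (ha : Tendsto a atTop (𝓝 0))
    (hc : Tendsto c atTop atTop)
    (hcau : ∀ n, ∫⁻ t in Ioc (a n) (c n), ∫⁻ x, ENNReal.ofReal (|u n t x - u (n + 1) t x| ^ (m + 1))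
      ∂ν ≤ ENNReal.ofReal ((1 / 2) ^ n)) :
    ∃ v G', LimitSol ν Γ m M b v G' ∧ G' ⊆ G ∧
      ∀ t ∈ G', LimAt ν (m + 1) (fun n => u n t) (v t) := by
  have hG := (h.sol 0).ae_mem
  obtain ⟨v, hv, hvb, hlim⟩ := exists_limit (ν := ν) (p := m + 1) (by linarith)
    (U := u) (fun n => (h.sol n).meas) h.bound_meas h.bound_nonneg
    (fun n => hG.mono fun t ht => (h.bound n t ht).mono fun x hx => ⟨((h.sol n).mem t x).1, hx⟩)
    (fun n => hG.mono fun t ht => ((h.sol n).bdd ht).integrable_rpow (by linarith))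
    ha hc (C := 1) (by simp) (fun n => (hcau n).trans (by
      rw [one_mul, ENNReal.ofReal_pow (by norm_num)]
      simp))
  have hvm : ∀ n, Measurable (Function.uncurry fun t x => u n t x ^ m) := fun n =>
    (h.sol n).meas_rpow
  have hwm : Measurable (Function.uncurry fun t x => v t x ^ m) := hv.pow_const m
  have hum : ∀ n t, Measurable (u n t) := fun n t => (h.sol n).meas.of_uncurry_left
  have hlim' : ∀ᵐ t ∂(volume.restrict (Ioi (0 : ℝ))), ∀ᵐ x ∂ν,
      Tendsto (fun n => u n t x ^ m) atTop (𝓝 (v t x ^ m)) := hlim.mono fun t ht =>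
    ht.tendsto.mono fun x hx => hx.rpow_const (Or.inr (by linarith))
  have hen : ∀ τ t, τ ∈ G → ∫⁻ r in Ioc τ t, energy Γ (fun x => v r x ^ m) ≤
      ENNReal.ofReal (b τ ^ m * M) := fun τ t hτ => by
    refine (lintegral_energy_le_liminf hM hvm (J := fun _ => Ioc τ t)
      (ae_restrict_of_ae_restrict_of_subset
        (fun r hr => ((h.sol 0).pos hτ).trans hr.1) hlim') (fun _ => measurableSet_Ioc)
      ((ae_restrict_mem measurableSet_Ioc).mono fun r hr => Eventually.of_forall fun _ => hr)).trans
      ?_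
    exact (liminf_le_liminf (Eventually.of_forall fun n => h.lintegral_energy_le hm n hτ t)).trans
      (by simp)
  have hfin : ∀ᵐ t ∂(volume.restrict (Ioi (0 : ℝ))), energy Γ (fun x => v t x ^ m) ≠ ⊤ := by
    have h1 : ∀ k : ℕ, ∀ᵐ t ∂(volume.restrict (Ioc ((k + 1 : ℝ)⁻¹) k)),
        energy Γ (fun x => v t x ^ m) ≠ ⊤ := fun k => by
      obtain ⟨τ, h1, -, h2⟩ := exists_mem_Ioo_of_ae hG (a := 0) (b := (k + 1 : ℝ)⁻¹) le_rfl
        (by positivity)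
      have h3 : ∫⁻ r in Ioc ((k + 1 : ℝ)⁻¹) k, energy Γ (fun x => v r x ^ m) ≠ ⊤ :=
        ne_top_of_le_ne_top ENNReal.ofReal_ne_top
          ((lintegral_mono_set (Ioc_subset_Ioc_left h2.le)).trans (hen τ k h1))
      exact (ae_lt_top (measurable_energy hwm) h3).mono fun t ht => ht.ne
    have h2 : Ioi (0 : ℝ) = ⋃ k : ℕ, Ioc ((k + 1 : ℝ)⁻¹) k := by
      ext t
      simp only [mem_Ioi, mem_iUnion, mem_Ioc]
      refine ⟨fun ht => ?_, fun ⟨k, hk, _⟩ => lt_trans (by positivity) hk⟩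
      obtain ⟨k, hk⟩ := exists_nat_gt (max t t⁻¹)
      refine ⟨k, ?_, (le_max_left _ _).trans hk.le⟩
      rw [inv_lt_comm₀ (by positivity) ht]
      linarith [le_max_right t t⁻¹]
    rw [h2, ae_restrict_iUnion_iff]
    exact h1
  refine ⟨v, {t | t ∈ G ∧ LimAt ν (m + 1) (fun n => u n t) (v t) ∧
    energy Γ (fun x => v t x ^ m) ≠ ⊤}, ?_, fun t ht => ht.1, fun t ht => ht.2.1⟩
  have hvt : ∀ t, Measurable (v t) := fun t => hv.of_uncurry_left
  have hv0 : ∀ t x, 0 ≤ v t x := fun t x => (hvb t x).1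
  have hmass : ∀ t ∈ G, LimAt ν (m + 1) (fun n => u n t) (v t) →
      ∫⁻ x, ENNReal.ofReal (v t x) ∂ν ≤ ENNReal.ofReal M := fun t ht hl => by
    calc ∫⁻ x, ENNReal.ofReal (v t x) ∂ν
        = ∫⁻ x, liminf (fun n => ENNReal.ofReal (u n t x)) atTop ∂ν :=
          lintegral_congr_ae (hl.tendsto.mono fun x hx => (ENNReal.tendsto_ofReal hx).liminf_eq.symm)
      _ ≤ liminf (fun n => ∫⁻ x, ENNReal.ofReal (u n t x) ∂ν) atTop :=
          lintegral_liminf_le fun n => (hum n t).ennreal_ofReal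
      _ ≤ liminf (fun _ : ℕ => ENNReal.ofReal M) atTop := by
          refine liminf_le_liminf (Eventually.of_forall fun n => ?_)
          rw [← ofReal_integral_eq_lintegral_ofReal ((h.sol n).int t ht)
            (Eventually.of_forall fun x => ((h.sol n).mem t x).1)]
          exact ENNReal.ofReal_le_ofReal (h.mass_le n ht)
      _ = _ := by simp
  have hint : ∀ t ∈ G, LimAt ν (m + 1) (fun n => u n t) (v t) → Integrable (v t) ν :=
    fun t ht hl => ⟨(hvt t).aestronglyMeasurable, by
      rw [hasFiniteIntegral_iff_ofReal (Eventually.of_forall (hv0 t))]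
      exact (hmass t ht hl).trans_lt ENNReal.ofReal_lt_top⟩
  have hpow : ∀ t, LimAt ν (m + 1) (fun n => u n t) (v t) →
      Integrable (fun x => |v t x| ^ (m + 1)) ν ∧
      Tendsto (fun n => ∫ x, |u n t x| ^ (m + 1) ∂ν) atTop (𝓝 (∫ x, |v t x| ^ (m + 1) ∂ν)) :=
    fun t hl => hl.tendsto_integral_comp (by linarith) (fun n => hum n t)
      (θ := fun a => |a| ^ (m + 1)) (continuous_abs.rpow_const fun _ => Or.inr (by linarith))
      (C := 1) zero_le_one fun a => by
        rw [one_mul, abs_of_nonneg (Real.rpow_nonneg (abs_nonneg a) _)]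
  refine ⟨hv, hvb, fun t ht => (h.sol 0).pos ht.1, ?_, fun t ht => hint t ht.1 ht.2.1,
    fun t ht => ?_, fun t ht => ht.2.2, fun t₁ h₁ t₂ h₂ h12 => ?_, fun t₁ h₁ t₂ h₂ h12 w hw => ?_⟩
  · filter_upwards [hG, hlim, hfin] with t h1 h2 h3 using ⟨h1, h2, h3⟩
  · have hM0 : 0 ≤ M := (integral_nonneg fun x => ((h.sol 0).mem t x).1).trans (h.mass_le 0 ht.1)
    rw [← ENNReal.ofReal_le_ofReal_iff hM0, ofReal_integral_eq_lintegral_ofReal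
      (hint t ht.1 ht.2.1) (Eventually.of_forall (hv0 t))]
    exact hmass t ht.1 ht.2.1
  · have e : ∀ t, (∫ x, v t x ^ (m + 1) ∂ν) = ∫ x, |v t x| ^ (m + 1) ∂ν := fun t => by
      simp only [abs_of_nonneg (hv0 t _)]
    have e' : ∀ n t, (∫ x, u n t x ^ (m + 1) ∂ν) = ∫ x, |u n t x| ^ (m + 1) ∂ν := fun n t => by
      simp only [abs_of_nonneg ((h.sol n).mem t _).1]
    have := ofReal_add_mul_le_of_liminf (c := 1) (((hpow t₂ h₂.2.1).2).div_const (m + 1))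
      (((hpow t₁ h₁.2.1).2).div_const (m + 1)) (by simp)
      (lintegral_energy_le_liminf hM hvm (I := Ioc t₁ t₂) (J := fun _ => Ioc t₁ t₂)
        (ae_restrict_of_ae_restrict_of_subset
          (fun r hr => ((h.sol 0).pos h₁.1).trans hr.1) hlim') (fun _ => measurableSet_Ioc)
        ((ae_restrict_mem measurableSet_Ioc).mono fun r hr =>
          Eventually.of_forall fun _ => hr))
      (Eventually.of_forall fun n => by
        rw [one_mul, ← e', ← e']
        exact (h.sol n).energy_le t₁ h₁.1 t₂ h₂.1 h12)
    rwa [one_mul, ← e, ← e] at this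
  · have hc := holderConjugate_conjExp hm
    have hmul : ∀ t, LimAt ν (m + 1) (fun n => u n t) (v t) →
        Integrable (fun x => v t x * w x) ν := fun t hl =>
      integrable_mul_of_rpow hc (hvt t) hw.meas (hpow t hl).1 hw.intq
    have hmul' : ∀ n, ∀ t ∈ G, Integrable (fun x => u n t x * w x) ν := fun n t ht =>
      integrable_mul_of_rpow hc (hum n t) hw.meas
        (((h.sol n).bdd ht).integrable_rpow (by linarith)) hw.intq
    have e1 : ∫ x, (v t₂ x - v t₁ x) * w x ∂ν = ∫ x, v t₂ x * w x ∂ν - ∫ x, v t₁ x * w x ∂ν := by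
      simp only [sub_mul]
      exact integral_sub (hmul t₂ h₂.2.1) (hmul t₁ h₁.2.1)
    have e2 : ∀ n, ∫ x, (u n t₂ x - u n t₁ x) * w x ∂ν =
        ∫ x, u n t₂ x * w x ∂ν - ∫ x, u n t₁ x * w x ∂ν := fun n => by
      simp only [sub_mul]
      exact integral_sub (hmul' n t₂ h₂.1) (hmul' n t₁ h₁.1)
    have l1 := ((h₂.2.1.tendsto_integral_mul hc (fun n => hum n t₂) hw.meas hw.intq).sub
      (h₁.2.1.tendsto_integral_mul hc (fun n => hum n t₁) hw.meas hw.intq))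
    have l2 := tendsto_integral_eform hM hvm hwm (I := Ioc t₁ t₂) (by simp) (J' := Ioc t₁ t₂)
      (J := fun _ => Ioc t₁ t₂) measurableSet_Ioc (fun _ => measurableSet_Ioc) subset_rfl
      (fun _ => subset_rfl) (ae_restrict_of_ae_restrict_of_subset
          (fun r hr => ((h.sol 0).pos h₁.1).trans hr.1) hlim')
      (Eventually.of_forall fun r => Eventually.of_forall fun _ => Iff.rfl)
      ENNReal.ofReal_ne_top (fun n => h.lintegral_energy_le hm n h₁.1 t₂) hw.meas hw.fin
    rw [e1]
    refine tendsto_nhds_unique (l1.add l2) ?_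
    refine tendsto_const_nhds.congr fun n => ?_
    rw [← e2]
    exact ((h.sol n).eq_between hm (h.dens n) h₁.1 h₂.1 h12 hw).symm

end ApproxSeq

variable {X : Type*} [MeasurableSpace X] {ν : Measure X} {Γ : Measure (X × X)}

lemma energy_sub_le {v w : X → ℝ} (hw : Measurable w) :
    energy Γ (fun x => v x - w x) ≤ 2 * energy Γ v + 2 * energy Γ w := by
  have hwm : Measurable fun p => ENNReal.ofReal (pdiff w p ^ 2) :=
    ((measurable_pdiff hw).pow_const 2).ennreal_ofReal
  unfold energy
  rw [← lintegral_const_mul' 2 _ (by simp), ← lintegral_const_mul 2 hwm,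
    ← lintegral_add_right _ (hwm.const_mul _)]
  refine lintegral_mono fun p => ?_
  have h2 : (2 : ℝ≥0∞) = ENNReal.ofReal 2 := by simp
  rw [h2, ← ENNReal.ofReal_mul (p := 2) (by norm_num), ← ENNReal.ofReal_mul (p := 2) (by norm_num),
    ← ENNReal.ofReal_add (by positivity) (by positivity)]
  apply ENNReal.ofReal_le_ofReal
  unfold pdiff
  nlinarith [sq_nonneg ((v p.1 - v p.2) + (w p.1 - w p.2))]

namespace ApproxSeq

variable {m M : ℝ} {b : ℝ → ℝ} {N : ℕ → ℝ} {f : ℕ → X → ℝ} {u : ℕ → ℝ → X → ℝ} {G : Set ℝ}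
  {ι : Type*}

/-- Compactness of pairings over a set `Q` carrying most of the mass, modulo finitely many
averages. -/
def CellCompact (ν : Measure X) (Γ : Measure (X × X)) (u : ℕ → ℝ → X → ℝ) (G : Set ℝ)
    (S : ι → Set X) : Prop :=
  ∀ T B η : ℝ, 0 < B → 0 < η → ∃ (Q : Set X) (J : Finset ι), MeasurableSet Q ∧
    (∀ n, ∀ t ∈ G, t ≤ T → ∫ x in Qᶜ, u n t x ∂ν ≤ η) ∧
    ∀ f w : X → ℝ, Measurable f → Measurable w → (∀ x, |f x| ≤ B) → (∀ x, |w x| ≤ B) →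
      energy Γ w ≠ ⊤ →
      |∫ x in Q, f x * w x ∂ν| ≤ η * (1 + (energy Γ w).toReal) +
        B * ∑ i ∈ J, |∫ x in S i, f x ∂ν|

lemma pairing_le (h : ApproxSeq ν Γ m M b N f u G) (hM : MarginalsAC ν Γ) (hm : 1 < m)
    {S : ι → Set X} {Q : Set X} {J : Finset ι} {B η δ τ t : ℝ} (hQ : MeasurableSet Q)
    (hB : 0 ≤ B) (hη : 0 ≤ η) (hτ : τ ∈ G) (ht : t ∈ G) (hbτ : b τ ≤ B) (hbt : b t ^ m ≤ B)
    (hQu : ∀ n, ∫ x in Qᶜ, u n τ x ∂ν ≤ η)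
    (hS : ∀ f w : X → ℝ, Measurable f → Measurable w → (∀ x, |f x| ≤ B) → (∀ x, |w x| ≤ B) →
      energy Γ w ≠ ⊤ →
      |∫ x in Q, f x * w x ∂ν| ≤ η * (1 + (energy Γ w).toReal) +
        B * ∑ i ∈ J, |∫ x in S i, f x ∂ν|) {n k : ℕ}
    (hδ : ∀ i ∈ J, |∫ x in S i, u n τ x ∂ν - ∫ x in S i, u k τ x ∂ν| ≤ δ) :
    ∫ x, (u n τ x - u k τ x) * (u n t x ^ m - u k t x ^ m) ∂ν ≤
      η * (1 + 2 * B) + B * (J.card * δ) + 2 * η * (energy Γ (fun x => u n t x ^ m)).toReal +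
        2 * η * (energy Γ (fun x => u k t x ^ m)).toReal := by
  have hum : ∀ n t, Measurable (u n t) := fun n t => (h.sol n).meas.of_uncurry_left
  have h0 : ∀ n t x, 0 ≤ u n t x := fun n t x => ((h.sol n).mem t x).1
  have hvB : ∀ n, ∀ᵐ x ∂ν, u n t x ^ m ∈ Icc 0 B := fun n => (h.bound n t ht).mono fun x hx =>
    ⟨Real.rpow_nonneg (h0 n t x) _,
      (Real.rpow_le_rpow (h0 n t x) hx (by linarith)).trans hbt⟩
  have huB : ∀ n, ∀ᵐ x ∂ν, u n τ x ∈ Icc 0 B := fun n => (h.bound n τ hτ).mono fun x hx =>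
    ⟨h0 n τ x, hx.trans hbτ⟩
  set a : X → ℝ := fun x => u n τ x - u k τ x with ha
  set w : X → ℝ := fun x => u n t x ^ m - u k t x ^ m with hw
  have ham : Measurable a := (hum n τ).sub (hum k τ)
  have hwm : Measurable w := ((hum n t).pow_const m).sub ((hum k t).pow_const m)
  have hai : Integrable a ν := ((h.sol n).int τ hτ).sub ((h.sol k).int τ hτ)
  have haB : ∀ᵐ x ∂ν, |a x| ≤ B := by
    filter_upwards [huB n, huB k] with x h1 h2
    exact abs_le.2 ⟨by linarith [h1.1, h2.2], by linarith [h1.2, h2.1]⟩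
  have hwB : ∀ᵐ x ∂ν, |w x| ≤ B := by
    filter_upwards [hvB n, hvB k] with x h1 h2
    exact abs_le.2 ⟨by linarith [h1.1, h2.2], by linarith [h1.2, h2.1]⟩
  have hawi : Integrable (fun x => a x * w x) ν :=
    hai.mul_bdd (c := B) hwm.aestronglyMeasurable (hwB.mono fun x hx => hx)
  rw [← integral_add_compl hQ hawi]
  have hout : ∫ x in Qᶜ, a x * w x ∂ν ≤ η * (2 * B) := by
    have h1 : ∫ x in Qᶜ, a x * w x ∂ν ≤ ∫ x in Qᶜ, B * (u n τ x + u k τ x) ∂ν := by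
      refine integral_mono_ae hawi.integrableOn
        ((((h.sol n).int τ hτ).add ((h.sol k).int τ hτ)).const_mul B).integrableOn
        (ae_restrict_of_ae (hwB.mono fun x hx => ?_))
      change a x * w x ≤ B * (u n τ x + u k τ x)
      have e : |a x| ≤ u n τ x + u k τ x := abs_le.2
        ⟨by linarith [h0 n τ x, h0 k τ x], by linarith [h0 n τ x, h0 k τ x]⟩
      calc a x * w x ≤ |a x| * |w x| := (le_abs_self _).trans (abs_mul _ _).le
        _ ≤ (u n τ x + u k τ x) * B := mul_le_mul e hx (abs_nonneg _)
          (add_nonneg (h0 n τ x) (h0 k τ x))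
        _ = _ := mul_comm _ _
    rw [integral_const_mul, integral_add ((h.sol n).int τ hτ).integrableOn
      ((h.sol k).int τ hτ).integrableOn] at h1
    have h2 := mul_le_mul_of_nonneg_left (add_le_add (hQu n) (hQu k)) hB
    linarith
  have hclamp : ∀ y, |max (-B) (min B y)| ≤ B := fun y =>
    abs_le.2 ⟨le_max_left _ _, max_le (by linarith) (min_le_left _ _)⟩
  have hclamp' : ∀ y, |y| ≤ B → max (-B) (min B y) = y := fun y hy => by
    rw [min_eq_right (abs_le.1 hy).2, max_eq_right (abs_le.1 hy).1]
  have hE : energy Γ (fun x => max (-B) (min B (w x))) = energy Γ w :=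
    hM.energy_congr (hwB.mono fun x hx => hclamp' _ hx)
  have hEle : energy Γ w ≤ 2 * energy Γ (fun x => u n t x ^ m) +
      2 * energy Γ (fun x => u k t x ^ m) := energy_sub_le ((hum k t).pow_const m)
  have hfn := (h.sol n).fin t ht
  have hfk := (h.sol k).fin t ht
  have hfin : 2 * energy Γ (fun x => u n t x ^ m) + 2 * energy Γ (fun x => u k t x ^ m) ≠ ⊤ :=
    ENNReal.add_ne_top.2 ⟨ENNReal.mul_ne_top (by simp) hfn, ENNReal.mul_ne_top (by simp) hfk⟩
  have hin := hS (fun x => max (-B) (min B (a x))) (fun x => max (-B) (min B (w x)))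
    (measurable_const.max (measurable_const.min ham))
    (measurable_const.max (measurable_const.min hwm)) (fun x => hclamp _) (fun x => hclamp _)
    (by rw [hE]; exact ne_top_of_le_ne_top hfin hEle)
  rw [hE, integral_congr_ae (g := fun x => a x * w x) (ae_restrict_of_ae (by
    filter_upwards [haB, hwB] with x h1 h2
    rw [hclamp' _ h1, hclamp' _ h2]))] at hin
  have hsum : ∑ i ∈ J, |∫ x in S i, max (-B) (min B (a x)) ∂ν| ≤ J.card * δ := by
    rw [← nsmul_eq_mul]
    refine Finset.sum_le_card_nsmul _ _ _ fun i hi => ?_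
    rw [integral_congr_ae (g := a) (ae_restrict_of_ae (haB.mono fun x hx => hclamp' _ hx)), ha,
      integral_sub ((h.sol n).int τ hτ).integrableOn ((h.sol k).int τ hτ).integrableOn]
    exact hδ i hi
  have hEr : (energy Γ w).toReal ≤ 2 * (energy Γ (fun x => u n t x ^ m)).toReal +
      2 * (energy Γ (fun x => u k t x ^ m)).toReal := by
    have := ENNReal.toReal_mono hfin hEle
    rwa [ENNReal.toReal_add (ENNReal.mul_ne_top (by simp) hfn) (ENNReal.mul_ne_top (by simp) hfk),
      ENNReal.toReal_mul, ENNReal.toReal_mul, ENNReal.toReal_ofNat] at this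
  have h3 := mul_le_mul_of_nonneg_left hEr hη
  have h4 := mul_le_mul_of_nonneg_left hsum hB
  have h5 := (le_abs_self _).trans hin
  linarith

lemma exists_distance_le [SFinite ν] [SFinite Γ] (h : ApproxSeq ν Γ m M b N f u G)
    (hM : MarginalsAC ν Γ) (hm : 1 < m)
    {S : ι → Set X} (hS : CellCompact ν Γ u G S) {τ T ε : ℝ} (hτ : τ ∈ G) (hε : 0 < ε) :
    ∃ (J : Finset ι) (δ : ℝ), 0 < δ ∧ ∀ n k,
      (∀ i ∈ J, |∫ x in S i, u n τ x ∂ν - ∫ x in S i, u k τ x ∂ν| ≤ δ) →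
      ∫⁻ t in Ioc τ T, ∫⁻ x, ENNReal.ofReal (|u n t x - u k t x| ^ (m + 1)) ∂ν ≤
        ENNReal.ofReal ε := by
  rcases le_or_gt T τ with hT | hT
  · exact ⟨∅, 1, one_pos, fun n k _ => by simp [Ioc_eq_empty hT.not_gt]⟩
  have hτ0 : (0 : ℝ) < τ := (h.sol 0).pos hτ
  have hM0 : 0 ≤ M := (integral_nonneg fun x => ((h.sol 0).mem τ x).1).trans (h.mass_le 0 hτ)
  have hb0 : 0 ≤ b τ ^ m := Real.rpow_nonneg (h.bound_nonneg τ) _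
  set B := max 1 (max (b τ) (b τ ^ m)) with hBdef
  have hB : 0 < B := lt_of_lt_of_le one_pos (le_max_left _ _)
  set A := (T - τ) * (1 + 2 * B) + 4 * (b τ ^ m * M) + 1 with hA
  have hA0 : 0 < A := by
    have : 0 ≤ (T - τ) * (1 + 2 * B) := mul_nonneg (by linarith) (by linarith)
    have : 0 ≤ b τ ^ m * M := mul_nonneg hb0 hM0
    linarith
  obtain ⟨Q, J, hQ, hQu, hQS⟩ := hS τ B (ε / (2 * A)) hB (by positivity)
  set D := (T - τ) * (B * J.card) + 1 with hD
  have hD0 : 0 < D := by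
    have : 0 ≤ (T - τ) * (B * J.card) := mul_nonneg (by linarith) (by positivity)
    linarith
  refine ⟨J, ε / (2 * D), by positivity, fun n k hδ => ?_⟩
  refine ((h.sol n).compare (h.sol k) hm (h.dens n) (h.dens k) hτ hτ).trans
    (ENNReal.ofReal_le_ofReal ?_)
  set η := ε / (2 * A) with hη
  set δ := ε / (2 * D) with hδdef
  have hη0 : 0 < η := by positivity
  have hEi : ∀ n, IntegrableOn (fun t => (energy Γ (fun x => u n t x ^ m)).toReal) (Ioc τ T) ∧
      ∫ t in Ioc τ T, (energy Γ (fun x => u n t x ^ m)).toReal ≤ b τ ^ m * M := fun n => by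
    have h1 := h.lintegral_energy_le hm n hτ T
    have h2 := ne_top_of_le_ne_top ENNReal.ofReal_ne_top h1
    have hme := measurable_energy (Γ := Γ) (h.sol n).meas_rpow
    refine ⟨integrable_toReal_of_lintegral_ne_top hme.aemeasurable h2, ?_⟩
    rw [integral_toReal hme.aemeasurable (ae_lt_top hme h2)]
    exact ENNReal.toReal_le_of_le_ofReal (mul_nonneg hb0 hM0) h1
  have hG : ∀ᵐ t ∂(volume.restrict (Ioc τ T)), t ∈ G :=
    ae_restrict_of_ae_restrict_of_subset (fun t ht => hτ0.trans ht.1) (h.sol 0).ae_mem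
  have hbound : ∫ t in Ioc τ T, ∫ x, (u n τ x - u k τ x) * (u n t x ^ m - u k t x ^ m) ∂ν ≤
      ∫ t in Ioc τ T, ((η * (1 + 2 * B) + B * (J.card * δ)) +
        2 * η * (energy Γ (fun x => u n t x ^ m)).toReal +
        2 * η * (energy Γ (fun x => u k t x ^ m)).toReal) := by
    refine integral_mono_ae ((h.sol n).integrable_pairing (h.sol k) hm
      (((h.sol n).meas.of_uncurry_left).sub ((h.sol k).meas.of_uncurry_left))
      (((h.sol n).int τ hτ).sub ((h.sol k).int τ hτ)))
      (((integrable_const _).add ((hEi n).1.const_mul _)).add ((hEi k).1.const_mul _)) ?_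
    filter_upwards [hG, ae_restrict_mem measurableSet_Ioc] with t ht htm
    have hbt : b t ≤ b τ := h.bound_anti hτ0 (hτ0.trans htm.1) htm.1.le
    exact h.pairing_le hM hm hQ hB.le hη0.le hτ ht ((le_max_left _ _).trans (le_max_right _ _))
      ((Real.rpow_le_rpow (h.bound_nonneg t) hbt (by linarith)).trans
        ((le_max_right _ _).trans (le_max_right _ _))) (fun n => hQu n τ hτ le_rfl) hQS hδ
  refine hbound.trans ?_
  have i0 : IntegrableOn (fun _ : ℝ => η * (1 + 2 * B) + B * (J.card * δ)) (Ioc τ T) :=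
    integrable_const _
  have i1 : IntegrableOn (fun t => 2 * η * (energy Γ (fun x => u n t x ^ m)).toReal) (Ioc τ T) :=
    (hEi n).1.const_mul _
  have i2 : IntegrableOn (fun t => 2 * η * (energy Γ (fun x => u k t x ^ m)).toReal) (Ioc τ T) :=
    (hEi k).1.const_mul _
  have i01 : IntegrableOn (fun t => η * (1 + 2 * B) + B * (J.card * δ) +
      2 * η * (energy Γ (fun x => u n t x ^ m)).toReal) (Ioc τ T) := i0.add i1
  rw [integral_add i01 i2, integral_add i0 i1, integral_const_mul, integral_const_mul,
    setIntegral_const, measureReal_def, Real.volume_Ioc, ENNReal.toReal_ofReal (by linarith),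
    smul_eq_mul]
  have e1 : η * A = ε / 2 := by rw [hη]; field_simp
  have e2 : δ * D = ε / 2 := by rw [hδdef]; field_simp
  have h1 := mul_le_mul_of_nonneg_left (hEi n).2 hη0.le
  have h2 := mul_le_mul_of_nonneg_left (hEi k).2 hη0.le
  have hδ0 : 0 < δ := by positivity
  rw [hA] at e1
  rw [hD] at e2
  nlinarith

lemma exists_cauchy_subseq [SFinite ν] [SFinite Γ] [Countable ι]
    (h : ApproxSeq ν Γ m M b N f u G) (hM : MarginalsAC ν Γ) (hm : 1 < m)
    {S : ι → Set X} (hS : CellCompact ν Γ u G S) :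
    ∃ (θ : ℕ → ℕ) (a : ℕ → ℝ), StrictMono θ ∧ Tendsto a atTop (𝓝 0) ∧
      ∀ n, ∫⁻ t in Ioc (a n) n, ∫⁻ x,
        ENNReal.ofReal (|u (θ n) t x - u (θ (n + 1)) t x| ^ (m + 1)) ∂ν ≤
        ENNReal.ofReal ((1 / 2) ^ n) := by
  have hG := (h.sol 0).ae_mem
  have hex : ∀ n : ℕ, ∃ t ∈ G, 0 < t ∧ t < 1 / ((n : ℝ) + 1) := fun n =>
    exists_mem_Ioo_of_ae hG le_rfl (by positivity)
  choose a haG ha0 ha1 using hex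
  have ha : Tendsto a atTop (𝓝 0) :=
    squeeze_zero (fun n => (ha0 n).le) (fun n => (ha1 n).le) tendsto_one_div_add_atTop_nhds_zero_nat
  have hcpt : IsCompact (univ.pi fun _ : ι × ℕ => Icc (0 : ℝ) M) :=
    isCompact_univ_pi fun _ => isCompact_Icc
  obtain ⟨L, -, ψ, hψ, hL⟩ := hcpt.tendsto_subseq
    (x := fun n (p : ι × ℕ) => ∫ x in S p.1, u n (a p.2) x ∂ν) fun n p _ => by
      have h0 : ∀ x, 0 ≤ u n (a p.2) x := fun x => ((h.sol n).mem _ x).1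
      exact ⟨integral_nonneg h0, (setIntegral_le_integral ((h.sol n).int _ (haG p.2))
        (Eventually.of_forall h0)).trans (h.mass_le n (haG p.2))⟩
  rw [tendsto_pi_nhds] at hL
  have hev : ∀ n : ℕ, ∀ᶠ k in atTop, ∀ k' ≥ k, ∫⁻ t in Ioc (a n) n, ∫⁻ x,
      ENNReal.ofReal (|u (ψ k) t x - u (ψ k') t x| ^ (m + 1)) ∂ν ≤
        ENNReal.ofReal ((1 / 2) ^ n) := fun n => by
    obtain ⟨J, δ, hδ, hJ⟩ := h.exists_distance_le hM hm hS (T := n) (haG n)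
      (ε := (1 / 2) ^ n) (by positivity)
    have h1 : ∀ᶠ k in atTop, ∀ i ∈ J,
        |∫ x in S i, u (ψ k) (a n) x ∂ν - L (i, n)| ≤ δ / 2 := by
      rw [Filter.eventually_all_finset]
      intro i _
      have := Metric.tendsto_atTop.1 (hL (i, n)) (δ / 2) (by positivity)
      obtain ⟨k₀, hk₀⟩ := this
      exact eventually_atTop.2 ⟨k₀, fun k hk => (hk₀ k hk).le⟩
    obtain ⟨k₀, hk₀⟩ := eventually_atTop.1 h1
    refine eventually_atTop.2 ⟨k₀, fun k hk k' hk' => hJ _ _ fun i hi => ?_⟩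
    have e1 := abs_le.1 (hk₀ k hk i hi)
    have e2 := abs_le.1 (hk₀ k' (hk.trans hk') i hi)
    exact abs_le.2 ⟨by linarith [e1.1, e2.2], by linarith [e1.2, e2.1]⟩
  obtain ⟨φ, hφ, hφ'⟩ := extraction_forall_of_eventually hev
  exact ⟨ψ ∘ φ, a, hψ.comp hφ, ha, fun n => hφ' n _ (hφ n.lt_succ_self).le⟩

end ApproxSeq

variable {X : Type*} [MeasurableSpace X] {ν : Measure X} {Γ : Measure (X × X)}

lemma setLIntegral_Ioc_comp_add {E : ℝ → ℝ≥0∞} (hE : Measurable E) (a b h : ℝ) :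
    ∫⁻ t in Ioc a b, E (t + h) = ∫⁻ t in Ioc (a + h) (b + h), E t := by
  rw [← (measurePreserving_add_right volume h).setLIntegral_comp_preimage measurableSet_Ioc hE]
  simp

lemma setLIntegral_Ioc_add_Ioc {E : ℝ → ℝ≥0∞} {a b c : ℝ} (hab : a ≤ b) (hbc : b ≤ c) :
    ∫⁻ t in Ioc a c, E t = (∫⁻ t in Ioc a b, E t) + ∫⁻ t in Ioc b c, E t := by
  rw [← Ioc_union_Ioc_eq_Ioc hab hbc, lintegral_union measurableSet_Ioc
    (Ioc_disjoint_Ioc_of_le le_rfl)]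

lemma lintegral_lintegral_Ioc_add_le {E : ℝ → ℝ≥0∞} (hE : Measurable E) (a b h : ℝ) :
    ∫⁻ t in Ioc a b, ∫⁻ r in Ioc 0 h, E (r + t) ≤
      ENNReal.ofReal h * ∫⁻ t in Ioc a (b + h), E t := by
  rw [lintegral_lintegral_swap (by fun_prop)]
  calc ∫⁻ r in Ioc 0 h, ∫⁻ t in Ioc a b, E (r + t)
      ≤ ∫⁻ _ in Ioc 0 h, ∫⁻ t in Ioc a (b + h), E t := by
        refine setLIntegral_mono measurable_const fun r hr => ?_
        simp only [add_comm r]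
        rw [setLIntegral_Ioc_comp_add hE]
        exact lintegral_mono_set (Ioc_subset_Ioc (by linarith [hr.1]) (by linarith [hr.2]))
    _ = _ := by rw [setLIntegral_const, Real.volume_Ioc, sub_zero, mul_comm]

namespace LimitSol

variable {m M : ℝ} {b : ℝ → ℝ} {u : ℝ → X → ℝ} {G : Set ℝ}

lemma bdd (hu : LimitSol ν Γ m M b u G) {t : ℝ} (ht : t ∈ G) : BddDensity ν (b t) (u t) :=
  ⟨hu.meas.of_uncurry_left, hu.mem t, hu.int t ht⟩

lemma formTest (hu : LimitSol ν Γ m M b u G) (hm : 1 < m) {t : ℝ} (ht : t ∈ G) :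
    FormTest ν Γ (conjExp m) fun x => u t x ^ m := (hu.bdd ht).formTest_rpow hm (hu.fin t ht)

lemma meas_rpow (hu : LimitSol ν Γ m M b u G) :
    Measurable (Function.uncurry fun t x => u t x ^ m) := hu.meas.pow_const m

lemma measurable_energy [SFinite Γ] (hu : LimitSol ν Γ m M b u G) :
    Measurable fun t => energy Γ (fun x => u t x ^ m) := _root_.measurable_energy hu.meas_rpow

lemma lintegral_energy_ne_top (hu : LimitSol ν Γ m M b u G) {τ : ℝ} (hτ : 0 < τ) (T : ℝ) :
    ∫⁻ t in Ioc τ T, energy Γ (fun x => u t x ^ m) ≠ ⊤ := by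
  obtain ⟨τ', h1, h2, h3⟩ := exists_mem_Ioo_of_ae hu.ae_mem (a := 0) (b := τ) le_rfl hτ
  obtain ⟨T', h4, h5, h6⟩ := exists_mem_Ioo_of_ae hu.ae_mem (a := max τ T) (b := max τ T + 1)
    (hτ.le.trans (le_max_left _ _)) (by linarith)
  refine ne_top_of_le_ne_top ENNReal.ofReal_ne_top (le_trans (lintegral_mono_set
    (Ioc_subset_Ioc h3.le ((le_max_right _ _).trans h5.le))) (le_add_self.trans
    (hu.energy_le τ' h1 T' h4 (h3.trans ((le_max_left _ _).trans_lt h5)))))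

lemma memLp_pdiff [SFinite Γ] (hu : LimitSol ν Γ m M b u G) {τ : ℝ} (hτ : 0 < τ) (T : ℝ) :
    MemLp (fun z : ℝ × (X × X) => pdiff (fun x => u z.1 x ^ m) z.2) 2
      ((volume.restrict (Ioc τ T)).prod Γ) :=
  memLp_pdiff_prod hu.meas_rpow (hu.lintegral_energy_ne_top hτ T)

lemma integrableOn_eform [SFinite Γ] (hu : LimitSol ν Γ m M b u G) {τ : ℝ} (hτ : 0 < τ) (T : ℝ)
    {w : X → ℝ} (hw : FormTest ν Γ (conjExp m) w) :
    IntegrableOn (fun r => eform Γ (fun x => u r x ^ m) w) (Ioc τ T) :=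
  (integral_eform_prod (w := fun _ => w) (hu.memLp_pdiff hτ T)
    (memLp_pdiff_const (by simp) hw.meas hw.fin)).1

/-- The entropy `∫ u^{m+1} / (m+1)`. -/
def entropy (ν : Measure X) (m : ℝ) (u : ℝ → X → ℝ) (t : ℝ) : ℝ≥0∞ :=
  ENNReal.ofReal ((∫ x, u t x ^ (m + 1) ∂ν) / (m + 1))

lemma measurable_entropy [SFinite ν] (hu : LimitSol ν Γ m M b u G) :
    Measurable (entropy ν m u) := by
  have h : StronglyMeasurable (Function.uncurry fun t x => u t x ^ (m + 1)) :=
    (hu.meas.pow_const _).stronglyMeasurable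
  exact (h.integral_prod_right.measurable.div_const _).ennreal_ofReal

lemma entropy_anti (hu : LimitSol ν Γ m M b u G) {t₁ t₂ : ℝ} (h₁ : t₁ ∈ G) (h₂ : t₂ ∈ G)
    (h : t₁ ≤ t₂) : entropy ν m u t₂ ≤ entropy ν m u t₁ := by
  rcases h.eq_or_lt with rfl | h
  · exact le_rfl
  · exact le_self_add.trans (hu.energy_le t₁ h₁ t₂ h₂ h)

lemma entropy_le [SFinite Γ] (hu : LimitSol ν Γ m M b u G) (hm : 1 < m) {t t' : ℝ} (ht : t ∈ G)
    (ht' : t' ∈ G) (htt : t < t') :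
    entropy ν m u t ≤ entropy ν m u t' +
      (ENNReal.ofReal (1 / 2) * (∫⁻ r in Ioc t t', energy Γ (fun x => u r x ^ m)) +
        ENNReal.ofReal ((t' - t) / 2) * energy Γ (fun x => u t x ^ m)) := by
  have hi : ∀ {r}, r ∈ G → Integrable (fun x => u r x ^ (m + 1)) ν := fun hr => by
    have := (hu.bdd hr).integrable_rpow (p := m + 1) (by linarith)
    simpa only [abs_of_nonneg (hu.mem _ _).1] using this
  have hF : ∀ r, 0 ≤ ∫ x, u r x ^ (m + 1) ∂ν := fun r =>
    integral_nonneg fun x => Real.rpow_nonneg (hu.mem r x).1 _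
  set w : X → ℝ := fun x => u t x ^ m with hw
  have hwT : FormTest ν Γ (conjExp m) w := hu.formTest hm ht
  have hsub : Integrable (fun x => (u t' x - u t x) * w x) ν := by
    have h1 := hu.bdd ht
    have h2 : BddDensity ν (max (b t) (b t')) (u t) := ⟨h1.meas, fun x =>
      ⟨(h1.mem x).1, (h1.mem x).2.trans (le_max_left _ _)⟩, h1.int⟩
    have h3 := hu.bdd ht'
    have h4 : BddDensity ν (max (b t) (b t')) (u t') := ⟨h3.meas, fun x =>
      ⟨(h3.mem x).1, (h3.mem x).2.trans (le_max_right _ _)⟩, h3.int⟩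
    exact integrable_sub_mul_formTest hm h4 h2 hwT
  have h1 : (∫ x, u t x ^ (m + 1) ∂ν) / (m + 1) - (∫ x, u t' x ^ (m + 1) ∂ν) / (m + 1) ≤
      -∫ x, (u t' x - u t x) * w x ∂ν := by
    rw [← sub_div, ← integral_sub (hi ht) (hi ht'), ← integral_div, ← integral_neg]
    refine integral_mono (((hi ht).sub (hi ht')).div_const _) hsub.neg fun x => ?_
    have := sub_mul_rpow_ge hm (hu.mem t x).1 (hu.mem t' x).1
    change (u t x ^ (m + 1) - u t' x ^ (m + 1)) / (m + 1) ≤ -((u t' x - u t x) * w x)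
    linarith
  have h2 := hu.eq t ht t' ht' htt w hwT
  have ht0 : (0 : ℝ) < t := hu.pos ht
  have hG : ∀ᵐ r ∂(volume.restrict (Ioc t t')), r ∈ G :=
    ae_restrict_of_ae_restrict_of_subset (fun r hr => ht0.trans hr.1) hu.ae_mem
  have hne := hu.lintegral_energy_ne_top ht0 t'
  have hEi : IntegrableOn (fun r => (energy Γ (fun x => u r x ^ m)).toReal) (Ioc t t') :=
    integrable_toReal_of_lintegral_ne_top hu.measurable_energy.aemeasurable hne
  have hL : ∀ {r}, r ∈ G → MemLp (pdiff fun x => u r x ^ m) 2 Γ := fun hr =>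
    memLp_pdiff_of_energy (hu.formTest hm hr).meas (hu.fin _ hr)
  have h3 : ∫ r in Ioc t t', eform Γ (fun x => u r x ^ m) w ≤
      ∫ r in Ioc t t', (1 / 2 * (energy Γ (fun x => u r x ^ m)).toReal +
        1 / 2 * (energy Γ w).toReal) := by
    refine integral_mono_ae (hu.integrableOn_eform ht0 t' hwT)
      ((hEi.const_mul _).add (integrable_const _)) (hG.mono fun r hr => ?_)
    have := (le_abs_self _).trans (abs_eform_le (hL hr) (hL ht))
    rw [← toReal_energy (hL hr), ← toReal_energy (hL ht)] at this
    change _ ≤ 1 / 2 * (energy Γ (fun x => u r x ^ m)).toReal + 1 / 2 * (energy Γ w).toReal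
    linarith
  rw [integral_add (hEi.const_mul _) (integrable_const _), integral_const_mul, setIntegral_const,
    measureReal_def, Real.volume_Ioc, ENNReal.toReal_ofReal (by linarith), smul_eq_mul,
    integral_toReal hu.measurable_energy.aemeasurable (ae_lt_top hu.measurable_energy hne)] at h3
  have hm1 : 0 < m + 1 := by linarith
  have hn1 : 0 ≤ 1 / 2 * (∫⁻ r in Ioc t t', energy Γ (fun x => u r x ^ m)).toReal := by positivity
  have hn2 : 0 ≤ (t' - t) / 2 * (energy Γ w).toReal :=
    mul_nonneg (by linarith) ENNReal.toReal_nonneg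
  rw [← ENNReal.ofReal_toReal hne, ← ENNReal.ofReal_toReal (hu.fin t ht), entropy, entropy,
    ← ENNReal.ofReal_mul (p := 1 / 2) (by norm_num),
    ← ENNReal.ofReal_mul (p := (t' - t) / 2) (by linarith),
    ← ENNReal.ofReal_add hn1 hn2,
    ← ENNReal.ofReal_add (div_nonneg (hF _) hm1.le) (add_nonneg hn1 hn2)]
  apply ENNReal.ofReal_le_ofReal
  change (∫ x, u t x ^ (m + 1) ∂ν) / (m + 1) ≤ (∫ x, u t' x ^ (m + 1) ∂ν) / (m + 1) +
    (1 / 2 * (∫⁻ r in Ioc t t', energy Γ (fun x => u r x ^ m)).toReal +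
      (t' - t) / 2 * (energy Γ w).toReal)
  linarith

lemma entropy_le_of_window [SFinite ν] [SFinite Γ] (hu : LimitSol ν Γ m M b u G) (hm : 1 < m)
    {c e h : ℝ} (hc : c ∈ G) (he : e ∈ G) (hce : c ≤ e) (hh : 0 < h) (hhc : h < c) :
    entropy ν m u c ≤ entropy ν m u e +
      ∫⁻ r in Ioc (c - h) (e + h), energy Γ (fun x => u r x ^ m) := by
  set E : ℝ → ℝ≥0∞ := fun r => energy Γ (fun x => u r x ^ m) with hE
  have hEm : Measurable E := hu.measurable_energy
  have hFm := hu.measurable_entropy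
  set F := entropy ν m u with hF
  have hG : ∀ᵐ t : ℝ, 0 < t → t ∈ G := (ae_restrict_iff' measurableSet_Ioi).1 hu.ae_mem
  have hG' : ∀ᵐ t : ℝ, 0 < t + h → t + h ∈ G :=
    (measurePreserving_add_right volume h).quasiMeasurePreserving.ae hG
  have key : ∫⁻ t in Ioc (c - h) e, F t ≤ (∫⁻ t in Ioc c (e + h), F t) +
      ENNReal.ofReal h * ∫⁻ r in Ioc (c - h) (e + h), E r := by
    have h1 : ∫⁻ t in Ioc (c - h) e, F t ≤ ∫⁻ t in Ioc (c - h) e, (F (t + h) +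
        (ENNReal.ofReal (1 / 2) * (∫⁻ r in Ioc 0 h, E (r + t)) + ENNReal.ofReal (h / 2) * E t)) := by
      refine lintegral_mono_ae ?_
      filter_upwards [ae_restrict_of_ae hG, ae_restrict_of_ae hG',
        ae_restrict_mem measurableSet_Ioc] with t h1 h2 h3
      have ht0 : 0 < t := by linarith [h3.1]
      have := hu.entropy_le hm (h1 ht0) (h2 (by linarith)) (by linarith)
      rw [setLIntegral_Ioc_comp_add hEm, zero_add, add_comm h t]
      rwa [add_sub_cancel_left] at this
    have m1 : Measurable fun t => ∫⁻ r in Ioc 0 h, E (r + t) :=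
      Measurable.lintegral_prod_right' (f := fun p : ℝ × ℝ => E (p.2 + p.1))
        (hEm.comp (measurable_snd.add measurable_fst))
    have m2 : Measurable fun t => ENNReal.ofReal (1 / 2) * (∫⁻ r in Ioc 0 h, E (r + t)) +
        ENNReal.ofReal (h / 2) * E t := (m1.const_mul _).add (hEm.const_mul _)
    rw [lintegral_add_right _ m2,
      lintegral_add_right _ (hEm.const_mul _), lintegral_const_mul _ m1, lintegral_const_mul _ hEm,
      setLIntegral_Ioc_comp_add hFm, sub_add_cancel] at h1
    refine h1.trans (add_le_add le_rfl ?_)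
    have h2 := lintegral_lintegral_Ioc_add_le hEm (c - h) e h
    have h3 : ∫⁻ t in Ioc (c - h) e, E t ≤ ∫⁻ t in Ioc (c - h) (e + h), E t :=
      lintegral_mono_set (Ioc_subset_Ioc_right (by linarith))
    calc _ ≤ ENNReal.ofReal (1 / 2) * (ENNReal.ofReal h * ∫⁻ t in Ioc (c - h) (e + h), E t) +
          ENNReal.ofReal (h / 2) * ∫⁻ t in Ioc (c - h) (e + h), E t := by gcongr
      _ = _ := by
        rw [← mul_assoc, ← ENNReal.ofReal_mul (by norm_num), ← add_mul,
          ← ENNReal.ofReal_add (by positivity) (by positivity)]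
        congr 2; ring
  have hGc : ∀ {a : ℝ}, 0 ≤ a → ∀ k, ∀ᵐ t ∂(volume.restrict (Ioc a k)), t ∈ G := fun ha k =>
    ae_restrict_of_ae_restrict_of_subset (fun r hr => ha.trans_lt hr.1) hu.ae_mem
  have hc0 : (0 : ℝ) < c := hu.pos hc
  have hfin : ∫⁻ t in Ioc c e, F t ≠ ⊤ := by
    have h1 : ∫⁻ t in Ioc c e, F t ≤ ∫⁻ _ in Ioc c e, F c := lintegral_mono_ae (by
      filter_upwards [hGc hc0.le e, ae_restrict_mem measurableSet_Ioc] with t h1 h2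
      exact hu.entropy_anti hc h1 h2.1.le)
    rw [setLIntegral_const] at h1
    exact ne_top_of_le_ne_top (ENNReal.mul_ne_top ENNReal.ofReal_ne_top (by simp)) h1
  rw [setLIntegral_Ioc_add_Ioc (b := c) (by linarith) hce,
    setLIntegral_Ioc_add_Ioc (a := c) (b := e) (c := e + h) hce (by linarith),
    add_comm, add_assoc, ENNReal.add_le_add_iff_left hfin] at key
  have l1 : ENNReal.ofReal h * F c ≤ ∫⁻ t in Ioc (c - h) c, F t := by
    calc ENNReal.ofReal h * F c = ∫⁻ _ in Ioc (c - h) c, F c := by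
          rw [setLIntegral_const, Real.volume_Ioc, sub_sub_cancel, mul_comm]
      _ ≤ _ := lintegral_mono_ae (by
          filter_upwards [hGc (a := c - h) (by linarith) c, ae_restrict_mem measurableSet_Ioc]
            with t h1 h2
          exact hu.entropy_anti h1 hc h2.2)
  have l2 : ∫⁻ t in Ioc e (e + h), F t ≤ ENNReal.ofReal h * F e := by
    calc ∫⁻ t in Ioc e (e + h), F t ≤ ∫⁻ _ in Ioc e (e + h), F e := lintegral_mono_ae (by
          filter_upwards [hGc (a := e) (hc0.le.trans hce) (e + h),
            ae_restrict_mem measurableSet_Ioc] with t h1 h2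
          exact hu.entropy_anti he h1 h2.1.le)
      _ = _ := by rw [setLIntegral_const, Real.volume_Ioc, add_sub_cancel_left, mul_comm]
  have l3 := l1.trans (key.trans (add_le_add l2 le_rfl))
  rw [← mul_add] at l3
  exact (ENNReal.mul_le_mul_iff_right (by simpa using hh) ENNReal.ofReal_ne_top).1 l3

/-- The energy identity. -/
lemma energy_eq [SFinite ν] [SFinite Γ] (hu : LimitSol ν Γ m M b u G) (hm : 1 < m) {c e : ℝ}
    (hc : c ∈ G) (he : e ∈ G) (hce : c < e) :
    entropy ν m u e + ∫⁻ r in Ioc c e, energy Γ (fun x => u r x ^ m) = entropy ν m u c := by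
  refine le_antisymm (hu.energy_le c hc e he hce) ?_
  have hc0 : (0 : ℝ) < c := hu.pos hc
  set E : ℝ → ℝ≥0∞ := fun r => energy Γ (fun x => u r x ^ m) with hE
  set h : ℕ → ℝ := fun n => c / 2 * (1 / ((n : ℝ) + 1)) with hh
  have hlim : Tendsto h atTop (𝓝 0) := by
    have := (tendsto_one_div_add_atTop_nhds_zero_nat (𝕜 := ℝ)).const_mul (c / 2)
    rwa [mul_zero] at this
  have hpos : ∀ n, 0 < h n := fun n => by positivity
  have hle : ∀ n, h n ≤ c / 2 := fun n => by
    have : 1 / ((n : ℝ) + 1) ≤ 1 := by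
      rw [div_le_one (by positivity)]; linarith [(n.cast_nonneg : (0 : ℝ) ≤ n)]
    exact mul_le_of_le_one_right (by linarith) this
  have hfin : ∫⁻ r in Ioc (c / 2) (e + c), E r ≠ ⊤ :=
    hu.lintegral_energy_ne_top (by linarith) _
  have hz : ∀ s : ℕ → Set ℝ, (∀ n, MeasurableSet (s n)) → (∀ n, s n ⊆ Ioc (c / 2) (e + c)) →
      (∀ n, volume (s n) = ENNReal.ofReal (h n)) →
      Tendsto (fun n => ∫⁻ r in s n, E r) atTop (𝓝 0) := fun s hs1 hs2 hs3 => by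
    have := tendsto_setLIntegral_zero hfin (l := atTop) (s := s) (by
      have h1 : ((volume.restrict (Ioc (c / 2) (e + c))) ∘ s) = fun n => ENNReal.ofReal (h n) := by
        ext n
        rw [Function.comp_apply, Measure.restrict_apply (hs1 n),
          inter_eq_self_of_subset_left (hs2 n), hs3]
      rw [h1]
      simpa using ENNReal.tendsto_ofReal hlim)
    refine this.congr fun n => ?_
    rw [Measure.restrict_restrict (hs1 n), inter_eq_self_of_subset_left (hs2 n)]
  have z1 := hz (fun n => Ioc (c - h n) c) (fun n => measurableSet_Ioc)
    (fun n => Ioc_subset_Ioc (by linarith [hle n]) (by linarith)) (fun n => by simp)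
  have z2 := hz (fun n => Ioc e (e + h n)) (fun n => measurableSet_Ioc)
    (fun n => Ioc_subset_Ioc (by linarith [hle n]) (by linarith [hle n])) (fun n => by simp)
  have z3 : Tendsto (fun n => entropy ν m u e + ((∫⁻ r in Ioc (c - h n) c, E r) +
      ((∫⁻ r in Ioc c e, E r) + ∫⁻ r in Ioc e (e + h n), E r))) atTop
      (𝓝 (entropy ν m u e + (0 + ((∫⁻ r in Ioc c e, E r) + 0)))) :=
    tendsto_const_nhds.add (z1.add (tendsto_const_nhds.add z2))
  rw [zero_add, add_zero] at z3
  refine ge_of_tendsto' z3 fun n => ?_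
  have := hu.entropy_le_of_window hm hc he hce.le (hpos n) (by linarith [hle n])
  rwa [setLIntegral_Ioc_add_Ioc (b := c) (by linarith [hpos n]) (by linarith [hpos n]),
    setLIntegral_Ioc_add_Ioc (a := c) (b := e) hce.le (by linarith [hpos n])] at this

end LimitSol

section Data

open scoped Convolution

variable {d : ℕ}

/-- A finite measure is the weak limit of bounded densities of no larger mass. -/
lemma exists_approx_data {ρ : Ed d → ℝ} {γ c : ℝ} (hγ0 : 0 ≤ γ) (hc : 0 < c) (hρ : Measurable ρ)
    (hpos : ∀ x, 0 < ρ x) (hge : ∀ᵐ x, c * (1 + ‖x‖) ^ (-γ) ≤ ρ x) (μ : Measure (Ed d))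
    [IsFiniteMeasure μ] :
    ∃ (N : ℕ → ℝ) (f : ℕ → Ed d → ℝ), (∀ n, 0 < N n) ∧
      (∀ n, BddDensity (weightMeasure ρ) (N n) (f n)) ∧
      (∀ n, ∫ x, f n x ∂weightMeasure ρ ≤ μ.real univ) ∧
      ∀ ψ : Ed d → ℝ, Continuous ψ → (∃ B : ℝ, ∀ x, |ψ x| ≤ B) →
        Tendsto (fun n => ∫ x, f n x * ψ x ∂weightMeasure ρ) atTop (𝓝 (∫ x, ψ x ∂μ)) := by
  let bump : ℕ → ContDiffBump (0 : Ed d) := fun n => ⟨1 / ((n : ℝ) + 2), 1 / ((n : ℝ) + 1),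
    by positivity, one_div_lt_one_div_of_lt (by positivity) (by linarith)⟩
  set k : ℕ → Ed d → ℝ := fun n => (bump n).normed volume with hk
  have hkc : ∀ n, Continuous (k n) := fun n => (bump n).continuous_normed
  have hk0 : ∀ n z, 0 ≤ k n z := fun n => (bump n).nonneg_normed
  have hk1 : ∀ n, ∫ z, k n z = 1 := fun n => (bump n).integral_normed
  have hki : ∀ n, Integrable (k n) := fun n => (bump n).integrable_normed
  have hS : ∀ n, ∃ S : ℝ, ∀ z, ‖k n z‖ ≤ S := fun n =>
    (hkc n).bounded_above_of_compact_support (bump n).hasCompactSupport_normed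
  choose S hS using hS
  have hS0 : ∀ n, 0 ≤ S n := fun n => (norm_nonneg _).trans (hS n 0)
  set g : ℕ → Ed d → ℝ := fun n x => ∫ y, k n (y - x) ∂μ with hg
  have hgm : ∀ n, Measurable (g n) := fun n => by
    have : StronglyMeasurable (Function.uncurry fun (x y : Ed d) => k n (y - x)) :=
      ((hkc n).comp (continuous_snd.sub continuous_fst)).stronglyMeasurable
    exact this.integral_prod_right.measurable
  have hg0 : ∀ n x, 0 ≤ g n x := fun n x => integral_nonneg fun y => hk0 n _
  have hgS : ∀ n x, g n x ≤ S n * μ.real univ := fun n x =>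
    (le_abs_self _).trans (norm_integral_le_of_norm_le_const (.of_forall fun y => hS n _))
  set Q : ℕ → Set (Ed d) := fun n => Metric.ball 0 n with hQ
  have hQm : ∀ n, MeasurableSet (Q n) := fun n => measurableSet_ball
  set l : ℕ → ℝ := fun n => c * (1 + n) ^ (-γ) with hl
  have hl0 : ∀ n, 0 < l n := fun n => by positivity
  set f : ℕ → Ed d → ℝ := fun n => (Q n).indicator fun x => g n x / max (ρ x) (l n) with hf
  have hmax : ∀ n x, 0 < max (ρ x) (l n) := fun n x => (hpos x).trans_le (le_max_left _ _)
  have hfm : ∀ n, Measurable (f n) := fun n =>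
    ((hgm n).div (hρ.max measurable_const)).indicator (hQm n)
  have hfmem : ∀ n x, f n x ∈ Icc 0 (S n * μ.real univ / l n + 1) := fun n x => by
    have h0 : 0 ≤ S n * μ.real univ / l n :=
      div_nonneg (mul_nonneg (hS0 n) measureReal_nonneg) (hl0 n).le
    by_cases hx : x ∈ Q n
    · simp only [hf, indicator_of_mem hx]
      refine ⟨div_nonneg (hg0 n x) (hmax n x).le, ?_⟩
      have : g n x / max (ρ x) (l n) ≤ S n * μ.real univ / l n :=
        div_le_div₀ (mul_nonneg (hS0 n) measureReal_nonneg) (hgS n x) (hl0 n) (le_max_right _ _)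
      linarith
    · simp only [hf, indicator_of_notMem hx]
      exact ⟨le_rfl, by linarith⟩
  have hfρ : ∀ n (ψ : Ed d → ℝ), (fun x => f n x * ψ x * ρ x) =ᵐ[volume]
      fun x => g n x * (Q n).indicator ψ x := fun n ψ => by
    filter_upwards [hge] with x hx
    by_cases hxQ : x ∈ Q n
    · have h1 : l n ≤ ρ x := by
        refine le_trans (mul_le_mul_of_nonneg_left ?_ hc.le) hx
        refine Real.rpow_le_rpow_of_nonpos (by positivity) ?_ (by linarith)
        have := mem_ball_zero_iff.1 hxQ
        linarith
      simp only [hf, indicator_of_mem hxQ, max_eq_left h1]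
      field_simp [(hpos x).ne']
    · simp [hf, indicator_of_notMem hxQ]
  have hQi : ∀ n (ψ : Ed d → ℝ), Measurable ψ → (∃ B : ℝ, ∀ x, |ψ x| ≤ B) →
      Integrable ((Q n).indicator ψ) := fun n ψ hψ ⟨B, hB⟩ =>
    (integrable_indicator_iff (hQm n)).2 (Measure.integrableOn_of_bounded measure_ball_lt_top.ne
      hψ.aestronglyMeasurable (.of_forall hB))
  have key : ∀ n (ψ : Ed d → ℝ), Measurable ψ → (∃ B : ℝ, ∀ x, |ψ x| ≤ B) →
      ∫ x, f n x * ψ x ∂weightMeasure ρ =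
        ∫ y, (k n ⋆[ContinuousLinearMap.lsmul ℝ ℝ, volume] (Q n).indicator ψ) y ∂μ := by
    intro n ψ hψ hB
    rw [integral_weightMeasure hρ hpos, integral_congr_ae (hfρ n ψ)]
    have h1 : ∀ x, g n x * (Q n).indicator ψ x = ∫ y, (Q n).indicator ψ x * k n (y - x) ∂μ :=
      fun x => by rw [integral_const_mul, mul_comm]
    simp only [h1]
    rw [integral_integral_swap (((hQi n ψ hψ hB).comp_fst μ).mul_bdd (c := S n)
      ((hkc n).comp (continuous_snd.sub continuous_fst)).aestronglyMeasurable
      (.of_forall fun p => hS n _))]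
    refine integral_congr_ae (.of_forall fun y => ?_)
    simp only [convolution_eq_swap, ContinuousLinearMap.lsmul_apply, smul_eq_mul, mul_comm]
  have hconv : ∀ n (ψ : Ed d → ℝ) (B : ℝ), (∀ x, |ψ x| ≤ B) → ∀ y,
      ‖(k n ⋆[ContinuousLinearMap.lsmul ℝ ℝ, volume] (Q n).indicator ψ) y‖ ≤ B := by
    intro n ψ B hB y
    have hB0 : 0 ≤ B := (abs_nonneg _).trans (hB 0)
    rw [convolution_def]
    refine (norm_integral_le_of_norm_le ((hki n).mul_const B) (.of_forall fun z => ?_)).trans_eq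
      (by rw [integral_mul_const, hk1, one_mul])
    rw [ContinuousLinearMap.lsmul_apply, smul_eq_mul, norm_mul, Real.norm_of_nonneg (hk0 n z)]
    refine mul_le_mul_of_nonneg_left ?_ (hk0 n z)
    by_cases hz : y - z ∈ Q n
    · rw [indicator_of_mem hz]; exact hB _
    · rwa [indicator_of_notMem hz, norm_zero]
  refine ⟨fun n => S n * μ.real univ / l n + 1, f, fun n => ?_, fun n => ⟨hfm n, hfmem n, ?_⟩,
    fun n => ?_, fun ψ hψ hB => ?_⟩
  · have := div_nonneg (mul_nonneg (hS0 n) (measureReal_nonneg (μ := μ) (s := univ))) (hl0 n).le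
    linarith
  · have h1 := hfρ n fun _ => 1
    rw [integrable_weightMeasure hρ hpos]
    simp only [mul_one] at h1
    refine Integrable.congr ?_ h1.symm
    simp only [mul_comm (g n _)]
    refine (hQi n (fun _ => 1) measurable_const ⟨1, by simp⟩).mul_bdd (c := S n * μ.real univ)
      (hgm n).aestronglyMeasurable (.of_forall fun x => ?_)
    rw [Real.norm_of_nonneg (hg0 n x)]
    exact hgS n x
  · have h1 := key n (fun _ => 1) measurable_const ⟨1, by simp⟩
    simp only [mul_one] at h1
    rw [h1]
    refine (le_abs_self _).trans ((norm_integral_le_of_norm_le_const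
      (.of_forall (hconv n _ 1 (by simp)))).trans_eq (one_mul _))
  · obtain ⟨B, hB'⟩ := hB
    simp only [key _ ψ hψ.measurable ⟨B, hB'⟩]
    have hcont : ∀ n, Continuous
        (k n ⋆[ContinuousLinearMap.lsmul ℝ ℝ, volume] (Q n).indicator ψ) := fun n =>
      (bump n).hasCompactSupport_normed.continuous_convolution_left _ (hkc n)
        (hQi n ψ hψ.measurable ⟨B, hB'⟩).locallyIntegrable
    refine tendsto_integral_filter_of_dominated_convergence (fun _ => B)
      (.of_forall fun n => (hcont n).aestronglyMeasurable)
      (.of_forall fun n => .of_forall (hconv n ψ B hB')) (integrable_const _)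
      (.of_forall fun y => ?_)
    refine ContDiffBump.convolution_tendsto_right (k := fun _ => y)
      tendsto_one_div_add_atTop_nhds_zero_nat (.of_forall fun n =>
        (hQi n ψ hψ.measurable ⟨B, hB'⟩).aestronglyMeasurable) ?_ tendsto_const_nhds
    have h1 : Tendsto (fun p : ℕ × Ed d => ψ p.2) (atTop ×ˢ 𝓝 y) (𝓝 (ψ y)) :=
      (hψ.tendsto y).comp tendsto_snd
    refine h1.congr' ?_
    have h2 : ∀ᶠ p : ℕ × Ed d in atTop ×ˢ 𝓝 y, ‖y‖ + 1 < p.1 ∧ p.2 ∈ Metric.ball y 1 :=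
      ((tendsto_natCast_atTop_atTop.eventually_gt_atTop (‖y‖ + 1)).prod_mk
        (Metric.ball_mem_nhds y one_pos))
    filter_upwards [h2] with p ⟨hp1, hp2⟩
    have : p.2 ∈ Q p.1 := by
      rw [hQ, mem_ball_zero_iff]
      have h3 := norm_le_norm_add_norm_sub y p.2
      rw [norm_sub_rev, ← dist_eq_norm] at h3
      linarith [Metric.mem_ball.1 hp2]
    exact (indicator_of_mem this ψ).symm

end Data

section Pairing

variable {X : Type*} [MeasurableSpace X] {ν : Measure X} {Γ : Measure (X × X)}

lemma BddDensity.integrable_mul {m N : ℝ} (hm : 1 < m) {u w : X → ℝ} (hu : BddDensity ν N u)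
    (hw : FormTest ν Γ (conjExp m) w) : Integrable (fun x => u x * w x) ν :=
  integrable_mul_of_rpow (holderConjugate_conjExp hm) hu.meas hw.meas
    (hu.integrable_rpow (by linarith)) hw.intq

/-- A bounded solution drifts away from its datum, tested against a function with controlled
form, at a rate governed by its sup bound. -/
lemma BddSol.abs_pairing_sub_le {m M N K t : ℝ} {b : ℝ → ℝ} {f w : X → ℝ} {u : ℝ → X → ℝ}
    {G : Set ℝ} (hu : BddSol ν Γ m N f u G) (hm : 1 < m) (hf : BddDensity ν N f)
    (hM : ∫ x, f x ∂ν ≤ M) (hb : ∀ t ∈ G, ∀ᵐ x ∂ν, u t x ≤ b t) (hb0 : ∀ t, 0 ≤ b t)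
    (hbi : IntegrableOn (fun r => b r ^ (m - 1)) (Ioc 0 t)) (hw : FormTest ν Γ (conjExp m) w)
    (hK0 : 0 ≤ K) (hK : ∀ v, Measurable v → Integrable v ν → energy Γ v ≠ ⊤ →
      |eform Γ v w| ≤ K * ∫ x, |v x| ∂ν) (ht : t ∈ G) :
    |(∫ x, u t x * w x ∂ν) - ∫ x, f x * w x ∂ν| ≤
      K * (M * ∫ r in Ioc 0 t, b r ^ (m - 1)) := by
  have h1 := hu.eq t ht w hw
  simp only [sub_mul] at h1
  rw [integral_sub ((hu.bdd ht).integrable_mul hm hw) (hf.integrable_mul hm hw)] at h1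
  rw [eq_neg_of_add_eq_zero_left h1, abs_neg, ← mul_assoc, ← integral_const_mul]
  refine norm_integral_le_of_norm_le (f := fun r => eform Γ (fun x => u r x ^ m) w)
    (hbi.const_mul (K * M)) ?_
  have hG : ∀ᵐ r ∂(volume.restrict (Ioc 0 t)), r ∈ G :=
    ae_restrict_of_ae_restrict_of_subset (fun r hr => hr.1) hu.ae_mem
  filter_upwards [hG] with r hr
  have hbr := hu.bdd hr
  have hi : Integrable (fun x => u r x ^ m) ν := hbr.integrable_rpow' hm.le
  refine (hK _ (hbr.meas.pow_const m) hi (hu.fin r hr)).trans ?_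
  rw [mul_assoc]
  refine mul_le_mul_of_nonneg_left ?_ hK0
  calc ∫ x, |u r x ^ m| ∂ν ≤ ∫ x, b r ^ (m - 1) * u r x ∂ν := by
        refine integral_mono_ae hi.abs (hbr.int.const_mul _) ((hb r hr).mono fun x hx => ?_)
        have hx0 := (hbr.mem x).1
        change |u r x ^ m| ≤ b r ^ (m - 1) * u r x
        rw [abs_of_nonneg (Real.rpow_nonneg hx0 _)]
        calc u r x ^ m = u r x ^ (m - 1) * u r x := by
              rw [← Real.rpow_add_one' hx0 (by linarith), sub_add_cancel]
          _ ≤ _ := mul_le_mul_of_nonneg_right (Real.rpow_le_rpow hx0 hx (by linarith)) hx0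
    _ ≤ M * b r ^ (m - 1) := by
        rw [integral_const_mul, mul_comm]
        exact mul_le_mul_of_nonneg_right ((hu.mass r hr).trans hM) (Real.rpow_nonneg (hb0 r) _)

end Pairing

section Cutoff

variable {d : ℕ}

/-- A family of cutoffs at scale `R`. -/
def IsCutoff (A : ℝ) (η : ℝ → Ed d → ℝ) : Prop :=
  ∀ R : ℝ, 1 ≤ R → TestBound A R (η R) ∧ (∀ x, η R x ∈ Icc 0 1) ∧ ∀ x, ‖x‖ ≤ R / 2 → η R x = 1

variable {A : ℝ} {η : ℝ → Ed d → ℝ}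

lemma IsCutoff.integrable_mul (hη : IsCutoff A η) {ν : Measure (Ed d)} {g : Ed d → ℝ}
    (hg : Integrable g ν) {R : ℝ} (hR : 1 ≤ R) : Integrable (fun x => g x * η R x) ν :=
  hg.mul_bdd (c := 1) (hη R hR).1.cont.aestronglyMeasurable (.of_forall fun x => by
    rw [Real.norm_of_nonneg ((hη R hR).2.1 x).1]; exact ((hη R hR).2.1 x).2)

lemma IsCutoff.tendsto_integral (hη : IsCutoff A η) {ν : Measure (Ed d)} {g : Ed d → ℝ}
    (hg : Integrable g ν) :
    Tendsto (fun R => ∫ x, g x * η R x ∂ν) atTop (𝓝 (∫ x, g x ∂ν)) := by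
  refine tendsto_integral_filter_of_dominated_convergence (fun x => |g x|)
    ((eventually_ge_atTop 1).mono fun R hR => (hη.integrable_mul hg hR).aestronglyMeasurable)
    ((eventually_ge_atTop 1).mono fun R hR => .of_forall fun x => ?_) hg.abs
    (.of_forall fun x => ?_)
  · rw [Real.norm_eq_abs, abs_mul, abs_of_nonneg ((hη R hR).2.1 x).1]
    exact mul_le_of_le_one_right (abs_nonneg _) ((hη R hR).2.1 x).2
  · refine tendsto_const_nhds.congr' ?_
    filter_upwards [eventually_ge_atTop 1, eventually_ge_atTop (2 * ‖x‖)] with R h1 h2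
    rw [(hη R h1).2.2 x (by linarith), mul_one]

lemma IsCutoff.setIntegral_compl_ball_le (hη : IsCutoff A η) {ν : Measure (Ed d)} {g : Ed d → ℝ}
    (hg : Integrable g ν) (hg0 : ∀ x, 0 ≤ g x) {R : ℝ} (hR : 1 ≤ R) :
    ∫ x in (Metric.ball 0 R)ᶜ, g x ∂ν ≤ (∫ x, g x ∂ν) - ∫ x, g x * η R x ∂ν := by
  rw [← integral_sub hg (hη.integrable_mul hg hR),
    ← integral_indicator measurableSet_ball.compl]
  refine integral_mono (hg.indicator measurableSet_ball.compl)
    (hg.sub (hη.integrable_mul hg hR)) fun x => ?_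
  change _ ≤ g x - g x * η R x
  by_cases hx : x ∈ Metric.ball 0 R
  · rw [indicator_of_notMem (by simpa using hx)]
    nlinarith [hg0 x, ((hη R hR).2.1 x).2]
  · rw [indicator_of_mem (by simpa using hx), (hη R hR).1.eq_zero x (by simpa using hx), mul_zero,
      sub_zero]

/-- A weakly convergent sequence of densities is tight. -/
lemma IsCutoff.exists_tail_le (hη : IsCutoff A η) {ν μ : Measure (Ed d)} [IsFiniteMeasure μ]
    {f : ℕ → Ed d → ℝ} (hf : ∀ n, Integrable (f n) ν) (hf0 : ∀ n x, 0 ≤ f n x)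
    (hlim : ∀ ψ : Ed d → ℝ, Continuous ψ → (∃ B : ℝ, ∀ x, |ψ x| ≤ B) →
      Tendsto (fun n => ∫ x, f n x * ψ x ∂ν) atTop (𝓝 (∫ x, ψ x ∂μ)))
    {ε : ℝ} (hε : 0 < ε) :
    ∃ R₀, ∀ R, R₀ ≤ R → ∀ n, (∫ x, f n x ∂ν) - ∫ x, f n x * η R x ∂ν ≤ ε := by
  have h1 := hη.tendsto_integral (ν := μ) (g := fun _ => 1) (integrable_const 1)
  simp only [one_mul] at h1
  obtain ⟨R₁, hR₁, hR1⟩ := ((h1.eventually (lt_mem_nhds (sub_lt_self _ hε))).and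
    (eventually_ge_atTop 1)).exists
  have hbd : ∃ B : ℝ, ∀ x, |η R₁ x| ≤ B := ⟨A, (hη R₁ hR1).1.bound⟩
  have h2 := (hlim (fun _ => 1) continuous_const ⟨1, by simp⟩).sub
    (hlim _ (hη R₁ hR1).1.cont hbd)
  simp only [mul_one] at h2
  obtain ⟨n₀, hn₀⟩ := eventually_atTop.1 (h2.eventually (gt_mem_nhds
    (show (∫ _, (1 : ℝ) ∂μ) - ∫ x, η R₁ x ∂μ < ε by linarith)))
  have h3 : ∀ᶠ R in atTop, ∀ n ∈ Finset.range n₀,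
      (∫ x, f n x ∂ν) - ∫ x, f n x * η R x ∂ν < ε := by
    refine (Filter.eventually_all_finset _).2 fun n _ => ?_
    have := (hη.tendsto_integral (hf n)).const_sub (∫ x, f n x ∂ν)
    rw [sub_self] at this
    exact this.eventually (gt_mem_nhds hε)
  obtain ⟨R₀, hR₀⟩ := eventually_atTop.1 (h3.and (eventually_ge_atTop (2 * R₁)))
  refine ⟨R₀, fun R hR n => ?_⟩
  obtain ⟨h4, h5⟩ := hR₀ R hR
  rcases lt_or_ge n n₀ with hn | hn
  · exact (h4 n (Finset.mem_range.2 hn)).le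
  · refine le_trans (sub_le_sub_left ?_ _) (hn₀ n hn).le
    refine integral_mono (hη.integrable_mul (hf n) hR1) (hη.integrable_mul (hf n) (by linarith))
      fun x => mul_le_mul_of_nonneg_left ?_ (hf0 n x)
    rcases le_total ‖x‖ R₁ with hx | hx
    · rw [(hη R (by linarith)).2.2 x (by linarith)]; exact ((hη R₁ hR1).2.1 x).2
    · rw [(hη R₁ hR1).1.eq_zero x hx]; exact ((hη R (by linarith)).2.1 x).1

end Cutoff

section MeasureData

variable {d : ℕ} [NeZero d] {s m γ κ c : ℝ} {ρ : Ed d → ℝ} {b : ℝ → ℝ}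

lemma tendsto_mul_rpow_sub_atTop (hγs : γ < 2 * s) (A K : ℝ) :
    Tendsto (fun R : ℝ => A * R ^ (γ - 2 * s) * K) atTop (𝓝 0) := by
  have := ((tendsto_rpow_neg_atTop (y := 2 * s - γ) (by linarith)).const_mul A).mul_const K
  rwa [mul_zero, zero_mul, neg_sub] at this

/-- Limit solutions issued from a finite measure. -/
theorem exists_limitSol_of_measure (hs0 : 0 < s) (hs1 : s < 1) (hγ0 : 0 ≤ γ) (hγs : γ < 2 * s)
    (hκ : 0 < κ) (hc : 0 < c) (hm : 1 < m) (hρ : Measurable ρ) (hpos : ∀ x, 0 < ρ x)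
    (hge : ∀ᵐ x, c * (1 + ‖x‖) ^ (-γ) ≤ ρ x)
    (hfin : ∀ R : ℝ, 0 < R → weightMeasure ρ (Metric.ball 0 R) ≠ ⊤) (μ : Measure (Ed d))
    [IsFiniteMeasure μ] (hb0 : ∀ t, 0 ≤ b t) (hba : AntitoneOn b (Ioi 0)) (hbm : Measurable b)
    (hbi : ∀ t, IntegrableOn (fun r => b r ^ (m - 1)) (Ioc 0 t))
    (hsm : ∀ (N : ℝ) (f : Ed d → ℝ) (u : ℝ → Ed d → ℝ) (G : Set ℝ), BddDensity (weightMeasure ρ) N f →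
      BddSol (weightMeasure ρ) (jumpMeasure d s κ) m N f u G →
      ∫ x, f x ∂weightMeasure ρ ≤ μ.real univ → ∀ t ∈ G, ∀ᵐ x ∂weightMeasure ρ, u t x ≤ b t) :
    ∃ (v : ℝ → Ed d → ℝ) (G : Set ℝ) (ω : ℝ → ℝ),
      LimitSol (weightMeasure ρ) (jumpMeasure d s κ) m (μ.real univ) b v G ∧
      Tendsto ω (𝓝[>] 0) (𝓝 0) ∧ ∀ t ∈ G, ∀ (A R : ℝ) (φ : Ed d → ℝ), 1 ≤ R → TestBound A R φ →
        |(∫ x, v t x * φ x ∂weightMeasure ρ) - ∫ x, φ x ∂μ| ≤ A * R ^ (γ - 2 * s) * ω t := by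
  set ν := weightMeasure ρ with hν
  set Γ := jumpMeasure d s κ with hΓ
  set M := μ.real univ with hM
  have hMAC : MarginalsAC ν Γ := marginalsAC_jump hρ hpos s κ
  obtain ⟨N, f, hN, hf, hfM, hlim⟩ := exists_approx_data hγ0 hc hρ hpos hge μ
  choose u G hu using fun n => exists_bddSol hMAC hm (hN n) (hf n)
  have hG0 : ∀ᵐ t ∂(volume.restrict (Ioi (0 : ℝ))), t ∈ ⋂ n, G n := by
    simpa only [mem_iInter] using ae_all_iff.2 fun n => (hu n).ae_mem
  have h : ApproxSeq ν Γ m M b N f u (⋂ n, G n) :=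
    ⟨fun n => (hu n).mono_times (iInter_subset _ n) hG0, hf, hfM, fun n t ht =>
      hsm _ _ _ _ (hf n) (hu n) (hfM n) t (mem_iInter.1 ht n), hb0, hba, hbm⟩
  obtain ⟨D, hD0, hD⟩ := exists_eform_bound hs0 hs1 hγ0 hγs hκ hc hρ hpos hge
  set ω : ℝ → ℝ := fun t => D * (M * ∫ r in Ioc 0 t, b r ^ (m - 1)) with hω
  have hbm0 : ∀ r, 0 ≤ b r ^ (m - 1) := fun r => Real.rpow_nonneg (hb0 r) _
  have hωmono : ∀ {t T}, t ≤ T → ω t ≤ ω T := fun {t T} htT => by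
    refine mul_le_mul_of_nonneg_left (mul_le_mul_of_nonneg_left ?_ measureReal_nonneg) hD0.le
    exact setIntegral_mono_set (hbi T) (.of_forall hbm0) (Ioc_subset_Ioc_right htT).eventuallyLE
  have hω0 : Tendsto ω (𝓝[>] 0) (𝓝 0) := by
    have h1 : ContinuousWithinAt (fun t => ∫ r in Ioc 0 t, b r ^ (m - 1)) (Icc 0 1) 0 :=
      intervalIntegral.continuousOn_primitive ((integrableOn_Icc_iff_integrableOn_Ioc (by simp)).2 (hbi 1)) 0
        (left_mem_Icc.2 zero_le_one)
    have h2 : Tendsto (fun t => ∫ r in Ioc 0 t, b r ^ (m - 1)) (𝓝[>] 0) (𝓝 0) := by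
      have h3 := h1.mono_left (nhdsWithin_le_iff.2 (Icc_mem_nhdsGT (zero_lt_one' ℝ)))
      simpa using h3
    simpa using (h2.const_mul M).const_mul D
  have hpair : ∀ n, ∀ t ∈ ⋂ n, G n, ∀ (A R : ℝ) (φ : Ed d → ℝ), 1 ≤ R → TestBound A R φ →
      |(∫ x, u n t x * φ x ∂ν) - ∫ x, f n x * φ x ∂ν| ≤ A * R ^ (γ - 2 * s) * ω t := by
    intro n t ht A R φ hR hφ
    have hR0 : 0 < R := by linarith
    have hφF := hφ.formTest hs0 hs1 hκ.le hR0 (q := conjExp m)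
      (zero_lt_one.trans (one_lt_conjExp hm)) (hfin R hR0)
    refine ((h.sol n).abs_pairing_sub_le hm (hf n) (hfM n) (h.bound n) hb0 (hbi t) hφF
      (K := D * A * R ^ (γ - 2 * s)) ?_ (fun v hv hvi hve =>
        hD A R v φ hφ hR hv hvi hve hφF.fin) ht).trans_eq (by rw [hω]; ring)
    have := hφ.nonneg
    positivity
  obtain ⟨A, η, hη⟩ := exists_cutoff d
  have hη : IsCutoff A η := hη
  have hcell : ApproxSeq.CellCompact ν Γ u (⋂ n, G n)
      fun i : ℕ × ℕ × ℕ => cell d i.1 i.2.1 ∩ Metric.ball 0 (i.2.2 : ℝ) := by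
    intro T B ε hB hε
    obtain ⟨R₀, hR₀⟩ := hη.exists_tail_le (fun n => (hf n).int) (fun n x => ((hf n).mem x).1) hlim
      (half_pos hε)
    obtain ⟨R, ⟨hR1, hR2⟩, hR3⟩ := (((tendsto_natCast_atTop_atTop.eventually_ge_atTop (1 : ℝ)).and
      (tendsto_natCast_atTop_atTop.eventually_ge_atTop R₀)).and (tendsto_natCast_atTop_atTop.eventually
        ((tendsto_mul_rpow_sub_atTop hγs A (ω T)).eventually (gt_mem_nhds (half_pos hε))))).exists
    have hR0 : (0 : ℝ) < R := by linarith
    obtain ⟨k, I, hI⟩ := exists_rellich hs0 hκ hρ (hfin R hR0) hB hε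
    refine ⟨Metric.ball 0 R, (Finset.range I).map ⟨fun i => (k, i, R), fun i j hij => by
      simpa using hij⟩, measurableSet_ball, fun n t ht htT => ?_, fun g w hg hw hgB hwB hwE => ?_⟩
    · have hb := (h.sol n).bdd ht
      have h1 := hη.setIntegral_compl_ball_le hb.int (fun x => (hb.mem x).1) hR1
      have h2 := (abs_le.1 (hpair n t ht A R (η R) hR1 (hη R hR1).1)).1
      have h3 := hR₀ R hR2 n
      have h4 := (h.sol n).mass t ht
      have h5 : A * (R : ℝ) ^ (γ - 2 * s) * ω t ≤ A * (R : ℝ) ^ (γ - 2 * s) * ω T := by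
        have := (hη R hR1).1.nonneg
        exact mul_le_mul_of_nonneg_left (hωmono htT) (by positivity)
      linarith
    · rw [Finset.sum_map]
      exact hI g w hg hw hgB hwB hwE
  obtain ⟨θ, a, hθ, ha, hcau⟩ := h.exists_cauchy_subseq hMAC hm hcell
  obtain ⟨v, G', hv, hG', hvl⟩ := (h.comp θ).exists_limitSol hMAC hm ha
    tendsto_natCast_atTop_atTop hcau
  refine ⟨v, G', ω, hv, hω0, fun t ht A R φ hR hφ => ?_⟩
  have hR0 : 0 < R := by linarith
  have hφF := hφ.formTest hs0 hs1 hκ.le hR0 (q := conjExp m)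
    (zero_lt_one.trans (one_lt_conjExp hm)) (hfin R hR0)
  have h1 := (hvl t ht).tendsto_integral_mul (holderConjugate_conjExp hm)
    (fun n => (h.sol (θ n)).meas.of_uncurry_left) hφF.meas hφF.intq
  have h2 := (hlim φ hφ.cont ⟨A, hφ.bound⟩).comp hθ.tendsto_atTop
  exact le_of_tendsto' (h1.sub h2).abs fun n => hpair (θ n) t (hG' ht) A R φ hR hφ

end MeasureData

section Trace

variable {d : ℕ}

lemma IsCutoff.abs_integral_mul_sub_le {A R B ε : ℝ} {η : ℝ → Ed d → ℝ} (hη : IsCutoff A η)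
    (hR : 1 ≤ R) {ν : Measure (Ed d)} {f φ g : Ed d → ℝ} (hf : Integrable f ν)
    (hf0 : ∀ x, 0 ≤ f x) (hφ : Continuous φ) (hB : ∀ x, |φ x| ≤ B) (hg : Continuous g)
    (hgφ : ∀ x, |g x - φ x * η R x| ≤ ε) :
    |(∫ x, f x * φ x ∂ν) - ∫ x, f x * g x ∂ν| ≤
      B * ((∫ x, f x ∂ν) - ∫ x, f x * η R x ∂ν) + ε * ∫ x, f x ∂ν := by
  have hη01 := (hη R hR).2.1
  have h1 : ∀ x, |φ x - g x| ≤ B * (1 - η R x) + ε := fun x => by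
    have e : φ x - g x = φ x * (1 - η R x) - (g x - φ x * η R x) := by ring
    rw [e]
    refine (abs_sub _ _).trans (add_le_add ?_ (hgφ x))
    rw [abs_mul, abs_of_nonneg (sub_nonneg.2 (hη01 x).2)]
    exact mul_le_mul_of_nonneg_right (hB x) (sub_nonneg.2 (hη01 x).2)
  have hB0 : 0 ≤ B := (abs_nonneg _).trans (hB 0)
  have hε0 : 0 ≤ ε := (abs_nonneg _).trans (hgφ 0)
  have iφ : Integrable (fun x => f x * φ x) ν :=
    hf.mul_bdd (c := B) hφ.aestronglyMeasurable (.of_forall hB)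
  have iφg : Integrable (fun x => f x * (φ x - g x)) ν :=
    hf.mul_bdd (c := B * 1 + ε) (hφ.sub hg).aestronglyMeasurable (.of_forall fun x =>
      (h1 x).trans (by nlinarith [(hη01 x).1]))
  have ig : Integrable (fun x => f x * g x) ν :=
    (iφ.sub iφg).congr (.of_forall fun x => by simp; ring)
  have iη := hη.integrable_mul hf hR
  have iB : Integrable (fun x => B * (f x - f x * η R x)) ν := (hf.sub iη).const_mul B
  rw [← integral_sub iφ ig, ← integral_sub hf iη, ← integral_const_mul, ← integral_const_mul,
    ← integral_add iB (hf.const_mul ε)]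
  refine norm_integral_le_of_norm_le (f := fun x => f x * φ x - f x * g x)
    (iB.add (hf.const_mul ε)) (.of_forall fun x => ?_)
  rw [← mul_sub, Real.norm_eq_abs, abs_mul, abs_of_nonneg (hf0 x)]
  exact (mul_le_mul_of_nonneg_left (h1 x) (hf0 x)).trans_eq (by ring)

/-- A family of densities that is asymptotically close to `μ` on test functions, with masses at
most that of `μ`, has the mass of `μ` and converges to `μ` against bounded continuous functions. -/
lemma integral_eq_and_tendsto_of_pairing {γ s : ℝ} (hγs : γ < 2 * s) {ν μ : Measure (Ed d)}
    [IsFiniteMeasure μ] {v : ℝ → Ed d → ℝ} {G : Set ℝ} {ω : ℝ → ℝ} (hv0 : ∀ t x, 0 ≤ v t x)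
    (hint : ∀ t ∈ G, Integrable (v t) ν) (hmass : ∀ t ∈ G, ∫ x, v t x ∂ν ≤ μ.real univ)
    (hω : Tendsto ω (𝓝[>] 0) (𝓝 0))
    (hpair : ∀ t ∈ G, ∀ (A R : ℝ) (φ : Ed d → ℝ), 1 ≤ R → TestBound A R φ →
      |(∫ x, v t x * φ x ∂ν) - ∫ x, φ x ∂μ| ≤ A * R ^ (γ - 2 * s) * ω t) :
    (∀ t ∈ G, ∫ x, v t x ∂ν = μ.real univ) ∧
    ∀ φ : Ed d → ℝ, Continuous φ → (∃ B : ℝ, ∀ x, |φ x| ≤ B) →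
      Tendsto (fun t => ∫ x, v t x * φ x ∂ν) (𝓝[Ioi 0 ∩ G] 0) (𝓝 (∫ x, φ x ∂μ)) := by
  obtain ⟨A, η, hη⟩ := exists_cutoff d
  have hη : IsCutoff A η := hη
  have h1 := hη.tendsto_integral (ν := μ) (g := fun _ => 1) (integrable_const 1)
  simp only [one_mul, integral_const, smul_eq_mul, mul_one] at h1
  have hlow : ∀ t ∈ G, ∀ R, 1 ≤ R →
      (∫ x, η R x ∂μ) - A * R ^ (γ - 2 * s) * ω t ≤ ∫ x, v t x * η R x ∂ν := fun t ht R hR => by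
    linarith [(abs_le.1 (hpair t ht A R (η R) hR (hη R hR).1)).1]
  have hmeq : ∀ t ∈ G, ∫ x, v t x ∂ν = μ.real univ := fun t ht => by
    refine le_antisymm (hmass t ht) ?_
    have h2 := h1.sub (tendsto_mul_rpow_sub_atTop hγs A (ω t))
    rw [sub_zero] at h2
    refine le_of_tendsto h2 ((eventually_ge_atTop 1).mono fun R hR => (hlow t ht R hR).trans ?_)
    refine integral_mono (hη.integrable_mul (hint t ht) hR) (hint t ht) fun x => ?_
    exact mul_le_of_le_one_right (hv0 t x) ((hη R hR).2.1 x).2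
  refine ⟨hmeq, fun φ hφ ⟨B, hB⟩ => Metric.tendsto_nhds.2 fun ε hε => ?_⟩
  set M := μ.real univ with hM
  have hM0 : 0 ≤ M := measureReal_nonneg
  have hB0 : 0 ≤ B := (abs_nonneg _).trans (hB 0)
  obtain ⟨δ, hδ, hδε⟩ : ∃ δ > 0, 2 * δ * (B + M) ≤ ε / 2 := by
    refine ⟨ε / (4 * (B + M + 1)), by positivity, ?_⟩
    rw [mul_div_assoc', div_mul_eq_mul_div, div_le_iff₀ (by positivity)]
    nlinarith
  obtain ⟨R, hR1, hR⟩ := ((h1.eventually (lt_mem_nhds (sub_lt_self M hδ))).and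
    (eventually_ge_atTop 1)).exists
  have hcs : HasCompactSupport fun x => φ x * η R x :=
    HasCompactSupport.intro (isCompact_closedBall (0 : Ed d) R) fun x hx => by
      rw [(hη R hR).1.eq_zero x (by simpa using (not_le.1 (mt mem_closedBall_zero_iff.2 hx)).le),
        mul_zero]
  obtain ⟨g, hg2, hgc, hg⟩ := exists_smooth_approx (hφ.mul (hη R hR).1.cont) hcs hδ
  obtain ⟨A', R', hR', hgT⟩ := exists_testBound hg2 hgc
  have hω' : Tendsto (fun t => B * (A * R ^ (γ - 2 * s) * ω t) + A' * R' ^ (γ - 2 * s) * ω t)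
      (𝓝[>] 0) (𝓝 0) := by
    simpa using ((hω.const_mul (A * R ^ (γ - 2 * s))).const_mul B).add
      (hω.const_mul (A' * R' ^ (γ - 2 * s)))
  have hev := (nhdsWithin_mono (0 : ℝ) (inter_subset_left (s := Ioi 0) (t := G)))
    (hω'.eventually (gt_mem_nhds (half_pos hε)))
  filter_upwards [hev, self_mem_nhdsWithin] with t h3 ht
  have a1 := hη.abs_integral_mul_sub_le hR (hint t ht.2) (hv0 t) hφ hB hg2.continuous hg
  have a2 := hη.abs_integral_mul_sub_le hR (ν := μ) (f := fun _ => 1) (integrable_const 1)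
    (fun _ => zero_le_one) hφ hB hg2.continuous hg
  simp only [one_mul, integral_const, smul_eq_mul, mul_one] at a2
  have a3 := hpair t ht.2 A' R' g hR' hgT
  have a4 := hlow t ht.2 R hR
  have a5 : B * ((∫ x, v t x ∂ν) - ∫ x, v t x * η R x ∂ν) ≤
      B * (δ + A * R ^ (γ - 2 * s) * ω t) :=
    mul_le_mul_of_nonneg_left (by linarith [hmeq t ht.2]) hB0
  have a6 : B * (M - ∫ x, η R x ∂μ) ≤ B * δ := mul_le_mul_of_nonneg_left (by linarith) hB0
  rw [hmeq t ht.2] at a1 a5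
  rw [Real.dist_eq]
  rw [abs_le] at a1 a2 a3
  rw [abs_lt]
  constructor <;> linarith [a1.1, a1.2, a2.1, a2.2, a3.1, a3.2]

end Trace

section WeakForm

variable {X : Type*} [MeasurableSpace X] {ν : Measure X} {Γ : Measure (X × X)} {m M : ℝ}
  {b : ℝ → ℝ} {u : ℝ → X → ℝ} {G : Set ℝ}

/-- The time-dependent weak formulation of limit solutions; `ψ'` is the time derivative of the
test function `ψ`, which vanishes at times `τ` and `T`. -/
lemma LimitSol.weak_formulation [SFinite ν] [SFinite Γ] (hu : LimitSol ν Γ m M b u G) (hm : 1 < m)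
    {τ T : ℝ} (hτ : τ ∈ G) {ψ ψ' : ℝ → X → ℝ} (hψm : Measurable (Function.uncurry ψ'))
    (hψ : ∀ t, FormTest ν Γ (conjExp m) (ψ' t)) {A : ℝ} (hA : ∀ t x, |ψ' t x| ≤ A) {E : ℝ≥0∞}
    (hE : E ≠ ⊤) (hψE : ∀ t, energy Γ (ψ' t) ≤ E) (hτψ : ∀ x, ψ τ x = 0)
    (hFTC : ∀ r x, τ ≤ r → r ≤ T → ∫ t in Ioc r T, ψ' t x = -ψ r x) (hτT : τ ≤ T) :
    ∫ t in Ioc τ T, ∫ x, u t x * ψ' t x ∂ν =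
      ∫ r in Ioc τ T, eform Γ (fun x => u r x ^ m) (ψ r) := by
  have hτ0 : 0 < τ := hu.pos hτ
  set η : Measure ℝ := volume.restrict (Ioc τ T) with hη
  set L : ℝ → ℝ → ℝ := fun t r => eform Γ (fun x => u r x ^ m) (ψ' t) with hL
  have hG : ∀ᵐ t ∂η, t ∈ G :=
    ae_restrict_of_ae_restrict_of_subset (fun t ht => hτ0.trans ht.1) hu.ae_mem
  have hH2 := hu.memLp_pdiff hτ0 T
  have hK2 : ∀ r, MemLp (fun z : ℝ × (X × X) => pdiff (ψ' z.1) z.2) 2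
      ((volume.restrict (Ioc r T)).prod Γ) := fun r => by
    refine memLp_pdiff_prod hψm (ne_top_of_le_ne_top ?_ (lintegral_mono hψE))
    rw [lintegral_const]
    exact ENNReal.mul_ne_top hE (measure_ne_top _ _)
  have hLi : Integrable (Function.uncurry L) (η.prod η) :=
    ((memLp_gram (measurable_uncurry_pdiff hu.meas_rpow) hH2).2.integrable_mul
      (memLp_gram (measurable_uncurry_pdiff hψm) (hK2 τ)).1).integral_prod_left
  have hbi : ∀ {r} x, IntegrableOn (fun t => ψ' t x) (Ioc r T) := fun {r} x =>
    Measure.integrableOn_of_bounded (M := A) (by simp)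
      (hψm.of_uncurry_right).aestronglyMeasurable (.of_forall fun t => hA t x)
  have hp : ∀ t, ∀ {r}, r ∈ G → Integrable (fun x => u r x * ψ' t x) ν := fun t r hr =>
    (hu.int r hr).mul_bdd (hψ t).meas.aestronglyMeasurable (.of_forall (hA t))
  have hind : Integrable (Function.uncurry fun t r => (Ici r).indicator (fun t => L t r) t)
      (η.prod η) := hLi.indicator (measurableSet_le measurable_snd measurable_fst)
  have hτi : Integrable (Function.uncurry fun t x => u τ x * ψ' t x) (η.prod ν) :=
    ((hu.int τ hτ).comp_snd η).mul_bdd (c := A) (g := Function.uncurry ψ')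
      hψm.aestronglyMeasurable (.of_forall fun z => hA z.1 z.2)
  have h1 : ∫ t, ∫ x, u t x * ψ' t x ∂ν ∂η =
      (∫ t, ∫ x, u τ x * ψ' t x ∂ν ∂η) - ∫ t, ∫ r, (Ici r).indicator (fun t => L t r) t ∂η ∂η := by
    have i1 : Integrable (fun t => ∫ x, u τ x * ψ' t x ∂ν) η := hτi.integral_prod_left
    have i2 : Integrable (fun t => ∫ r, (Ici r).indicator (fun t => L t r) t ∂η) η :=
      hind.integral_prod_left
    rw [← integral_sub i1 i2]
    refine integral_congr_ae ?_
    filter_upwards [hG, ae_restrict_mem measurableSet_Ioc] with t ht htI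
    have e1 : ∫ r, (Ici r).indicator (fun t => L t r) t ∂η = ∫ r in Ioc τ t, L t r := by
      have e2 : (fun r => (Ici r).indicator (fun t => L t r) t) = (Iic t).indicator (L t) := by
        ext r
        by_cases hr : r ≤ t <;> simp [hr]
      rw [e2, integral_indicator measurableSet_Iic, hη, Measure.restrict_restrict measurableSet_Iic,
        inter_comm, ← Ioi_inter_Iic, inter_assoc, Iic_inter_Iic, min_eq_right htI.2, Ioi_inter_Iic]
    have e3 := hu.eq τ hτ t ht htI.1 _ (hψ t)
    simp_rw [sub_mul] at e3
    rw [integral_sub (hp t ht) (hp t hτ)] at e3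
    rw [e1]
    linarith
  have h2 : ∫ t, ∫ x, u τ x * ψ' t x ∂ν ∂η = 0 := by
    rw [integral_integral_swap hτi]
    simp_rw [integral_const_mul]
    simp [hη, hFTC τ _ le_rfl hτT, hτψ]
  rw [h1, h2, zero_sub, integral_integral_swap hind, ← integral_neg]
  refine integral_congr_ae ?_
  filter_upwards [hG, ae_restrict_mem measurableSet_Ioc] with r hr hrI
  have e1 : Ici r ∩ Ioc τ T = Icc r T := by
    ext t
    exact ⟨fun h => ⟨h.1, h.2.2⟩, fun h => ⟨h.1, hrI.1.trans_le h.1, h.2⟩⟩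
  rw [integral_indicator measurableSet_Ici, hη, Measure.restrict_restrict measurableSet_Ici, e1,
    integral_Icc_eq_integral_Ioc]
  have hsw : Integrable (Function.uncurry fun t p => pdiff (fun x => u r x ^ m) p * pdiff (ψ' t) p)
      ((volume.restrict (Ioc r T)).prod Γ) :=
    (memLp_pdiff_const (by simp) (hu.formTest hm hr).meas (hu.fin r hr)).integrable_mul (hK2 r)
  simp only [hL, eform]
  rw [integral_integral_swap hsw, ← integral_neg]
  refine integral_congr_ae (.of_forall fun p => ?_)
  simp only [integral_const_mul, pdiff]
  rw [integral_sub (hbi p.1) (hbi p.2), hFTC r _ hrI.1.le hrI.2, hFTC r _ hrI.1.le hrI.2]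
  ring

end WeakForm

section WeakForm

variable {d : ℕ} [NeZero d] {s m κ M : ℝ} {ρ : Ed d → ℝ} {b : ℝ → ℝ} {v : ℝ → Ed d → ℝ}
  {G : Set ℝ}

lemma LimitSol.integral_deriv_test (hs0 : 0 < s) (hs1 : s < 1) (hκ : 0 < κ) (hm : 1 < m)
    (hfin : ∀ R : ℝ, 0 < R → weightMeasure ρ (Metric.ball 0 R) ≠ ⊤)
    (hρ : Measurable ρ) (hpos : ∀ x, 0 < ρ x)
    (hu : LimitSol (weightMeasure ρ) (jumpMeasure d s κ) m M b v G) {φ : Ed d × ℝ → ℝ}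
    (hφ : IsTestFn d φ) :
    -(∫ t in Ioi (0 : ℝ), ∫ x : Ed d, v t x * deriv (fun τ => φ (x, τ)) t * ρ x)
      + ∫ t in Ioi (0 : ℝ), gagliardoE d s κ (fun x => v t x ^ m) (fun x => φ (x, t)) = 0 := by
  obtain ⟨hφs, hφc, hφ0⟩ := hφ
  set ψ : Ed d × ℝ → ℝ := fun z => fderiv ℝ φ z (0, 1) with hψ
  have hψs : ContDiff ℝ 2 ψ :=
    (contDiff_infty.1 (hφs.fderiv_right (m := (⊤ : ℕ∞)) (by simp)) 2).clm_apply contDiff_const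
  have hψc : HasCompactSupport ψ := hφc.fderiv_apply (𝕜 := ℝ) (0, 1)
  have hder : ∀ x t, HasDerivAt (fun τ => φ (x, τ)) (ψ (x, t)) t := fun x t =>
    ((hφs.differentiable (by simp)) (x, t)).hasFDerivAt.comp_hasDerivAt t
      ((hasDerivAt_const t x).prodMk (hasDerivAt_id t))
  have hcpt : IsCompact (Prod.snd '' tsupport φ) := hφc.isCompact.image continuous_snd
  obtain ⟨B, hB⟩ := hcpt.bddAbove
  obtain ⟨ε, hε, hεK⟩ := Metric.isOpen_iff.1 hcpt.isClosed.isOpen_compl (0 : ℝ) (by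
    rintro ⟨z, hz, hz0⟩
    exact (hφ0 hz).2.ne' hz0)
  have hzero : ∀ x t, t < ε ∨ B < t → (x, t) ∉ tsupport φ := fun x t ht hxt => by
    have h1 : t ∈ Prod.snd '' tsupport φ := ⟨_, hxt, rfl⟩
    rcases ht with ht | ht
    · refine hεK (a := t) ?_ h1
      rwa [Metric.mem_ball, Real.dist_0_eq_abs, abs_of_pos (hφ0 hxt).2]
    · exact ht.not_ge (hB h1)
  have hφz : ∀ x t, t < ε ∨ B < t → φ (x, t) = 0 := fun x t ht =>
    image_eq_zero_of_notMem_tsupport (hzero x t ht)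
  have hψz : ∀ x t, t < ε ∨ B < t → ψ (x, t) = 0 := fun x t ht => by
    have h1 : fderiv ℝ φ (x, t) = 0 := image_eq_zero_of_notMem_tsupport fun h =>
      hzero x t ht (tsupport_fderiv_subset ℝ h)
    simp [hψ, h1]
  obtain ⟨τ, hτ, hτ0, hτε⟩ := exists_mem_Ioo_of_ae hu.ae_mem le_rfl hε
  set T := max B τ + 1 with hT
  have hBT : B < T := (le_max_left _ _).trans_lt (lt_add_one _)
  have hτT : τ < T := (le_max_right _ _).trans_lt (lt_add_one _)
  obtain ⟨A, R, hR, hA⟩ := exists_testBound_family hψs hψc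
  have hR0 : 0 < R := by linarith
  obtain ⟨E, hE, hEb⟩ := exists_energy_bound (d := d) hs0 hs1 hκ.le A hR0
  have key := hu.weak_formulation hm hτ (ψ := fun t x => φ (x, t)) (ψ' := fun t x => ψ (x, t))
    (hψs.continuous.comp continuous_swap).measurable
    (fun t => (hA t).formTest hs0 hs1 hκ.le hR0 (zero_lt_one.trans (one_lt_conjExp hm))
      (hfin R hR0)) (fun t x => (hA t).bound x) hE (fun t => hEb _ (hA t))
    (fun x => hφz x τ (.inl hτε)) (fun r x _ hrT => by
      rw [← intervalIntegral.integral_of_le hrT, intervalIntegral.integral_eq_sub_of_hasDerivAt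
        (fun t _ => hder x t) ((hψs.continuous.comp (by fun_prop)).intervalIntegrable _ _),
        hφz x T (.inr hBT), zero_sub]) hτT.le
  have hsub : Ioc τ T ⊆ Ioi 0 := fun t ht => hτ0.trans ht.1
  have hout : ∀ t ∈ Ioi 0 \ Ioc τ T, t < ε ∨ B < t := fun t ht => by
    by_contra! h
    exact ht.2 ⟨hτε.trans_le h.1, h.2.trans hBT.le⟩
  have e1 : ∫ t in Ioi (0 : ℝ), ∫ x : Ed d, v t x * deriv (fun τ => φ (x, τ)) t * ρ x =
      ∫ t in Ioi (0 : ℝ), ∫ x, v t x * ψ (x, t) ∂weightMeasure ρ := by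
    simp_rw [integral_weightMeasure hρ hpos, (hder _ _).deriv]
  simp_rw [e1, ← eform_jump_eq hκ.le]
  rw [setIntegral_eq_of_subset_of_forall_sdiff_eq_zero measurableSet_Ioi hsub fun t ht => by
      simp [hψz _ t (hout t ht)], key,
    setIntegral_eq_of_subset_of_forall_sdiff_eq_zero measurableSet_Ioi hsub fun t ht => by
      simp [eform, pdiff, hφz _ t (hout t ht)], neg_add_cancel]

end WeakForm

section Assembly

variable {d : ℕ}

lemma AdmissibleWeight.weightMeasure_ball_ne_top [NeZero d] {ρ : Ed d → ℝ} {γ₀ γ c C : ℝ}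
    (h : AdmissibleWeight d ρ γ₀ γ c C) (hγ : γ₀ ≤ γ) (hγd : γ < d) {R : ℝ} (hR : 0 < R) :
    weightMeasure ρ (Metric.ball 0 R) ≠ ⊤ := by
  obtain ⟨I, -, hI⟩ := exists_radial_integral (d := d) hγd
  have hC : 0 ≤ C := h.1.le.trans h.2.1.le
  rw [weightMeasure, withDensity_apply _ measurableSet_ball]
  refine ne_top_of_le_ne_top (ENNReal.mul_ne_top ENNReal.ofReal_ne_top ENNReal.ofReal_ne_top)
    ((lintegral_mono_ae (g := fun x => ENNReal.ofReal C * ENNReal.ofReal (‖x‖ ^ (-γ)))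
      ?_).trans ((lintegral_const_mul' _ _ ENNReal.ofReal_ne_top).trans_le
        (mul_le_mul_right (hI R hR) (ENNReal.ofReal C))))
  filter_upwards [ae_restrict_of_ae (h.ae_le (NeZero.pos d) hγ)] with x hx
  rw [← ENNReal.ofReal_mul hC]
  exact ENNReal.ofReal_le_ofReal hx

lemma integrableOn_smoothing_rpow {K α p : ℝ} (hK : 0 ≤ K) (h : α * p < 1) (t : ℝ) :
    IntegrableOn (fun r : ℝ => (K * |r| ^ (-α)) ^ p) (Ioc 0 t) := by
  rcases le_total t 0 with ht | ht
  · simp [Ioc_eq_empty_of_le ht]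
  have h1 : IntegrableOn (fun r : ℝ => r ^ (-(α * p))) (Ioc 0 t) :=
    (intervalIntegrable_iff_integrableOn_Ioc_of_le ht).1
      (intervalIntegral.intervalIntegrable_rpow' (by linarith))
  refine IntegrableOn.congr_fun (h1.const_mul (K ^ p)) (fun r hr => ?_) measurableSet_Ioc
  rw [abs_of_pos hr.1, Real.mul_rpow hK (Real.rpow_nonneg hr.1.le _), ← Real.rpow_mul hr.1.le,
    neg_mul]

end Assembly

/-- **Existence of weak solutions with measure data.** Given `d > 2s`, `m > 1`
and an admissibility range for the weight, there exists `K > 0` depending only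
on `m, γ, s, d` (and the constant `C` of the weight bounds, and the
normalizing constant `κ`) such that for every admissible weight `ρ` with
exponents `(γ₀,γ)` and constants `c,C`, and every positive finite Radon
measure `μ`, there is a weak solution `u` of
`ρ u_t + (-Δ)^s(u^m) = 0` with initial datum `μ` which
(a) conserves mass, (b) satisfies the smoothing estimate
`‖u(t)‖_∞ ≤ K t^{-α} μ(ℝ^d)^β` with
`α = (d-γ)/((m-1)(d-γ)+2s-γ)`, `β = (2s-γ)/((m-1)(d-γ)+2s-γ)`, and
(c) satisfies the energy identity. -/
theorem existence_weak_solution_measure_data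
    (d : ℕ) (s m γ C κ : ℝ)
    (hs0 : 0 < s) (hs1 : s < 1) (hd : 2 * s < (d : ℝ)) (hm : 1 < m) (hκ : 0 < κ)
    (hγ0 : 0 ≤ γ) (hγs : γ < 2 * s) (hγd : γ ≤ (d : ℝ) - 2 * s) (hC : 0 < C) :
    ∃ K : ℝ, 0 < K ∧
      ∀ (γ₀ c : ℝ) (ρ : Ed d → ℝ) (μ : Measure (Ed d)), IsFiniteMeasure μ →
        0 ≤ γ₀ → γ₀ ≤ γ → AdmissibleWeight d ρ γ₀ γ c C →
        ∃ u : Ed d → ℝ → ℝ, IsWeakSolution d s m κ ρ μ u ∧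
          -- (a) conservation of mass
          (∀ᵐ t ∂(volume.restrict (Ioi (0 : ℝ))),
            (∫ x : Ed d, u x t * ρ x) = (μ univ).toReal) ∧
          -- (b) smoothing estimate
          (∀ᵐ t ∂(volume.restrict (Ioi (0 : ℝ))), ∀ᵐ x ∂(volume : Measure (Ed d)),
            u x t ≤ K *
              t ^ (-(((d : ℝ) - γ) / ((m - 1) * ((d : ℝ) - γ) + 2 * s - γ))) *
              ((μ univ).toReal) ^ ((2 * s - γ) / ((m - 1) * ((d : ℝ) - γ) + 2 * s - γ))) ∧
          -- (c) energy identity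
          (∀ᵐ p ∂(volume : Measure (ℝ × ℝ)), 0 < p.1 → p.1 < p.2 →
            (∫⁻ t in Ioc p.1 p.2, gagliardoSq d s κ (fun x => u x t ^ m)).toReal
              + (1 / (m + 1)) * ∫ x : Ed d, u x p.2 ^ (m + 1) * ρ x
              = (1 / (m + 1)) * ∫ x : Ed d, u x p.1 ^ (m + 1) * ρ x) := by
  have : NeZero d := ⟨by rintro rfl; norm_num at hd; linarith⟩
  obtain ⟨S, hS, hFK⟩ := exists_faberKrahn (d := d) (κ := κ) hs0 hd hκ hγ0 hγs hC
  have hγd' : γ < d := by linarith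
  have hD : 0 < (m - 1) * ((d : ℝ) - γ) + 2 * s - γ := by
    have := mul_pos (sub_pos.2 hm) (sub_pos.2 hγd')
    linarith
  set σ := (2 * s - γ) / ((d : ℝ) - γ) with hσ
  have hσ0 : 0 < σ := div_pos (by linarith) (by linarith)
  set α := ((d : ℝ) - γ) / ((m - 1) * ((d : ℝ) - γ) + 2 * s - γ) with hα
  set β := (2 * s - γ) / ((m - 1) * ((d : ℝ) - γ) + 2 * s - γ) with hβ
  have hdγ : (d : ℝ) - γ ≠ 0 := by linarith
  have hden : m - 1 + σ = ((m - 1) * ((d : ℝ) - γ) + 2 * s - γ) / ((d : ℝ) - γ) := by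
    rw [hσ]; field_simp; ring
  have hα' : α = 1 / (m - 1 + σ) := by rw [hden, one_div_div]
  have hβ' : β = σ / (m - 1 + σ) := by rw [hden, hσ, div_div_div_cancel_right₀ hdγ]
  have hα0 : 0 < α := div_pos (by linarith) hD
  have hβ0 : 0 < β := div_pos (by linarith) hD
  have hK := smoothConst_pos (m := m) (σ := σ) hS
  refine ⟨smoothConst m S σ, hK, fun γ₀ c ρ μ hμ hγ₀ hγ₀γ hadm => ?_⟩
  have hρ : Measurable ρ := hadm.2.2.1
  have hpos : ∀ x, 0 < ρ x := hadm.2.2.2.1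
  have hfin : ∀ R : ℝ, 0 < R → weightMeasure ρ (Metric.ball 0 R) ≠ ⊤ :=
    fun R hR => hadm.weightMeasure_ball_ne_top hγ₀γ hγd' hR
  have hM0 : 0 ≤ μ.real univ := measureReal_nonneg
  set K := smoothConst m S σ * μ.real univ ^ β with hKdef
  have hK0 : 0 ≤ K := mul_nonneg hK.le (Real.rpow_nonneg hM0 _)
  set b : ℝ → ℝ := fun t => K * |t| ^ (-α) with hb
  have hba : AntitoneOn b (Ioi 0) := fun t ht r hr htr => by
    simp only [hb, abs_of_pos (mem_Ioi.1 ht), abs_of_pos (mem_Ioi.1 hr)]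
    exact mul_le_mul_of_nonneg_left (Real.rpow_le_rpow_of_nonpos ht htr (by linarith)) hK0
  obtain ⟨v, G, ω, hv, hω, hpair⟩ := exists_limitSol_of_measure (b := b) hs0 hs1 hγ0 hγs hκ hadm.1 hm
    hρ hpos (hadm.ae_ge (NeZero.pos d) hγ₀ hγ₀γ) hfin μ
    (fun t => mul_nonneg hK0 (Real.rpow_nonneg (abs_nonneg t) _)) hba (by fun_prop)
    (integrableOn_smoothing_rpow hK0 (by
      rw [hα', div_mul_eq_mul_div, one_mul, div_lt_one (by linarith)]; linarith))
    (fun N f u G hf hu hfM t ht => by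
      filter_upwards [hu.smoothing hm hσ0 hS (hFK γ₀ c ρ hγ₀ hγ₀γ hadm) ht] with x hx
      have ht0 : 0 < t := hu.pos ht
      rw [← hα', ← hβ'] at hx
      refine hx.trans ?_
      simp only [hb, hKdef, abs_of_pos ht0, mul_right_comm _ (μ.real univ ^ β)]
      have := Real.rpow_le_rpow (integral_nonneg fun x => (hf.mem x).1) hfM hβ0.le
      exact mul_le_mul_of_nonneg_left this (by positivity))
  obtain ⟨hmass, htrace⟩ := integral_eq_and_tendsto_of_pairing hγs (fun t x => (hv.mem t x).1)
    hv.int hv.mass hω hpair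
  have henergy : ∀ t, energy (jumpMeasure d s κ) (fun x => v t x ^ m) =
      gagliardoSq d s κ fun x => v t x ^ m := fun t =>
    energy_jump_eq hκ.le hv.meas_rpow.of_uncurry_left
  refine ⟨fun x t => v t x, ⟨⟨hv.meas.comp measurable_swap, fun x t => (hv.mem t x).1,
    ⟨μ.real univ, ?_⟩, fun τ hτ => ⟨b τ, ?_⟩, ?_, fun t₁ t₂ h₁ _ => ?_, fun φ hφ =>
      hv.integral_deriv_test hs0 hs1 hκ hm hfin hρ hpos hφ⟩, Ioi 0 \ G, ?_, fun φ hφ hφB => ?_⟩,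
    ?_, ?_, ?_⟩
  · filter_upwards [hv.ae_mem] with t ht
    exact ⟨(integrable_weightMeasure hρ hpos).1 (hv.int t ht),
      (integral_weightMeasure hρ hpos _).symm.trans_le (hv.mass t ht)⟩
  · exact .of_forall fun p hp => (hv.mem _ _).2.trans (hba hτ (hτ.trans hp) hp.le)
  · filter_upwards [hv.ae_mem] with t ht
    rw [← henergy]
    exact (hv.fin t ht).lt_top
  · simp_rw [← henergy]
    exact hv.lintegral_energy_ne_top h₁ t₂
  · have := (ae_restrict_iff' measurableSet_Ioi).1 hv.ae_mem
    rw [ae_iff] at this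
    simpa [sdiff_eq, inter_def] using this
  · have h := htrace φ hφ hφB
    rw [sdiff_sdiff_right_self]
    refine h.congr fun t => ?_
    rw [integral_weightMeasure hρ hpos]
    exact integral_congr_ae (.of_forall fun x => by ring)
  · filter_upwards [hv.ae_mem] with t ht
    exact (integral_weightMeasure hρ hpos _).symm.trans (hmass t ht)
  · filter_upwards [ae_restrict_mem measurableSet_Ioi] with t ht
    refine .of_forall fun x => (hv.mem t x).2.trans_eq ?_
    rw [hb, hKdef, measureReal_def]
    simp only [abs_of_pos (mem_Ioi.1 ht)]
    ring
  · have hG := (ae_restrict_iff' measurableSet_Ioi).1 hv.ae_mem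
    filter_upwards [Measure.quasiMeasurePreserving_fst.ae hG,
      Measure.quasiMeasurePreserving_snd.ae hG] with p h₁ h₂ hp0 hp
    have hE := hv.energy_eq hm (h₁ hp0) (h₂ (hp0.trans hp)) hp
    have hnn : ∀ t, 0 ≤ (∫ x, v t x ^ (m + 1) ∂weightMeasure ρ) / (m + 1) := fun t =>
      div_nonneg (integral_nonneg fun x => Real.rpow_nonneg (hv.mem t x).1 _) (by linarith)
    simp_rw [henergy] at hE
    have hE' := congrArg ENNReal.toReal hE
    have hfinE : ∫⁻ t in Ioc p.1 p.2, gagliardoSq d s κ (fun x => v t x ^ m) ≠ ⊤ := by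
      simp_rw [← henergy]
      exact hv.lintegral_energy_ne_top hp0 _
    rw [LimitSol.entropy, LimitSol.entropy, ENNReal.toReal_add ENNReal.ofReal_ne_top hfinE,
      ENNReal.toReal_ofReal (hnn _), ENNReal.toReal_ofReal (hnn _),
      integral_weightMeasure hρ hpos, integral_weightMeasure hρ hpos] at hE'
    rw [one_div_mul_eq_div, one_div_mul_eq_div, ← hE', add_comm]
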